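/- The set S of possible ordered spectra of sums g Λ_A g⁻¹ + h Λ_B h⁻¹ over g, h ∈ SU(p,q) is a convex polyhedral set: it is the intersection of finitely many closed affine half-spaces of ℝⁿ. -/

import Mathlib

open Matrix Polynomial

noncomputable section

/-- The signature matrix `J = diag(1,…,1,−1,…,−1)` with `p` ones and `q` minus ones. -/
def Jmat (p q : ℕ) : Matrix (Fin (p + q)) (Fin (p + q)) ℂ :=
  Matrix.diagonal fun i => if (i : ℕ) < p then 1 else -1

/-- The group `SU(p,q)` of complex `(p+q)×(p+q)` matrices `g` with `det g = 1` and
`gᴴ J g = J`. -/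
def SUpq (p q : ℕ) : Set (Matrix (Fin (p + q)) (Fin (p + q)) ℂ) :=
  { g | g.det = 1 ∧ g.conjTranspose * Jmat p q * g = Jmat p q }

/-- `x` is the ordered spectrum of `M`: the entries of `x` are non-increasing within the
first `p` coordinates and within the last `q` coordinates, every entry of the first block
is strictly greater than every entry of the second block, and the eigenvalues of `M`
counted with multiplicity are exactly the entries of `x` (its characteristic polynomial is
`∏ i (X - x i)`). -/
def IsOrderedSpectrum (p q : ℕ) (M : Matrix (Fin (p + q)) (Fin (p + q)) ℂ)
    (x : Fin (p + q) → ℝ) : Prop :=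
  (∀ i j : Fin (p + q), i ≤ j → ((j : ℕ) < p ∨ p ≤ (i : ℕ)) → x j ≤ x i) ∧
  (∀ i j : Fin (p + q), (i : ℕ) < p → p ≤ (j : ℕ) → x j < x i) ∧
  M.charpoly = ∏ i, (X - Polynomial.C ((x i : ℂ)))

set_option linter.unusedSectionVars false

namespace Spectra

open scoped ComplexOrder
open Filter Topology

/-- Abel summation with slack. -/
theorem abel_slack {ι : Type*} [DecidableEq ι] (rk : ι → ℕ)
    (C : ℝ) (hC : 0 ≤ C) (s : Finset ι) (al x : ι → ℝ) (hrk : Set.InjOn rk s)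
    (hal : ∀ i ∈ s, ∀ j ∈ s, rk i ≤ rk j → al j ≤ al i)
    (hx : ∀ b : ℕ, -C ≤ ∑ i ∈ s with rk i < b, x i) (c c' : ℝ)
    (hc : ∀ i ∈ s, c ≤ al i) (hc' : ∀ i ∈ s, al i ≤ c') (hcc : c ≤ c') :
    -C * (c' - c) ≤ ∑ i ∈ s, (al i - c) * x i := by
  induction s using Finset.induction_on_max_value rk generalizing c with
  | empty => simp; nlinarith
  | insert m s hm hmax ih =>
    have hrk' : Set.InjOn rk s := hrk.mono (by simp)
    have hlt : ∀ i ∈ s, rk i < rk m := fun i hi => lt_of_le_of_ne (hmax i hi) fun h =>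
      hm ((hrk (by simp [hi]) (by simp) h) ▸ hi)
    have key := ih hrk' (fun i hi j hj => hal i (by simp [hi]) j (by simp [hj]))
      (fun b => by
        rcases le_or_gt b (rk m) with h | h
        · have := hx b
          rwa [Finset.filter_insert, if_neg (by omega)] at this
        · have := hx (rk m)
          rw [Finset.filter_insert, if_neg (by omega)] at this
          convert this using 2
          ext i; simp only [Finset.mem_filter]
          constructor
          · rintro ⟨h1, -⟩; exact ⟨h1, hlt i h1⟩
          · rintro ⟨h1, -⟩; exact ⟨h1, (hlt i h1).trans h⟩)
      (al m) (fun i hi => hal i (by simp [hi]) m (by simp) (hmax i hi))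
      (fun i hi => hc' i (by simp [hi])) (hc' m (by simp))
    have htot := hx (rk m + 1)
    rw [Finset.filter_insert, if_pos (by omega), Finset.sum_insert (by simp [hm])] at htot
    have e : s.filter (fun i => rk i < rk m + 1) = s := by
      ext i; simp only [Finset.mem_filter, and_iff_left_iff_imp]
      intro h; have := hlt i h; omega
    rw [e] at htot
    rw [Finset.sum_insert hm]
    have e2 : ∑ i ∈ s, (al i - c) * x i
        = ∑ i ∈ s, (al i - al m) * x i + (al m - c) * ∑ i ∈ s, x i := by
      rw [Finset.mul_sum, ← Finset.sum_add_distrib]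
      exact Finset.sum_congr rfl fun i _ => by ring
    rw [e2]
    have := hc m (by simp)
    nlinarith

section Pivots

variable {ι : Type*} [Fintype ι] [DecidableEq ι]

/-- Coordinate subspace of vectors supported on indices of rank `< b`. -/
def low (rk : ι → ℕ) (b : ℕ) : Submodule ℂ (ι → ℂ) where
  carrier := {v | ∀ l, b ≤ rk l → v l = 0}
  add_mem' := by intro v w hv hw l hl; simp [hv l hl, hw l hl]
  zero_mem' := by intro l _; rfl
  smul_mem' := by intro c v hv l hl; simp [hv l hl]

theorem mem_low {rk : ι → ℕ} {b : ℕ} {v : ι → ℂ} :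
    v ∈ low rk b ↔ ∀ l, b ≤ rk l → v l = 0 := Iff.rfl

open Classical in
/-- Positions of the last nonzero coordinate among vectors of `V`. -/
def piv (rk : ι → ℕ) (V : Submodule ℂ (ι → ℂ)) : Finset ι :=
  Finset.univ.filter fun i => ∃ v ∈ V, v i ≠ 0 ∧ ∀ l, rk i < rk l → v l = 0

theorem mem_piv {rk : ι → ℕ} {V : Submodule ℂ (ι → ℂ)} {i : ι} :
    i ∈ piv rk V ↔ ∃ v ∈ V, v i ≠ 0 ∧ ∀ l, rk i < rk l → v l = 0 := by
  simp [piv]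

theorem exists_top {rk : ι → ℕ} {v : ι → ℂ} (hv : v ≠ 0) :
    ∃ i, v i ≠ 0 ∧ ∀ l, rk i < rk l → v l = 0 := by
  classical
  have hne : (Finset.univ.filter fun i => v i ≠ 0).Nonempty := by
    obtain ⟨i, hi⟩ := Function.ne_iff.1 hv
    exact ⟨i, by simpa using hi⟩
  obtain ⟨i, hi, hmax⟩ := Finset.exists_max_image _ rk hne
  refine ⟨i, by simpa using hi, fun l hl => ?_⟩
  by_contra h
  have := hmax l (by simpa using h)
  omega

theorem card_piv {rk : ι → ℕ} (hrk : Function.Injective rk) (V : Submodule ℂ (ι → ℂ)) :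
    (piv rk V).card = Module.finrank ℂ V := by
  apply le_antisymm
  · have h : ∀ i : piv rk V, ∃ v : V, (v : ι → ℂ) i ≠ 0 ∧ ∀ l, rk i < rk l → (v : ι → ℂ) l = 0 := by
      rintro ⟨i, hi⟩
      obtain ⟨v, hv, h⟩ := mem_piv.1 hi
      exact ⟨⟨v, hv⟩, h⟩
    choose f hf1 hf2 using h
    have hli : LinearIndependent ℂ f := by
      rw [Fintype.linearIndependent_iff]
      intro g hg
      by_contra! hne
      obtain ⟨i0, hi0⟩ := hne
      have hne : (Finset.univ.filter fun i => g i ≠ 0).Nonempty := ⟨i0, by simpa using hi0⟩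
      obtain ⟨i, hi, hmax⟩ := Finset.exists_max_image _ (fun i => rk i.1) hne
      have h0 : (∑ j, g j • (f j : ι → ℂ)) i = 0 := by
        have := congrArg (fun v : V => (v : ι → ℂ) i) hg
        simpa using this
      rw [Finset.sum_apply, Finset.sum_eq_single i] at h0
      · simp only [Pi.smul_apply, smul_eq_mul, mul_eq_zero] at h0
        rcases h0 with h | h
        · simp at hi; exact hi h
        · exact hf1 i h
      · intro j _ hj
        simp only [Pi.smul_apply, smul_eq_mul, mul_eq_zero]
        by_cases hgj : g j = 0
        · exact Or.inl hgj
        · right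
          apply hf2
          exact lt_of_le_of_ne (hmax j (by simpa using hgj))
            fun h => hj (Subtype.ext (hrk h))
      · simp
    simpa using hli.fintype_card_le_finrank
  · let L : V →ₗ[ℂ] (piv rk V → ℂ) :=
      (LinearMap.funLeft ℂ ℂ (Subtype.val : piv rk V → ι)).comp V.subtype
    have hL : Function.Injective L := by
      rw [← LinearMap.ker_eq_bot, LinearMap.ker_eq_bot']
      rintro ⟨v, hv⟩ h
      by_contra hne
      have hv0 : v ≠ 0 := by simpa using hne
      obtain ⟨i, hi, hi2⟩ := exists_top (rk := rk) hv0
      exact hi (congrFun h ⟨i, mem_piv.2 ⟨v, hv, hi, hi2⟩⟩)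
    simpa using LinearMap.finrank_le_finrank_of_injective hL

theorem piv_inf_low {rk : ι → ℕ} (V : Submodule ℂ (ι → ℂ)) (b : ℕ) :
    piv rk (V ⊓ low rk b) = (piv rk V).filter fun i => rk i < b := by
  ext i
  simp only [mem_piv, Finset.mem_filter, Submodule.mem_inf, mem_low]
  constructor
  · rintro ⟨v, ⟨h1, h2⟩, h3, h4⟩
    refine ⟨⟨v, h1, h3, h4⟩, ?_⟩
    by_contra h
    exact h3 (h2 i (by omega))
  · rintro ⟨⟨v, h1, h3, h4⟩, h⟩
    exact ⟨v, ⟨h1, fun l hl => h4 l (by omega)⟩, h3, h4⟩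

theorem card_piv_filter {rk : ι → ℕ} (hrk : Function.Injective rk) (V : Submodule ℂ (ι → ℂ))
    (b : ℕ) : ((piv rk V).filter fun i => rk i < b).card
      = Module.finrank ℂ ↥(V ⊓ low rk b) := by
  rw [← piv_inf_low, card_piv hrk]

theorem piv_mono {rk : ι → ℕ} {V V' : Submodule ℂ (ι → ℂ)} (h : V ≤ V') :
    piv rk V ⊆ piv rk V' := by
  intro i hi
  obtain ⟨v, h1, h2⟩ := mem_piv.1 hi
  exact mem_piv.2 ⟨v, h h1, h2⟩

theorem piv_top {rk : ι → ℕ} (hrk : Function.Injective rk) :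
    piv rk (⊤ : Submodule ℂ (ι → ℂ)) = Finset.univ := by
  apply (Finset.card_eq_iff_eq_univ _).1
  rw [card_piv hrk]; simp

end Pivots

section Quad
variable {m n : Type*} [Fintype m] [Fintype n]

/-- Real part of the sesquilinear form of `H`. -/
def qf (H : Matrix n n ℂ) (x : n → ℂ) : ℝ := (star x ⬝ᵥ H *ᵥ x).re

/-- Squared Euclidean length. -/
def nsq (x : n → ℂ) : ℝ := ∑ i, Complex.normSq (x i)

theorem nsq_nonneg (x : n → ℂ) : 0 ≤ nsq x := Finset.sum_nonneg fun _ _ => Complex.normSq_nonneg _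

theorem nsq_pos {x : n → ℂ} (hx : x ≠ 0) : 0 < nsq x := by
  obtain ⟨i, hi⟩ := Function.ne_iff.1 hx
  exact lt_of_lt_of_le (Complex.normSq_pos.2 hi)
    (Finset.single_le_sum (f := fun i => Complex.normSq (x i))
      (fun _ _ => Complex.normSq_nonneg _) (Finset.mem_univ i))

theorem normSq_le_nsq (x : n → ℂ) (i : n) : Complex.normSq (x i) ≤ nsq x :=
  Finset.single_le_sum (f := fun i => Complex.normSq (x i))
      (fun _ _ => Complex.normSq_nonneg _) (Finset.mem_univ i)

theorem star_dotProduct_self (x : n → ℂ) : star x ⬝ᵥ x = (nsq x : ℂ) := by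
  simp only [dotProduct, nsq, Pi.star_apply, Complex.ofReal_sum, Complex.normSq_eq_conj_mul_self]
  rfl

theorem qf_one [DecidableEq n] (x : n → ℂ) : qf 1 x = nsq x := by
  simp [qf, star_dotProduct_self]

theorem qf_add (H K : Matrix n n ℂ) (x : n → ℂ) : qf (H + K) x = qf H x + qf K x := by
  simp [qf, add_mulVec, dotProduct_add]

theorem qf_sub (H K : Matrix n n ℂ) (x : n → ℂ) : qf (H - K) x = qf H x - qf K x := by
  simp [qf, sub_mulVec, dotProduct_sub]

theorem qf_smul (c : ℝ) (H : Matrix n n ℂ) (x : n → ℂ) :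
    qf ((c : ℂ) • H) x = c * qf H x := by
  simp [qf, smul_mulVec]

theorem qf_conj (H : Matrix n n ℂ) (T : Matrix n m ℂ) (x : m → ℂ) :
    qf (Tᴴ * H * T) x = qf H (T *ᵥ x) := by
  simp only [qf]
  rw [star_mulVec, ← mulVec_mulVec, ← mulVec_mulVec, dotProduct_mulVec, dotProduct_mulVec,
    dotProduct_mulVec]

theorem qf_diagonal [DecidableEq n] (d : n → ℝ) (x : n → ℂ) :
    qf (diagonal fun i => (d i : ℂ)) x = ∑ i, d i * Complex.normSq (x i) := by
  simp only [qf, dotProduct, mulVec_diagonal, Complex.re_sum, Pi.star_apply]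
  refine Finset.sum_congr rfl fun i _ => ?_
  have : star (x i) * ((d i : ℂ) * x i) = ((d i * Complex.normSq (x i) : ℝ) : ℂ) := by
    push_cast
    rw [Complex.normSq_eq_conj_mul_self]
    change (starRingEnd ℂ) (x i) * _ = _
    ring
  rw [this, Complex.ofReal_re]

theorem isHermitian_dot {H : Matrix n n ℂ} (hH : H.IsHermitian) (x : n → ℂ) :
    star x ⬝ᵥ H *ᵥ x = (qf H x : ℂ) := by
  have := hH.im_star_dotProduct_mulVec_self x
  apply Complex.ext
  · simp [qf]
  · simpa using this

theorem posDef_of_qf {H : Matrix n n ℂ} (hH : H.IsHermitian) (h : ∀ x, x ≠ 0 → 0 < qf H x) :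
    H.PosDef := by
  refine PosDef.of_dotProduct_mulVec_pos hH fun x hx => ?_
  rw [isHermitian_dot hH]
  exact_mod_cast h x hx

theorem qf_pos {H : Matrix n n ℂ} (hH : H.PosDef) {x : n → ℂ} (hx : x ≠ 0) : 0 < qf H x :=
  hH.re_dotProduct_pos hx

theorem qf_nonneg {H : Matrix n n ℂ} (hH : H.PosDef) (x : n → ℂ) : 0 ≤ qf H x :=
  hH.posSemidef.re_dotProduct_nonneg x

theorem qf_conj_one [DecidableEq n] (T : Matrix n m ℂ) (x : m → ℂ) :
    qf (Tᴴ * T) x = nsq (T *ᵥ x) := by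
  have := qf_conj 1 T x
  rwa [Matrix.mul_one, qf_one] at this

variable [DecidableEq n]

theorem spectral (H : Matrix n n ℂ) (hH : H.IsHermitian) :
    ∃ (k : Matrix n n ℂ) (d : n → ℝ), kᴴ * k = 1 ∧ k * kᴴ = 1 ∧
      H = kᴴ * diagonal (fun i => (d i : ℂ)) * k := by
  refine ⟨((hH.eigenvectorUnitary : Matrix n n ℂ))ᴴ, hH.eigenvalues, ?_, ?_, ?_⟩
  · rw [conjTranspose_conjTranspose, ← star_eq_conjTranspose]
    exact Unitary.coe_mul_star_self _
  · rw [conjTranspose_conjTranspose, ← star_eq_conjTranspose]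
    exact Unitary.coe_star_mul_self _
  · conv_lhs => rw [hH.spectral_theorem]
    rw [Unitary.conjStarAlgAut_apply, conjTranspose_conjTranspose, star_eq_conjTranspose]
    rfl

theorem nsq_unitary {k : Matrix n n ℂ} (hk : kᴴ * k = 1) (x : n → ℂ) : nsq (k *ᵥ x) = nsq x := by
  rw [← qf_conj_one, hk, qf_one]

theorem posDef_lower {H : Matrix n n ℂ} (hH : H.PosDef) : ∃ c > 0, ∀ x, c * nsq x ≤ qf H x := by
  obtain ⟨k, d, hk, hk', h⟩ := spectral H hH.isHermitian
  have hd : ∀ i, 0 < d i := by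
    intro i
    have hx : kᴴ *ᵥ (Pi.single i 1) ≠ 0 := by
      intro h0
      have : k *ᵥ (kᴴ *ᵥ (Pi.single i 1 : n → ℂ)) = 0 := by rw [h0, mulVec_zero]
      rw [mulVec_mulVec, hk', one_mulVec] at this
      have := congrFun this i
      simp at this
    have h1 := qf_pos hH hx
    rw [h, qf_conj, mulVec_mulVec, hk', one_mulVec, qf_diagonal, Finset.sum_eq_single i] at h1
    · simpa using h1
    · intro j _ hj; simp [hj]
    · simp
  obtain ⟨c, hc, hc2⟩ : ∃ c > 0, ∀ i, c ≤ d i := by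
    rcases isEmpty_or_nonempty n with he | hne
    · exact ⟨1, one_pos, fun i => he.elim i⟩
    · obtain ⟨i, hi⟩ := Finite.exists_min d
      exact ⟨d i, hd i, hi⟩
  refine ⟨c, hc, fun x => ?_⟩
  rw [h, qf_conj, qf_diagonal, ← nsq_unitary hk x, nsq, Finset.mul_sum]
  exact Finset.sum_le_sum fun i _ => mul_le_mul_of_nonneg_right (hc2 i) (Complex.normSq_nonneg _)

/-- Sum of the moduli of the entries. -/
def esum (H : Matrix n n ℂ) : ℝ := ∑ i, ∑ j, ‖H i j‖

theorem esum_nonneg (H : Matrix n n ℂ) : 0 ≤ esum H := 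
  Finset.sum_nonneg fun _ _ => Finset.sum_nonneg fun _ _ => norm_nonneg _

theorem abs_qf_le (H : Matrix n n ℂ) (x : n → ℂ) : |qf H x| ≤ esum H * nsq x := by
  have h1 : |qf H x| ≤ ‖star x ⬝ᵥ H *ᵥ x‖ := Complex.abs_re_le_norm _
  refine h1.trans ?_
  simp only [dotProduct, mulVec, esum, Finset.mul_sum, Finset.sum_mul]
  refine (norm_sum_le _ _).trans (Finset.sum_le_sum fun i _ => (norm_sum_le _ _).trans
    (Finset.sum_le_sum fun j _ => ?_))
  simp only [norm_mul, Pi.star_apply, norm_star]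
  have hi := normSq_le_nsq x i
  have hj := normSq_le_nsq x j
  rw [Complex.normSq_eq_norm_sq] at hi hj
  have : ‖x i‖ * ‖x j‖ ≤ nsq x := by nlinarith [sq_nonneg (‖x i‖ - ‖x j‖)]
  nlinarith [norm_nonneg (H i j)]

theorem posDef_of_lower {H : Matrix n n ℂ} (hH : H.IsHermitian) {c : ℝ} (hc : 0 < c)
    (h : ∀ x, c * nsq x ≤ qf H x) : H.PosDef :=
  posDef_of_qf hH fun x hx => lt_of_lt_of_le (mul_pos hc (nsq_pos hx)) (h x)

theorem posDef_det_ne {H : Matrix n n ℂ} (hH : H.PosDef) : H.det ≠ 0 := hH.det_pos.ne'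

theorem entry_bound {H : Matrix n n ℂ} (hH : H.IsHermitian) {M : ℝ}
    (h : ∀ x, |qf H x| ≤ M * nsq x) (i j : n) : ‖H i j‖ ≤ 2 * M := by
  obtain ⟨k, d, hk, hk', e⟩ := spectral H hH
  have hd : ∀ l, |d l| ≤ M := by
    intro l
    have := h (kᴴ *ᵥ Pi.single l 1)
    rw [e, qf_conj, mulVec_mulVec, hk', one_mulVec, qf_diagonal, Finset.sum_eq_single l] at this
    · have e2 : nsq (kᴴ *ᵥ (Pi.single l 1 : n → ℂ)) = 1 := by
        rw [nsq_unitary (by simpa using hk'), nsq, Finset.sum_eq_single l]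
        · simp
        · intro j _ hj; simp [hj]
        · simp
      rw [e2] at this
      simpa using this
    · intro j _ hj; simp [hj]
    · simp
  have hcol : ∀ j, ∑ l, ‖k l j‖ ^ 2 = 1 := by
    intro j
    have e2 : nsq (k *ᵥ (Pi.single j 1 : n → ℂ)) = 1 := by
        rw [nsq_unitary hk, nsq, Finset.sum_eq_single j]
        · simp
        · intro j _ hj; simp [hj]
        · simp
    rw [← e2, nsq]
    simp [Complex.normSq_eq_norm_sq]
  have hM : 0 ≤ M := (abs_nonneg _).trans (hd i)
  have e3 : H i j = ∑ l, star (k l i) * (d l : ℂ) * k l j := by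
    conv_lhs => rw [e]
    rw [Matrix.mul_apply]
    simp only [mul_diagonal, conjTranspose_apply]
  rw [e3]
  calc _ ≤ ∑ l, ‖star (k l i) * (d l : ℂ) * k l j‖ := norm_sum_le _ _
    _ ≤ ∑ l, (M * ‖k l i‖ ^ 2 + M * ‖k l j‖ ^ 2) := by
      refine Finset.sum_le_sum fun l _ => ?_
      simp only [norm_mul, norm_star, Complex.norm_real, Real.norm_eq_abs]
      have h1 : ‖k l i‖ * ‖k l j‖ ≤ ‖k l i‖ ^ 2 + ‖k l j‖ ^ 2 := by
        nlinarith [sq_nonneg (‖k l i‖ - ‖k l j‖), sq_nonneg (‖k l i‖), sq_nonneg (‖k l j‖)]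
      have h2 := hd l
      have h3 : 0 ≤ ‖k l i‖ * ‖k l j‖ := by positivity
      nlinarith [abs_nonneg (d l)]
    _ = 2 * M := by rw [Finset.sum_add_distrib, ← Finset.mul_sum, ← Finset.mul_sum, hcol, hcol]; ring

end Quad

section Mask
variable {ι : Type*} [Fintype ι] [DecidableEq ι]

/-- Projection onto the coordinates of rank `< b`. -/
def pmat (rk : ι → ℕ) (b : ℕ) : Matrix ι ι ℂ := diagonal fun i => if rk i < b then 1 else 0

/-- Leading block of `N`, extended by the identity. -/
def mask (rk : ι → ℕ) (b : ℕ) (N : Matrix ι ι ℂ) : Matrix ι ι ℂ :=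
  pmat rk b * N * pmat rk b + (1 - pmat rk b)

theorem pmat_sq (rk : ι → ℕ) (b : ℕ) : pmat rk b * pmat rk b = pmat rk b := by
  rw [pmat, diagonal_mul_diagonal]; congr 1; ext i; split_ifs <;> simp

theorem pmat_conj (rk : ι → ℕ) (b : ℕ) : (pmat rk b)ᴴ = pmat rk b := by
  rw [pmat, diagonal_conjTranspose]; congr 1; ext i; simp only [Pi.star_apply]; split_ifs <;> simp

theorem mask_conjTranspose (rk : ι → ℕ) (b : ℕ) (N : Matrix ι ι ℂ) :
    (mask rk b N)ᴴ = mask rk b Nᴴ := by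
  simp [mask, conjTranspose_mul, pmat_conj, Matrix.mul_assoc]

theorem mask_apply (rk : ι → ℕ) (b : ℕ) (N : Matrix ι ι ℂ) (i j : ι) :
    mask rk b N i j = if rk i < b ∧ rk j < b then N i j else if i = j then 1 else 0 := by
  simp only [mask, pmat, Matrix.add_apply, Matrix.sub_apply, mul_diagonal, diagonal_mul, one_apply,
    diagonal_apply]
  by_cases h1 : rk i < b <;> by_cases h2 : rk j < b <;> by_cases h3 : i = j
  all_goals first | (subst h3; simp [*]) | simp [*]

theorem pmat_comm_upper {rk : ι → ℕ} {T : Matrix ι ι ℂ} (hT : BlockTriangular T rk) (b : ℕ) :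
    T * pmat rk b = pmat rk b * T * pmat rk b := by
  ext i j
  simp only [pmat, mul_diagonal, diagonal_mul]
  by_cases h1 : rk i < b <;> by_cases h2 : rk j < b <;> simp [h1, h2]
  exact hT (by omega)

theorem mask_conj {rk : ι → ℕ} {T : Matrix ι ι ℂ} (hT : BlockTriangular T rk) (b : ℕ)
    (N : Matrix ι ι ℂ) :
    mask rk b (Tᴴ * N * T) = (mask rk b T)ᴴ * mask rk b N * mask rk b T := by
  have h1 := pmat_comm_upper hT b
  have h2 : pmat rk b * Tᴴ = pmat rk b * Tᴴ * pmat rk b := by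
    have := congrArg conjTranspose h1
    simpa [conjTranspose_mul, pmat_conj, Matrix.mul_assoc] using this
  rw [mask_conjTranspose]
  have hp := pmat_sq rk b
  set P := pmat rk b with hP
  have hq : P * (1 - P) = 0 := by rw [Matrix.mul_sub, hp]; simp
  have hq' : (1 - P) * P = 0 := by rw [Matrix.sub_mul, hp]; simp
  have hq2 : (1 - P) * (1 - P) = 1 - P := by rw [Matrix.sub_mul, hq]; simp
  have lhs : P * (Tᴴ * N * T) * P = P * Tᴴ * P * N * (P * T * P) := by
    calc P * (Tᴴ * N * T) * P = (P * Tᴴ) * N * (T * P) := by simp only [Matrix.mul_assoc]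
      _ = _ := by rw [h2, h1]; simp only [Matrix.mul_assoc]; rw [← Matrix.mul_assoc P P, hp]
  have rhs : (P * Tᴴ * P + (1 - P)) * (P * N * P + (1 - P)) * (P * T * P + (1 - P))
      = P * Tᴴ * P * N * (P * T * P) + (1 - P) := by
    have e1 : (P * Tᴴ * P + (1 - P)) * (P * N * P + (1 - P)) = P * Tᴴ * P * N * P + (1 - P) := by
      rw [Matrix.add_mul, Matrix.mul_add, Matrix.mul_add, hq2]
      have a1 : P * Tᴴ * P * (P * N * P) = P * Tᴴ * (P * P) * N * P := by
        simp only [Matrix.mul_assoc]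
      have a2 : P * Tᴴ * P * (1 - P) = 0 := by rw [Matrix.mul_assoc, hq, Matrix.mul_zero]
      have a3 : (1 - P) * (P * N * P) = 0 := by
        rw [← Matrix.mul_assoc, ← Matrix.mul_assoc, hq', Matrix.zero_mul, Matrix.zero_mul]
      rw [a1, a2, a3, hp]; simp
    rw [e1, Matrix.add_mul, Matrix.mul_add, Matrix.mul_add, hq2]
    have a1 : P * Tᴴ * P * N * P * (P * T * P) = P * Tᴴ * P * N * ((P * P) * T * P) := by
      simp only [Matrix.mul_assoc]
    have a2 : P * Tᴴ * P * N * P * (1 - P) = 0 := by rw [Matrix.mul_assoc, hq, Matrix.mul_zero]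
    have a3 : (1 - P) * (P * T * P) = 0 := by
      rw [← Matrix.mul_assoc, ← Matrix.mul_assoc, hq', Matrix.zero_mul, Matrix.zero_mul]
    rw [a1, a2, a3, hp]; simp
  simp only [mask]
  rw [lhs, rhs]

theorem det_upper {rk : ι → ℕ} (hrk : Function.Injective rk) {T : Matrix ι ι ℂ}
    (hT : BlockTriangular T rk) : T.det = ∏ i, T i i := by
  rw [hT.det, Finset.prod_image (fun i _ j _ h => hrk h)]
  refine Finset.prod_congr rfl fun i _ => ?_
  let _ : Unique { a // rk a = rk i } := ⟨⟨⟨i, rfl⟩⟩, fun a => Subtype.ext (hrk a.2)⟩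
  rw [det_unique]
  rfl

theorem mask_upper {rk : ι → ℕ} {T : Matrix ι ι ℂ} (hT : BlockTriangular T rk) (b : ℕ) :
    BlockTriangular (mask rk b T) rk := by
  intro i j hij
  rw [mask_apply]
  split_ifs with h1 h2
  · exact hT hij
  · subst h2; simp at hij
  · rfl

theorem det_mask_upper {rk : ι → ℕ} (hrk : Function.Injective rk) {T : Matrix ι ι ℂ}
    (hT : BlockTriangular T rk) (b : ℕ) :
    (mask rk b T).det = ∏ i with rk i < b, T i i := by
  rw [det_upper hrk (mask_upper hT b), Finset.prod_filter]
  refine Finset.prod_congr rfl fun i _ => ?_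
  rw [mask_apply]; simp

/-- Logarithm of the modulus of a leading minor. -/
def lmin (rk : ι → ℕ) (b : ℕ) (N : Matrix ι ι ℂ) : ℝ := Real.log ‖(mask rk b N).det‖

/-- Logarithm of the modulus of a ratio of consecutive leading minors. -/
def ell (rk : ι → ℕ) (i : ι) (N : Matrix ι ι ℂ) : ℝ := lmin rk (rk i + 1) N - lmin rk (rk i) N

/-- Weighted sum of the logarithmic ratios of leading minors. -/
def phi (rk : ι → ℕ) (al : ι → ℝ) (N : Matrix ι ι ℂ) : ℝ := ∑ i, al i * ell rk i N

theorem lmin_conj {rk : ι → ℕ} (hrk : Function.Injective rk) {T : Matrix ι ι ℂ}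
    (hT : BlockTriangular T rk) (hT0 : ∀ i, T i i ≠ 0) (b : ℕ) {N : Matrix ι ι ℂ}
    (hN : (mask rk b N).det ≠ 0) :
    lmin rk b (Tᴴ * N * T) = lmin rk b N + ∑ i with rk i < b, 2 * Real.log ‖T i i‖ := by
  rw [lmin, mask_conj hT, det_mul, det_mul, det_conjTranspose, det_mask_upper hrk hT, norm_mul,
    norm_mul, norm_star, lmin]
  have h0 : ‖∏ i with rk i < b, T i i‖ ≠ 0 := by
    rw [norm_ne_zero_iff]; exact Finset.prod_ne_zero_iff.2 fun i _ => hT0 i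
  have h1 : ‖(mask rk b N).det‖ ≠ 0 := norm_ne_zero_iff.2 hN
  rw [Real.log_mul (mul_ne_zero h0 h1) h0, Real.log_mul h0 h1, ← Finset.mul_sum, norm_prod,
    Real.log_prod (fun i _ => norm_ne_zero_iff.2 (hT0 i))]
  ring

theorem ell_conj {rk : ι → ℕ} (hrk : Function.Injective rk) {T : Matrix ι ι ℂ}
    (hT : BlockTriangular T rk) (hT0 : ∀ i, T i i ≠ 0) (i : ι) {N : Matrix ι ι ℂ}
    (hN : ∀ b, (mask rk b N).det ≠ 0) :
    ell rk i (Tᴴ * N * T) = ell rk i N + 2 * Real.log ‖T i i‖ := by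
  rw [ell, lmin_conj hrk hT hT0 _ (hN _), lmin_conj hrk hT hT0 _ (hN _), ell]
  have : (Finset.univ.filter fun j => rk j < rk i + 1)
      = insert i (Finset.univ.filter fun j => rk j < rk i) := by
    ext j; simp only [Finset.mem_filter, Finset.mem_univ, true_and, Finset.mem_insert]
    constructor
    · intro h
      rcases Nat.lt_succ_iff_lt_or_eq.1 h with h | h
      · exact Or.inr h
      · exact Or.inl (hrk h)
    · rintro (rfl | h) <;> omega
  rw [this, Finset.sum_insert (by simp)]
  ring

theorem det_mask_diagonal (rk : ι → ℕ) (b : ℕ) (d : ι → ℂ) :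
    (mask rk b (diagonal d)).det = ∏ i with rk i < b, d i := by
  have : mask rk b (diagonal d) = diagonal fun i => if rk i < b then d i else 1 := by
    ext i j
    rw [mask_apply]
    by_cases h : i = j
    · subst h; simp
    · simp [h]
  rw [this, det_diagonal, Finset.prod_filter]

theorem lmin_sign (rk : ι → ℕ) (b : ℕ) {d : ι → ℂ} (hd : ∀ i, ‖d i‖ = 1) :
    lmin rk b (diagonal d) = 0 := by
  rw [lmin, det_mask_diagonal, norm_prod]; simp [hd]

theorem det_mask_sign_ne (rk : ι → ℕ) (b : ℕ) {d : ι → ℂ} (hd : ∀ i, ‖d i‖ = 1) :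
    (mask rk b (diagonal d)).det ≠ 0 := by
  rw [det_mask_diagonal]
  refine Finset.prod_ne_zero_iff.2 fun i _ h => ?_
  have := hd i; rw [h] at this; simp at this

theorem ell_sign_conj {rk : ι → ℕ} (hrk : Function.Injective rk) {T : Matrix ι ι ℂ}
    (hT : BlockTriangular T rk) (hT0 : ∀ i, T i i ≠ 0) (i : ι) {d : ι → ℂ}
    (hd : ∀ i, ‖d i‖ = 1) :
    ell rk i (Tᴴ * diagonal d * T) = 2 * Real.log ‖T i i‖ := by
  rw [ell_conj hrk hT hT0 i (fun b => det_mask_sign_ne rk b hd), ell, lmin_sign rk _ hd,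
    lmin_sign rk _ hd]
  simp

theorem sum_ell {rk : ι → ℕ} (hrk : Function.Injective rk) {T : Matrix ι ι ℂ}
    (hT : BlockTriangular T rk) (hT0 : ∀ i, T i i ≠ 0) {d : ι → ℂ} (hd : ∀ i, ‖d i‖ = 1) (b : ℕ) :
    ∑ i with rk i < b, ell rk i (Tᴴ * diagonal d * T) = lmin rk b (Tᴴ * diagonal d * T) := by
  rw [lmin_conj hrk hT hT0 _ (det_mask_sign_ne rk b hd), lmin_sign rk _ hd, zero_add]
  exact Finset.sum_congr rfl fun i _ => ell_sign_conj hrk hT hT0 i hd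

theorem mask_of_lt {rk : ι → ℕ} {b : ℕ} (hb : ∀ i, rk i < b) (N : Matrix ι ι ℂ) :
    mask rk b N = N := by
  ext i j; rw [mask_apply]; simp [hb]

theorem mask_posDef {N : Matrix ι ι ℂ} (hN : N.PosDef) (rk : ι → ℕ) (b : ℕ) :
    (mask rk b N).PosDef := by
  have hp := pmat_sq rk b
  have e : mask rk b N = (pmat rk b)ᴴ * N * pmat rk b + (1 - pmat rk b)ᴴ * (1 - pmat rk b) := by
    rw [mask, pmat_conj, conjTranspose_sub, pmat_conj, conjTranspose_one]
    congr 1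
    rw [Matrix.sub_mul, Matrix.mul_sub, Matrix.mul_sub, hp]; simp
  refine posDef_of_qf ?_ fun x hx => ?_
  · rw [IsHermitian, mask_conjTranspose, hN.isHermitian.eq]
  · rw [e, qf_add, qf_conj, qf_conj_one]
    by_cases h : pmat rk b *ᵥ x = 0
    · rw [h, sub_mulVec, h, one_mulVec, sub_zero]
      have := nsq_pos hx
      simpa [qf] using this
    · have := qf_pos hN h
      have := nsq_nonneg ((1 - pmat rk b) *ᵥ x)
      linarith

theorem upper_inv {rk : ι → ℕ} {T : Matrix ι ι ℂ} (hT : BlockTriangular T rk)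
    (h : IsUnit T.det) : BlockTriangular T⁻¹ rk := by
  let _ := T.invertibleOfIsUnitDet h
  exact blockTriangular_inv_of_blockTriangular hT

/-- Diagonal Cholesky entries are monotone in the positive definite matrix. -/
theorem chol_mono {rk : ι → ℕ} (hrk : Function.Injective rk) {T T' : Matrix ι ι ℂ}
    (hT : BlockTriangular T rk) (hT' : BlockTriangular T' rk) (hT0' : ∀ i, T' i i ≠ 0)
    (hle : ∀ x, qf (Tᴴ * T) x ≤ qf (T'ᴴ * T') x) (i : ι) : ‖T i i‖ ≤ ‖T' i i‖ := by
  have hdet : IsUnit T'.det := by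
    rw [det_upper hrk hT', isUnit_iff_ne_zero]; exact Finset.prod_ne_zero_iff.2 fun i _ => hT0' i
  have hinv := upper_inv hT' hdet
  have htop : ∀ (A : Matrix ι ι ℂ) (v : ι → ℂ), BlockTriangular A rk →
      (∀ l, rk i < rk l → v l = 0) → (A *ᵥ v) i = A i i * v i := by
    intro A v hA hv
    simp only [mulVec, dotProduct]
    rw [Finset.sum_eq_single i]
    · intro j _ hj
      rcases lt_or_gt_of_ne (fun h => hj (hrk h) : rk j ≠ rk i) with h | h
      · rw [hA h, zero_mul]
      · rw [hv j h, mul_zero]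
    · simp
  set v := T'⁻¹ *ᵥ (Pi.single i 1 : ι → ℂ) with hv
  have hvl : ∀ l, rk i < rk l → v l = 0 := by
    intro l hl
    rw [hv, mulVec_single_one]
    exact hinv hl
  have hTv : T' *ᵥ v = Pi.single i 1 := by
    rw [hv, mulVec_mulVec, mul_nonsing_inv _ hdet, one_mulVec]
  have h1 := hle v
  rw [qf_conj_one, qf_conj_one, hTv] at h1
  have h2 : nsq (Pi.single i 1 : ι → ℂ) = 1 := by
    rw [nsq, Finset.sum_eq_single i]
    · simp
    · intro j _ hj; simp [hj]
    · simp
  rw [h2] at h1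
  have h3 := (normSq_le_nsq (T *ᵥ v) i).trans h1
  rw [htop T v hT hvl] at h3
  have h4 : T' i i * v i = 1 := by
    rw [← htop T' v hT' hvl, hTv]; simp
  have h5 : ‖T' i i‖ * ‖v i‖ = 1 := by rw [← norm_mul, h4, norm_one]
  rw [Complex.normSq_eq_norm_sq, norm_mul] at h3
  have h6 : ‖T i i‖ * ‖v i‖ ≤ ‖T' i i‖ * ‖v i‖ := by
    rw [h5]; nlinarith [mul_nonneg (norm_nonneg (T i i)) (norm_nonneg (v i))]
  have h7 : 0 < ‖v i‖ := by
    rcases (norm_nonneg (v i)).eq_or_lt with h | h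
    · rw [← h] at h5; simp at h5
    · exact h
  exact le_of_mul_le_mul_right h6 h7

end Mask

section Fin
variable {m : ℕ}

theorem cholesky {N : Matrix (Fin m) (Fin m) ℂ} (hN : N.PosDef) :
    ∃ T : Matrix (Fin m) (Fin m) ℂ, BlockTriangular T Fin.val ∧ (∀ i, T i i ≠ 0) ∧ N = Tᴴ * T := by
  have h1 := LDL.lower_conj_diag hN
  set L := LDL.lower hN with hL
  have hinvtri : (LDL.lowerInv hN).BlockTriangular OrderDual.toDual := by
    intro i j hij; exact LDL.lowerInv_triangular hN hij
  have hdetne : N.det ≠ 0 := posDef_det_ne hN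
  have hLtri : L.BlockTriangular OrderDual.toDual := by
    rw [hL, LDL.lower]
    exact blockTriangular_inv_of_blockTriangular hinvtri
  have hdiag : ∀ i, 0 < (LDL.diag hN) i i := by
    intro i
    have hpd : (LDL.diag hN).PosDef := by
      rw [LDL.diag_eq_lowerInv_conj]
      refine hN.mul_mul_conjTranspose_same ?_
      have : IsUnit (LDL.lowerInv hN) := isUnit_of_invertible _
      exact vecMul_injective_of_isUnit this
    exact hpd.diag_pos
  have hD : LDL.diag hN = diagonal fun i => (((LDL.diag hN) i i).re : ℂ) := by
    have : ∀ i, (LDL.diag hN) i i = (((LDL.diag hN) i i).re : ℂ) := by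
      intro i
      have := (Complex.lt_def.1 (hdiag i)).2
      apply Complex.ext <;> simp
      simpa using this.symm
    ext i j
    by_cases hij : i = j
    · subst hij; simpa using this i
    · rw [diagonal_apply_ne _ hij, LDL.diag, diagonal_apply_ne _ hij]
  set d : Fin m → ℝ := fun i => ((LDL.diag hN) i i).re with hd
  have hdpos : ∀ i, 0 < d i := fun i => (Complex.lt_def.1 (hdiag i)).1
  let T : Matrix (Fin m) (Fin m) ℂ := diagonal (fun i => ((Real.sqrt (d i) : ℝ) : ℂ)) * Lᴴ
  have hTT : N = Tᴴ * T := by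
    conv_lhs => rw [← h1, hD]
    simp only [T, conjTranspose_mul, conjTranspose_conjTranspose, diagonal_conjTranspose]
    simp only [Matrix.mul_assoc]
    congr 1
    rw [← Matrix.mul_assoc (diagonal _) (diagonal _) (Lᴴ), diagonal_mul_diagonal]
    congr 3
    ext i
    simp only [Pi.star_apply, Complex.star_def, Complex.conj_ofReal]
    rw [← Complex.ofReal_mul, Real.mul_self_sqrt (hdpos i).le]
  have hTtri : BlockTriangular T Fin.val := by
    intro i j hij
    simp only [T, diagonal_mul, conjTranspose_apply]
    rw [hLtri (show OrderDual.toDual i < OrderDual.toDual j from hij)]; simp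
  refine ⟨T, hTtri, ?_, hTT⟩
  have : T.det ≠ 0 := by
    intro h0
    apply hdetne
    rw [hTT, det_mul, h0, mul_zero]
  rw [det_upper Fin.val_injective hTtri] at this
  exact fun i => Finset.prod_ne_zero_iff.1 this i (Finset.mem_univ i)

theorem diagonal_one_mul (T : Matrix (Fin m) (Fin m) ℂ) :
    Tᴴ * T = Tᴴ * diagonal (fun _ => (1 : ℂ)) * T := by
  rw [diagonal_one, Matrix.mul_one]

theorem ell_chol {T : Matrix (Fin m) (Fin m) ℂ} (hT : BlockTriangular T Fin.val)
    (hT0 : ∀ i, T i i ≠ 0) (i : Fin m) : ell Fin.val i (Tᴴ * T) = 2 * Real.log ‖T i i‖ := by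
  rw [diagonal_one_mul, ell_sign_conj Fin.val_injective hT hT0 i (by simp)]

theorem ell_mono {N N' : Matrix (Fin m) (Fin m) ℂ} (hN : N.PosDef) (hN' : N'.PosDef)
    (h : ∀ x, qf N x ≤ qf N' x) (i : Fin m) : ell Fin.val i N ≤ ell Fin.val i N' := by
  obtain ⟨T, hT, hT0, rfl⟩ := cholesky hN
  obtain ⟨T', hT', hT0', rfl⟩ := cholesky hN'
  rw [ell_chol hT hT0, ell_chol hT' hT0']
  have := chol_mono Fin.val_injective hT hT' hT0' h i
  have := Real.log_le_log (norm_pos_iff.2 (hT0 i)) this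
  linarith

theorem sum_ell_fin {N : Matrix (Fin m) (Fin m) ℂ} (hN : N.PosDef) (b : ℕ) :
    ∑ i : Fin m with Fin.val i < b, ell Fin.val i N = lmin Fin.val b N := by
  obtain ⟨T, hT, hT0, rfl⟩ := cholesky hN
  rw [diagonal_one_mul]
  exact sum_ell Fin.val_injective hT hT0 (by simp) b

theorem sum_ell_univ {N : Matrix (Fin m) (Fin m) ℂ} (hN : N.PosDef) :
    ∑ i : Fin m, ell Fin.val i N = Real.log ‖N.det‖ := by
  have := sum_ell_fin hN m
  rw [lmin, mask_of_lt (fun i => i.2)] at this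
  rw [← this]; congr 1; ext i; simp

end Fin

section Block
variable {p q : ℕ}

/-- Position of an index when the first block comes first. -/
def rkU : Fin p ⊕ Fin q → ℕ := Sum.elim (fun i => (i : ℕ)) (fun j => p + j)

/-- Position of an index when the second block comes first. -/
def rkW : Fin p ⊕ Fin q → ℕ := Sum.elim (fun i => q + i) (fun j => (j : ℕ))

theorem rkU_inj : Function.Injective (rkU : Fin p ⊕ Fin q → ℕ) := by
  rintro (i | i) (j | j) h <;> simp only [rkU, Sum.elim_inl, Sum.elim_inr] at h
  · exact congrArg _ (Fin.ext h)
  · omega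
  · omega
  · exact congrArg _ (Fin.ext (by omega))

theorem rkW_inj : Function.Injective (rkW : Fin p ⊕ Fin q → ℕ) := by
  rintro (i | i) (j | j) h <;> simp only [rkW, Sum.elim_inl, Sum.elim_inr] at h
  · exact congrArg _ (Fin.ext (by omega))
  · omega
  · omega
  · exact congrArg _ (Fin.ext h)

/-- Signs of the Hermitian form. -/
def sg : Fin p ⊕ Fin q → ℝ := Sum.elim (fun _ => 1) (fun _ => -1)

/-- The standard Hermitian form of signature `(p, q)`. -/
def J0 (p q : ℕ) : Matrix (Fin p ⊕ Fin q) (Fin p ⊕ Fin q) ℂ := diagonal fun i => ((sg i : ℝ) : ℂ)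

theorem sg_mul_self (i : Fin p ⊕ Fin q) : sg i * sg i = 1 := by
  rcases i with i | i <;> simp [sg]

theorem norm_sg (i : Fin p ⊕ Fin q) : ‖((sg i : ℝ) : ℂ)‖ = 1 := by
  rcases i with i | i <;> simp [sg]

theorem J0_eq : J0 p q = fromBlocks 1 0 0 (-1) := by
  ext (i | i) (j | j) <;> simp [J0, sg, diagonal_apply, one_apply]
  split_ifs <;> simp

theorem J0_sq : J0 p q * J0 p q = 1 := by
  rw [J0, diagonal_mul_diagonal, ← diagonal_one]; congr 1; ext i
  rw [← Complex.ofReal_mul, sg_mul_self]; simp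

theorem J0_conj : (J0 p q)ᴴ = J0 p q := by
  rw [J0, diagonal_conjTranspose]; congr 1; ext i; simp

theorem det_isUnit_of_diag {m : ℕ} {T : Matrix (Fin m) (Fin m) ℂ}
    (hT : BlockTriangular T Fin.val) (hT0 : ∀ i, T i i ≠ 0) : IsUnit T.det := by
  rw [det_upper Fin.val_injective hT, isUnit_iff_ne_zero]
  exact Finset.prod_ne_zero_iff.2 fun i _ => hT0 i

theorem phi_block {rk : Fin p ⊕ Fin q → ℕ} (hrk : Function.Injective rk)
    {T : Matrix (Fin p ⊕ Fin q) (Fin p ⊕ Fin q) ℂ} (hT : BlockTriangular T rk)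
    {TU : Matrix (Fin p) (Fin p) ℂ} {TW : Matrix (Fin q) (Fin q) ℂ}
    (hU : BlockTriangular TU Fin.val) (hU0 : ∀ i, TU i i ≠ 0)
    (hW : BlockTriangular TW Fin.val) (hW0 : ∀ i, TW i i ≠ 0)
    (h1 : ∀ i, T (Sum.inl i) (Sum.inl i) = TU i i)
    (h2 : ∀ i, T (Sum.inr i) (Sum.inr i) = TW i i) (al : Fin p ⊕ Fin q → ℝ) :
    phi rk al (Tᴴ * J0 p q * T) = phi Fin.val (fun i => al (Sum.inl i)) (TUᴴ * TU)
      + phi Fin.val (fun i => al (Sum.inr i)) (TWᴴ * TW) := by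
  have hT0 : ∀ i, T i i ≠ 0 := by
    rintro (i | i)
    · rw [h1]; exact hU0 i
    · rw [h2]; exact hW0 i
  simp only [phi, Fintype.sum_sum_type]
  simp only [J0]
  congr 1
  · refine Finset.sum_congr rfl fun i _ => ?_
    rw [ell_sign_conj hrk hT hT0 _ norm_sg, ell_chol hU hU0, h1]
  · refine Finset.sum_congr rfl fun i _ => ?_
    rw [ell_sign_conj hrk hT hT0 _ norm_sg, ell_chol hW hW0, h2]

theorem block_W (H' : Matrix (Fin p) (Fin p) ℂ) (Y : Matrix (Fin p) (Fin q) ℂ)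
    (R : Matrix (Fin q) (Fin q) ℂ) (hR : R.PosDef) (hM : (H' + Y * R⁻¹ * Yᴴ).PosDef) :
    ∃ T : Matrix (Fin p ⊕ Fin q) (Fin p ⊕ Fin q) ℂ, BlockTriangular T rkW ∧ (∀ i, T i i ≠ 0) ∧
      fromBlocks H' Y Yᴴ (-R) = Tᴴ * J0 p q * T ∧
      ∀ al, phi rkW al (fromBlocks H' Y Yᴴ (-R))
        = phi Fin.val (fun i => al (Sum.inl i)) (H' + Y * R⁻¹ * Yᴴ)
          + phi Fin.val (fun i => al (Sum.inr i)) R := by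
  obtain ⟨TW, hW, hW0, eR⟩ := cholesky hR
  obtain ⟨TU, hU, hU0, eM⟩ := cholesky hM
  have uW := det_isUnit_of_diag hW hW0
  have uW' : IsUnit (TWᴴ).det := by rw [det_conjTranspose]; exact uW.star
  set Z : Matrix (Fin q) (Fin p) ℂ := -((TWᴴ)⁻¹ * Yᴴ) with hZ
  have hZc : Zᴴ = -(Y * TW⁻¹) := by
    rw [hZ, conjTranspose_neg, conjTranspose_mul, conjTranspose_conjTranspose,
      conjTranspose_nonsing_inv, conjTranspose_conjTranspose]
  let T := fromBlocks TU 0 Z TW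
  have hT : BlockTriangular T rkW := by
    rintro (i | i) (j | j) h <;> simp only [rkW, Sum.elim_inl, Sum.elim_inr] at h
    · exact hU (show (j : ℕ) < i by omega)
    · rfl
    · exfalso; omega
    · exact hW h
  have eT : fromBlocks H' Y Yᴴ (-R) = Tᴴ * J0 p q * T := by
    rw [J0_eq]
    simp only [T, fromBlocks_conjTranspose, fromBlocks_multiply, conjTranspose_zero,
      Matrix.mul_one, Matrix.mul_zero, Matrix.zero_mul, add_zero, zero_add, Matrix.mul_neg,
      Matrix.neg_mul]
    rw [← eM, ← eR, fromBlocks_inj]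
    refine ⟨?_, ?_, ?_, rfl⟩
    · rw [hZc, hZ, eR, Matrix.mul_inv_rev]
      simp only [Matrix.neg_mul, Matrix.mul_neg, neg_neg, Matrix.mul_assoc]
      abel
    · rw [hZc, Matrix.neg_mul, neg_neg, Matrix.mul_assoc, nonsing_inv_mul _ uW, Matrix.mul_one]
    · rw [hZ, Matrix.mul_neg, neg_neg, ← Matrix.mul_assoc, mul_nonsing_inv _ uW', Matrix.one_mul]
  refine ⟨T, hT, ?_, eT, fun al => ?_⟩
  · rintro (i | i)
    · exact hU0 i
    · exact hW0 i
  · rw [eT, phi_block rkW_inj hT hU hU0 hW hW0 (fun _ => rfl) (fun _ => rfl), ← eM, ← eR]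

theorem block_U (H : Matrix (Fin p) (Fin p) ℂ) (S : Matrix (Fin p) (Fin q) ℂ)
    (L : Matrix (Fin q) (Fin q) ℂ) (hH : H.PosDef) (hM : (L + Sᴴ * H⁻¹ * S).PosDef) :
    ∃ T : Matrix (Fin p ⊕ Fin q) (Fin p ⊕ Fin q) ℂ, BlockTriangular T rkU ∧ (∀ i, T i i ≠ 0) ∧
      fromBlocks H S Sᴴ (-L) = Tᴴ * J0 p q * T ∧
      ∀ al, phi rkU al (fromBlocks H S Sᴴ (-L))
        = phi Fin.val (fun i => al (Sum.inl i)) H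
          + phi Fin.val (fun i => al (Sum.inr i)) (L + Sᴴ * H⁻¹ * S) := by
  obtain ⟨TU, hU, hU0, eH⟩ := cholesky hH
  obtain ⟨TW, hW, hW0, eM⟩ := cholesky hM
  have uU := det_isUnit_of_diag hU hU0
  have uU' : IsUnit (TUᴴ).det := by rw [det_conjTranspose]; exact uU.star
  set Z : Matrix (Fin p) (Fin q) ℂ := (TUᴴ)⁻¹ * S with hZ
  have hZc : Zᴴ = Sᴴ * TU⁻¹ := by
    rw [hZ, conjTranspose_mul, conjTranspose_nonsing_inv, conjTranspose_conjTranspose]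
  let T := fromBlocks TU Z 0 TW
  have hT : BlockTriangular T rkU := by
    rintro (i | i) (j | j) h <;> simp only [rkU, Sum.elim_inl, Sum.elim_inr] at h
    · exact hU h
    · exfalso; omega
    · rfl
    · exact hW (show (j : ℕ) < i by omega)
  have eT : fromBlocks H S Sᴴ (-L) = Tᴴ * J0 p q * T := by
    rw [J0_eq]
    simp only [T, fromBlocks_conjTranspose, fromBlocks_multiply, conjTranspose_zero,
      Matrix.mul_one, Matrix.mul_zero, Matrix.zero_mul, add_zero, zero_add, Matrix.mul_neg,
      Matrix.neg_mul, neg_zero]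
    rw [← eM, ← eH, fromBlocks_inj]
    refine ⟨rfl, ?_, ?_, ?_⟩
    · rw [hZ, ← Matrix.mul_assoc, mul_nonsing_inv _ uU', Matrix.one_mul]
    · rw [hZc, Matrix.mul_assoc, nonsing_inv_mul _ uU, Matrix.mul_one]
    · rw [hZc, hZ, eH, Matrix.mul_inv_rev]
      simp only [Matrix.mul_assoc]
      abel
  refine ⟨T, hT, ?_, eT, fun al => ?_⟩
  · rintro (i | i)
    · exact hU0 i
    · exact hW0 i
  · rw [eT, phi_block rkU_inj hT hU hU0 hW hW0 (fun _ => rfl) (fun _ => rfl), ← eM, ← eH]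

theorem phi_sub_ge {m : ℕ} {N N' : Matrix (Fin m) (Fin m) ℂ} (hN : N.PosDef) (hN' : N'.PosDef)
    (h : ∀ x, qf N x ≤ qf N' x) {al : Fin m → ℝ} {c : ℝ} (hc : ∀ i, c ≤ al i) :
    c * (Real.log ‖N'.det‖ - Real.log ‖N.det‖) ≤ phi Fin.val al N' - phi Fin.val al N := by
  rw [← sum_ell_univ hN, ← sum_ell_univ hN', phi, phi, ← Finset.sum_sub_distrib,
    ← Finset.sum_sub_distrib, Finset.mul_sum]
  refine Finset.sum_le_sum fun i _ => ?_
  have := ell_mono hN hN' h i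
  nlinarith [hc i]

theorem phi_sub_le {m : ℕ} {N N' : Matrix (Fin m) (Fin m) ℂ} (hN : N.PosDef) (hN' : N'.PosDef)
    (h : ∀ x, qf N x ≤ qf N' x) {al : Fin m → ℝ} {c : ℝ} (hc : ∀ i, al i ≤ c) :
    phi Fin.val al N' - phi Fin.val al N ≤ c * (Real.log ‖N'.det‖ - Real.log ‖N.det‖) := by
  rw [← sum_ell_univ hN, ← sum_ell_univ hN', phi, phi, ← Finset.sum_sub_distrib,
    ← Finset.sum_sub_distrib, Finset.mul_sum]
  refine Finset.sum_le_sum fun i _ => ?_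
  have := ell_mono hN hN' h i
  nlinarith [hc i]

theorem det_schur {H : Matrix (Fin p) (Fin p) ℂ} (Y : Matrix (Fin p) (Fin q) ℂ)
    {R : Matrix (Fin q) (Fin q) ℂ} (hH : IsUnit H.det) (hR : IsUnit R.det) :
    R.det * (H + Y * R⁻¹ * Yᴴ).det = H.det * (R + Yᴴ * H⁻¹ * Y).det := by
  let _ := H.invertibleOfIsUnitDet hH
  let _ := R.invertibleOfIsUnitDet hR
  let _ : Invertible (-R) := invertibleNeg R
  have h1 := det_fromBlocks₁₁ H Y Yᴴ (-R)
  have h2 := det_fromBlocks₂₂ H Y Yᴴ (-R)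
  rw [h1] at h2
  have e1 : -R - Yᴴ * ⅟H * Y = -(R + Yᴴ * H⁻¹ * Y) := by
    rw [invOf_eq_nonsing_inv]; abel
  have e2 : H - Y * ⅟(-R) * Yᴴ = H + Y * R⁻¹ * Yᴴ := by
    rw [invOf_neg, invOf_eq_nonsing_inv, Matrix.mul_neg, Matrix.neg_mul]; abel
  rw [e1, e2, det_neg, det_neg] at h2
  have h3 : ((-1 : ℂ) ^ Fintype.card (Fin q)) ≠ 0 := pow_ne_zero _ (by norm_num)
  apply mul_left_cancel₀ h3
  linear_combination -h2

end Block

theorem finrank_map_of_injective {E F : Type*} [AddCommGroup E] [Module ℂ E] [AddCommGroup F]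
    [Module ℂ F] {f : E →ₗ[ℂ] F} (hf : Function.Injective f) (V : Submodule ℂ E) :
    Module.finrank ℂ (V.map f) = Module.finrank ℂ V :=
  (LinearEquiv.finrank_eq (Submodule.equivMapOfInjective f hf V)).symm

section Rows
variable {m : ℕ}

theorem piv_low (b : ℕ) : piv (Fin.val : Fin m → ℕ) (low Fin.val b)
    = Finset.univ.filter fun i : Fin m => Fin.val i < b := by
  have := piv_inf_low (rk := (Fin.val : Fin m → ℕ)) ⊤ b
  rw [top_inf_eq, piv_top Fin.val_injective] at this
  exact this

theorem finrank_low {b : ℕ} (hb : b ≤ m) :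
    Module.finrank ℂ (low (Fin.val : Fin m → ℕ) b) = b := by
  rw [← card_piv Fin.val_injective, piv_low]
  have : (Finset.univ.filter fun i : Fin m => Fin.val i < b)
      = Finset.univ.map (Fin.castLEEmb hb) := by
    ext i; simp only [Finset.mem_filter, Finset.mem_univ, true_and, Finset.mem_map]
    constructor
    · intro h; exact ⟨⟨i, h⟩, rfl⟩
    · rintro ⟨a, rfl⟩; exact a.2
  rw [this]; simp

/-- The row permutation attached to an invertible matrix: all leading minors of the permuted
matrix are nonzero, and it computes the pivots of preimages of coordinate subspaces. -/
theorem exists_row_perm (M : Matrix (Fin m) (Fin m) ℂ) (hM : IsUnit M.det) :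
    ∃ e : Equiv.Perm (Fin m),
      (∀ b, (mask Fin.val b (M.submatrix e id)).det ≠ 0) ∧
      ∀ (c : ℕ) (i : Fin m), (e i : ℕ) < c ↔
        i ∈ piv Fin.val ((low Fin.val c).comap (Matrix.mulVecLin M)) := by
  classical
  set f := Matrix.mulVecLin M with hf
  have hinj : Function.Injective f := by
    intro x y h
    have : M⁻¹ *ᵥ (M *ᵥ x) = M⁻¹ *ᵥ (M *ᵥ y) := by
      have h' : M *ᵥ x = M *ᵥ y := h
      rw [h']
    simpa [mulVec_mulVec, nonsing_inv_mul _ hM] using this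
  let V : ℕ → Submodule ℂ (Fin m → ℂ) := fun b => (low Fin.val b).map f
  let I : ℕ → Finset (Fin m) := fun b => piv Fin.val (V b)
  have hlow : ∀ {b b' : ℕ}, b ≤ b' → low (Fin.val : Fin m → ℕ) b ≤ low Fin.val b' :=
    fun h v hv l hl => hv l (h.trans hl)
  have hmono : ∀ {b b' : ℕ}, b ≤ b' → I b ⊆ I b' := fun h => piv_mono (Submodule.map_mono (hlow h))
  have hcard : ∀ b ≤ m, (I b).card = b := by
    intro b hb
    rw [card_piv Fin.val_injective, finrank_map_of_injective hinj, finrank_low hb]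
  have hex : ∀ i : Fin m, ∃ r, r ∈ I (i + 1) ∧ r ∉ I i := by
    intro i
    by_contra! h
    have : (I (i + 1)).card ≤ (I i).card := Finset.card_le_card h
    rw [hcard _ i.2, hcard _ i.2.le] at this
    omega
  choose g hg1 hg2 using hex
  have hgI : ∀ (i : Fin m) (b : ℕ), (i : ℕ) < b → g i ∈ I b := fun i b h => hmono h (hg1 i)
  have hginj : Function.Injective g := by
    intro i j h
    rcases lt_trichotomy i j with h' | h' | h'
    · exact absurd (h ▸ hgI i j h') (hg2 j)
    · exact h'
    · exact absurd (h ▸ hgI j i h') (hg2 i)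
  let e : Equiv.Perm (Fin m) := Equiv.ofBijective g (Finite.injective_iff_bijective.1 hginj)
  have hI : ∀ b ≤ m, I b = (Finset.univ.filter fun i : Fin m => Fin.val i < b).image g := by
    intro b hb
    symm
    apply Finset.eq_of_subset_of_card_le
    · intro r hr
      obtain ⟨i, hi, rfl⟩ := Finset.mem_image.1 hr
      exact hgI i b (by simpa using hi)
    · rw [hcard b hb, Finset.card_image_of_injective _ hginj, ← piv_low, card_piv Fin.val_injective,
        finrank_low hb]
  have hIb : ∀ b, (b ≤ m ∨ m < b) := fun b => le_or_gt b m
  refine ⟨e, fun b => ?_, fun c => ?_⟩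
  · intro h0
    obtain ⟨x, hx, hx0⟩ := exists_mulVec_eq_zero_iff.2 h0
    have hmv : ∀ i, (mask Fin.val b (M.submatrix e id) *ᵥ x) i
        = if Fin.val i < b then ∑ j : Fin m, (if Fin.val j < b then M (g i) j else 0) * x j else x i := by
      intro i
      simp only [mulVec, dotProduct]
      split_ifs with hi
      · refine Finset.sum_congr rfl fun j _ => ?_
        rw [mask_apply]
        by_cases hj : (j : ℕ) < b
        · simp [hi, hj, e]
        · have : i ≠ j := by rintro rfl; exact hj hi
          simp [hj, this]
      · rw [Finset.sum_eq_single i]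
        · rw [mask_apply]; simp [hi]
        · intro j _ hj
          rw [mask_apply]; simp [hi, Ne.symm hj]
        · simp
    have hxlow : x ∈ low (Fin.val : Fin m → ℕ) b := by
      intro i hi
      have := congrFun hx0 i
      rw [hmv, if_neg (by omega)] at this
      exact this
    have hy0 : f x ≠ 0 := fun h => hx (hinj (by rw [h, map_zero]))
    have hyV : f x ∈ V b := Submodule.mem_map_of_mem hxlow
    obtain ⟨r, hr1, hr2⟩ := exists_top (rk := (Fin.val : Fin m → ℕ)) hy0
    have hrI : r ∈ I b := mem_piv.2 ⟨_, hyV, hr1, hr2⟩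
    have : ∃ i : Fin m, (i : ℕ) < b ∧ g i = r := by
      rcases hIb b with h | h
      · rw [hI b h] at hrI
        simpa using hrI
      · obtain ⟨i, hi⟩ := e.surjective r
        exact ⟨i, i.2.trans h, hi⟩
    obtain ⟨i, hi, rfl⟩ := this
    apply hr1
    have h2 := congrFun hx0 i
    rw [hmv, if_pos hi] at h2
    change ∑ j, M (g i) j * x j = 0
    rw [Pi.zero_apply] at h2
    rw [← h2]
    refine Finset.sum_congr rfl fun j _ => ?_
    split_ifs with hj
    · rfl
    · rw [hxlow j (by omega)]; simp
  · set W := (low (Fin.val : Fin m → ℕ) c).comap f with hW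
    have hcount : ∀ b ≤ m, ((Finset.univ.filter fun i : Fin m => Fin.val (e i) < c).filter
        fun i => Fin.val i < b).card = ((piv Fin.val W).filter fun i => Fin.val i < b).card := by
      intro b hb
      rw [card_piv_filter Fin.val_injective]
      have h1 : V b ⊓ low Fin.val c = (W ⊓ low Fin.val b).map f := by
        ext y
        constructor
        · rintro ⟨⟨x, hx, rfl⟩, h2⟩
          exact ⟨x, ⟨h2, hx⟩, rfl⟩
        · rintro ⟨x, ⟨h1, h2⟩, rfl⟩
          exact ⟨⟨x, h2, rfl⟩, h1⟩
      rw [← finrank_map_of_injective hinj, ← h1, ← card_piv_filter Fin.val_injective]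
      change _ = ((I b).filter _).card
      rw [hI b hb, Finset.filter_image, Finset.card_image_of_injective _ hginj, Finset.filter_filter,
        Finset.filter_filter]
      congr 1
      ext i; simp [e, and_comm]
    intro i
    have key : ∀ P : Finset (Fin m), (P.filter fun j => Fin.val j < i + 1).card
        = (P.filter fun j => Fin.val j < i).card + if i ∈ P then 1 else 0 := by
      intro P
      have : (P.filter fun j => Fin.val j < i + 1)
          = (P.filter fun j => Fin.val j < i) ∪ (P.filter fun j => j = i) := by
        ext j; simp only [Finset.mem_filter, Finset.mem_union, Fin.ext_iff]
        constructor
        · rintro ⟨h1, h2⟩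
          rcases Nat.lt_succ_iff_lt_or_eq.1 h2 with h | h
          · exact Or.inl ⟨h1, h⟩
          · exact Or.inr ⟨h1, h⟩
        · rintro (⟨h1, h2⟩ | ⟨h1, h2⟩) <;> exact ⟨h1, by omega⟩
      rw [this, Finset.card_union_of_disjoint, Finset.filter_eq']
      · congr 1
        split_ifs <;> simp
      · rw [Finset.disjoint_left]
        intro j hj hj'
        simp only [Finset.mem_filter, Fin.ext_iff] at hj hj'
        omega
    have h1 := hcount (i + 1) i.2
    have h2 := hcount i i.2.le
    rw [key, key, h2] at h1
    have h3 : (i ∈ Finset.univ.filter fun i : Fin m => Fin.val (e i) < c) ↔ Fin.val (e i) < c := by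
      simp
    rw [← h3]
    split_ifs at h1 with h4 h5 h5 <;> simp_all

end Rows

section Local
variable {m : ℕ}

theorem log_det_mono {N N' : Matrix (Fin m) (Fin m) ℂ} (hN : N.PosDef) (hN' : N'.PosDef)
    (h : ∀ x, qf N x ≤ qf N' x) : Real.log ‖N.det‖ ≤ Real.log ‖N'.det‖ := by
  rw [← sum_ell_univ hN, ← sum_ell_univ hN']
  exact Finset.sum_le_sum fun i _ => ell_mono hN hN' h i

theorem posDef_diag_exp (s : Fin m → ℝ) :
    (diagonal fun i => ((Real.exp (s i) : ℝ) : ℂ)).PosDef := by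
  refine posDef_of_qf ?_ fun x hx => ?_
  · rw [IsHermitian, diagonal_conjTranspose]; congr 1; ext i; exact Complex.conj_ofReal _
  · rw [qf_diagonal]
    obtain ⟨i, hi⟩ := Function.ne_iff.1 hx
    refine Finset.sum_pos' (fun i _ => mul_nonneg (Real.exp_pos _).le (Complex.normSq_nonneg _))
      ⟨i, Finset.mem_univ _, mul_pos (Real.exp_pos _) (Complex.normSq_pos.2 hi)⟩

theorem posDef_conj {N : Matrix (Fin m) (Fin m) ℂ} (hN : N.PosDef) {A : Matrix (Fin m) (Fin m) ℂ}
    (hA : A.det ≠ 0) : (Aᴴ * N * A).PosDef := by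
  refine posDef_of_qf ?_ fun x hx => ?_
  · exact isHermitian_conjTranspose_mul_mul A hN.isHermitian
  · rw [qf_conj]
    refine qf_pos hN fun h => hx ?_
    by_contra hx
    exact hA (exists_mulVec_eq_zero_iff.1 ⟨x, hx, h⟩)

theorem qf_mask (N : Matrix (Fin m) (Fin m) ℂ) (b : ℕ) (x : Fin m → ℂ) :
    qf (mask Fin.val b N) x = qf N (pmat Fin.val b *ᵥ x)
      + ∑ i : Fin m, (if Fin.val i < b then 0 else 1) * Complex.normSq (x i) := by
  rw [mask, qf_add]
  congr 1
  · have := qf_conj N (pmat (Fin.val : Fin m → ℕ) b) x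
    rwa [pmat_conj] at this
  · rw [← qf_diagonal]; congr 1
    ext i j
    rw [pmat, ← diagonal_one, diagonal_sub]
    congr 2; ext i; split_ifs <;> simp

theorem lmin_conj_ge {A : Matrix (Fin m) (Fin m) ℂ} (hA : A.det ≠ 0) (b : ℕ)
    (hAb : (mask Fin.val b A).det ≠ 0) (s : Fin m → ℝ) :
    ∑ i : Fin m with Fin.val i < b, s i + 2 * Real.log ‖(mask Fin.val b A).det‖
      ≤ lmin Fin.val b (Aᴴ * diagonal (fun i => ((Real.exp (s i) : ℝ) : ℂ)) * A) := by
  set D := diagonal fun i => ((Real.exp (s i) : ℝ) : ℂ) with hD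
  have hDp : D.PosDef := posDef_diag_exp s
  have h1 : ((mask Fin.val b A)ᴴ * mask Fin.val b D * mask Fin.val b A).PosDef :=
    posDef_conj (mask_posDef hDp _ _) hAb
  have h2 : (mask Fin.val b (Aᴴ * D * A)).PosDef := mask_posDef (posDef_conj hDp hA) _ _
  refine le_trans (le_of_eq ?_) (log_det_mono h1 h2 fun x => ?_)
  · rw [det_mul, det_mul, det_conjTranspose, norm_mul, norm_mul, norm_star,
      Real.log_mul (mul_ne_zero (norm_ne_zero_iff.2 hAb) (norm_ne_zero_iff.2
        (posDef_det_ne (mask_posDef hDp _ _)))) (norm_ne_zero_iff.2 hAb),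
      Real.log_mul (norm_ne_zero_iff.2 hAb) (norm_ne_zero_iff.2
        (posDef_det_ne (mask_posDef hDp _ _))), hD, det_mask_diagonal, norm_prod,
      Real.log_prod (fun i _ => by simp)]
    simp only [Complex.norm_real, Real.norm_eq_abs, Real.abs_exp, Real.log_exp]
    ring
  · rw [qf_conj, qf_mask, qf_mask, qf_conj]
    have hlow : ∀ i : Fin m, Fin.val i < b → (mask Fin.val b A *ᵥ x) i = (A *ᵥ (pmat Fin.val b *ᵥ x)) i := by
      intro i hi
      simp only [mulVec, dotProduct, pmat]
      refine Finset.sum_congr rfl fun j _ => ?_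
      rw [mask_apply]
      simp only [diagonal_apply, ite_mul, zero_mul, Finset.sum_ite_eq, Finset.mem_univ, if_true, hi,
        true_and]
      by_cases hj : Fin.val j < b
      · simp [hj]
      · have : i ≠ j := by rintro rfl; exact hj hi
        simp [hj, this]
    have hhigh : ∀ i : Fin m, ¬ Fin.val i < b → (mask Fin.val b A *ᵥ x) i = x i := by
      intro i hi
      simp only [mulVec, dotProduct]
      rw [Finset.sum_eq_single i]
      · rw [mask_apply]; simp [hi]
      · intro j _ hj; rw [mask_apply]; simp [hi, Ne.symm hj]
      · simp
    refine add_le_add ?_ (le_of_eq ?_)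
    · rw [hD, qf_diagonal, qf_diagonal]
      refine Finset.sum_le_sum fun i _ => mul_le_mul_of_nonneg_left ?_ (Real.exp_pos _).le
      have : (pmat Fin.val b *ᵥ (mask Fin.val b A *ᵥ x)) i
          = if Fin.val i < b then (A *ᵥ (pmat Fin.val b *ᵥ x)) i else 0 := by
        rw [pmat, mulVec_diagonal]
        split_ifs with h
        · rw [one_mul, hlow i h, pmat]
        · simp
      rw [this]
      split_ifs
      · exact le_rfl
      · simpa using Complex.normSq_nonneg _
    · refine Finset.sum_congr rfl fun i _ => ?_
      split_ifs with h
      · simp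
      · rw [hhigh i h]

theorem phi_local (M0 : Matrix (Fin m) (Fin m) ℂ) (e : Equiv.Perm (Fin m))
    (he : ∀ b, (mask Fin.val b (M0.submatrix e id)).det ≠ 0) (al : Fin m → ℝ) (hal : Antitone al) :
    ∃ C, 0 ≤ C ∧ ∀ᶠ M in 𝓝 M0, ∀ s : Fin m → ℝ, ∑ i, al i * s (e i) - C ≤
      phi Fin.val al (Mᴴ * diagonal (fun i => ((Real.exp (s i) : ℝ) : ℂ)) * M) := by
  let δ : ℕ → Matrix (Fin m) (Fin m) ℂ → ℂ := fun b M => (mask Fin.val b (M.submatrix e id)).det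
  have hcont : ∀ b, Continuous (δ b) := by
    intro b
    refine Continuous.matrix_det ?_
    refine continuous_matrix fun i j => ?_
    simp only [mask_apply, submatrix_apply, id]
    split_ifs
    · exact continuous_id.matrix_elem _ _
    · exact continuous_const
    · exact continuous_const
  have hmask : ∀ b (A : Matrix (Fin m) (Fin m) ℂ), mask Fin.val b A = mask Fin.val (min b m) A := by
    intro b A
    rcases le_total b m with h | h
    · rw [min_eq_left h]
    · rw [min_eq_right h, mask_of_lt (fun i => i.2.trans_le h), mask_of_lt (fun i => i.2)]
  obtain ⟨C, hC⟩ : ∃ C, ∀ b ∈ Finset.range (m + 1), |2 * Real.log ‖δ b M0‖| ≤ C := by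
    exact ⟨∑ b ∈ Finset.range (m + 1), |2 * Real.log ‖δ b M0‖|, fun b hb =>
      Finset.single_le_sum (f := fun b => |2 * Real.log ‖δ b M0‖|) (fun _ _ => abs_nonneg _) hb⟩
  have hC0 : 0 ≤ C := (abs_nonneg _).trans (hC 0 (by simp))
  have hev : ∀ᶠ M in 𝓝 M0, ∀ b ∈ Finset.range (m + 1),
      δ b M ≠ 0 ∧ |2 * Real.log ‖δ b M‖| < C + 1 := by
    rw [eventually_all_finset]
    intro b hb
    have hne : ‖δ b M0‖ ≠ 0 := norm_ne_zero_iff.2 (he b)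
    have h1 : ∀ᶠ M in 𝓝 M0, δ b M ≠ 0 := (hcont b).continuousAt.eventually_ne (he b)
    have h2 : ContinuousAt (fun M => |2 * Real.log ‖δ b M‖|) M0 :=
      (continuousAt_const.mul ((hcont b).continuousAt.norm.log hne)).abs
    exact h1.and (h2.eventually_lt_const (by linarith [hC b hb]))
  by_cases hm : m = 0
  · subst hm; exact ⟨0, le_rfl, .of_forall fun M s => by simp [phi]⟩
  have hm0 : 0 < m := Nat.pos_of_ne_zero hm
  set c := al ⟨m - 1, by omega⟩ with hc
  set c' := al ⟨0, hm0⟩ with hc'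
  have hcc : c ≤ c' := hal (by simp)
  refine ⟨(C + 1) * (c' - c) + |c| * (C + 1), by
    have := abs_nonneg c
    have : 0 ≤ c' - c := by linarith
    positivity, ?_⟩
  filter_upwards [hev] with M hM s
  have hMb : ∀ b, (mask Fin.val b (M.submatrix e id)).det ≠ 0 ∧
      |2 * Real.log ‖(mask Fin.val b (M.submatrix e id)).det‖| < C + 1 := by
    intro b
    rw [hmask]
    exact hM (min b m) (by simp)
  set A := M.submatrix e id with hA
  have hAdet : A.det ≠ 0 := by
    have := (hMb m).1
    rwa [mask_of_lt (fun i => i.2)] at this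
  have hMA : Mᴴ * diagonal (fun i => ((Real.exp (s i) : ℝ) : ℂ)) * M
      = Aᴴ * diagonal (fun i => ((Real.exp (s (e i)) : ℝ) : ℂ)) * A := by
    ext i j
    rw [mul_apply, mul_apply]; simp only [mul_diagonal, hA, conjTranspose_apply, submatrix_apply, id]
    exact (Equiv.sum_comp e fun l => star (M l i) * ((Real.exp (s l) : ℝ) : ℂ) * M l j).symm
  rw [hMA]
  set N := Aᴴ * diagonal (fun i => ((Real.exp (s (e i)) : ℝ) : ℂ)) * A with hN
  have hNp : N.PosDef := posDef_conj (posDef_diag_exp _) hAdet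
  have htot : ∑ i, (ell Fin.val i N - s (e i)) = 2 * Real.log ‖A.det‖ := by
    rw [Finset.sum_sub_distrib, sum_ell_univ hNp, hN, det_mul, det_mul, det_conjTranspose, norm_mul,
      norm_mul, norm_star, det_diagonal, norm_prod]
    have hA0 := norm_ne_zero_iff.2 hAdet
    have hp : ∏ i, ‖((Real.exp (s (e i)) : ℝ) : ℂ)‖ ≠ 0 :=
      Finset.prod_ne_zero_iff.2 fun i _ => by simp
    rw [Real.log_mul (mul_ne_zero hA0 hp) hA0, Real.log_mul hA0 hp, Real.log_prod (fun i _ => by simp)]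
    simp only [Complex.norm_real, Real.norm_eq_abs, Real.abs_exp, Real.log_exp]
    ring
  have hAabs : |∑ i, (ell Fin.val i N - s (e i))| ≤ C + 1 := by
    rw [htot]
    have := (hMb m).2
    rw [mask_of_lt (fun i => i.2)] at this
    exact this.le
  have key := abel_slack (Fin.val : Fin m → ℕ) (C + 1) (by linarith) Finset.univ al
    (fun i => ell Fin.val i N - s (e i)) (Fin.val_injective.injOn)
    (fun i _ j _ h => hal h) (fun b => by
      rw [Finset.sum_sub_distrib, sum_ell_fin hNp]
      have h1 := lmin_conj_ge hAdet b (hMb b).1 (fun i => s (e i))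
      have h2 := (abs_lt.1 (hMb b).2).1
      rw [← hN] at h1
      linarith) c c' (fun i _ => hal (by rw [Fin.le_def]; simp; omega))
      (fun i _ => hal (by rw [Fin.le_def]; simp)) hcc
  have e1 : phi Fin.val al N = ∑ i, (al i - c) * (ell Fin.val i N - s (e i))
      + c * ∑ i, (ell Fin.val i N - s (e i)) + ∑ i, al i * s (e i) := by
    rw [phi, Finset.mul_sum, ← Finset.sum_add_distrib, ← Finset.sum_add_distrib]
    exact Finset.sum_congr rfl fun i _ => by ring
  rw [e1]
  have : -(|c| * (C + 1)) ≤ c * ∑ i, (ell Fin.val i N - s (e i)) := by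
    refine (abs_le.1 ?_).1
    rw [abs_mul]
    exact mul_le_mul_of_nonneg_left hAabs (abs_nonneg c)
  linarith

end Local

theorem level_sum {ι : Type*} [Fintype ι] [DecidableEq ι] (r : ι → ι → Prop) (lam : ι → ℝ)
    (h0 : ∑ i, lam i = 0) {C eps : ℝ} (hC : 0 ≤ C) (heps : 0 ≤ eps) (n : ℕ) :
    ∀ s : ι → ℝ, (Finset.univ.image s).card ≤ n → (∀ i j, r i j → s i ≤ s j + C) →
      (∀ t, (∀ i j, r i j → s j ≤ t → s i ≤ t) → (∃ i, s i ≤ t) → (∃ i, t < s i) →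
        ∑ i with s i ≤ t, lam i ≤ -eps) →
      ∀ i j, eps * (s i - s j) ≤ ∑ l, lam l * s l + n * ((eps + ∑ l, |lam l|) * C) := by
  have hK : 0 ≤ (eps + ∑ l, |lam l|) * C :=
    mul_nonneg (add_nonneg heps (Finset.sum_nonneg fun _ _ => abs_nonneg _)) hC
  induction n with
  | zero =>
    intro s hs _ _ i _
    have : s i ∈ Finset.univ.image s := Finset.mem_image_of_mem _ (Finset.mem_univ _)
    rw [Finset.card_eq_zero.1 (Nat.le_zero.1 hs)] at this
    simp at this
  | succ n ih =>
    intro s hs hr hl i0 j0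
    by_cases hconst : ∀ i, s i = s i0
    · have : ∑ l, lam l * s l = 0 := by
        simp_rw [hconst, ← Finset.sum_mul, h0, zero_mul]
      rw [this, hconst j0, sub_self, mul_zero, zero_add]
      positivity
    push Not at hconst
    obtain ⟨i1, hi1⟩ := hconst
    set I := Finset.univ.image s with hI
    have hIne : I.Nonempty := ⟨s i0, Finset.mem_image_of_mem _ (Finset.mem_univ _)⟩
    set M := I.max' hIne with hM
    have hle : ∀ i, s i ≤ M := fun i => I.le_max' _ (Finset.mem_image_of_mem _ (Finset.mem_univ _))
    have hMI : M ∈ I := I.max'_mem hIne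
    obtain ⟨iM, -, hiM⟩ := Finset.mem_image.1 hMI
    have hE : (I.erase M).Nonempty := by
      rcases ne_or_eq (s i0) M with h | h
      · exact ⟨s i0, Finset.mem_erase.2 ⟨h, Finset.mem_image_of_mem _ (Finset.mem_univ _)⟩⟩
      · exact ⟨s i1, Finset.mem_erase.2 ⟨fun h' => hi1 (h'.trans h.symm),
          Finset.mem_image_of_mem _ (Finset.mem_univ _)⟩⟩
    set M' := (I.erase M).max' hE with hM'
    have hM'I : M' ∈ I.erase M := (I.erase M).max'_mem hE
    obtain ⟨iM', -, hiM'⟩ := Finset.mem_image.1 (Finset.mem_of_mem_erase hM'I)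
    have hlt : M' < M := lt_of_le_of_ne (hiM' ▸ hle iM') (Finset.ne_of_mem_erase hM'I)
    have hdich : ∀ i, s i = M ∨ s i ≤ M' := by
      intro i
      by_cases h : s i = M
      · exact Or.inl h
      · exact Or.inr ((I.erase M).le_max' _
          (Finset.mem_erase.2 ⟨h, Finset.mem_image_of_mem _ (Finset.mem_univ _)⟩))
    have key := ih (fun i => min (s i) M') (by
        have : Finset.univ.image (fun i => min (s i) M') ⊆ I.erase M := by
          intro x hx
          obtain ⟨i, -, rfl⟩ := Finset.mem_image.1 hx
          rcases hdich i with h | h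
          · rw [h, min_eq_right hlt.le]; exact hM'I
          · rw [min_eq_left h]
            exact Finset.mem_erase.2 ⟨by linarith, Finset.mem_image_of_mem _ (Finset.mem_univ _)⟩
        have h1 := Finset.card_le_card this
        rw [Finset.card_erase_of_mem hMI] at h1
        omega) (fun i j hij => by
          have := hr i j hij
          change min (s i) M' ≤ min (s j) M' + C
          rcases min_choice (s j) M' with h | h
          · rw [h]; exact (min_le_left _ _).trans this
          · rw [h]; exact (min_le_right _ _).trans (by linarith)) (by
          intro t h1 h2 h3
          obtain ⟨i3, h3⟩ := h3
          have htM : t < M' := lt_of_lt_of_le h3 (min_le_right _ _)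
          have e : ∀ i, min (s i) M' ≤ t ↔ s i ≤ t := fun i => by
            rw [min_le_iff]; constructor
            · rintro (h | h); exacts [h, absurd h (not_le.2 htM)]
            · exact Or.inl
          simp only [e] at h1 h2 ⊢
          exact hl t h1 h2 ⟨iM', by rw [hiM']; exact htM⟩) i0 j0
    have hsum : ∑ l, lam l * s l = ∑ l, lam l * min (s l) M'
        - (M - M') * ∑ l with s l ≤ M', lam l := by
      have : ∑ l with s l ≤ M', lam l = ∑ l, lam l - ∑ l with ¬ s l ≤ M', lam l := by
        rw [← Finset.sum_filter_add_sum_filter_not Finset.univ (fun l => s l ≤ M')]; ring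
      rw [this, h0, zero_sub, mul_neg, sub_neg_eq_add, Finset.sum_filter, Finset.mul_sum,
        ← Finset.sum_add_distrib]
      refine Finset.sum_congr rfl fun l _ => ?_
      rcases hdich l with h | h
      · rw [h, min_eq_right hlt.le, if_pos (not_le.2 hlt)]; ring
      · rw [min_eq_left h, if_neg (not_not.2 h)]; ring
    have hij : s i0 - s j0 ≤ min (s i0) M' - min (s j0) M' + (M - M') := by
      have h1 : s i0 ≤ min (s i0) M' + (M - M') := by
        rcases hdich i0 with h | h
        · rw [h, min_eq_right hlt.le]; linarith
        · rw [min_eq_left h]; linarith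
      have h2 : min (s j0) M' ≤ s j0 := min_le_left _ _
      linarith
    have h4 : eps * (s i0 - s j0) ≤ eps * (min (s i0) M' - min (s j0) M') + eps * (M - M') := by
      rw [← mul_add]; exact mul_le_mul_of_nonneg_left hij heps
    have h5 : eps * (M - M') ≤ -((M - M') * ∑ l with s l ≤ M', lam l)
        + (eps + ∑ l, |lam l|) * C := by
      rcases le_or_gt (M - M') C with h | h
      · have h6 : ∑ l with s l ≤ M', lam l ≤ ∑ l, |lam l| :=
          (Finset.sum_le_sum fun l _ => le_abs_self _).trans
            (Finset.sum_le_sum_of_subset_of_nonneg (Finset.filter_subset _ _)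
              fun _ _ _ => abs_nonneg _)
        have h7 : 0 ≤ ∑ l, |lam l| := Finset.sum_nonneg fun _ _ => abs_nonneg _
        nlinarith [mul_le_mul_of_nonneg_left h6 (sub_nonneg.2 hlt.le)]
      · have h6 := hl M' (fun i j hij hj => by
          rcases hdich i with h' | h'
          · have := hr i j hij; linarith
          · exact h') ⟨iM', hiM'.le⟩ ⟨iM, by rw [hiM]; exact hlt⟩
        nlinarith
    push_cast
    linarith

theorem monotone_level {m : ℕ} {s : Fin m → ℝ} (hs : Monotone s) (x : ℝ) :
    ∃ b ≤ m, ∀ j, s j ≤ x ↔ Fin.val j < b := by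
  induction m with
  | zero => exact ⟨0, le_rfl, fun j => j.elim0⟩
  | succ m ih =>
    by_cases h : s (Fin.last m) ≤ x
    · exact ⟨m + 1, le_rfl, fun j => ⟨fun _ => j.2, fun _ => (hs (Fin.le_last j)).trans h⟩⟩
    · obtain ⟨b, hb, h'⟩ := ih (s := fun j => s j.castSucc) (fun i j hij => hs (by simpa using hij))
      refine ⟨b, by omega, fun j => ?_⟩
      induction j using Fin.lastCases with
      | last => simp only [h, Fin.val_last, false_iff]; omega
      | cast j => simpa using h' j

theorem single_mem_low {m : ℕ} (a : Fin m) (b : ℕ) :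
    (Pi.single a (1 : ℂ) : Fin m → ℂ) ∈ low (Fin.val : Fin m → ℕ) b ↔ Fin.val a < b := by
  constructor
  · intro h
    by_contra h'
    have := h a (not_lt.1 h')
    simp at this
  · intro h l hl
    rw [Pi.single_eq_of_ne]
    rintro rfl; omega

section Coercive
variable {T : Type*} [Fintype T] {p q : ℕ}
  (EU : T → Matrix (Fin p) (Fin p) ℂ) (EW : T → Matrix (Fin q) (Fin q) ℂ)
  (X : Matrix (Fin p) (Fin q) ℂ) (aU : T → Fin p → ℝ) (aW : T → Fin q → ℝ)

/-- Strict slope inequalities for pairs of subspaces compatible with `X`. -/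
def KStable : Prop :=
  ∀ (VU : Submodule ℂ (Fin p → ℂ)) (VW : Submodule ℂ (Fin q → ℂ)),
    (∀ w ∈ VW, X *ᵥ w ∈ VU) → ¬ (VU = ⊥ ∧ VW = ⊥) → ¬ (VU = ⊤ ∧ VW = ⊤) →
    ∑ t, (∑ i ∈ piv Fin.val (VU.comap (Matrix.mulVecLin (EU t))), aU t i
      + ∑ i ∈ piv Fin.val (VW.comap (Matrix.mulVecLin (EW t))), aW t i) < 0

/-- The compact-type functional. -/
def kfun (H : Matrix (Fin p) (Fin p) ℂ) (h : Matrix (Fin q) (Fin q) ℂ) : ℝ :=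
  ∑ t, (phi Fin.val (aU t) ((EU t)ᴴ * H * EU t) + phi Fin.val (aW t) ((EW t)ᴴ * h * EW t))

/-- Diagonal matrix with prescribed logarithms of the entries. -/
def dexp {m : ℕ} (s : Fin m → ℝ) : Matrix (Fin m) (Fin m) ℂ :=
  diagonal fun i => ((Real.exp (s i) : ℝ) : ℂ)

/-- Coercivity with given constants along frames in a set. -/
def KCoercive (S : Set (Matrix (Fin p) (Fin p) ℂ × Matrix (Fin q) (Fin q) ℂ)) : Prop :=
  ∃ eps > 0, ∃ C, ∀ k ∈ S, ∀ (s : Fin p → ℝ) (t : Fin q → ℝ), Monotone s → Monotone t →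
    (∀ a b, Real.exp (s a) * Complex.normSq ((k.1 * X * k.2ᴴ) a b) ≤ 4 * Real.exp (t b)) →
    ∀ i j, eps * (Sum.elim s t i - Sum.elim s t j) - C
      ≤ kfun EU EW aU aW (k.1ᴴ * dexp s * k.1) (k.2ᴴ * dexp t * k.2)

variable {EU EW X aU aW}

theorem kCoercive_local (hEU : ∀ t, IsUnit (EU t).det) (hEW : ∀ t, IsUnit (EW t).det)
    (haU : ∀ t, Antitone (aU t)) (haW : ∀ t, Antitone (aW t))
    (hsum : ∑ t, (∑ i, aU t i + ∑ i, aW t i) = 0) (hst : KStable EU EW X aU aW)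
    (u0 : Matrix (Fin p) (Fin p) ℂ) (w0 : Matrix (Fin q) (Fin q) ℂ)
    (hu : u0ᴴ * u0 = 1) (hw : w0ᴴ * w0 = 1) :
    ∃ S ∈ 𝓝 (u0, w0), KCoercive EU EW X aU aW S := by
  classical
  have hu' : u0 * u0ᴴ = 1 := mul_eq_one_comm.1 hu
  have hw' : w0 * w0ᴴ = 1 := mul_eq_one_comm.1 hw
  have hud : IsUnit u0.det := (isUnit_iff_isUnit_det _).1 (.of_mul_eq_one _ hu')
  have hwd : IsUnit w0.det := (isUnit_iff_isUnit_det _).1 (.of_mul_eq_one _ hw')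
  have hpU := fun t => exists_row_perm (u0 * EU t) (by rw [det_mul]; exact hud.mul (hEU t))
  have hpW := fun t => exists_row_perm (w0 * EW t) (by rw [det_mul]; exact hwd.mul (hEW t))
  choose eU heU hpivU using hpU
  choose eW heW hpivW using hpW
  choose CU hCU0 hCU using fun t => phi_local (u0 * EU t) (eU t) (heU t) (aU t) (haU t)
  choose CW hCW0 hCW using fun t => phi_local (w0 * EW t) (eW t) (heW t) (aW t) (haW t)
  let VU : ℕ → Submodule ℂ (Fin p → ℂ) := fun b => (low Fin.val b).comap (mulVecLin u0)
  let VW : ℕ → Submodule ℂ (Fin q → ℂ) := fun b => (low Fin.val b).comap (mulVecLin w0)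
  let Lam : ℕ × ℕ → ℝ := fun b => ∑ t, (∑ i ∈ piv Fin.val ((VU b.1).comap (mulVecLin (EU t))), aU t i
      + ∑ i ∈ piv Fin.val ((VW b.2).comap (mulVecLin (EW t))), aW t i)
  obtain ⟨eps, heps1, heps⟩ : ∃ eps : ℝ, (∀ b ∈ Finset.range (p + 1) ×ˢ Finset.range (q + 1),
      Lam b < 0 → Lam b ≤ -eps) ∧ 0 < eps := by
    have : ∀ᶠ eps : ℝ in 𝓝[>] 0, ∀ b ∈ Finset.range (p + 1) ×ˢ Finset.range (q + 1),
      Lam b < 0 → Lam b ≤ -eps := by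
      rw [eventually_all_finset]
      intro b _
      by_cases h : Lam b < 0
      · filter_upwards [Ioo_mem_nhdsGT (neg_pos.2 h)] with eps he _
        linarith [he.2]
      · exact .of_forall fun _ h' => absurd h' h
    exact (this.and self_mem_nhdsWithin).exists
  let lam : Fin p ⊕ Fin q → ℝ := Sum.elim (fun j => ∑ t, aU t ((eU t).symm j))
    (fun j => ∑ t, aW t ((eW t).symm j))
  have hlamU : ∀ (t) (f : Fin p → ℝ), ∑ j, aU t ((eU t).symm j) * f j = ∑ i, aU t i * f (eU t i) :=
    fun t f => by rw [← Equiv.sum_comp (eU t)]; simp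
  have hlamW : ∀ (t) (f : Fin q → ℝ), ∑ j, aW t ((eW t).symm j) * f j = ∑ i, aW t i * f (eW t i) :=
    fun t f => by rw [← Equiv.sum_comp (eW t)]; simp
  have hlam : ∀ (f : Fin p → ℝ) (g : Fin q → ℝ), ∑ i, lam i * Sum.elim f g i
      = ∑ t, (∑ i, aU t i * f (eU t i) + ∑ i, aW t i * g (eW t i)) := by
    intro f g
    rw [Fintype.sum_sum_type]
    simp only [lam, Sum.elim_inl, Sum.elim_inr, Finset.sum_mul]
    rw [Finset.sum_comm, Finset.sum_comm (s := (Finset.univ : Finset (Fin q))),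
      ← Finset.sum_add_distrib]
    exact Finset.sum_congr rfl fun t _ => by rw [hlamU, hlamW]
  have hlam0 : ∑ i, lam i = 0 := by
    have := hlam (fun _ => 1) (fun _ => 1)
    simp only [mul_one] at this
    rw [hsum] at this
    rw [← this]
    exact Finset.sum_congr rfl fun i _ => by rcases i with i | i <;> simp
  let r : Fin p ⊕ Fin q → Fin p ⊕ Fin q → Prop := fun i j =>
    ∃ a b, i = Sum.inl a ∧ j = Sum.inr b ∧ (u0 * X * w0ᴴ) a b ≠ 0
  have hcontX : Continuous fun k : Matrix (Fin p) (Fin p) ℂ × Matrix (Fin q) (Fin q) ℂ =>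
      k.1 * X * k.2ᴴ := (continuous_fst.matrix_mul continuous_const).matrix_mul
        continuous_snd.matrix_conjTranspose
  have hCab : ∀ a b, ∃ C, 0 ≤ C ∧ ((u0 * X * w0ᴴ) a b ≠ 0 →
      ∀ᶠ k in 𝓝 (u0, w0), ∀ s t : ℝ, Real.exp s * Complex.normSq ((k.1 * X * k.2ᴴ) a b)
        ≤ 4 * Real.exp t → s ≤ t + C) := by
    intro a b
    by_cases h : (u0 * X * w0ᴴ) a b = 0
    · exact ⟨0, le_rfl, fun h' => absurd h h'⟩
    have hpos : 0 < Complex.normSq ((u0 * X * w0ᴴ) a b) := Complex.normSq_pos.2 h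
    set δ := Complex.normSq ((u0 * X * w0ᴴ) a b) / 2 with hδ
    have hδ0 : 0 < δ := by positivity
    refine ⟨|Real.log (4 / δ)|, abs_nonneg _, fun _ => ?_⟩
    have hc : Continuous fun k : Matrix (Fin p) (Fin p) ℂ × Matrix (Fin q) (Fin q) ℂ =>
      Complex.normSq ((k.1 * X * k.2ᴴ) a b) :=
        Complex.continuous_normSq.comp (hcontX.matrix_elem a b)
    have hev : ∀ᶠ k in 𝓝 (u0, w0), δ < Complex.normSq ((k.1 * X * k.2ᴴ) a b) :=
      hc.continuousAt.eventually_const_lt (by simp only [δ]; linarith)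
    filter_upwards [hev] with k hk s t hst
    have h1 : Real.exp s * δ ≤ 4 * Real.exp t :=
      (mul_le_mul_of_nonneg_left hk.le (Real.exp_pos s).le).trans hst
    have h2 : Real.exp s ≤ Real.exp (t + Real.log (4 / δ)) := by
      rw [Real.exp_add, Real.exp_log (by positivity)]
      rw [mul_div_assoc', le_div_iff₀ hδ0]; linarith
    have := Real.exp_le_exp.1 h2
    linarith [le_abs_self (Real.log (4 / δ))]
  choose Cab hCab0 hCab using hCab
  set CC := ∑ a, ∑ b, Cab a b with hCC
  have hCC0 : 0 ≤ CC := Finset.sum_nonneg fun a _ => Finset.sum_nonneg fun b _ => hCab0 a b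
  have hCle : ∀ a b, Cab a b ≤ CC := fun a b =>
    (Finset.single_le_sum (f := fun b => Cab a b) (fun b _ => hCab0 a b) (Finset.mem_univ b)).trans
      (Finset.single_le_sum (f := fun a => ∑ b, Cab a b)
        (fun a _ => Finset.sum_nonneg fun b _ => hCab0 a b) (Finset.mem_univ a))
  have hev1 : ∀ᶠ k in 𝓝 (u0, w0), ∀ a b, (u0 * X * w0ᴴ) a b ≠ 0 → ∀ s t : ℝ,
      Real.exp s * Complex.normSq ((k.1 * X * k.2ᴴ) a b) ≤ 4 * Real.exp t → s ≤ t + CC := by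
    rw [eventually_all]; intro a; rw [eventually_all]; intro b
    by_cases h : (u0 * X * w0ᴴ) a b = 0
    · exact .of_forall fun _ h' => absurd h h'
    · filter_upwards [hCab a b h] with k hk _ s t hst
      exact (hk s t hst).trans (by linarith [hCle a b])
  have hev2 : ∀ᶠ k in 𝓝 (u0, w0), ∀ t, ∀ s : Fin p → ℝ, ∑ i, aU t i * s (eU t i) - CU t ≤
      phi Fin.val (aU t) ((k.1 * EU t)ᴴ * diagonal (fun i => ((Real.exp (s i) : ℝ) : ℂ)) * (k.1 * EU t)) := by
    rw [eventually_all]; intro t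
    have hc : Continuous fun k : Matrix (Fin p) (Fin p) ℂ × Matrix (Fin q) (Fin q) ℂ =>
      k.1 * EU t := continuous_fst.matrix_mul continuous_const
    exact (hc.continuousAt (x := (u0, w0))).eventually (hCU t)
  have hev3 : ∀ᶠ k in 𝓝 (u0, w0), ∀ t, ∀ s : Fin q → ℝ, ∑ i, aW t i * s (eW t i) - CW t ≤
      phi Fin.val (aW t) ((k.2 * EW t)ᴴ * diagonal (fun i => ((Real.exp (s i) : ℝ) : ℂ)) * (k.2 * EW t)) := by
    rw [eventually_all]; intro t
    have hc : Continuous fun k : Matrix (Fin p) (Fin p) ℂ × Matrix (Fin q) (Fin q) ℂ =>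
      k.2 * EW t := continuous_snd.matrix_mul continuous_const
    exact (hc.continuousAt (x := (u0, w0))).eventually (hCW t)
  refine ⟨_, (hev1.and (hev2.and hev3)), eps, heps,
    ((Fintype.card (Fin p ⊕ Fin q) : ℕ) : ℝ) * ((eps + ∑ l, |lam l|) * CC) + ∑ t, (CU t + CW t), ?_⟩
  rintro k ⟨hk1, hk2, hk3⟩ s t hs ht hst' i j
  have hmain := level_sum r lam hlam0 hCC0 heps.le (Fintype.card (Fin p ⊕ Fin q)) (Sum.elim s t)
    Finset.card_image_le (by
      rintro _ _ ⟨a, b, rfl, rfl, hab⟩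
      exact hk1 a b hab _ _ (hst' a b)) (by
      intro x hcl hne hpr
      obtain ⟨bU, hbU, hsU⟩ := monotone_level hs x
      obtain ⟨bW, hbW, hsW⟩ := monotone_level ht x
      have hL : ∑ i with Sum.elim s t i ≤ x, lam i = Lam (bU, bW) := by
        have := hlam (fun j => if s j ≤ x then 1 else 0) (fun j => if t j ≤ x then 1 else 0)
        rw [Finset.sum_filter]
        trans ∑ i, lam i * Sum.elim (fun j => if s j ≤ x then (1 : ℝ) else 0)
          (fun j => if t j ≤ x then (1 : ℝ) else 0) i
        · refine Finset.sum_congr rfl fun i _ => ?_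
          rcases i with i | i
          · by_cases h : s i ≤ x <;> simp [h]
          · by_cases h : t i ≤ x <;> simp [h]
        rw [this]
        simp only [Lam]
        refine Finset.sum_congr rfl fun t' _ => ?_
        congr 1
        · have e : piv Fin.val ((VU bU).comap (mulVecLin (EU t')))
              = Finset.univ.filter fun i => s (eU t' i) ≤ x := by
            ext i
            rw [Finset.mem_filter, hsU, hpivU, mulVecLin_mul]
            simp [VU, Submodule.comap_comp]
          rw [e, Finset.sum_filter]; simp
        · have e : piv Fin.val ((VW bW).comap (mulVecLin (EW t')))
              = Finset.univ.filter fun i => t (eW t' i) ≤ x := by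
            ext i
            rw [Finset.mem_filter, hsW, hpivW, mulVecLin_mul]
            simp [VW, Submodule.comap_comp]
          rw [e, Finset.sum_filter]; simp
      rw [hL]
      refine heps1 _ (by simp; omega) (hst (VU bU) (VW bW) ?_ ?_ ?_)
      · intro w hw1
        change u0 *ᵥ (X *ᵥ w) ∈ low _ _
        have e : u0 *ᵥ (X *ᵥ w) = (u0 * X * w0ᴴ) *ᵥ (w0 *ᵥ w) := by
          simp only [mulVec_mulVec, Matrix.mul_assoc, hw, Matrix.mul_one]
        rw [e]
        intro a ha
        change ∑ b, (u0 * X * w0ᴴ) a b * (w0 *ᵥ w) b = 0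
        refine Finset.sum_eq_zero fun b _ => ?_
        by_cases hb : Fin.val b < bW
        · by_contra hne
          have := hcl (Sum.inl a) (Sum.inr b) ⟨a, b, rfl, rfl, left_ne_zero_of_mul hne⟩ ((hsW b).2 hb)
          exact absurd ((hsU a).1 this) (by omega)
        · rw [show (w0 *ᵥ w) b = 0 from hw1 b (not_lt.1 hb), mul_zero]
      · rintro ⟨h1, h2⟩
        obtain ⟨i, hi⟩ := hne
        rcases i with i | i
        · have : u0ᴴ *ᵥ Pi.single i 1 ∈ VU bU := by
            change u0 *ᵥ (u0ᴴ *ᵥ Pi.single i 1) ∈ low _ _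
            rw [mulVec_mulVec, hu', one_mulVec]
            exact (single_mem_low _ _).2 ((hsU i).1 hi)
          rw [h1, Submodule.mem_bot] at this
          have h3 : u0 *ᵥ (u0ᴴ *ᵥ Pi.single i 1) = 0 := by rw [this, mulVec_zero]
          rw [mulVec_mulVec, hu', one_mulVec] at h3
          simpa using congrFun h3 i
        · have : w0ᴴ *ᵥ Pi.single i 1 ∈ VW bW := by
            change w0 *ᵥ (w0ᴴ *ᵥ Pi.single i 1) ∈ low _ _
            rw [mulVec_mulVec, hw', one_mulVec]
            exact (single_mem_low _ _).2 ((hsW i).1 hi)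
          rw [h2, Submodule.mem_bot] at this
          have h3 : w0 *ᵥ (w0ᴴ *ᵥ Pi.single i 1) = 0 := by rw [this, mulVec_zero]
          rw [mulVec_mulVec, hw', one_mulVec] at h3
          simpa using congrFun h3 i
      · rintro ⟨h1, h2⟩
        obtain ⟨i, hi⟩ := hpr
        rcases i with i | i
        · have : u0ᴴ *ᵥ Pi.single i 1 ∈ VU bU := by rw [h1]; trivial
          change u0 *ᵥ (u0ᴴ *ᵥ Pi.single i 1) ∈ low _ _ at this
          rw [mulVec_mulVec, hu', one_mulVec, single_mem_low, ← hsU] at this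
          exact absurd this (not_le.2 hi)
        · have : w0ᴴ *ᵥ Pi.single i 1 ∈ VW bW := by rw [h2]; trivial
          change w0 *ᵥ (w0ᴴ *ᵥ Pi.single i 1) ∈ low _ _ at this
          rw [mulVec_mulVec, hw', one_mulVec, single_mem_low, ← hsW] at this
          exact absurd this (not_le.2 hi)) i j
  have hsum2 : ∑ l, lam l * Sum.elim s t l - ∑ t, (CU t + CW t)
      ≤ kfun EU EW aU aW (k.1ᴴ * dexp s * k.1) (k.2ᴴ * dexp t * k.2) := by
    rw [hlam, kfun, ← Finset.sum_sub_distrib]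
    refine Finset.sum_le_sum fun t' _ => ?_
    have h1 := hk2 t' s
    have h2 := hk3 t' t
    simp only [conjTranspose_mul, Matrix.mul_assoc] at h1 h2
    simp only [dexp, Matrix.mul_assoc]
    linarith
  linarith

end Coercive

theorem isCompact_entries {m n : Type*} [Fintype m] [Fintype n] (C : ℝ) :
    IsCompact {A : Matrix m n ℂ | ∀ i j, ‖A i j‖ ≤ C} := by
  have h : IsCompact (Set.univ.pi fun _ : m => Set.univ.pi fun _ : n => Metric.closedBall (0 : ℂ) C) :=
    isCompact_univ_pi fun _ => isCompact_univ_pi fun _ => isCompact_closedBall 0 C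
  have e : {A : Matrix m n ℂ | ∀ i j, ‖A i j‖ ≤ C}
      = Set.univ.pi fun _ : m => Set.univ.pi fun _ : n => Metric.closedBall (0 : ℂ) C := by
    ext A
    exact ⟨fun h i _ j _ => mem_closedBall_zero_iff.2 (h i j),
      fun h i j => mem_closedBall_zero_iff.1 (h i trivial j trivial)⟩
  rw [e]
  exact h

theorem isCompact_unitary (m : ℕ) : IsCompact {k : Matrix (Fin m) (Fin m) ℂ | kᴴ * k = 1} := by
  refine (isCompact_entries 1).of_isClosed_subset ?_ ?_
  · exact isClosed_eq (continuous_id.matrix_conjTranspose.matrix_mul continuous_id) continuous_const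
  · intro k hk i j
    have h : nsq (k *ᵥ Pi.single j 1) = 1 := by
      rw [nsq_unitary hk, nsq, Finset.sum_eq_single j]
      · simp
      · intro b _ hb; simp [hb]
      · simp
    have h2 := normSq_le_nsq (k *ᵥ Pi.single j 1) i
    rw [h, mulVec_single_one, Complex.normSq_eq_norm_sq] at h2
    exact (sq_le_one_iff₀ (norm_nonneg _)).1 h2

theorem sorted_spectral {m : ℕ} {H : Matrix (Fin m) (Fin m) ℂ} (hH : H.PosDef) :
    ∃ (k : Matrix (Fin m) (Fin m) ℂ) (s : Fin m → ℝ), kᴴ * k = 1 ∧ Monotone s ∧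
      H = kᴴ * dexp s * k := by
  obtain ⟨k, d, hk, hk', e⟩ := spectral H hH.isHermitian
  have hd : ∀ i, 0 < d i := by
    intro i
    have h1 : kᴴ *ᵥ Pi.single i 1 ≠ 0 := by
      intro h
      have : k *ᵥ (kᴴ *ᵥ Pi.single i 1) = 0 := by rw [h, mulVec_zero]
      rw [mulVec_mulVec, hk', one_mulVec] at this
      simpa using congrFun this i
    have h2 := qf_pos hH h1
    rw [e, qf_conj, mulVec_mulVec, hk', one_mulVec, qf_diagonal, Finset.sum_eq_single i] at h2
    · simpa using h2
    · intro b _ hb; simp [hb]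
    · simp
  let σ := Tuple.sort (fun i => Real.log (d i))
  refine ⟨k.submatrix σ id, fun i => Real.log (d (σ i)), ?_, Tuple.monotone_sort fun i => Real.log (d i), ?_⟩
  · rw [← hk]
    ext i j
    simp only [mul_apply, conjTranspose_apply, submatrix_apply, id]
    exact Equiv.sum_comp σ fun l => star (k l i) * k l j
  · rw [e]
    ext i j
    rw [mul_apply, mul_apply]
    simp only [mul_diagonal, dexp, conjTranspose_apply, submatrix_apply, id, Real.exp_log (hd _)]
    exact (Equiv.sum_comp σ fun l => star (k l i) * (d l : ℂ) * k l j).symm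

section Coercive
variable {T : Type*} [Fintype T] {p q : ℕ}
  {EU : T → Matrix (Fin p) (Fin p) ℂ} {EW : T → Matrix (Fin q) (Fin q) ℂ}
  {X : Matrix (Fin p) (Fin q) ℂ} {aU : T → Fin p → ℝ} {aW : T → Fin q → ℝ}

theorem nsq_single {m : ℕ} (j : Fin m) : nsq (Pi.single j (1 : ℂ)) = 1 := by
  rw [nsq, Finset.sum_eq_single j]
  · simp
  · intro b _ hb; simp [hb]
  · simp

theorem qf_dexp_bounds {m : ℕ} {k : Matrix (Fin m) (Fin m) ℂ} (hk : kᴴ * k = 1) (s : Fin m → ℝ)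
    {a b : ℝ} (h : ∀ i, a ≤ s i ∧ s i ≤ b) (x : Fin m → ℂ) :
    Real.exp a * nsq x ≤ qf (kᴴ * dexp s * k) x ∧ qf (kᴴ * dexp s * k) x ≤ Real.exp b * nsq x := by
  rw [qf_conj, dexp, qf_diagonal, ← nsq_unitary hk x, nsq, Finset.mul_sum, Finset.mul_sum]
  exact ⟨Finset.sum_le_sum fun i _ => mul_le_mul_of_nonneg_right (Real.exp_le_exp.2 (h i).1)
      (Complex.normSq_nonneg _),
    Finset.sum_le_sum fun i _ => mul_le_mul_of_nonneg_right (Real.exp_le_exp.2 (h i).2)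
      (Complex.normSq_nonneg _)⟩

theorem kfun_coercive [Nonempty (Fin p ⊕ Fin q)]
    (hEU : ∀ t, IsUnit (EU t).det) (hEW : ∀ t, IsUnit (EW t).det)
    (haU : ∀ t, Antitone (aU t)) (haW : ∀ t, Antitone (aW t))
    (hsum : ∑ t, (∑ i, aU t i + ∑ i, aW t i) = 0) (hst : KStable EU EW X aU aW) :
    ∃ eps > 0, ∃ C, ∀ (H : Matrix (Fin p) (Fin p) ℂ) (h : Matrix (Fin q) (Fin q) ℂ),
      H.PosDef → h.PosDef → (∀ w, qf H (X *ᵥ w) ≤ 4 * qf h w) →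
      ∃ mm MM : ℝ, (∀ x, Real.exp mm * nsq x ≤ qf H x ∧ qf H x ≤ Real.exp MM * nsq x) ∧
        (∀ x, Real.exp mm * nsq x ≤ qf h x ∧ qf h x ≤ Real.exp MM * nsq x) ∧
        eps * (MM - mm) - C ≤ kfun EU EW aU aW H h := by
  have hcpt := (isCompact_unitary p).prod (isCompact_unitary q)
  have hco : KCoercive EU EW X aU aW ({k | kᴴ * k = 1} ×ˢ {k | kᴴ * k = 1}) := by
    refine hcpt.induction_on (p := KCoercive EU EW X aU aW) ?_ ?_ ?_ ?_
    · exact ⟨1, one_pos, 0, fun k hk => absurd hk (Set.notMem_empty k)⟩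
    · rintro S S' hS ⟨e, he, C, h⟩
      exact ⟨e, he, C, fun k hk => h k (hS hk)⟩
    · rintro S S' ⟨e, he, C, h⟩ ⟨e', he', C', h'⟩
      refine ⟨min e e', lt_min he he', max C C', ?_⟩
      have aux : ∀ (e0 C0 F : ℝ) (x : Fin p ⊕ Fin q → ℝ), min e e' ≤ e0 → 0 ≤ e0 → C0 ≤ max C C' →
          (∀ i j, e0 * (x i - x j) - C0 ≤ F) → ∀ i j, min e e' * (x i - x j) - max C C' ≤ F := by
        intro e0 C0 F x h1 h2 h3 h4 i j
        rcases le_total (x i) (x j) with hij | hij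
        · have := h4 i i
          rw [sub_self, mul_zero] at this
          have h5 : min e e' * (x i - x j) ≤ 0 :=
            mul_nonpos_of_nonneg_of_nonpos (lt_min he he').le (by linarith)
          linarith
        · have := h4 i j
          have h5 : min e e' * (x i - x j) ≤ e0 * (x i - x j) :=
            mul_le_mul_of_nonneg_right h1 (by linarith)
          linarith
      rintro k (hk | hk) s t hs ht hc
      · exact aux e C _ _ (min_le_left _ _) he.le (le_max_left _ _) (h k hk s t hs ht hc)
      · exact aux e' C' _ _ (min_le_right _ _) he'.le (le_max_right _ _) (h' k hk s t hs ht hc)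
    · rintro ⟨u0, w0⟩ ⟨hu, hw⟩
      obtain ⟨S, hS, h⟩ := kCoercive_local hEU hEW haU haW hsum hst u0 w0 hu hw
      exact ⟨S, mem_nhdsWithin_of_mem_nhds hS, h⟩
  obtain ⟨eps, heps, C, hC⟩ := hco
  refine ⟨eps, heps, C, fun H h hH hh hcon => ?_⟩
  obtain ⟨u, s, hu, hs, rfl⟩ := sorted_spectral hH
  obtain ⟨w, t, hw, ht, rfl⟩ := sorted_spectral hh
  have hw' : w * wᴴ = 1 := mul_eq_one_comm.1 hw
  obtain ⟨i, hi⟩ := Finite.exists_max (Sum.elim s t)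
  obtain ⟨j, hj⟩ := Finite.exists_min (Sum.elim s t)
  refine ⟨Sum.elim s t j, Sum.elim s t i, ?_, ?_, hC (u, w) ⟨hu, hw⟩ s t hs ht ?_ i j⟩
  · exact qf_dexp_bounds hu s fun l => ⟨hj (Sum.inl l), hi (Sum.inl l)⟩
  · exact qf_dexp_bounds hw t fun l => ⟨hj (Sum.inr l), hi (Sum.inr l)⟩
  · intro a b
    have h1 := hcon (wᴴ *ᵥ Pi.single b 1)
    rw [qf_conj, qf_conj, mulVec_mulVec _ w wᴴ, hw', one_mulVec, dexp, dexp, qf_diagonal, qf_diagonal] at h1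
    have h2 : ∑ i, Real.exp (t i) * Complex.normSq ((Pi.single b 1 : Fin q → ℂ) i) = Real.exp (t b) := by
      rw [Finset.sum_eq_single b]
      · simp
      · intro c _ hc; simp [hc]
      · simp
    rw [h2] at h1
    refine le_trans ?_ h1
    have h3 : (u *ᵥ X *ᵥ wᴴ *ᵥ Pi.single b 1) = (u * X * wᴴ) *ᵥ Pi.single b 1 := by
      simp only [mulVec_mulVec, Matrix.mul_assoc]
    rw [h3, mulVec_single_one]
    exact Finset.single_le_sum (f := fun i => Real.exp (s i) * Complex.normSq ((u * X * wᴴ).col b i))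
      (fun i _ => mul_nonneg (Real.exp_pos _).le (Complex.normSq_nonneg _)) (Finset.mem_univ a)

end Coercive

section Blocks
variable {p q : ℕ} {H : Matrix (Fin p) (Fin p) ℂ} {S : Matrix (Fin p) (Fin q) ℂ}
  {L : Matrix (Fin q) (Fin q) ℂ} {X : Matrix (Fin p) (Fin q) ℂ}
  {AU : Matrix (Fin p) (Fin p) ℂ} {AW : Matrix (Fin q) (Fin q) ℂ}

/-- Minus the restriction of the form `[[H, S], [Sᴴ, -L]]` to the graph of `X`. -/
def Rm (X : Matrix (Fin p) (Fin q) ℂ) (H : Matrix (Fin p) (Fin p) ℂ) (S : Matrix (Fin p) (Fin q) ℂ)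
    (L : Matrix (Fin q) (Fin q) ℂ) : Matrix (Fin q) (Fin q) ℂ :=
  L - Xᴴ * H * X - Xᴴ * S - Sᴴ * X

/-- Minus the form induced on the orthogonal complement of the first block. -/
def hm (H : Matrix (Fin p) (Fin p) ℂ) (S : Matrix (Fin p) (Fin q) ℂ)
    (L : Matrix (Fin q) (Fin q) ℂ) : Matrix (Fin q) (Fin q) ℂ :=
  L + Sᴴ * H⁻¹ * S

theorem hm_eq (hH : H.PosDef) :
    hm H S L = Rm X H S L + (H * X + S)ᴴ * H⁻¹ * (H * X + S) := by
  have hd : IsUnit H.det := isUnit_iff_ne_zero.2 (posDef_det_ne hH)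
  have e : (H * X + S)ᴴ * H⁻¹ * (H * X + S)
      = Xᴴ * H * X + Xᴴ * S + Sᴴ * X + Sᴴ * H⁻¹ * S := by
    rw [conjTranspose_add, conjTranspose_mul, hH.isHermitian.eq, Matrix.add_mul,
      Matrix.mul_assoc Xᴴ H, mul_nonsing_inv _ hd, Matrix.mul_one, Matrix.add_mul, Matrix.mul_add,
      Matrix.mul_add, Matrix.mul_assoc Sᴴ H⁻¹ (H * X), ← Matrix.mul_assoc H⁻¹,
      nonsing_inv_mul _ hd, Matrix.one_mul, Matrix.mul_assoc Xᴴ H X]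
    abel
  rw [e, hm, Rm]; abel

theorem isHermitian_Rm (hH : H.IsHermitian) (hL : L.IsHermitian) : (Rm X H S L).IsHermitian := by
  rw [IsHermitian, Rm]
  simp only [conjTranspose_sub, conjTranspose_mul, conjTranspose_conjTranspose, hH.eq, hL.eq,
    Matrix.mul_assoc]
  abel

theorem posDef_add_nonneg {m : ℕ} {R P : Matrix (Fin m) (Fin m) ℂ} (hR : R.PosDef)
    (hP : P.IsHermitian) (h : ∀ x, 0 ≤ qf P x) : (R + P).PosDef :=
  posDef_of_qf (hR.isHermitian.add hP) fun x hx => by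
    rw [qf_add]; linarith [qf_pos hR hx, h x]

theorem qf_hm (hH : H.PosDef) (x : Fin q → ℂ) :
    qf (hm H S L) x = qf (Rm X H S L) x + qf H⁻¹ ((H * X + S) *ᵥ x) := by
  rw [hm_eq (X := X) hH, qf_add, qf_conj]

theorem qf_Rm_le (hH : H.PosDef) (x : Fin q → ℂ) : qf (Rm X H S L) x ≤ qf (hm H S L) x := by
  rw [qf_hm (X := X) hH]; linarith [qf_nonneg hH.inv ((H * X + S) *ᵥ x)]

theorem posDef_hm (hH : H.PosDef) (hR : (Rm X H S L).PosDef) : (hm H S L).PosDef := by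
  rw [hm_eq (X := X) hH]
  exact posDef_add_nonneg hR (isHermitian_conjTranspose_mul_mul _ hH.inv.isHermitian)
    fun x => by rw [qf_conj]; exact qf_nonneg hH.inv _

theorem conj_frame (hH : H.IsHermitian) :
    (fromBlocks AU (X * AW) 0 AW)ᴴ * fromBlocks H S Sᴴ (-L) * fromBlocks AU (X * AW) 0 AW
    = fromBlocks (AUᴴ * H * AU) (AUᴴ * (H * X + S) * AW)
        (AUᴴ * (H * X + S) * AW)ᴴ (-(AWᴴ * Rm X H S L * AW)) := by
  rw [fromBlocks_conjTranspose, fromBlocks_multiply, fromBlocks_multiply]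
  congr 1
  · simp
  · simp only [conjTranspose_zero, Matrix.zero_mul, add_zero, Matrix.mul_add, Matrix.add_mul,
      Matrix.mul_assoc]
  · simp only [conjTranspose_mul, conjTranspose_add, conjTranspose_conjTranspose, hH.eq,
      Matrix.mul_zero, add_zero, Matrix.mul_add, Matrix.add_mul, Matrix.mul_assoc]
  · simp only [Rm, conjTranspose_mul, Matrix.add_mul, Matrix.mul_sub,
      Matrix.sub_mul, Matrix.mul_assoc, Matrix.mul_neg, Matrix.neg_mul]
    abel

theorem posDef_conj' {m : ℕ} {N A : Matrix (Fin m) (Fin m) ℂ} (hN : N.PosDef) (hA : IsUnit A.det) :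
    (Aᴴ * N * A).PosDef := posDef_conj hN hA.ne_zero

theorem posDef_upper_block (hH : H.PosDef) (hR : (Rm X H S L).PosDef) (Y : Matrix (Fin p) (Fin q) ℂ) :
    (H + Y * (Rm X H S L)⁻¹ * Yᴴ).PosDef := by
  have := isHermitian_conjTranspose_mul_mul Yᴴ hR.inv.isHermitian
  rw [conjTranspose_conjTranspose] at this
  refine posDef_add_nonneg hH this fun x => ?_
  have h2 := qf_conj (Rm X H S L)⁻¹ Yᴴ x
  rw [conjTranspose_conjTranspose] at h2
  rw [h2]; exact qf_nonneg hR.inv _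

theorem frame_W (hH : H.PosDef) (hR : (Rm X H S L).PosDef) (hAU : IsUnit AU.det)
    (hAW : IsUnit AW.det) :
    ∃ T : Matrix (Fin p ⊕ Fin q) (Fin p ⊕ Fin q) ℂ, BlockTriangular T rkW ∧ (∀ i, T i i ≠ 0) ∧
      (fromBlocks AU (X * AW) 0 AW)ᴴ * fromBlocks H S Sᴴ (-L) * fromBlocks AU (X * AW) 0 AW
        = Tᴴ * J0 p q * T ∧
      ∀ al, phi rkW al ((fromBlocks AU (X * AW) 0 AW)ᴴ * fromBlocks H S Sᴴ (-L)
          * fromBlocks AU (X * AW) 0 AW)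
        = phi Fin.val (fun i => al (Sum.inl i))
            (AUᴴ * (H + (H * X + S) * (Rm X H S L)⁻¹ * (H * X + S)ᴴ) * AU)
          + phi Fin.val (fun i => al (Sum.inr i)) (AWᴴ * Rm X H S L * AW) := by
  rw [conj_frame hH.isHermitian]
  generalize H * X + S = Y
  set R := Rm X H S L
  have hAWs : IsUnit (AWᴴ).det := by rw [det_conjTranspose]; exact hAW.star
  have e : AUᴴ * H * AU + AUᴴ * Y * AW * (AWᴴ * R * AW)⁻¹ * (AUᴴ * Y * AW)ᴴ
      = AUᴴ * (H + Y * R⁻¹ * Yᴴ) * AU := by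
    have : AW * (AWᴴ * R * AW)⁻¹ * AWᴴ = R⁻¹ := by
      rw [Matrix.mul_inv_rev, Matrix.mul_inv_rev, ← Matrix.mul_assoc, mul_nonsing_inv _ hAW,
        Matrix.one_mul, Matrix.mul_assoc, nonsing_inv_mul _ hAWs, Matrix.mul_one]
    rw [Matrix.mul_add AUᴴ H, Matrix.add_mul, ← this]
    simp only [conjTranspose_mul, conjTranspose_conjTranspose, Matrix.mul_assoc]
  have h := block_W (AUᴴ * H * AU) (AUᴴ * Y * AW) (AWᴴ * R * AW) (posDef_conj' hR hAW)
    (by rw [e]; exact posDef_conj' (posDef_upper_block hH hR Y) hAU)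
  rw [e] at h
  exact h

theorem log_det_conj {m : ℕ} {N A : Matrix (Fin m) (Fin m) ℂ} (hN : N.PosDef) (hA : IsUnit A.det) :
    Real.log ‖(Aᴴ * N * A).det‖ = Real.log ‖N.det‖ + 2 * Real.log ‖A.det‖ := by
  have h1 := norm_ne_zero_iff.2 hA.ne_zero
  have h2 := norm_ne_zero_iff.2 (posDef_det_ne hN)
  rw [det_mul, det_mul, det_conjTranspose, norm_mul, norm_mul, norm_star,
    Real.log_mul (mul_ne_zero h1 h2) h1, Real.log_mul h1 h2]
  ring

theorem phi_frame_ge (hH : H.PosDef) (hR : (Rm X H S L).PosDef) (hAU : IsUnit AU.det)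
    (hAW : IsUnit AW.det) {al : Fin p ⊕ Fin q → ℝ} {c c' : ℝ} (hc : ∀ i, c ≤ al (Sum.inl i))
    (hc' : ∀ i, al (Sum.inr i) ≤ c') :
    phi Fin.val (fun i => al (Sum.inl i)) (AUᴴ * H * AU)
      + phi Fin.val (fun i => al (Sum.inr i)) (AWᴴ * hm H S L * AW)
      + (c - c') * (Real.log ‖(hm H S L).det‖ - Real.log ‖(Rm X H S L).det‖)
    ≤ phi rkW al ((fromBlocks AU (X * AW) 0 AW)ᴴ * fromBlocks H S Sᴴ (-L)
          * fromBlocks AU (X * AW) 0 AW) := by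
  obtain ⟨T, -, -, -, h⟩ := frame_W (S := S) (L := L) hH hR hAU hAW
  rw [h]
  set Y := H * X + S
  set R := Rm X H S L
  set M := H + Y * R⁻¹ * Yᴴ
  have hM : M.PosDef := posDef_upper_block hH hR Y
  have hh : (hm H S L).PosDef := posDef_hm hH hR
  have h1 := phi_sub_ge (posDef_conj' hH hAU) (posDef_conj' hM hAU) (fun x => by
    rw [qf_conj, qf_conj, qf_add]
    have h2 := qf_conj R⁻¹ Yᴴ (AU *ᵥ x)
    rw [conjTranspose_conjTranspose] at h2
    rw [h2]; linarith [qf_nonneg hR.inv (Yᴴ *ᵥ AU *ᵥ x)]) hc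
  have h2 := phi_sub_le (posDef_conj' hR hAW) (posDef_conj' hh hAW) (fun x => by
    rw [qf_conj, qf_conj]; exact qf_Rm_le hH _) hc'
  rw [log_det_conj hH hAU, log_det_conj hM hAU] at h1
  rw [log_det_conj hR hAW, log_det_conj hh hAW] at h2
  have h3 := det_schur Y (isUnit_iff_ne_zero.2 (posDef_det_ne hH))
    (isUnit_iff_ne_zero.2 (posDef_det_ne hR))
  rw [← hm_eq hH] at h3
  have h4 : Real.log ‖R.det‖ + Real.log ‖M.det‖ = Real.log ‖H.det‖ + Real.log ‖(hm H S L).det‖ := by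
    rw [← Real.log_mul, ← Real.log_mul, ← norm_mul, ← norm_mul, h3]
    all_goals exact norm_ne_zero_iff.2 (posDef_det_ne ‹_›)
  have h5 : Real.log ‖M.det‖ - Real.log ‖H.det‖
      = Real.log ‖(hm H S L).det‖ - Real.log ‖R.det‖ := by linarith
  have h6 : c * (Real.log ‖M.det‖ + 2 * Real.log ‖AU.det‖ - (Real.log ‖H.det‖ + 2 * Real.log ‖AU.det‖))
      = c * (Real.log ‖(hm H S L).det‖ - Real.log ‖R.det‖) := by rw [← h5]; ring
  rw [h6] at h1
  nlinarith

/-- The form controls the difference of two graphs. -/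
theorem qf_diff_le {X' : Matrix (Fin p) (Fin q) ℂ} (hH : H.PosDef) (hR : (Rm X H S L).PosDef)
    (hR' : (Rm X' H S L).PosDef) (w : Fin q → ℂ) :
    qf H ((X - X') *ᵥ w) ≤ 4 * qf (hm H S L) w := by
  have hd : IsUnit H.det := isUnit_iff_ne_zero.2 (posDef_det_ne hH)
  have h1 := qf_hm (X := X) (S := S) (L := L) hH w
  have h2 := qf_hm (X := X') (S := S) (L := L) hH w
  have h3 := qf_nonneg hR w
  have h4 := qf_nonneg hR' w
  set u := (H * X + S) *ᵥ w
  set v := (H * X' + S) *ᵥ w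
  have h5 : (X - X') *ᵥ w = H⁻¹ *ᵥ (u - v) := by
    rw [← sub_mulVec, mulVec_mulVec, add_sub_add_right_eq_sub, ← Matrix.mul_sub, ← Matrix.mul_assoc,
      nonsing_inv_mul _ hd, Matrix.one_mul]
  have h6 : qf H (H⁻¹ *ᵥ (u - v)) = qf H⁻¹ (u - v) := by
    rw [← qf_conj, hH.inv.isHermitian.eq, nonsing_inv_mul _ hd, Matrix.one_mul]
  have h7 : qf H⁻¹ (u - v) + qf H⁻¹ (u + v) = 2 * qf H⁻¹ u + 2 * qf H⁻¹ v := by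
    simp only [qf, mulVec_sub, mulVec_add, star_sub, star_add, sub_dotProduct, dotProduct_sub,
      add_dotProduct, dotProduct_add, Complex.add_re, Complex.sub_re]
    ring
  have h8 := qf_nonneg hH.inv (u + v)
  rw [h5, h6]
  linarith

end Blocks

section Minimise

theorem phi_smul {ι : Type*} [Fintype ι] [DecidableEq ι] {rk : ι → ℕ} (hrk : Function.Injective rk)
    (al : ι → ℝ) {N : Matrix ι ι ℂ} (hN : ∀ b, (mask rk b N).det ≠ 0) {c : ℝ} (hc : 0 < c) :
    phi rk al ((c : ℂ) • N) = phi rk al N + (∑ i, al i) * Real.log c := by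
  have hs : (0 : ℝ) < Real.sqrt c := Real.sqrt_pos.2 hc
  set T : Matrix ι ι ℂ := diagonal fun _ => ((Real.sqrt c : ℝ) : ℂ)
  have hT : BlockTriangular T rk := blockTriangular_diagonal _
  have hT0 : ∀ i, T i i ≠ 0 := fun i => by
    simp only [T, diagonal_apply_eq]; exact_mod_cast hs.ne'
  have e : (c : ℂ) • N = Tᴴ * N * T := by
    ext i j
    simp only [T, diagonal_conjTranspose, mul_diagonal, diagonal_mul, Matrix.smul_apply,
      Pi.star_apply, Complex.star_def, Complex.conj_ofReal, smul_eq_mul]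
    have h1 : ((Real.sqrt c : ℝ) : ℂ) * ((Real.sqrt c : ℝ) : ℂ) = (c : ℂ) := by
      rw [← Complex.ofReal_mul, Real.mul_self_sqrt hc.le]
    rw [← h1]; ring
  have h2 : ∀ i, 2 * Real.log ‖T i i‖ = Real.log c := fun i => by
    simp only [T, diagonal_apply_eq, Complex.norm_real, Real.norm_eq_abs, abs_of_pos hs]
    rw [Real.log_sqrt hc.le]; ring
  rw [e, phi, phi, Finset.sum_mul, ← Finset.sum_add_distrib]
  refine Finset.sum_congr rfl fun i _ => ?_
  rw [ell_conj hrk hT hT0 i hN, h2]; ring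

theorem det_mask_conj_ne {p q : ℕ} {rk : Fin p ⊕ Fin q → ℕ} (hrk : Function.Injective rk)
    {T : Matrix (Fin p ⊕ Fin q) (Fin p ⊕ Fin q) ℂ} (hT : BlockTriangular T rk)
    (hT0 : ∀ i, T i i ≠ 0) (b : ℕ) : (mask rk b (Tᴴ * J0 p q * T)).det ≠ 0 := by
  have h1 : (mask rk b T).det ≠ 0 := by
    rw [det_mask_upper hrk hT]; exact Finset.prod_ne_zero_iff.2 fun i _ => hT0 i
  rw [mask_conj hT, det_mul, det_mul, det_conjTranspose]
  exact mul_ne_zero (mul_ne_zero (star_ne_zero.2 h1) (det_mask_sign_ne rk b norm_sg)) h1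

variable {p q : ℕ}

/-- Coordinates on Hermitian forms. -/
abbrev Dat (p q : ℕ) := Matrix (Fin p) (Fin p) ℂ × Matrix (Fin p) (Fin q) ℂ × Matrix (Fin q) (Fin q) ℂ

/-- The Hermitian form with given blocks. -/
def formM (D : Dat p q) : Matrix (Fin p ⊕ Fin q) (Fin p ⊕ Fin q) ℂ :=
  fromBlocks D.1 D.2.1 D.2.1ᴴ (-D.2.2)

/-- Position function attached to each of the three flags. -/
def rkT : Option Bool → Fin p ⊕ Fin q → ℕ
  | none => rkU
  | some _ => rkW

theorem rkT_inj (t : Option Bool) : Function.Injective (rkT t : Fin p ⊕ Fin q → ℕ) := by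
  cases t
  exacts [rkU_inj, rkW_inj]

variable (AU : Bool → Matrix (Fin p) (Fin p) ℂ) (AW : Bool → Matrix (Fin q) (Fin q) ℂ)
  (XX : Bool → Matrix (Fin p) (Fin q) ℂ) (al : Option Bool → Fin p ⊕ Fin q → ℝ)

/-- Frames of the three flags. -/
def frm : Option Bool → Matrix (Fin p ⊕ Fin q) (Fin p ⊕ Fin q) ℂ
  | none => 1
  | some b => fromBlocks (AU b) (XX b * AW b) 0 (AW b)

/-- The Kempf-Ness function. -/
def bigPhi (D : Dat p q) : ℝ :=
  ∑ t, phi (rkT t) (al t) ((frm AU AW XX t)ᴴ * formM D * frm AU AW XX t)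

/-- Forms positive on the first block and negative on both graphs. -/
def Om : Set (Dat p q) := {D | D.1.PosDef ∧ ∀ b, (Rm (XX b) D.1 D.2.1 D.2.2).PosDef}

variable {AU AW XX al}

theorem frame_exists (hAU : ∀ b, IsUnit (AU b).det) (hAW : ∀ b, IsUnit (AW b).det) {D : Dat p q}
    (hD : D ∈ Om XX) (t : Option Bool) :
    ∃ T : Matrix (Fin p ⊕ Fin q) (Fin p ⊕ Fin q) ℂ, BlockTriangular T (rkT t) ∧
      (∀ i, T i i ≠ 0) ∧ (frm AU AW XX t)ᴴ * formM D * frm AU AW XX t = Tᴴ * J0 p q * T := by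
  rcases t with - | b
  · obtain ⟨T, h1, h2, h3, -⟩ := block_U D.1 D.2.1 D.2.2 hD.1 (posDef_hm hD.1 (hD.2 true))
    refine ⟨T, h1, h2, ?_⟩
    rw [← h3]; simp [frm, formM]
  · obtain ⟨T, h1, h2, h3, -⟩ := frame_W hD.1 (hD.2 b) (hAU b) (hAW b)
    exact ⟨T, h1, h2, h3⟩

theorem det_mask_frame_ne (hAU : ∀ b, IsUnit (AU b).det) (hAW : ∀ b, IsUnit (AW b).det)
    {D : Dat p q} (hD : D ∈ Om XX) (t : Option Bool) (k : ℕ) :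
    (mask (rkT t) k ((frm AU AW XX t)ᴴ * formM D * frm AU AW XX t)).det ≠ 0 := by
  obtain ⟨T, h1, h2, h3⟩ := frame_exists hAU hAW hD t
  rw [h3]
  exact det_mask_conj_ne (rkT_inj t) h1 h2 k

theorem formM_smul (c : ℝ) (D : Dat p q) : formM ((c : ℂ) • D) = (c : ℂ) • formM D := by
  rw [formM, formM, fromBlocks_smul]
  simp

theorem Rm_smul (c : ℝ) (X : Matrix (Fin p) (Fin q) ℂ) (D : Dat p q) :
    Rm X ((c : ℂ) • D).1 ((c : ℂ) • D).2.1 ((c : ℂ) • D).2.2 = (c : ℂ) • Rm X D.1 D.2.1 D.2.2 := by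
  simp [Rm, smul_sub]

theorem posDef_smul {m : ℕ} {N : Matrix (Fin m) (Fin m) ℂ} (hN : N.PosDef) {c : ℝ} (hc : 0 < c) :
    ((c : ℂ) • N).PosDef :=
  hN.smul (by exact_mod_cast hc)

theorem Om_smul {D : Dat p q} (hD : D ∈ Om XX) {c : ℝ} (hc : 0 < c) : (c : ℂ) • D ∈ Om XX :=
  ⟨posDef_smul hD.1 hc, fun b => by rw [Rm_smul]; exact posDef_smul (hD.2 b) hc⟩

theorem bigPhi_smul (hAU : ∀ b, IsUnit (AU b).det) (hAW : ∀ b, IsUnit (AW b).det)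
    (hsum : ∑ t, ∑ i, al t i = 0) {D : Dat p q} (hD : D ∈ Om XX) {c : ℝ} (hc : 0 < c) :
    bigPhi AU AW XX al ((c : ℂ) • D) = bigPhi AU AW XX al D := by
  have h : ∀ t, phi (rkT t) (al t) ((frm AU AW XX t)ᴴ * formM ((c : ℂ) • D) * frm AU AW XX t)
      = phi (rkT t) (al t) ((frm AU AW XX t)ᴴ * formM D * frm AU AW XX t)
        + (∑ i, al t i) * Real.log c := fun t => by
    rw [← phi_smul (rkT_inj t) (al t) (det_mask_frame_ne hAU hAW hD t) hc, formM_smul,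
      Matrix.mul_smul, Matrix.smul_mul]
  rw [bigPhi, Finset.sum_congr rfl fun t _ => h t, Finset.sum_add_distrib, ← Finset.sum_mul, hsum,
    zero_mul, add_zero, bigPhi]

/-- Block frames of the three flags. -/
def frU (A : Bool → Matrix (Fin p) (Fin p) ℂ) : Option Bool → Matrix (Fin p) (Fin p) ℂ
  | none => 1
  | some b => A b

theorem bigPhi_ge (hAU : ∀ b, IsUnit (AU b).det) (hAW : ∀ b, IsUnit (AW b).det)
    {c c' : ℝ} (hc : ∀ b i, c' + c ≤ al (some b) (Sum.inl i))
    (hc' : ∀ b i, al (some b) (Sum.inr i) ≤ c') {D : Dat p q} (hD : D ∈ Om XX) :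
    kfun (frU AU) (frU AW) (fun t i => al t (Sum.inl i)) (fun t i => al t (Sum.inr i)) D.1
        (hm D.1 D.2.1 D.2.2)
      + ∑ b, c * (Real.log ‖(hm D.1 D.2.1 D.2.2).det‖
          - Real.log ‖(Rm (XX b) D.1 D.2.1 D.2.2).det‖)
    ≤ bigPhi AU AW XX al D := by
  rw [bigPhi, kfun, Fintype.sum_option, Fintype.sum_option, add_assoc, ← Finset.sum_add_distrib]
  refine add_le_add ?_ (Finset.sum_le_sum fun b _ => ?_)
  · obtain ⟨T, -, -, -, h⟩ := block_U D.1 D.2.1 D.2.2 hD.1 (posDef_hm hD.1 (hD.2 true))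
    have h1 := h (al none)
    simp only [frm, frU, formM, conjTranspose_one, Matrix.one_mul, Matrix.mul_one, rkT]
    rw [h1, hm]
  · have := phi_frame_ge (al := al (some b)) hD.1 (hD.2 b) (hAU b) (hAW b) (hc b) (hc' b)
    rw [add_sub_cancel_left] at this
    exact this

end Minimise

section Bounded

theorem posDef_lower_of_det {m : ℕ} {R : Matrix (Fin m) (Fin m) ℂ} (hR : R.PosDef) {M D : ℝ}
    (hM : 0 ≤ M) (hle : ∀ x, qf R x ≤ Real.exp M * nsq x) (hD : -D ≤ Real.log ‖R.det‖)
    (x : Fin m → ℂ) : Real.exp (-D - m * M) * nsq x ≤ qf R x := by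
  obtain ⟨k, s, hk, -, rfl⟩ := sorted_spectral hR
  have hk' : k * kᴴ = 1 := mul_eq_one_comm.1 hk
  have hs : ∀ j, s j ≤ M := fun j => by
    have h1 := hle (kᴴ *ᵥ Pi.single j 1)
    have hk2 : (kᴴ)ᴴ * kᴴ = 1 := by rw [conjTranspose_conjTranspose, hk']
    rw [qf_conj, mulVec_mulVec _ k kᴴ, hk', one_mulVec, dexp, qf_diagonal, nsq_unitary hk2,
      nsq_single, mul_one, Finset.sum_eq_single j (fun c _ hc => by simp [hc]) (by simp)] at h1
    simpa using h1
  have hdet : Real.log ‖(kᴴ * dexp s * k).det‖ = ∑ j, s j := by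
    rw [det_mul, det_mul, mul_right_comm, ← det_mul, hk, det_one, one_mul, dexp, det_diagonal,
      norm_prod, Real.log_prod (fun i _ => by simp)]
    exact Finset.sum_congr rfl fun i _ => by
      rw [Complex.norm_real, Real.norm_eq_abs, Real.abs_exp, Real.log_exp]
  rw [hdet] at hD
  refine (qf_dexp_bounds hk s (b := M) (fun i => ⟨?_, hs i⟩) x).1
  have h1 : ∑ j, (M - s j) = m * M - ∑ j, s j := by simp [Finset.sum_sub_distrib]
  have h2 := Finset.single_le_sum (f := fun j => M - s j) (fun j _ => sub_nonneg.2 (hs j))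
    (Finset.mem_univ i)
  linarith

theorem nsq_le_inv {m : ℕ} {H : Matrix (Fin m) (Fin m) ℂ} (hH : H.PosDef) {M : ℝ} (hM : 0 < M)
    (hle : ∀ x, qf H x ≤ M * nsq x) (v : Fin m → ℂ) : nsq v ≤ M * qf H⁻¹ v := by
  have hd : IsUnit H.det := isUnit_iff_ne_zero.2 (posDef_det_ne hH)
  have h1 := qf_nonneg hH ((1 - (M : ℂ) • H⁻¹) *ᵥ v)
  have e : (1 - (M : ℂ) • H⁻¹)ᴴ * H * (1 - (M : ℂ) • H⁻¹)
      = H - ((2 * M : ℝ) : ℂ) • 1 + ((M * M : ℝ) : ℂ) • H⁻¹ := by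
    rw [conjTranspose_sub, conjTranspose_smul, hH.inv.isHermitian.eq, conjTranspose_one,
      Matrix.sub_mul, Matrix.one_mul, Matrix.smul_mul, nonsing_inv_mul _ hd, Matrix.mul_sub,
      Matrix.mul_one, Matrix.sub_mul, Matrix.mul_smul, mul_nonsing_inv _ hd, Complex.star_def,
      Complex.conj_ofReal, Matrix.smul_mul, Matrix.one_mul, smul_smul]
    push_cast
    rw [two_mul, add_smul]; abel
  rw [← qf_conj, e, qf_add, qf_sub, qf_smul, qf_smul, qf_one] at h1
  have h2 := hle v
  have h3 : 0 ≤ M * (M * qf H⁻¹ v - nsq v) := by nlinarith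
  have := nonneg_of_mul_nonneg_right h3 hM
  linarith

variable {p q : ℕ} {AU : Bool → Matrix (Fin p) (Fin p) ℂ} {AW : Bool → Matrix (Fin q) (Fin q) ℂ}
  {XX : Bool → Matrix (Fin p) (Fin q) ℂ} {al : Option Bool → Fin p ⊕ Fin q → ℝ}

theorem hm_smul {D : Dat p q} (hH : D.1.PosDef) {c : ℝ} (hc : 0 < c) :
    hm ((c : ℂ) • D).1 ((c : ℂ) • D).2.1 ((c : ℂ) • D).2.2 = (c : ℂ) • hm D.1 D.2.1 D.2.2 := by
  have hd : IsUnit D.1.det := isUnit_iff_ne_zero.2 (posDef_det_ne hH)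
  have hc' : (c : ℂ) ≠ 0 := by exact_mod_cast hc.ne'
  have e : ((c : ℂ) • D.1)⁻¹ = (c : ℂ)⁻¹ • D.1⁻¹ := by
    refine Matrix.inv_eq_left_inv ?_
    rw [Matrix.smul_mul, Matrix.mul_smul, smul_smul, inv_mul_cancel₀ hc', one_smul,
      nonsing_inv_mul _ hd]
  simp only [hm, Prod.smul_fst, Prod.smul_snd, e, conjTranspose_smul, Complex.star_def,
    Complex.conj_ofReal, Matrix.smul_mul, Matrix.mul_smul, smul_smul, smul_add]
  rw [inv_mul_cancel₀ hc', mul_one]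

theorem bounded_of_le (hp : 0 < p) (hAU : ∀ b, IsUnit (AU b).det) (hAW : ∀ b, IsUnit (AW b).det)
    {c c' : ℝ} (hcpos : 0 < c) (hc : ∀ b i, c' + c ≤ al (some b) (Sum.inl i))
    (hc' : ∀ b i, al (some b) (Sum.inr i) ≤ c')
    (haU : ∀ t, Antitone fun i => al t (Sum.inl i)) (haW : ∀ t, Antitone fun i => al t (Sum.inr i))
    (hsum : ∑ t, ∑ i, al t i = 0)
    (hst : KStable (frU AU) (frU AW) (XX true - XX false) (fun t i => al t (Sum.inl i))
      (fun t i => al t (Sum.inr i))) (B : ℝ) :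
    ∃ e > 0, ∃ K, ∀ D ∈ Om XX, bigPhi AU AW XX al D ≤ B → ∃ s : ℝ, 0 < s ∧
      (∀ x, e * nsq x ≤ qf ((s : ℂ) • D).1 x) ∧
      (∀ b x, e * nsq x ≤ qf (Rm (XX b) ((s : ℂ) • D).1 ((s : ℂ) • D).2.1 ((s : ℂ) • D).2.2) x) ∧
      (∀ i j, ‖((s : ℂ) • D).1 i j‖ ≤ K) ∧
      (∀ i j, ‖(((s : ℂ) • D).1 * XX true + ((s : ℂ) • D).2.1) i j‖ ≤ K) ∧
      (∀ i j, ‖Rm (XX true) ((s : ℂ) • D).1 ((s : ℂ) • D).2.1 ((s : ℂ) • D).2.2 i j‖ ≤ K) := by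
  have hfrU : ∀ t, IsUnit (frU AU t).det := by
    rintro (- | b)
    exacts [by simp [frU], hAU b]
  have hfrW : ∀ t, IsUnit (frU AW t).det := by
    rintro (- | b)
    exacts [by simp [frU], hAW b]
  have : Nonempty (Fin p ⊕ Fin q) := ⟨Sum.inl ⟨0, hp⟩⟩
  obtain ⟨eps, heps, C, hC⟩ := kfun_coercive hfrU hfrW haU haW
    (by rw [← hsum]; exact Finset.sum_congr rfl fun t _ => (Fintype.sum_sum_type _).symm) hst
  set D0 := max 0 ((B + C) / eps)
  set D1 := max 0 ((B + C) / c)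
  have hD0 : 0 ≤ D0 := le_max_left _ _
  have hD1 : 0 ≤ D1 := le_max_left _ _
  refine ⟨Real.exp (-D1 - q * D0), Real.exp_pos _, 2 * Real.exp D0, fun D hD hB => ?_⟩
  obtain ⟨mm, MM, hH, hh, hk⟩ := hC D.1 (hm D.1 D.2.1 D.2.2) hD.1 (posDef_hm hD.1 (hD.2 true))
    (qf_diff_le hD.1 (hD.2 true) (hD.2 false))
  have hlog : ∀ {D : Dat p q}, D ∈ Om XX → ∀ b,
      0 ≤ c * (Real.log ‖(hm D.1 D.2.1 D.2.2).det‖ - Real.log ‖(Rm (XX b) D.1 D.2.1 D.2.2).det‖) :=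
    fun hD b => mul_nonneg hcpos.le (sub_nonneg.2
      (log_det_mono (hD.2 b) (posDef_hm hD.1 (hD.2 true)) (qf_Rm_le hD.1)))
  have hge := bigPhi_ge hAU hAW hc hc' hD
  have hMM : MM - mm ≤ D0 := by
    refine le_max_of_le_right ((le_div_iff₀ heps).2 ?_)
    have := Finset.sum_nonneg fun b (_ : b ∈ Finset.univ) => hlog hD b
    linarith
  refine ⟨Real.exp (-mm), Real.exp_pos _, ?_⟩
  have hsc : ∀ {m : ℕ} (N : Matrix (Fin m) (Fin m) ℂ), (∀ x, Real.exp mm * nsq x ≤ qf N x ∧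
      qf N x ≤ Real.exp MM * nsq x) → ∀ x, nsq x ≤ qf (((Real.exp (-mm) : ℝ) : ℂ) • N) x ∧
      qf (((Real.exp (-mm) : ℝ) : ℂ) • N) x ≤ Real.exp D0 * nsq x := by
    intro m N hN x
    have h1 := mul_le_mul_of_nonneg_left (hN x).1 (Real.exp_pos (-mm)).le
    have h2 := mul_le_mul_of_nonneg_left (hN x).2 (Real.exp_pos (-mm)).le
    rw [← mul_assoc, ← Real.exp_add] at h1 h2
    rw [neg_add_cancel, Real.exp_zero, one_mul] at h1
    rw [qf_smul]
    refine ⟨h1, h2.trans (mul_le_mul_of_nonneg_right (Real.exp_le_exp.2 (by linarith))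
      (nsq_nonneg x))⟩
  have hH' := hsc _ hH
  have hh' := hsc _ hh
  rw [← hm_smul hD.1 (Real.exp_pos _)] at hh'
  have hΦ := bigPhi_smul hAU hAW hsum hD (Real.exp_pos (-mm))
  have hD' : (((Real.exp (-mm) : ℝ) : ℂ) • D) ∈ Om XX := Om_smul hD (Real.exp_pos _)
  rw [← hΦ] at hB
  rw [← Prod.smul_fst] at hH'
  generalize ((Real.exp (-mm) : ℝ) : ℂ) • D = F at *
  have hhP := posDef_hm hD'.1 (hD'.2 true)
  obtain ⟨m', M', h1, h2, h3⟩ := hC F.1 _ hD'.1 hhP (qf_diff_le hD'.1 (hD'.2 true) (hD'.2 false))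
  have hm' : m' ≤ M' := by
    have := (h1 (Pi.single ⟨0, hp⟩ 1)).1.trans (h1 (Pi.single ⟨0, hp⟩ 1)).2
    rwa [nsq_single, mul_one, mul_one, Real.exp_le_exp] at this
  have hge' := bigPhi_ge hAU hAW hc hc' hD'
  have hdet : ∀ b, -D1 ≤ Real.log ‖(Rm (XX b) F.1 F.2.1 F.2.2).det‖ := fun b => by
    have h4 := Finset.single_le_sum (f := fun b => c * (Real.log ‖(hm F.1 F.2.1 F.2.2).det‖
      - Real.log ‖(Rm (XX b) F.1 F.2.1 F.2.2).det‖)) (fun b _ => hlog hD' b) (Finset.mem_univ b)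
    have h5 : 0 ≤ eps * (M' - m') := mul_nonneg heps.le (by linarith)
    have h6 : Real.log ‖(hm F.1 F.2.1 F.2.2).det‖ - Real.log ‖(Rm (XX b) F.1 F.2.1 F.2.2).det‖
        ≤ D1 := by
      refine le_max_of_le_right ((le_div_iff₀ hcpos).2 ?_)
      linarith
    have h7 := log_det_mono PosDef.one hhP fun x => by rw [qf_one]; exact (hh' x).1
    rw [det_one, norm_one, Real.log_one] at h7
    linarith
  have hup : ∀ b x, qf (Rm (XX b) F.1 F.2.1 F.2.2) x ≤ Real.exp D0 * nsq x := fun b x =>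
    (qf_Rm_le hD'.1 x).trans (hh' x).2
  have hle1 : Real.exp (-D1 - q * D0) ≤ 1 := by
    rw [Real.exp_le_one_iff]; nlinarith [mul_nonneg (Nat.cast_nonneg (α := ℝ) q) hD0]
  have hbd : ∀ {m : ℕ} {N : Matrix (Fin m) (Fin m) ℂ}, N.PosDef →
      (∀ x, qf N x ≤ Real.exp D0 * nsq x) → ∀ i j, ‖N i j‖ ≤ 2 * Real.exp D0 := fun hN h =>
    entry_bound hN.isHermitian fun x => by rw [abs_of_nonneg (qf_nonneg hN x)]; exact h x
  refine ⟨fun x => ?_, fun b => posDef_lower_of_det (hD'.2 b) hD0 (hup b) (hdet b),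
    hbd hD'.1 fun x => (hH' x).2, fun i j => ?_, hbd (hD'.2 true) (hup true)⟩
  · exact (mul_le_of_le_one_left (nsq_nonneg x) hle1).trans (hH' x).1
  · have h4 := qf_hm (X := XX true) (S := F.2.1) (L := F.2.2) hD'.1 (Pi.single j 1)
    have h5 := (hh' (Pi.single j 1)).2
    have h6 := qf_nonneg (hD'.2 true) (Pi.single j 1)
    have h7 := nsq_le_inv hD'.1 (Real.exp_pos D0) (fun x => (hH' x).2)
      ((F.1 * XX true + F.2.1) *ᵥ Pi.single j 1)
    rw [nsq_single, mul_one] at h5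
    have h8 := normSq_le_nsq ((F.1 * XX true + F.2.1) *ᵥ Pi.single j 1) i
    rw [mulVec_single_one, Matrix.col_apply] at h8
    rw [Complex.normSq_eq_norm_sq] at h8
    have h9 : ‖(F.1 * XX true + F.2.1) i j‖ ^ 2 ≤ Real.exp D0 ^ 2 := by
      rw [mulVec_single_one] at h7 h4
      refine h8.trans (h7.trans ?_)
      rw [sq]
      exact mul_le_mul_of_nonneg_left (by linarith) (Real.exp_pos _).le
    have := abs_le_of_sq_le_sq' h9 (Real.exp_pos _).le
    linarith [Real.exp_pos D0, this.2]

end Bounded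

section Minimiser

variable {p q : ℕ} {AU : Bool → Matrix (Fin p) (Fin p) ℂ} {AW : Bool → Matrix (Fin q) (Fin q) ℂ}
  {XX : Bool → Matrix (Fin p) (Fin q) ℂ} {al : Option Bool → Fin p ⊕ Fin q → ℝ}

theorem Om_nonempty : (Om XX).Nonempty := by
  set M : ℝ := 1 + ∑ b, esum ((XX b)ᴴ * XX b)
  have hM : 0 < M := by
    have := Finset.sum_nonneg fun b (_ : b ∈ Finset.univ) => esum_nonneg ((XX b)ᴴ * XX b)
    linarith
  refine ⟨(1, 0, (M : ℂ) • 1), PosDef.one, fun b => ?_⟩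
  have hL : ((M : ℂ) • (1 : Matrix (Fin q) (Fin q) ℂ)).IsHermitian :=
    (posDef_smul PosDef.one hM).isHermitian
  refine posDef_of_lower (isHermitian_Rm isHermitian_one hL) one_pos fun x => ?_
  simp only [Rm, Matrix.mul_one, Matrix.mul_zero, sub_zero, conjTranspose_zero, Matrix.zero_mul]
  rw [qf_sub, qf_smul, qf_one]
  have h1 := (abs_le.1 (abs_qf_le ((XX b)ᴴ * XX b) x)).2
  have h2 := Finset.single_le_sum (f := fun b => esum ((XX b)ᴴ * XX b))
    (fun b _ => esum_nonneg _) (Finset.mem_univ b)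
  have h3 := mul_le_mul_of_nonneg_right h2 (nsq_nonneg x)
  nlinarith

theorem continuous_mask {ι : Type*} [Fintype ι] [DecidableEq ι] (rk : ι → ℕ) (b : ℕ) :
    Continuous (mask rk b) := by
  unfold mask; fun_prop

theorem continuous_formM : Continuous (formM : Dat p q → _) := by
  unfold formM
  exact Continuous.matrix_fromBlocks continuous_fst (continuous_fst.comp continuous_snd)
    (continuous_fst.comp continuous_snd).matrix_conjTranspose
    (continuous_snd.comp continuous_snd).neg

theorem continuousAt_bigPhi (hAU : ∀ b, IsUnit (AU b).det) (hAW : ∀ b, IsUnit (AW b).det)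
    {D : Dat p q} (hD : D ∈ Om XX) : ContinuousAt (bigPhi AU AW XX al) D := by
  have h1 : ∀ t k, ContinuousAt
      (fun D => lmin (rkT t) k ((frm AU AW XX t)ᴴ * formM D * frm AU AW XX t)) D := fun t k => by
    have hc : Continuous fun D => mask (rkT t) k ((frm AU AW XX t)ᴴ * formM D * frm AU AW XX t) :=
      (continuous_mask _ _).comp ((continuous_const.matrix_mul continuous_formM).matrix_mul
        continuous_const)
    exact ContinuousAt.log hc.matrix_det.norm.continuousAt
      (norm_ne_zero_iff.2 (det_mask_frame_ne hAU hAW hD t k))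
  unfold bigPhi phi ell
  refine tendsto_finsetSum _ fun t _ => tendsto_finsetSum _ fun i _ => ?_
  exact ((h1 t _).sub (h1 t _)).const_mul _

theorem continuous_qf {m : Type*} [Fintype m] (x : m → ℂ) :
    Continuous fun H : Matrix m m ℂ => qf H x := by
  unfold qf
  exact Complex.continuous_re.comp
    (continuous_const.dotProduct (continuous_id.matrix_mulVec continuous_const))

theorem continuous_Rm (X : Matrix (Fin p) (Fin q) ℂ) :
    Continuous fun D : Dat p q => Rm X D.1 D.2.1 D.2.2 := by
  unfold Rm
  fun_prop

/-- Recovering a form from its restriction to a graph. -/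
def unRm (X : Matrix (Fin p) (Fin q) ℂ) (D : Dat p q) : Dat p q :=
  (D.1, D.2.1 - D.1 * X,
    D.2.2 + Xᴴ * D.1 * X + Xᴴ * (D.2.1 - D.1 * X) + (D.2.1 - D.1 * X)ᴴ * X)

theorem continuous_unRm (X : Matrix (Fin p) (Fin q) ℂ) : Continuous (unRm X) := by
  unfold unRm
  fun_prop

theorem unRm_Rm (X : Matrix (Fin p) (Fin q) ℂ) (D : Dat p q) :
    unRm X (D.1, D.1 * X + D.2.1, Rm X D.1 D.2.1 D.2.2) = D := by
  simp only [unRm, add_sub_cancel_left, Rm]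
  refine Prod.ext rfl (Prod.ext rfl ?_)
  simp only
  abel

theorem exists_min (hp : 0 < p) (hAU : ∀ b, IsUnit (AU b).det) (hAW : ∀ b, IsUnit (AW b).det)
    {c c' : ℝ} (hcpos : 0 < c) (hc : ∀ b i, c' + c ≤ al (some b) (Sum.inl i))
    (hc' : ∀ b i, al (some b) (Sum.inr i) ≤ c')
    (haU : ∀ t, Antitone fun i => al t (Sum.inl i)) (haW : ∀ t, Antitone fun i => al t (Sum.inr i))
    (hsum : ∑ t, ∑ i, al t i = 0)
    (hst : KStable (frU AU) (frU AW) (XX true - XX false) (fun t i => al t (Sum.inl i))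
      (fun t i => al t (Sum.inr i))) :
    ∃ D ∈ Om XX, ∀ D' ∈ Om XX, bigPhi AU AW XX al D ≤ bigPhi AU AW XX al D' := by
  obtain ⟨D0, hD0⟩ := Om_nonempty (XX := XX)
  obtain ⟨e, he, K, hK⟩ := bounded_of_le hp hAU hAW hcpos hc hc' haU haW hsum hst
    (bigPhi AU AW XX al D0)
  set Z : Set (Dat p q) := {D | D.1.IsHermitian} ∩ {D | D.2.2.IsHermitian} ∩
    {D | ∀ x, e * nsq x ≤ qf D.1 x} ∩ {D | ∀ b x, e * nsq x ≤ qf (Rm (XX b) D.1 D.2.1 D.2.2) x}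
  have hZ : IsClosed Z := by
    refine IsClosed.inter (IsClosed.inter (IsClosed.inter ?_ ?_) ?_) ?_
    · exact isClosed_eq (by fun_prop) (by fun_prop)
    · exact isClosed_eq (by fun_prop) (by fun_prop)
    · rw [Set.ofPred_forall]
      exact isClosed_iInter fun x => isClosed_le continuous_const
        ((continuous_qf x).comp continuous_fst)
    · simp only [Set.ofPred_forall]
      exact isClosed_iInter fun b => isClosed_iInter fun x => isClosed_le continuous_const
        ((continuous_qf x).comp (continuous_Rm (XX b)))
  have hZO : Z ⊆ Om XX := by
    rintro D ⟨⟨⟨h1, h2⟩, h3⟩, h4⟩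
    exact ⟨posDef_of_lower h1 he h3, fun b => posDef_of_lower (isHermitian_Rm h1 h2) he (h4 b)⟩
  set Q : Set (Dat p q) := unRm (XX true) '' ({A | ∀ i j, ‖A i j‖ ≤ K} ×ˢ
    ({A | ∀ i j, ‖A i j‖ ≤ K} ×ˢ {A | ∀ i j, ‖A i j‖ ≤ K})) ∩ Z
  have hQ : IsCompact Q := ((((isCompact_entries K).prod ((isCompact_entries K).prod
    (isCompact_entries K)))).image (continuous_unRm (XX true))).inter_right hZ
  have hmem : ∀ D ∈ Om XX, bigPhi AU AW XX al D ≤ bigPhi AU AW XX al D0 →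
      ∃ D' ∈ Q, bigPhi AU AW XX al D' = bigPhi AU AW XX al D := by
    intro D hD hle
    obtain ⟨s, hs, h1, h2, h3, h4, h5⟩ := hK D hD hle
    have hD' := Om_smul hD hs
    have hpre : (((s : ℂ) • D).1, ((s : ℂ) • D).1 * XX true + ((s : ℂ) • D).2.1,
        Rm (XX true) ((s : ℂ) • D).1 ((s : ℂ) • D).2.1 ((s : ℂ) • D).2.2)
        ∈ {A : Matrix (Fin p) (Fin p) ℂ | ∀ i j, ‖A i j‖ ≤ K} ×ˢ
        ({A : Matrix (Fin p) (Fin q) ℂ | ∀ i j, ‖A i j‖ ≤ K} ×ˢ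
          {A : Matrix (Fin q) (Fin q) ℂ | ∀ i j, ‖A i j‖ ≤ K}) := ⟨h3, h4, h5⟩
    refine ⟨(s : ℂ) • D, ⟨⟨_, hpre, unRm_Rm (XX true) ((s : ℂ) • D)⟩,
      ⟨⟨hD'.1.isHermitian, ?_⟩, h1⟩, h2⟩, bigPhi_smul hAU hAW hsum hD hs⟩
    have h6 := (hD'.2 true).isHermitian
    have h7 := hD'.1.isHermitian
    generalize (s : ℂ) • D = F at h6 h7
    have e : F.2.2 = Rm (XX true) F.1 F.2.1 F.2.2 + (XX true)ᴴ * F.1 * XX true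
        + ((XX true)ᴴ * F.2.1 + F.2.1ᴴ * XX true) := by
      rw [Rm]; abel
    change F.2.2.IsHermitian
    rw [e]
    refine (h6.add (isHermitian_conjTranspose_mul_mul _ h7)).add ?_
    rw [IsHermitian, conjTranspose_add, conjTranspose_mul, conjTranspose_mul,
      conjTranspose_conjTranspose, conjTranspose_conjTranspose, add_comm]
  obtain ⟨D1, hD1, -⟩ := hmem D0 hD0 le_rfl
  obtain ⟨D, hD, hmin⟩ := hQ.exists_isMinOn ⟨D1, hD1⟩ (f := bigPhi AU AW XX al)
    fun D hD => (continuousAt_bigPhi hAU hAW (hZO hD.2)).continuousWithinAt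
  refine ⟨D, hZO hD.2, fun D' hD' => ?_⟩
  have hle : ∀ D' ∈ Om XX, bigPhi AU AW XX al D' ≤ bigPhi AU AW XX al D0 →
      bigPhi AU AW XX al D ≤ bigPhi AU AW XX al D' := fun D' hD' h => by
    obtain ⟨D2, h2, h3⟩ := hmem D' hD' h
    rw [← h3]; exact hmin h2
  rcases le_total (bigPhi AU AW XX al D') (bigPhi AU AW XX al D0) with h | h
  · exact hle D' hD' h
  · exact (hle D0 hD0 le_rfl).trans h

end Minimiser

section Critical

theorem hasDerivAt_log_det {ι : Type*} [Fintype ι] [DecidableEq ι] (A : Matrix ι ι ℂ) :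
    HasDerivAt (fun t : ℝ => Real.log ‖(1 + (t : ℂ) • A).det‖) A.trace.re 0 := by
  have h1 : HasDerivAt (fun z : ℂ => (1 + z • A).det) A.trace 0 := by
    have e : (fun z : ℂ => (1 + z • A).det)
        = fun z => 1 + A.trace * z + ((1 + (X : ℂ[X]) • A.map C).det.divX.divX).eval z * z ^ 2 :=
      funext fun z => det_one_add_smul z A
    rw [e]
    have h2 := (((hasDerivAt_id (0 : ℂ)).const_mul A.trace).const_add 1).add
      ((((1 + (X : ℂ[X]) • A.map C).det.divX.divX).hasDerivAt 0).mul ((hasDerivAt_id (0 : ℂ)).pow 2))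
    refine HasDerivAt.congr_deriv (f := fun z => _) h2 ?_
    simp
  have h3 : HasDerivAt (fun z : ℂ => Complex.log (1 + z • A).det) A.trace ((0 : ℝ) : ℂ) := by
    rw [Complex.ofReal_zero]
    simpa using h1.clog (by simp)
  have h4 := h3.real_of_complex
  simpa only [Complex.log_re] using h4

variable {p q : ℕ}

theorem mask_add_smul {ι : Type*} [Fintype ι] [DecidableEq ι] (rk : ι → ℕ) (k : ℕ)
    (N M : Matrix ι ι ℂ) (t : ℂ) :
    mask rk k (N + t • M) = mask rk k N + t • (pmat rk k * M * pmat rk k) := by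
  simp only [mask, Matrix.mul_add, Matrix.add_mul, Matrix.mul_smul, Matrix.smul_mul]
  abel

theorem hasDerivAt_lmin (rk : Fin p ⊕ Fin q → ℕ) (k : ℕ)
    (M : Matrix (Fin p ⊕ Fin q) (Fin p ⊕ Fin q) ℂ) :
    HasDerivAt (fun t : ℝ => lmin rk k (J0 p q + (t : ℂ) • M))
      (∑ i with rk i < k, sg i * (M i i).re) 0 := by
  set Z := mask rk k (J0 p q)
  have hZ : Z * Z = 1 := by
    ext i j
    rw [mul_apply, Finset.sum_eq_single i]
    · simp only [Z, mask_apply, J0, diagonal_apply, one_apply]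
      by_cases h : i = j
      · subst h
        have := sg_mul_self i
        by_cases h2 : rk i < k <;> simp [h2, ← Complex.ofReal_mul, this]
      · simp [h]
    · intro b _ hb
      simp [Z, mask_apply, J0, diagonal_apply, Ne.symm hb]
    · simp
  set A := Z * (pmat rk k * M * pmat rk k)
  have e : ∀ t : ℝ, lmin rk k (J0 p q + (t : ℂ) • M) = Real.log ‖(1 + (t : ℂ) • A).det‖ := by
    intro t
    have h1 : mask rk k (J0 p q + (t : ℂ) • M) = Z * (1 + (t : ℂ) • A) := by
      rw [mask_add_smul, Matrix.mul_add, Matrix.mul_smul, ← Matrix.mul_assoc Z Z, hZ, Matrix.one_mul,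
        Matrix.mul_one]
    have h2 : ‖Z.det‖ = 1 := by
      have := congrArg norm (congrArg det hZ)
      rw [det_mul, norm_mul, det_one, norm_one] at this
      nlinarith [norm_nonneg Z.det]
    rw [lmin, h1, det_mul, norm_mul, h2, one_mul]
  have h3 : A.trace.re = ∑ i with rk i < k, sg i * (M i i).re := by
    rw [trace, Complex.re_sum, Finset.sum_filter]
    refine Finset.sum_congr rfl fun i _ => ?_
    change ((Z * (pmat rk k * M * pmat rk k)) i i).re = _
    rw [mul_apply, Finset.sum_eq_single i]
    · simp only [Z, mask_apply, J0, diagonal_apply, pmat, mul_diagonal, diagonal_mul]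
      by_cases h2 : rk i < k <;> simp [h2]
    · intro b _ hb
      simp [Z, mask_apply, J0, Ne.symm hb]
    · simp
  rw [← h3]
  simpa only [e] using hasDerivAt_log_det A

theorem hasDerivAt_phi {rk : Fin p ⊕ Fin q → ℕ} (hrk : Function.Injective rk)
    (al : Fin p ⊕ Fin q → ℝ) {T : Matrix (Fin p ⊕ Fin q) (Fin p ⊕ Fin q) ℂ}
    (hT : BlockTriangular T rk) (hT0 : ∀ i, T i i ≠ 0)
    (M : Matrix (Fin p ⊕ Fin q) (Fin p ⊕ Fin q) ℂ) :
    HasDerivAt (fun t : ℝ => phi rk al (Tᴴ * (J0 p q + (t : ℂ) • M) * T))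
      (∑ i, al i * (sg i * (M i i).re)) 0 := by
  have hl : ∀ k, HasDerivAt (fun t : ℝ => lmin rk k (Tᴴ * (J0 p q + (t : ℂ) • M) * T))
      (∑ i with rk i < k, sg i * (M i i).re) 0 := by
    intro k
    refine ((hasDerivAt_lmin rk k M).add_const (∑ i with rk i < k, 2 * Real.log ‖T i i‖)).congr_of_eventuallyEq ?_
    have hc : Continuous fun t : ℝ => (mask rk k (J0 p q + (t : ℂ) • M)).det := by
      refine Continuous.matrix_det ((continuous_mask rk k).comp ?_)
      exact continuous_const.add (Complex.continuous_ofReal.smul continuous_const)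
    have h0 : (mask rk k (J0 p q + ((0 : ℝ) : ℂ) • M)).det ≠ 0 := by
      rw [Complex.ofReal_zero, zero_smul, add_zero]
      exact det_mask_sign_ne rk k norm_sg
    filter_upwards [hc.continuousAt.eventually_ne h0] with t ht
    exact lmin_conj hrk hT hT0 k ht
  unfold phi ell
  refine HasDerivAt.fun_sum fun i _ => HasDerivAt.const_mul _ ?_
  have h := (hl (rk i + 1)).sub (hl (rk i))
  refine h.congr_deriv ?_
  have : (Finset.univ.filter fun j => rk j < rk i + 1)
      = insert i (Finset.univ.filter fun j => rk j < rk i) := by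
    ext j
    simp only [Finset.mem_filter, Finset.mem_univ, true_and, Finset.mem_insert]
    constructor
    · intro hj
      rcases Nat.lt_succ_iff_lt_or_eq.1 hj with h | h
      · exact Or.inr h
      · exact Or.inl (hrk h)
    · rintro (rfl | hj) <;> omega
  rw [this, Finset.sum_insert (by simp)]
  ring

/-- Three matrices with spectra `al t` lying in orbits of the unitary group of a common form of
signature `(p, q)` can be chosen with vanishing sum. -/
def Realize {T : Type*} [Fintype T] (al : T → Fin p ⊕ Fin q → ℝ) : Prop :=
  ∃ (J : Matrix (Fin p ⊕ Fin q) (Fin p ⊕ Fin q) ℂ)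
    (w : T → Matrix (Fin p ⊕ Fin q) (Fin p ⊕ Fin q) ℂ),
    (∀ t, (w t)ᴴ * J * w t = J0 p q) ∧
    ∑ t, w t * diagonal (fun i => ((al t i : ℝ) : ℂ)) * (w t)⁻¹ = 0

theorem realize_of_critical {T : Type*} [Fintype T] {al : T → Fin p ⊕ Fin q → ℝ}
    {J : Matrix (Fin p ⊕ Fin q) (Fin p ⊕ Fin q) ℂ}
    {w : T → Matrix (Fin p ⊕ Fin q) (Fin p ⊕ Fin q) ℂ}
    (hw : ∀ t, (w t)ᴴ * J * w t = J0 p q)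
    (hcrit : ∀ K : Matrix (Fin p ⊕ Fin q) (Fin p ⊕ Fin q) ℂ, K.IsHermitian →
      ∑ t, ∑ i, al t i * (sg i * (((w t)ᴴ * K * w t) i i).re) = 0) : Realize al := by
  refine ⟨J, w, hw, ?_⟩
  set d : T → Matrix (Fin p ⊕ Fin q) (Fin p ⊕ Fin q) ℂ := fun t =>
    diagonal fun i => ((al t i * sg i : ℝ) : ℂ)
  set G := ∑ t, w t * d t * (w t)ᴴ
  have hd : ∀ t, (d t)ᴴ = d t := fun t => by
    simp only [d, diagonal_conjTranspose]
    congr 1; ext i; simp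
  have hG : G.IsHermitian := by
    rw [IsHermitian, conjTranspose_sum]
    refine Finset.sum_congr rfl fun t _ => ?_
    rw [conjTranspose_mul, conjTranspose_mul, conjTranspose_conjTranspose, hd, Matrix.mul_assoc]
  have htr : (Gᴴ * G).trace.re = 0 := by
    rw [← hcrit G hG, hG.eq]
    conv_lhs => enter [1, 1, 1]; rw [show G = ∑ t, w t * d t * (w t)ᴴ from rfl]
    rw [Matrix.sum_mul, trace_sum, Complex.re_sum]
    refine Finset.sum_congr rfl fun t _ => ?_
    have h1 : (w t * d t * (w t)ᴴ * G).trace = (d t * ((w t)ᴴ * G * w t)).trace := by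
      rw [Matrix.mul_assoc (w t), Matrix.mul_assoc (w t), trace_mul_comm]
      simp only [Matrix.mul_assoc]
    rw [h1, trace, Complex.re_sum]
    refine Finset.sum_congr rfl fun i _ => ?_
    rw [diag_apply, diagonal_mul, Complex.re_ofReal_mul, mul_assoc]
  have hG0 : G = 0 := by
    rw [← trace_conjTranspose_mul_self_eq_zero_iff]
    refine Complex.ext htr ?_
    have := trace_conjTranspose (Gᴴ * G)
    rw [conjTranspose_mul, conjTranspose_conjTranspose] at this
    exact Complex.conj_eq_iff_im.1 this.symm
  have e : ∀ t, w t * diagonal (fun i => ((al t i : ℝ) : ℂ)) * (w t)⁻¹ = w t * d t * (w t)ᴴ * J := by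
    intro t
    have h1 : (J0 p q * (w t)ᴴ * J) * w t = 1 := by
      rw [Matrix.mul_assoc, Matrix.mul_assoc, ← Matrix.mul_assoc (w t)ᴴ, hw, J0_sq]
    rw [Matrix.inv_eq_left_inv h1]
    have h2 : d t = diagonal (fun i => ((al t i : ℝ) : ℂ)) * J0 p q := by
      rw [J0, diagonal_mul_diagonal]; simp only [d, Complex.ofReal_mul]
    rw [h2]
    simp only [Matrix.mul_assoc]
  rw [Finset.sum_congr rfl fun t _ => e t, ← Matrix.sum_mul]
  change G * J = 0
  rw [hG0, Matrix.zero_mul]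

end Critical

section KempfNess

theorem posDef_perturb {m : ℕ} {N N' : Matrix (Fin m) (Fin m) ℂ} (hN : N.PosDef)
    (hN' : N'.IsHermitian) : ∀ᶠ t : ℝ in 𝓝 0, (N + (t : ℂ) • N').PosDef := by
  obtain ⟨c, hc, h⟩ := posDef_lower hN
  have hcont : Continuous fun t : ℝ => |t| * esum N' := by fun_prop
  have h0 : |(0 : ℝ)| * esum N' < c / 2 := by simpa using hc
  filter_upwards [hcont.continuousAt.eventually_lt_const h0] with t ht
  refine posDef_of_lower (hN.isHermitian.add ?_) (half_pos hc) fun x => ?_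
  · rw [IsHermitian, conjTranspose_smul, hN'.eq, Complex.star_def, Complex.conj_ofReal]
  · rw [qf_add, qf_smul]
    have h1 : |t * qf N' x| ≤ |t| * esum N' * nsq x := by
      rw [abs_mul, mul_assoc]
      exact mul_le_mul_of_nonneg_left (abs_qf_le N' x) (abs_nonneg t)
    have h2 := mul_le_mul_of_nonneg_right ht.le (nsq_nonneg x)
    have h3 := (abs_le.1 h1).1
    have h4 := h x
    linarith

variable {p q : ℕ} {AU : Bool → Matrix (Fin p) (Fin p) ℂ} {AW : Bool → Matrix (Fin q) (Fin q) ℂ}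
  {XX : Bool → Matrix (Fin p) (Fin q) ℂ} {al : Option Bool → Fin p ⊕ Fin q → ℝ}

theorem formM_add_smul (D K : Dat p q) (t : ℝ) :
    formM (D + (t : ℂ) • K) = formM D + (t : ℂ) • formM K := by
  rw [← formM_smul, formM, formM, formM, fromBlocks_add]
  congr 1
  · simp
  · simp [add_comm]

theorem Rm_add_smul (X : Matrix (Fin p) (Fin q) ℂ) (D K : Dat p q) (t : ℝ) :
    Rm X (D + (t : ℂ) • K).1 (D + (t : ℂ) • K).2.1 (D + (t : ℂ) • K).2.2
      = Rm X D.1 D.2.1 D.2.2 + (t : ℂ) • Rm X K.1 K.2.1 K.2.2 := by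
  rw [← Rm_smul]
  simp only [Rm, Prod.fst_add, Prod.snd_add, Matrix.mul_add, Matrix.add_mul, conjTranspose_add]
  abel

theorem realize_of_isMin (hAU : ∀ b, IsUnit (AU b).det) (hAW : ∀ b, IsUnit (AW b).det)
    {D : Dat p q} (hD : D ∈ Om XX)
    (hmin : ∀ D' ∈ Om XX, bigPhi AU AW XX al D ≤ bigPhi AU AW XX al D') : Realize al := by
  choose T hT hT0 hTe using frame_exists hAU hAW hD
  have hTd : ∀ t, IsUnit (T t).det := fun t => by
    rw [det_upper (rkT_inj t) (hT t)]
    exact isUnit_iff_ne_zero.2 (Finset.prod_ne_zero_iff.2 fun i _ => hT0 t i)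
  have hTs : ∀ t, IsUnit (T t)ᴴ.det := fun t => by rw [det_conjTranspose]; exact (hTd t).star
  refine realize_of_critical (J := formM D) (w := fun t => frm AU AW XX t * (T t)⁻¹) (fun t => ?_)
    fun K hK => ?_
  · have : (frm AU AW XX t * (T t)⁻¹)ᴴ * formM D * (frm AU AW XX t * (T t)⁻¹)
        = ((T t)ᴴ)⁻¹ * ((frm AU AW XX t)ᴴ * formM D * frm AU AW XX t) * (T t)⁻¹ := by
      rw [conjTranspose_mul, conjTranspose_nonsing_inv]; simp only [Matrix.mul_assoc]
    rw [this, hTe, Matrix.mul_assoc (T t)ᴴ, ← Matrix.mul_assoc, nonsing_inv_mul _ (hTs t),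
      Matrix.one_mul, Matrix.mul_assoc, mul_nonsing_inv _ (hTd t), Matrix.mul_one]
  · set KD : Dat p q := (K.toBlocks₁₁, K.toBlocks₁₂, -K.toBlocks₂₂)
    have h11 : K.toBlocks₁₁.IsHermitian := by
      ext i j; exact congrFun (congrFun hK.eq (Sum.inl i)) (Sum.inl j)
    have h22 : (-K.toBlocks₂₂).IsHermitian := by
      refine IsHermitian.neg ?_
      ext i j; exact congrFun (congrFun hK.eq (Sum.inr i)) (Sum.inr j)
    have hKD : formM KD = K := by
      have h21 : K.toBlocks₁₂ᴴ = K.toBlocks₂₁ := by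
        ext i j; exact congrFun (congrFun hK.eq (Sum.inr i)) (Sum.inl j)
      rw [formM]
      simp only [KD, neg_neg, h21]
      exact fromBlocks_toBlocks K
    set f : ℝ → ℝ := fun s => bigPhi AU AW XX al (D + (s : ℂ) • KD)
    have hder : HasDerivAt f (∑ t, ∑ i, al t i * (sg i *
        (((frm AU AW XX t * (T t)⁻¹)ᴴ * K * (frm AU AW XX t * (T t)⁻¹)) i i).re)) 0 := by
      refine HasDerivAt.fun_sum fun t _ => ?_
      have h := hasDerivAt_phi (rkT_inj t) (al t) (hT t) (hT0 t)
        ((frm AU AW XX t * (T t)⁻¹)ᴴ * K * (frm AU AW XX t * (T t)⁻¹))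
      have e : ∀ s : ℝ, (frm AU AW XX t)ᴴ * formM (D + (s : ℂ) • KD) * frm AU AW XX t
          = (T t)ᴴ * (J0 p q + (s : ℂ) • ((frm AU AW XX t * (T t)⁻¹)ᴴ * K
            * (frm AU AW XX t * (T t)⁻¹))) * T t := by
        intro s
        have h1 : (T t)ᴴ * ((frm AU AW XX t * (T t)⁻¹)ᴴ * K * (frm AU AW XX t * (T t)⁻¹)) * T t
            = (frm AU AW XX t)ᴴ * K * frm AU AW XX t := by
          have h2 : frm AU AW XX t * (T t)⁻¹ * T t = frm AU AW XX t := by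
            rw [Matrix.mul_assoc, nonsing_inv_mul _ (hTd t), Matrix.mul_one]
          generalize frm AU AW XX t * (T t)⁻¹ = Z at h2
          rw [← h2, conjTranspose_mul]
          simp only [Matrix.mul_assoc]
        rw [formM_add_smul, hKD, Matrix.mul_add, Matrix.add_mul, hTe, Matrix.mul_smul,
          Matrix.smul_mul, Matrix.mul_add, Matrix.add_mul, Matrix.mul_smul, Matrix.smul_mul, h1]
      simp only [e]
      exact h
    refine IsLocalMin.hasDerivAt_eq_zero (f := f) ?_ hder
    filter_upwards [posDef_perturb hD.1 h11, (eventually_all (ι := Bool)).2 fun b =>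
      posDef_perturb (hD.2 b) (isHermitian_Rm (X := XX b) (S := K.toBlocks₁₂) h11 h22)] with s h1 h2
    have h3 : f 0 = bigPhi AU AW XX al D := by simp [f]
    rw [h3]
    exact hmin _ ⟨h1, fun b => by rw [Rm_add_smul]; exact h2 b⟩

theorem realize_of_kStable (hp : 0 < p) (hAU : ∀ b, IsUnit (AU b).det)
    (hAW : ∀ b, IsUnit (AW b).det)
    {c c' : ℝ} (hcpos : 0 < c) (hc : ∀ b i, c' + c ≤ al (some b) (Sum.inl i))
    (hc' : ∀ b i, al (some b) (Sum.inr i) ≤ c')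
    (haU : ∀ t, Antitone fun i => al t (Sum.inl i)) (haW : ∀ t, Antitone fun i => al t (Sum.inr i))
    (hsum : ∑ t, ∑ i, al t i = 0)
    (hst : KStable (frU AU) (frU AW) (XX true - XX false) (fun t i => al t (Sum.inl i))
      (fun t i => al t (Sum.inr i))) : Realize al := by
  obtain ⟨D, hD, hmin⟩ := exists_min hp hAU hAW hcpos hc hc' haU haW hsum hst
  exact realize_of_isMin hAU hAW hD hmin

end KempfNess

section Independent

open Cardinal

theorem exists_ringHom_of_transcendenceBasis {k : Type} [Field k] [Algebra k ℂ] {ι : Type} {v w : ι → ℂ}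
    (hv : IsTranscendenceBasis k v) (hw : IsTranscendenceBasis k w) :
    ∃ σ : ℂ →+* ℂ, ∀ i, σ (v i) = w i := by
  have i1 := IsAlgClosed.isAlgClosure_of_transcendence_basis v hv
  have i2 := IsAlgClosed.isAlgClosure_of_transcendence_basis w hw
  let e : Algebra.adjoin k (Set.range v) ≃+* Algebra.adjoin k (Set.range w) :=
    (hv.1.aevalEquiv.symm.trans hw.1.aevalEquiv).toRingEquiv
  refine ⟨(IsAlgClosure.equivOfEquiv ℂ ℂ e : ℂ ≃+* ℂ).toRingHom, fun i => ?_⟩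
  have h1 := IsAlgClosure.equivOfEquiv_algebraMap ℂ ℂ e (hv.1.aevalEquiv (MvPolynomial.X i))
  have h2 : e (hv.1.aevalEquiv (MvPolynomial.X i)) = hw.1.aevalEquiv (MvPolynomial.X i) := by
    simp [e]
  rw [h2, hv.1.algebraMap_aevalEquiv, hw.1.algebraMap_aevalEquiv] at h1
  simpa using h1

theorem exists_ringHom_of_algebraicIndependent {k : Type} [Field k] [Algebra k ℂ] (hk : Cardinal.mk k ≤ ℵ₀)
    {N : Type} [Finite N] {x y : N → ℂ} (hx : AlgebraicIndependent k x)
    (hy : AlgebraicIndependent k y) : ∃ σ : ℂ →+* ℂ, ∀ i, σ (x i) = y i := by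
  have hux : ∃ S : Set ℂ, Set.range x ⊆ S ∧ IsTranscendenceBasis k ((↑) : S → ℂ) :=
    exists_isTranscendenceBasis_superset hx.coe_range
  have huy : ∃ S : Set ℂ, Set.range y ⊆ S ∧ IsTranscendenceBasis k ((↑) : S → ℂ) :=
    exists_isTranscendenceBasis_superset hy.coe_range
  obtain ⟨S, hxS, hS⟩ := hux
  obtain ⟨T, hyT, hT⟩ := huy
  have hC : ℵ₀ < Cardinal.mk ℂ := by rw [Cardinal.mk_complex]; exact Cardinal.aleph0_lt_continuum
  have cS := IsAlgClosed.cardinal_eq_cardinal_transcendence_basis_of_aleph0_lt _ hS hk hC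
  have cT := IsAlgClosed.cardinal_eq_cardinal_transcendence_basis_of_aleph0_lt _ hT hk hC
  simp only [Cardinal.lift_id] at cS cT
  have hST : Nonempty (S ≃ T) := Cardinal.eq.1 (cS.symm.trans cT)
  let xs : N → S := fun i => ⟨x i, hxS ⟨i, rfl⟩⟩
  let ys : N → T := fun i => ⟨y i, hyT ⟨i, rfl⟩⟩
  have hxs : Function.Injective xs := fun i j h => hx.injective (congrArg Subtype.val h)
  have hys : Function.Injective ys := fun i j h => hy.injective (congrArg Subtype.val h)
  let f : Set.range xs ↪ T :=
    ⟨fun s => ys ((Equiv.ofInjective xs hxs).symm s), hys.comp (Equiv.injective _)⟩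
  have hlt : Cardinal.mk (Set.range xs) < Cardinal.mk S := by
    rw [← cS]
    exact (Cardinal.lt_aleph0_of_finite _).trans hC
  obtain ⟨g, hg⟩ := Cardinal.extend_function_of_lt f hlt hST
  have hgx : ∀ i, g (xs i) = ys i := fun i => by
    have := hg ⟨xs i, i, rfl⟩
    rw [this]
    change ys _ = _
    congr 1
    exact Equiv.ofInjective_symm_apply hxs i
  obtain ⟨σ, hσ⟩ := exists_ringHom_of_transcendenceBasis hS (w := fun s => ((g s : T) : ℂ))
    (hT.comp_equiv g)
  exact ⟨σ, fun i => by rw [show x i = ((xs i : S) : ℂ) from rfl, hσ, hgx]⟩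

theorem exists_algebraicIndependent {k : Type} [Field k] [Algebra k ℂ] (hk : Cardinal.mk k ≤ ℵ₀)
    (N : Type) [Finite N] : ∃ x : N → ℂ, AlgebraicIndependent k x := by
  obtain ⟨S, hS⟩ := exists_isTranscendenceBasis k ℂ
  have hC : ℵ₀ < Cardinal.mk ℂ := by rw [Cardinal.mk_complex]; exact Cardinal.aleph0_lt_continuum
  have cS := IsAlgClosed.cardinal_eq_cardinal_transcendence_basis_of_aleph0_lt _ hS hk hC
  simp only [Cardinal.lift_id] at cS
  have hlt : Cardinal.mk N ≤ Cardinal.mk S := by rw [← cS]; exact ((Cardinal.lt_aleph0_of_finite _).trans hC).le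
  obtain ⟨f⟩ := Cardinal.le_def _ _ |>.1 hlt
  exact ⟨_, hS.1.comp f f.injective⟩

theorem dense_algebraicClosure : Dense (Set.range (algebraMap (algebraicClosure ℚ ℂ) ℂ)) := by
  have hI : (Complex.I : ℂ) ∈ algebraicClosure ℚ ℂ := by
    rw [mem_algebraicClosure_iff]
    exact ⟨X ^ 2 + 1, fun h => by simpa using congrArg (Polynomial.eval 0) h, by simp⟩
  intro z
  rw [Metric.mem_closure_iff]
  intro e he
  obtain ⟨a, ha⟩ := Metric.dense_iff.1 (Rat.denseRange_cast (𝕜 := ℝ)) z.re (e / 2) (by positivity)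
  obtain ⟨b, hb⟩ := Metric.dense_iff.1 (Rat.denseRange_cast (𝕜 := ℝ)) z.im (e / 2) (by positivity)
  obtain ⟨ha, a, rfl⟩ := ha
  obtain ⟨hb, b, rfl⟩ := hb
  refine ⟨_, ⟨(a : algebraicClosure ℚ ℂ) + (b : algebraicClosure ℚ ℂ) * ⟨Complex.I, hI⟩, rfl⟩, ?_⟩
  have : algebraMap (algebraicClosure ℚ ℂ) ℂ
      ((a : algebraicClosure ℚ ℂ) + (b : algebraicClosure ℚ ℂ) * ⟨Complex.I, hI⟩)
      = (a : ℂ) + (b : ℂ) * Complex.I := by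
    rw [map_add, map_mul, map_ratCast, map_ratCast]; rfl
  rw [this, dist_comm, Complex.dist_eq]
  refine (Complex.norm_le_abs_re_add_abs_im _).trans_lt ?_
  simp only [Metric.mem_ball, Real.dist_eq] at ha hb
  simp
  linarith

theorem dense_algebraicIndependent (N : Type) [Finite N] :
    Cardinal.mk (algebraicClosure ℚ ℂ) ≤ ℵ₀ ∧
      Dense {x : N → ℂ | AlgebraicIndependent (algebraicClosure ℚ ℂ) x} := by
  have hk : Cardinal.mk (algebraicClosure ℚ ℂ) ≤ ℵ₀ := by
    rw [Cardinal.mk_le_aleph0_iff]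
    have : (algebraicClosure ℚ ℂ : Set ℂ).Countable := by
      convert Algebraic.countable ℚ ℂ using 1
      ext x; exact mem_algebraicClosure_iff
    exact this.to_subtype
  refine ⟨hk, ?_⟩
  obtain ⟨b, hb⟩ := exists_algebraicIndependent hk N
  have hd := dense_algebraicClosure.sdiff_singleton 0
  have hb0 : ∀ i, b i ≠ 0 := fun i => hb.ne_zero i
  have h1 : ∀ i, Dense ((fun r => r * b i) '' (Set.range (algebraMap (algebraicClosure ℚ ℂ) ℂ) \ {0})) :=
    fun i => ((mul_right_surjective₀ (hb0 i)).denseRange).dense_image (by fun_prop) hd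
  refine (dense_pi Set.univ fun i _ => h1 i).mono ?_
  intro x hx
  have h2 : ∀ i, ∃ r : algebraicClosure ℚ ℂ, r ≠ 0 ∧ x i = algebraMap _ ℂ r * b i := fun i => by
    obtain ⟨_, ⟨⟨r, rfl⟩, hr⟩, h⟩ := hx i trivial
    exact ⟨r, fun h => hr (by simp [h]), h.symm⟩
  choose r hr hxr using h2
  have := hb.polynomial_aeval_of_transcendental (f := fun i => Polynomial.C (r i) * Polynomial.X)
    (fun i => Polynomial.transcendental _ (by rw [Polynomial.natDegree_C_mul_X _ (hr i)]; simp)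
      (by simpa using hr i))
  have e : x = fun i => Polynomial.aeval (b i) (Polynomial.C (r i) * Polynomial.X) := by
    ext i; simp [hxr]
  change AlgebraicIndependent _ x
  rw [e]
  exact this

end Independent

section Generic

variable {n : Type} [Fintype n] [DecidableEq n] {N A S : Type} [Finite N] [Finite A] [Finite S]

/-- Parameters for which a family of matrices has a `d`-dimensional invariant subspace meeting
the kernels of another family in large dimension, in coordinates. -/
def InvSet (F : A → (N → ℂ) → Matrix n n ℂ) (B : S → (N → ℂ) → Matrix n n ℂ) (d : ℕ) (c : S → ℕ) :
    Set (N → ℂ) :=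
  {x | ∃ (M : Matrix n (Fin d) ℂ) (M' : Matrix (Fin d) n ℂ)
      (K : ∀ s, Matrix (Fin d) (Fin (c s)) ℂ) (K' : ∀ s, Matrix (Fin (c s)) (Fin d) ℂ),
      M' * M = 1 ∧ (∀ a, F a x * M = M * (M' * (F a x * M))) ∧ (∀ s, K' s * K s = 1) ∧
      ∀ s, B s x * (M * K s) = 0}

variable {F : A → (N → ℂ) → Matrix n n ℂ} {B : S → (N → ℂ) → Matrix n n ℂ} {d : ℕ} {c : S → ℕ}

theorem invSet_map (hF : ∀ a (σ : ℂ →+* ℂ) x, F a (fun i => σ (x i)) = (F a x).map σ)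
    (hB : ∀ s (σ : ℂ →+* ℂ) x, B s (fun i => σ (x i)) = (B s x).map σ) (σ : ℂ →+* ℂ) {x : N → ℂ}
    (hx : x ∈ InvSet F B d c) : (fun i => σ (x i)) ∈ InvSet F B d c := by
  obtain ⟨M, M', K, K', h1, h2, h3, h4⟩ := hx
  refine ⟨M.map σ, M'.map σ, fun s => (K s).map σ, fun s => (K' s).map σ, ?_, fun a => ?_,
    fun s => ?_, fun s => ?_⟩
  · rw [← Matrix.map_mul, h1, Matrix.map_one σ (map_zero _) (map_one _)]
  · rw [hF, ← Matrix.map_mul, ← Matrix.map_mul, ← Matrix.map_mul, ← h2]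
  · rw [← Matrix.map_mul, h3, Matrix.map_one σ (map_zero _) (map_one _)]
  · rw [hB, ← Matrix.map_mul, ← Matrix.map_mul, h4, Matrix.map_zero σ (map_zero _)]

theorem exists_orthonormal {m : Type} [Fintype m] [DecidableEq m] {d : ℕ}
    {M : Matrix m (Fin d) ℂ} {M' : Matrix (Fin d) m ℂ} (h : M' * M = 1) :
    ∃ T T' : Matrix (Fin d) (Fin d) ℂ, T * T' = 1 ∧ T' * T = 1 ∧ (M * T)ᴴ * (M * T) = 1 := by
  have hP : (Mᴴ * M).PosDef := by
    apply Matrix.PosDef.conjTranspose_mul_self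
    intro x y hxy
    have := congrArg (fun v => M' *ᵥ v) hxy
    simpa [h] using this
  obtain ⟨T, hT, hd, hN⟩ := cholesky hP
  have hu : IsUnit T.det := by
    rw [det_upper (Fin.val_injective) hT]
    exact (Finset.prod_ne_zero_iff.2 fun i _ => hd i).isUnit
  refine ⟨T⁻¹, T, nonsing_inv_mul _ hu, mul_nonsing_inv _ hu, ?_⟩
  rw [conjTranspose_mul, Matrix.mul_assoc, ← Matrix.mul_assoc Mᴴ, hN, Matrix.mul_assoc Tᴴ,
    mul_nonsing_inv _ hu, Matrix.mul_one, ← conjTranspose_mul, mul_nonsing_inv _ hu,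
    conjTranspose_one]

theorem invSet_orthonormal {x : N → ℂ} (hx : x ∈ InvSet F B d c) :
    ∃ (M : Matrix n (Fin d) ℂ) (K : ∀ s, Matrix (Fin d) (Fin (c s)) ℂ),
      Mᴴ * M = 1 ∧ (∀ a, F a x * M = M * (Mᴴ * (F a x * M))) ∧ (∀ s, (K s)ᴴ * K s = 1) ∧
      ∀ s, B s x * (M * K s) = 0 := by
  obtain ⟨M, M', K, K', h1, h2, h3, h4⟩ := hx
  obtain ⟨T, T', hT, hT', hM⟩ := exists_orthonormal h1
  have hK : ∀ s, (K' s * T) * (T' * K s) = 1 := fun s => by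
    rw [Matrix.mul_assoc, ← Matrix.mul_assoc T, hT, Matrix.one_mul, h3]
  choose Q Q' hQ hQ' hKQ using fun s => exists_orthonormal (hK s)
  refine ⟨M * T, fun s => T' * K s * Q s, hM, fun a => ?_, hKQ, fun s => ?_⟩
  · have e : F a x * (M * T) = (M * T) * (T' * (M' * (F a x * M)) * T) := by
      rw [← Matrix.mul_assoc, h2 a]
      simp only [Matrix.mul_assoc]
      rw [← Matrix.mul_assoc T, hT, Matrix.one_mul, ← Matrix.mul_assoc M' M, h1, Matrix.one_mul]
    rw [e]
    rw [← Matrix.mul_assoc (M * T)ᴴ, hM, Matrix.one_mul]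
  · have e : M * T * (T' * K s * Q s) = M * K s * Q s := by
      simp only [Matrix.mul_assoc]
      rw [← Matrix.mul_assoc T, hT, Matrix.one_mul]
    rw [e, ← Matrix.mul_assoc, h4, Matrix.zero_mul]

theorem isCompact_orthonormal {m : Type} [Fintype m] (d : ℕ) :
    IsCompact {M : Matrix m (Fin d) ℂ | Mᴴ * M = 1} := by
  refine (isCompact_entries 1).of_isClosed_subset ?_ ?_
  · exact isClosed_eq (continuous_id.matrix_conjTranspose.matrix_mul continuous_id) continuous_const
  · intro M hM i j
    have h1 : ∑ k, Complex.normSq (M k j) = 1 := by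
      have h := congrArg Complex.re (congrFun (congrFun hM j) j)
      rw [Matrix.mul_apply, Complex.re_sum, one_apply_eq] at h
      rw [← Complex.one_re, ← h]
      refine Finset.sum_congr rfl fun k _ => ?_
      rw [conjTranspose_apply, Complex.star_def, ← Complex.normSq_eq_conj_mul_self, Complex.ofReal_re]
    have h2 : Complex.normSq (M i j) ≤ 1 := by
      rw [← h1]
      exact Finset.single_le_sum (f := fun k => Complex.normSq (M k j))
        (fun k _ => Complex.normSq_nonneg _) (Finset.mem_univ i)
    rw [Complex.normSq_eq_norm_sq] at h2
    nlinarith [norm_nonneg (M i j)]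

theorem tendsto_matrix_mul {a b c : Type} [Fintype b] {f : ℕ → Matrix a b ℂ}
    {g : ℕ → Matrix b c ℂ} {f0 : Matrix a b ℂ} {g0 : Matrix b c ℂ}
    (hf : Tendsto f atTop (𝓝 f0)) (hg : Tendsto g atTop (𝓝 g0)) :
    Tendsto (fun k => f k * g k) atTop (𝓝 (f0 * g0)) := by
  refine tendsto_pi_nhds.2 fun i => tendsto_pi_nhds.2 fun j => ?_
  simp only [Matrix.mul_apply]
  refine tendsto_finsetSum _ fun l _ => ?_
  exact (tendsto_pi_nhds.1 (tendsto_pi_nhds.1 hf i) l).mul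
    (tendsto_pi_nhds.1 (tendsto_pi_nhds.1 hg l) j)

theorem isCompact_orthonormal_pi {S : Type} (d : ℕ) (c : S → ℕ) :
    IsCompact {K : ∀ s, Matrix (Fin d) (Fin (c s)) ℂ | ∀ s, (K s)ᴴ * K s = 1} := by
  have h := isCompact_univ_pi (s := fun s : S => {M : Matrix (Fin d) (Fin (c s)) ℂ | Mᴴ * M = 1})
    fun s => isCompact_orthonormal (c s)
  have e : (Set.univ.pi fun s => {M : Matrix (Fin d) (Fin (c s)) ℂ | Mᴴ * M = 1})
      = {K : ∀ s, Matrix (Fin d) (Fin (c s)) ℂ | ∀ s, (K s)ᴴ * K s = 1} := by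
    apply Set.ext
    intro K
    rw [Set.mem_univ_pi]
    rfl
  rw [← e]
  exact h

theorem isClosed_invSet (hF : ∀ a, Continuous (F a)) (hB : ∀ s, Continuous (B s)) :
    IsClosed (InvSet F B d c) := by
  rw [← isSeqClosed_iff_isClosed]
  intro x y hx hxy
  choose M K h1 h2 h3 h4 using fun k => invSet_orthonormal (hx k)
  have hcpt : IsCompact ({M : Matrix n (Fin d) ℂ | Mᴴ * M = 1} ×ˢ
      {K : ∀ s, Matrix (Fin d) (Fin (c s)) ℂ | ∀ s, (K s)ᴴ * K s = 1}) := (isCompact_orthonormal d).prod (isCompact_orthonormal_pi d c)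
  have i1 : ∀ (m k : Type) [Fintype m] [Fintype k], FirstCountableTopology (Matrix m k ℂ) :=
    fun m k _ _ => inferInstanceAs (FirstCountableTopology (m → k → ℂ))
  have i2 : FirstCountableTopology (∀ s, Matrix (Fin d) (Fin (c s)) ℂ) := by
    have := fun s => i1 (Fin d) (Fin (c s))
    infer_instance
  have i3 := i1 n (Fin d)
  obtain ⟨⟨M0, K0⟩, ⟨hM0, hK0⟩, g, hg, hlim⟩ := hcpt.tendsto_subseq (x := fun k => (M k, K k))
    (fun k => ⟨h1 k, h3 k⟩)
  have hM : Tendsto (fun k => M (g k)) atTop (𝓝 M0) := hlim.fst_nhds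
  have hK' : Tendsto (fun k => K (g k)) atTop (𝓝 K0) := hlim.snd_nhds
  have hK : ∀ s, Tendsto (fun k => K (g k) s) atTop (𝓝 (K0 s)) := fun s =>
    tendsto_pi_nhds.1 hK' s
  have hx' : Tendsto (fun k => x (g k)) atTop (𝓝 y) := hxy.comp hg.tendsto_atTop
  have hcc : Continuous fun A : Matrix n (Fin d) ℂ => Aᴴ := continuous_id.matrix_conjTranspose
  have hMc : Tendsto (fun k => (M (g k))ᴴ) atTop (𝓝 M0ᴴ) := (hcc.tendsto M0).comp hM
  refine ⟨M0, M0ᴴ, K0, fun s => (K0 s)ᴴ, hM0, fun a => ?_, fun s => hK0 s, fun s => ?_⟩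
  · have hFa : Tendsto (fun k => F a (x (g k))) atTop (𝓝 (F a y)) := ((hF a).tendsto y).comp hx'
    refine tendsto_nhds_unique (tendsto_matrix_mul hFa hM) ?_
    refine (tendsto_matrix_mul hM (tendsto_matrix_mul hMc (tendsto_matrix_mul hFa hM))).congr fun k => ?_
    exact (h2 (g k) a).symm
  · have hBs : Tendsto (fun k => B s (x (g k))) atTop (𝓝 (B s y)) := ((hB s).tendsto y).comp hx'
    refine tendsto_nhds_unique (tendsto_matrix_mul hBs (tendsto_matrix_mul hM (hK s))) ?_
    refine tendsto_const_nhds.congr fun k => ?_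
    exact (h4 (g k) s).symm

/-- At an algebraically independent parameter only the unavoidable subspaces occur. -/
theorem invSet_eq_univ (hF : ∀ a (σ : ℂ →+* ℂ) x, F a (fun i => σ (x i)) = (F a x).map σ)
    (hB : ∀ s (σ : ℂ →+* ℂ) x, B s (fun i => σ (x i)) = (B s x).map σ)
    (hFc : ∀ a, Continuous (F a)) (hBc : ∀ s, Continuous (B s)) {x : N → ℂ}
    (hx : AlgebraicIndependent (algebraicClosure ℚ ℂ) x) (hxi : x ∈ InvSet F B d c) (y : N → ℂ) :
    y ∈ InvSet F B d c := by
  obtain ⟨hk, hd⟩ := dense_algebraicIndependent N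
  refine (isClosed_invSet hFc hBc).closure_subset_iff.2 ?_ (hd y)
  intro z hz
  obtain ⟨σ, hσ⟩ := exists_ringHom_of_algebraicIndependent hk hx hz
  have := invSet_map hF hB σ hxi
  rwa [show (fun i => σ (x i)) = z from funext hσ] at this

end Generic

section Frames

variable {n : Type} [Fintype n] [DecidableEq n]

theorem exists_frame (V : Submodule ℂ (n → ℂ)) {d : ℕ} (hd : d ≤ Module.finrank ℂ V) :
    ∃ (M : Matrix n (Fin d) ℂ) (M' : Matrix (Fin d) n ℂ), M' * M = 1 ∧ ∀ w, M *ᵥ w ∈ V := by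
  let b := Module.finBasis ℂ V
  let f : Fin d → V := fun j => b (Fin.castLE hd j)
  have hf : LinearIndependent ℂ f := b.linearIndependent.comp _ (Fin.castLE_injective hd)
  have hf' : LinearIndependent ℂ fun j => ((f j : V) : n → ℂ) :=
    hf.map' V.subtype (Submodule.ker_subtype V)
  let M : Matrix n (Fin d) ℂ := Matrix.of fun i j => (f j : n → ℂ) i
  have hM : Function.Injective (mulVecLin M) := by
    have : LinearIndependent ℂ M.col := hf'
    exact Matrix.mulVec_injective_iff.2 this
  obtain ⟨g, hg⟩ := LinearMap.exists_leftInverse_of_injective (mulVecLin M)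
    (LinearMap.ker_eq_bot.2 hM)
  refine ⟨M, LinearMap.toMatrix' g, ?_, fun w => ?_⟩
  · have := congrArg LinearMap.toMatrix' hg
    rwa [LinearMap.toMatrix'_comp, ← Matrix.toLin'_apply', LinearMap.toMatrix'_toLin', LinearMap.toMatrix'_id] at this
  · have : M *ᵥ w = ∑ j, w j • ((f j : V) : n → ℂ) := by
      ext i
      simp [M, mulVec, dotProduct, mul_comm]
    rw [this]
    exact V.sum_mem fun j _ => V.smul_mem _ (f j).2

theorem finrank_range_of_leftInverse {d : ℕ} {M : Matrix n (Fin d) ℂ} {M' : Matrix (Fin d) n ℂ}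
    (h : M' * M = 1) : Module.finrank ℂ (LinearMap.range (mulVecLin M)) = d := by
  rw [LinearMap.finrank_range_of_inj]
  · simp
  · intro x y hxy
    have := congrArg (fun v => M' *ᵥ v) hxy
    simpa [h] using this

theorem mul_leftInverse_of_mem {V : Submodule ℂ (n → ℂ)} {d : ℕ} {M : Matrix n (Fin d) ℂ}
    {M' : Matrix (Fin d) n ℂ} (h : M' * M = 1) (hV : ∀ w, M *ᵥ w ∈ V)
    (hd : Module.finrank ℂ V = d) {e : Type} [Fintype e] [DecidableEq e] (Q : Matrix n e ℂ)
    (hQ : ∀ w, Q *ᵥ w ∈ V) : M * (M' * Q) = Q := by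
  have hr : LinearMap.range (mulVecLin M) = V := by
    apply Submodule.eq_of_le_of_finrank_eq
    · rintro _ ⟨w, rfl⟩; exact hV w
    · rw [finrank_range_of_leftInverse h, hd]
  apply Matrix.ext_of_mulVec_single
  intro j
  have := hQ (Pi.single j 1)
  rw [← hr] at this
  obtain ⟨w, hw⟩ := this
  rw [mulVecLin_apply] at hw
  rw [← mulVec_mulVec, ← mulVec_mulVec, ← hw, mulVec_mulVec w M' M, h, one_mulVec]

variable {N A S : Type} {F : A → (N → ℂ) → Matrix n n ℂ} {B : S → (N → ℂ) → Matrix n n ℂ}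
  {d : ℕ} {c : S → ℕ}

theorem mem_invSet_iff {x : N → ℂ} : x ∈ InvSet F B d c ↔
    ∃ V : Submodule ℂ (n → ℂ), Module.finrank ℂ V = d ∧ (∀ a, ∀ v ∈ V, F a x *ᵥ v ∈ V) ∧
      ∀ s, c s ≤ Module.finrank ℂ ↥(V ⊓ LinearMap.ker (mulVecLin (B s x))) := by
  constructor
  · rintro ⟨M, M', K, K', h1, h2, h3, h4⟩
    refine ⟨LinearMap.range (mulVecLin M), finrank_range_of_leftInverse h1, ?_, fun s => ?_⟩
    · rintro a _ ⟨w, rfl⟩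
      rw [mulVecLin_apply, mulVec_mulVec, h2, ← mulVec_mulVec]
      exact ⟨_, rfl⟩
    · have e : (K' s * M') * (M * K s) = 1 := by
        rw [Matrix.mul_assoc, ← Matrix.mul_assoc M', h1, Matrix.one_mul, h3]
      rw [← finrank_range_of_leftInverse e]
      apply Submodule.finrank_mono
      rintro _ ⟨w, rfl⟩
      refine ⟨⟨K s *ᵥ w, by simp⟩, ?_⟩
      rw [SetLike.mem_coe, LinearMap.mem_ker, mulVecLin_apply, mulVecLin_apply, mulVec_mulVec, h4,
        zero_mulVec]
  · rintro ⟨V, hd, hF, hB⟩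
    obtain ⟨M, M', h1, hV⟩ := exists_frame V hd.ge
    choose P P' hP hPV using fun s => exists_frame _ (hB s)
    have e : ∀ s, M * (M' * P s) = P s := fun s =>
      mul_leftInverse_of_mem h1 hV hd _ fun w => (hPV s w).1
    refine ⟨M, M', fun s => M' * P s, fun s => P' s * M, h1, fun a => ?_, fun s => ?_, fun s => ?_⟩
    · refine (mul_leftInverse_of_mem h1 hV hd _ fun w => ?_).symm
      rw [← mulVec_mulVec]
      exact hF a _ (hV w)
    · rw [Matrix.mul_assoc, e, hP]
    · rw [e]
      apply Matrix.ext_of_mulVec_single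
      intro j
      rw [← mulVec_mulVec, zero_mulVec]
      exact (hPV s _).2

end Frames

section Products

variable {p q : ℕ}

/-- The direct sum of two coordinate subspaces. -/
def prodSub (VU : Submodule ℂ (Fin p → ℂ)) (VW : Submodule ℂ (Fin q → ℂ)) :
    Submodule ℂ (Fin p ⊕ Fin q → ℂ) where
  carrier := {v | v ∘ Sum.inl ∈ VU ∧ v ∘ Sum.inr ∈ VW}
  add_mem' := fun hv hw => ⟨VU.add_mem hv.1 hw.1, VW.add_mem hv.2 hw.2⟩
  zero_mem' := ⟨VU.zero_mem, VW.zero_mem⟩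
  smul_mem' := fun c _ hv => ⟨VU.smul_mem c hv.1, VW.smul_mem c hv.2⟩

theorem mem_prodSub {VU : Submodule ℂ (Fin p → ℂ)} {VW : Submodule ℂ (Fin q → ℂ)}
    {v : Fin p ⊕ Fin q → ℂ} : v ∈ prodSub VU VW ↔ v ∘ Sum.inl ∈ VU ∧ v ∘ Sum.inr ∈ VW := Iff.rfl

theorem piv_prodSub {rk : Fin p ⊕ Fin q → ℕ}
    (hU : ∀ i i', rk (Sum.inl i) < rk (Sum.inl i') ↔ i < i')
    (hW : ∀ i i', rk (Sum.inr i) < rk (Sum.inr i') ↔ i < i')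
    (VU : Submodule ℂ (Fin p → ℂ)) (VW : Submodule ℂ (Fin q → ℂ)) :
    piv rk (prodSub VU VW) = (piv Fin.val VU).disjSum (piv Fin.val VW) := by
  ext i
  rcases i with i | i
  · rw [Finset.inl_mem_disjSum, mem_piv, mem_piv]
    constructor
    · rintro ⟨v, hv, h1, h2⟩
      exact ⟨_, hv.1, h1, fun l hl => h2 _ ((hU _ _).2 hl)⟩
    · rintro ⟨u, hu, h1, h2⟩
      refine ⟨Sum.elim u 0, ⟨by simpa using hu, by simp⟩, by simpa using h1, ?_⟩
      rintro (l | l) hl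
      · exact h2 l ((hU _ _).1 hl)
      · rfl
  · rw [Finset.inr_mem_disjSum, mem_piv, mem_piv]
    constructor
    · rintro ⟨v, hv, h1, h2⟩
      exact ⟨_, hv.2, h1, fun l hl => h2 _ ((hW _ _).2 hl)⟩
    · rintro ⟨u, hu, h1, h2⟩
      refine ⟨Sum.elim 0 u, ⟨by simp, by simpa using hu⟩, by simpa using h1, ?_⟩
      rintro (l | l) hl
      · rfl
      · exact h2 l ((hW _ _).1 hl)

theorem rkU_inl_lt (i i' : Fin p) :
    rkU (Sum.inl i : Fin p ⊕ Fin q) < rkU (Sum.inl i' : Fin p ⊕ Fin q) ↔ i < i' := by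
  simp [rkU]

theorem rkU_inr_lt (i i' : Fin q) :
    rkU (Sum.inr i : Fin p ⊕ Fin q) < rkU (Sum.inr i' : Fin p ⊕ Fin q) ↔ i < i' := by
  simp [rkU]

theorem rkW_inl_lt (i i' : Fin p) :
    rkW (Sum.inl i : Fin p ⊕ Fin q) < rkW (Sum.inl i' : Fin p ⊕ Fin q) ↔ i < i' := by
  simp [rkW]

theorem rkW_inr_lt (i i' : Fin q) :
    rkW (Sum.inr i : Fin p ⊕ Fin q) < rkW (Sum.inr i' : Fin p ⊕ Fin q) ↔ i < i' := by
  simp [rkW]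

theorem finrank_prodSub (VU : Submodule ℂ (Fin p → ℂ)) (VW : Submodule ℂ (Fin q → ℂ)) :
    Module.finrank ℂ (prodSub VU VW) = Module.finrank ℂ VU + Module.finrank ℂ VW := by
  rw [← card_piv rkU_inj, piv_prodSub rkU_inl_lt rkU_inr_lt, Finset.card_disjSum,
    card_piv Fin.val_injective, card_piv Fin.val_injective]

theorem sum_piv_le_of_finrank_le {m : ℕ} {V V' : Submodule ℂ (Fin m → ℂ)}
    (hd : Module.finrank ℂ V' = Module.finrank ℂ V)
    (h : ∀ b, Module.finrank ℂ ↥(V ⊓ low Fin.val b) ≤ Module.finrank ℂ ↥(V' ⊓ low Fin.val b))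
    {al : Fin m → ℝ} (hal : Antitone al) :
    ∑ i ∈ piv Fin.val V, al i ≤ ∑ i ∈ piv Fin.val V', al i := by
  classical
  rcases Nat.eq_zero_or_pos m with rfl | hm
  · rw [Finset.sum_of_isEmpty, Finset.sum_of_isEmpty]
  let x : Fin m → ℝ := fun i => (if i ∈ piv Fin.val V' then 1 else 0)
    - (if i ∈ piv Fin.val V then 1 else 0)
  have hx : ∀ (P : Finset (Fin m)) (b : ℕ), (∑ i : Fin m with Fin.val i < b, if i ∈ P then (1 : ℝ) else 0)
      = (P.filter fun i => i.val < b).card := fun P b => by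
    rw [Finset.sum_ite_mem, Finset.sum_const, nsmul_eq_mul, mul_one]
    congr 2
    ext i; simp [and_comm]
  have key := abel_slack Fin.val 0 le_rfl Finset.univ al x (Fin.val_injective.injOn)
    (fun i _ j _ hij => hal hij) (fun b => by
      simp only [x]
      rw [Finset.sum_sub_distrib, hx, hx, card_piv_filter Fin.val_injective,
        card_piv_filter Fin.val_injective]
      have : (Module.finrank ℂ ↥(V ⊓ low Fin.val b) : ℝ) ≤ Module.finrank ℂ ↥(V' ⊓ low Fin.val b) := by
        exact_mod_cast h b
      linarith) (al ⟨m - 1, by omega⟩) (al ⟨0, hm⟩)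
      (fun i _ => hal (by rw [Fin.le_def]; simp; omega)) (fun i _ => hal (by rw [Fin.le_def]; simp))
      (hal (by rw [Fin.le_def]; simp))
  generalize al ⟨m - 1, by omega⟩ = c at key
  have hs : ∀ (P : Finset (Fin m)) (f : Fin m → ℝ), (∑ i, f i * if i ∈ P then (1 : ℝ) else 0) = ∑ i ∈ P, f i :=
    fun P f => by simp
  have hc : ∀ P : Finset (Fin m), ∑ i ∈ P, (al i - c) = ∑ i ∈ P, al i - P.card * c := fun P => by
    rw [Finset.sum_sub_distrib, Finset.sum_const, nsmul_eq_mul]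
  simp only [x, mul_sub, Finset.sum_sub_distrib] at key
  rw [hs, hs, hc, hc, card_piv Fin.val_injective, card_piv Fin.val_injective, hd] at key
  linarith

end Products

section Parameters

variable {p q : ℕ}

/-- Index set of the entries of a configuration. -/
abbrev Par (p q : ℕ) : Type := (Bool × Fin p × Fin p) ⊕ (Bool × Fin q × Fin q) ⊕ (Fin p × Fin q)

/-- First family of square matrices of a parameter. -/
def parU (x : Par p q → ℂ) (b : Bool) : Matrix (Fin p) (Fin p) ℂ :=
  Matrix.of fun i j => x (Sum.inl (b, i, j))

/-- Second family of square matrices of a parameter. -/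
def parW (x : Par p q → ℂ) (b : Bool) : Matrix (Fin q) (Fin q) ℂ :=
  Matrix.of fun i j => x (Sum.inr (Sum.inl (b, i, j)))

/-- Off-diagonal block of a parameter. -/
def parX (x : Par p q → ℂ) : Matrix (Fin p) (Fin q) ℂ :=
  Matrix.of fun i j => x (Sum.inr (Sum.inr (i, j)))

/-- The rows of a matrix from a given one on. -/
def rowsFrom {m : ℕ} (b : ℕ) (A : Matrix (Fin m) (Fin m) ℂ) : Matrix (Fin m) (Fin m) ℂ :=
  Matrix.of fun i j => if b ≤ i.val then A i j else 0

theorem rowsFrom_mulVec {m : ℕ} {b : ℕ} {A : Matrix (Fin m) (Fin m) ℂ} {v : Fin m → ℂ} :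
    rowsFrom b A *ᵥ v = 0 ↔ A *ᵥ v ∈ low Fin.val b := by
  rw [mem_low, funext_iff]
  refine forall_congr' fun i => ?_
  simp only [rowsFrom, mulVec, dotProduct, of_apply, Pi.zero_apply]
  by_cases h : b ≤ i.val <;> simp [h]

theorem rowsFrom_map {m : ℕ} (b : ℕ) (A : Matrix (Fin m) (Fin m) ℂ) (σ : ℂ →+* ℂ) :
    rowsFrom b (A.map σ) = (rowsFrom b A).map σ := by
  ext i j
  simp only [rowsFrom, of_apply, map_apply]
  split_ifs <;> simp

theorem frU_map {m : ℕ} (A : Bool → Matrix (Fin m) (Fin m) ℂ) (σ : ℂ →+* ℂ) (t : Option Bool) :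
    frU (fun b => (A b).map σ) t = (frU A t).map σ := by
  cases t
  · exact (Matrix.map_one σ (map_zero _) (map_one _)).symm
  · rfl

/-- Operators whose common invariant subspaces are the subspaces compatible with `X`. -/
def opF (a : Bool) (x : Par p q → ℂ) : Matrix (Fin p ⊕ Fin q) (Fin p ⊕ Fin q) ℂ :=
  if a then fromBlocks 1 0 0 0 else fromBlocks 0 (parX x) 0 0

/-- Operators whose kernels are the steps of the flags. -/
def opB (s : Option Bool × (Fin (p + 1) ⊕ Fin (q + 1))) (x : Par p q → ℂ) :
    Matrix (Fin p ⊕ Fin q) (Fin p ⊕ Fin q) ℂ :=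
  match s with
  | (t, Sum.inl b) => fromBlocks (rowsFrom b.val (frU (parU x) t)) 0 0 1
  | (t, Sum.inr b) => fromBlocks 1 0 0 (rowsFrom b.val (frU (parW x) t))

theorem opF_map (a : Bool) (σ : ℂ →+* ℂ) (x : Par p q → ℂ) :
    opF a (fun i => σ (x i)) = (opF a x).map σ := by
  have h : parX (fun i => σ (x i)) = (parX x).map σ := rfl
  cases a <;> simp [opF, fromBlocks_map, h]

theorem opB_map (s : Option Bool × (Fin (p + 1) ⊕ Fin (q + 1))) (σ : ℂ →+* ℂ) (x : Par p q → ℂ) :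
    opB s (fun i => σ (x i)) = (opB s x).map σ := by
  have h1 : parU (fun i => σ (x i)) = fun b => (parU x b).map σ := rfl
  have h2 : parW (fun i => σ (x i)) = fun b => (parW x b).map σ := rfl
  obtain ⟨t, b | b⟩ := s
  · simp only [opB, fromBlocks_map, h1, frU_map, rowsFrom_map]
    rw [Matrix.map_zero σ (map_zero _), Matrix.map_zero σ (map_zero _),
      Matrix.map_one σ (map_zero _) (map_one _)]
  · simp only [opB, fromBlocks_map, h2, frU_map, rowsFrom_map]
    rw [Matrix.map_zero σ (map_zero _), Matrix.map_zero σ (map_zero _),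
      Matrix.map_one σ (map_zero _) (map_one _)]

theorem continuous_rowsFrom {m : ℕ} (b : ℕ) {E : Type} [TopologicalSpace E]
    {f : E → Matrix (Fin m) (Fin m) ℂ} (hf : Continuous f) :
    Continuous fun x => rowsFrom b (f x) := by
  refine continuous_matrix fun i j => ?_
  by_cases h : b ≤ i.val
  · simpa [rowsFrom, h] using hf.matrix_elem i j
  · simpa [rowsFrom, h] using continuous_const

theorem continuous_frU {m : ℕ} {E : Type} [TopologicalSpace E]
    {f : E → Bool → Matrix (Fin m) (Fin m) ℂ} (hf : ∀ b, Continuous fun x => f x b)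
    (t : Option Bool) : Continuous fun x => frU (f x) t := by
  cases t
  · exact continuous_const
  · exact hf _

theorem continuous_parU (b : Bool) : Continuous fun x : Par p q → ℂ => parU x b :=
  continuous_matrix fun _ _ => continuous_apply _

theorem continuous_parW (b : Bool) : Continuous fun x : Par p q → ℂ => parW x b :=
  continuous_matrix fun _ _ => continuous_apply _

theorem continuous_opF (a : Bool) : Continuous (opF a : (Par p q → ℂ) → _) := by
  have h : Continuous fun x : Par p q → ℂ => parX x := continuous_matrix fun _ _ => continuous_apply _
  cases a
  · exact continuous_const.matrix_fromBlocks h continuous_const continuous_const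
  · exact continuous_const (y := fromBlocks 1 0 0 0)

theorem continuous_opB (s : Option Bool × (Fin (p + 1) ⊕ Fin (q + 1))) :
    Continuous (opB s : (Par p q → ℂ) → _) := by
  obtain ⟨t, b | b⟩ := s
  · exact (continuous_rowsFrom b.val (continuous_frU continuous_parU t)).matrix_fromBlocks
      continuous_const continuous_const continuous_const
  · exact continuous_const.matrix_fromBlocks continuous_const continuous_const
      (continuous_rowsFrom b.val (continuous_frU continuous_parW t))

theorem fromBlocks_mulVec_elim (A : Matrix (Fin p) (Fin p) ℂ) (B : Matrix (Fin p) (Fin q) ℂ)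
    (C : Matrix (Fin q) (Fin p) ℂ) (D : Matrix (Fin q) (Fin q) ℂ) (v : Fin p ⊕ Fin q → ℂ) :
    fromBlocks A B C D *ᵥ v = Sum.elim (A *ᵥ (v ∘ Sum.inl) + B *ᵥ (v ∘ Sum.inr))
      (C *ᵥ (v ∘ Sum.inl) + D *ᵥ (v ∘ Sum.inr)) := by
  rw [fromBlocks_mulVec]

theorem elim_zero_iff (u : Fin p → ℂ) (w : Fin q → ℂ) : Sum.elim u w = 0 ↔ u = 0 ∧ w = 0 := by
  constructor
  · intro h
    exact ⟨funext fun i => congrFun h (Sum.inl i), funext fun i => congrFun h (Sum.inr i)⟩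
  · rintro ⟨rfl, rfl⟩
    ext (i | i) <;> rfl

theorem prodSub_inf_ker_inl (VU : Submodule ℂ (Fin p → ℂ)) (VW : Submodule ℂ (Fin q → ℂ))
    (x : Par p q → ℂ) (t : Option Bool) (b : Fin (p + 1)) :
    prodSub VU VW ⊓ LinearMap.ker (mulVecLin (opB (t, Sum.inl b) x))
      = prodSub (VU ⊓ (low Fin.val b.val).comap (mulVecLin (frU (parU x) t))) ⊥ := by
  ext v
  rw [Submodule.mem_inf, LinearMap.mem_ker, mulVecLin_apply, mem_prodSub, mem_prodSub,
    Submodule.mem_inf, Submodule.mem_comap, mulVecLin_apply, Submodule.mem_bot]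
  simp only [opB]
  rw [fromBlocks_mulVec_elim, elim_zero_iff]
  simp only [zero_mulVec, add_zero, zero_add, one_mulVec, rowsFrom_mulVec]
  constructor
  · rintro ⟨⟨h1, h2⟩, h3, h4⟩; exact ⟨⟨h1, h3⟩, h4⟩
  · rintro ⟨⟨h1, h3⟩, h4⟩; exact ⟨⟨h1, h4 ▸ VW.zero_mem⟩, h3, h4⟩

theorem prodSub_inf_ker_inr (VU : Submodule ℂ (Fin p → ℂ)) (VW : Submodule ℂ (Fin q → ℂ))
    (x : Par p q → ℂ) (t : Option Bool) (b : Fin (q + 1)) :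
    prodSub VU VW ⊓ LinearMap.ker (mulVecLin (opB (t, Sum.inr b) x))
      = prodSub ⊥ (VW ⊓ (low Fin.val b.val).comap (mulVecLin (frU (parW x) t))) := by
  ext v
  rw [Submodule.mem_inf, LinearMap.mem_ker, mulVecLin_apply, mem_prodSub, mem_prodSub,
    Submodule.mem_inf, Submodule.mem_comap, mulVecLin_apply, Submodule.mem_bot]
  simp only [opB]
  rw [fromBlocks_mulVec_elim, elim_zero_iff]
  simp only [zero_mulVec, add_zero, zero_add, one_mulVec, rowsFrom_mulVec]
  constructor
  · rintro ⟨⟨h1, h2⟩, h3, h4⟩; exact ⟨h3, h2, h4⟩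
  · rintro ⟨h3, h2, h4⟩; exact ⟨⟨h3 ▸ VU.zero_mem, h2⟩, h3, h4⟩

theorem frU_inv {m : ℕ} {A A' : Bool → Matrix (Fin m) (Fin m) ℂ} (h : ∀ b, A b * A' b = 1)
    (t : Option Bool) : frU A t * frU A' t = 1 := by
  cases t
  · exact Matrix.one_mul 1
  · exact h _

theorem finrank_inf_comap {m : ℕ} {E e : Matrix (Fin m) (Fin m) ℂ} (h : E * e = 1)
    (V : Submodule ℂ (Fin m → ℂ)) (b : ℕ) :
    Module.finrank ℂ ↥(V ⊓ (low Fin.val b).comap (mulVecLin e))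
      = Module.finrank ℂ ↥(V.comap (mulVecLin E) ⊓ low Fin.val b) := by
  have h' : e * E = 1 := mul_eq_one_comm.1 h
  have hinj : Function.Injective (mulVecLin E) := fun x y hxy => by
    have := congrArg (fun v => e *ᵥ v) hxy
    simpa [h'] using this
  have e2 : V ⊓ (low Fin.val b).comap (mulVecLin e)
      = (V.comap (mulVecLin E) ⊓ low Fin.val b).map (mulVecLin E) := by
    ext v
    constructor
    · rintro ⟨h1, h2⟩
      refine ⟨e *ᵥ v, ⟨?_, h2⟩, ?_⟩
      · change E *ᵥ (e *ᵥ v) ∈ V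
        rw [mulVec_mulVec, h, one_mulVec]; exact h1
      · rw [mulVecLin_apply, mulVec_mulVec, h, one_mulVec]
    · rintro ⟨z, ⟨h1, h2⟩, rfl⟩
      refine ⟨h1, ?_⟩
      change e *ᵥ (E *ᵥ z) ∈ low Fin.val b
      rw [mulVec_mulVec, h', one_mulVec]; exact h2
  rw [e2, finrank_map_of_injective hinj]

end Parameters

section GenericConfig

variable {p q : ℕ}

theorem le_finrank_of_opB {VU VU' : Submodule ℂ (Fin p → ℂ)} {VW VW' : Submodule ℂ (Fin q → ℂ)}
    {x y : Par p q → ℂ}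
    (h : ∀ s, Module.finrank ℂ ↥(prodSub VU VW ⊓ LinearMap.ker (mulVecLin (opB s x)))
      ≤ Module.finrank ℂ ↥(prodSub VU' VW' ⊓ LinearMap.ker (mulVecLin (opB s y))))
    {AU AU' : Bool → Matrix (Fin p) (Fin p) ℂ} {AW AW' : Bool → Matrix (Fin q) (Fin q) ℂ}
    (hU : ∀ b, AU b * parU x b = 1) (hW : ∀ b, AW b * parW x b = 1)
    (hU' : ∀ b, AU' b * parU y b = 1) (hW' : ∀ b, AW' b * parW y b = 1) (t : Option Bool) :
    (∀ b ≤ p, Module.finrank ℂ ↥(VU.comap (mulVecLin (frU AU t)) ⊓ low Fin.val b)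
      ≤ Module.finrank ℂ ↥(VU'.comap (mulVecLin (frU AU' t)) ⊓ low Fin.val b)) ∧
    (∀ b ≤ q, Module.finrank ℂ ↥(VW.comap (mulVecLin (frU AW t)) ⊓ low Fin.val b)
      ≤ Module.finrank ℂ ↥(VW'.comap (mulVecLin (frU AW' t)) ⊓ low Fin.val b)) := by
  constructor
  · intro b hb
    have := h (t, Sum.inl ⟨b, by omega⟩)
    rw [prodSub_inf_ker_inl, prodSub_inf_ker_inl, finrank_prodSub, finrank_prodSub,
      finrank_inf_comap (frU_inv hU t), finrank_inf_comap (frU_inv hU' t)] at this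
    simpa using this
  · intro b hb
    have := h (t, Sum.inr ⟨b, by omega⟩)
    rw [prodSub_inf_ker_inr, prodSub_inf_ker_inr, finrank_prodSub, finrank_prodSub,
      finrank_inf_comap (frU_inv hW t), finrank_inf_comap (frU_inv hW' t)] at this
    simpa using this

theorem low_of_le {m b : ℕ} (h : m ≤ b) : low (Fin.val : Fin m → ℕ) b = ⊤ := by
  rw [eq_top_iff]
  intro v _ l hl
  have := l.2
  omega

theorem finrank_comap_of_mul {m : ℕ} {E e : Matrix (Fin m) (Fin m) ℂ} (h : E * e = 1)
    (V : Submodule ℂ (Fin m → ℂ)) :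
    Module.finrank ℂ ↥(V.comap (mulVecLin E)) = Module.finrank ℂ V := by
  have := finrank_inf_comap h V m
  rw [low_of_le le_rfl, Submodule.comap_top, inf_top_eq, inf_top_eq] at this
  exact this.symm

theorem eq_prodSub {V : Submodule ℂ (Fin p ⊕ Fin q → ℂ)} {x : Par p q → ℂ}
    (hF : ∀ a, ∀ v ∈ V, opF a x *ᵥ v ∈ V) :
    ∃ (VU : Submodule ℂ (Fin p → ℂ)) (VW : Submodule ℂ (Fin q → ℂ)),
      V = prodSub VU VW ∧ ∀ w ∈ VW, parX x *ᵥ w ∈ VU := by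
  have hU : ∀ v ∈ V, Sum.elim (v ∘ Sum.inl) 0 ∈ V := fun v hv => by
    have := hF true v hv
    simp only [opF] at this
    rw [if_pos trivial, fromBlocks_mulVec_elim] at this
    simpa using this
  have hW : ∀ v ∈ V, Sum.elim (parX x *ᵥ (v ∘ Sum.inr)) 0 ∈ V := fun v hv => by
    have := hF false v hv
    simp only [opF] at this
    rw [if_neg (by simp), fromBlocks_mulVec_elim] at this
    simpa using this
  let VU : Submodule ℂ (Fin p → ℂ) :=
    { carrier := {u | Sum.elim u (0 : Fin q → ℂ) ∈ V}
      add_mem' := fun {a b} ha hb => by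
        have := V.add_mem ha hb
        rwa [← Sum.elim_add_add, add_zero] at this
      zero_mem' := by
        have := V.zero_mem
        change Sum.elim (0 : Fin p → ℂ) (0 : Fin q → ℂ) ∈ V
        rwa [(elim_zero_iff 0 0).2 ⟨rfl, rfl⟩]
      smul_mem' := fun c a ha => by
        have := V.smul_mem c ha
        have e : c • Sum.elim a (0 : Fin q → ℂ) = Sum.elim (c • a) 0 := by ext (i | i) <;> simp
        rwa [e] at this }
  let VW : Submodule ℂ (Fin q → ℂ) :=
    { carrier := {w | Sum.elim (0 : Fin p → ℂ) w ∈ V}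
      add_mem' := fun {a b} ha hb => by
        have := V.add_mem ha hb
        rwa [← Sum.elim_add_add, add_zero] at this
      zero_mem' := by
        have := V.zero_mem
        change Sum.elim (0 : Fin p → ℂ) (0 : Fin q → ℂ) ∈ V
        rwa [(elim_zero_iff 0 0).2 ⟨rfl, rfl⟩]
      smul_mem' := fun c a ha => by
        have := V.smul_mem c ha
        have e : c • Sum.elim (0 : Fin p → ℂ) a = Sum.elim (0 : Fin p → ℂ) (c • a) := by ext (i | i) <;> simp
        rwa [e] at this }
  refine ⟨VU, VW, ?_, ?_⟩
  · ext v
    have e : Sum.elim (v ∘ Sum.inl) 0 + Sum.elim (0 : Fin p → ℂ) (v ∘ Sum.inr) = v := by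
      ext (i | i) <;> simp
    constructor
    · intro hv
      refine ⟨hU v hv, ?_⟩
      have := V.sub_mem hv (hU v hv)
      rwa [← eq_sub_of_add_eq' e] at this
    · rintro ⟨h1, h2⟩
      have := V.add_mem h1 h2
      rwa [e] at this
  · intro w hw
    have := hW _ hw
    rw [Sum.elim_comp_inr] at this
    exact this

/-- The weighted count of pivots of a pair of subspaces along three flags. -/
def slope (EU : Option Bool → Matrix (Fin p) (Fin p) ℂ) (EW : Option Bool → Matrix (Fin q) (Fin q) ℂ)
    (aU : Option Bool → Fin p → ℝ) (aW : Option Bool → Fin q → ℝ)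
    (VU : Submodule ℂ (Fin p → ℂ)) (VW : Submodule ℂ (Fin q → ℂ)) : ℝ :=
  ∑ t, (∑ i ∈ piv Fin.val (VU.comap (Matrix.mulVecLin (EU t))), aU t i
    + ∑ i ∈ piv Fin.val (VW.comap (Matrix.mulVecLin (EW t))), aW t i)

theorem exists_generic (p q : ℕ) : ∃ (AU : Bool → Matrix (Fin p) (Fin p) ℂ)
    (AW : Bool → Matrix (Fin q) (Fin q) ℂ) (X : Matrix (Fin p) (Fin q) ℂ),
    (∀ b, IsUnit (AU b).det) ∧ (∀ b, IsUnit (AW b).det) ∧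
    ∀ (AU' : Bool → Matrix (Fin p) (Fin p) ℂ) (AW' : Bool → Matrix (Fin q) (Fin q) ℂ)
      (X' : Matrix (Fin p) (Fin q) ℂ), (∀ b, IsUnit (AU' b).det) → (∀ b, IsUnit (AW' b).det) →
      ∀ (VU : Submodule ℂ (Fin p → ℂ)) (VW : Submodule ℂ (Fin q → ℂ)), (∀ w ∈ VW, X *ᵥ w ∈ VU) →
      ∃ (VU' : Submodule ℂ (Fin p → ℂ)) (VW' : Submodule ℂ (Fin q → ℂ)),
        (∀ w ∈ VW', X' *ᵥ w ∈ VU') ∧ Module.finrank ℂ VU' = Module.finrank ℂ VU ∧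
        Module.finrank ℂ VW' = Module.finrank ℂ VW ∧
        ∀ aU aW, (∀ t, Antitone (aU t)) → (∀ t, Antitone (aW t)) →
          slope (frU AU) (frU AW) aU aW VU VW ≤ slope (frU AU') (frU AW') aU aW VU' VW' := by
  have hopen : IsOpen {x : Par p q → ℂ | (∀ b, (parU x b).det ≠ 0) ∧ ∀ b, (parW x b).det ≠ 0} := by
    rw [Set.ofPred_and, Set.ofPred_forall, Set.ofPred_forall]
    refine (isOpen_iInter_of_finite fun b => ?_).inter (isOpen_iInter_of_finite fun b => ?_)
    · exact isOpen_ne_fun (continuous_parU b).matrix_det continuous_const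
    · exact isOpen_ne_fun (continuous_parW b).matrix_det continuous_const
  have hne : {x : Par p q → ℂ | (∀ b, (parU x b).det ≠ 0) ∧ ∀ b, (parW x b).det ≠ 0}.Nonempty := by
    refine ⟨Sum.elim (fun z => (1 : Matrix (Fin p) (Fin p) ℂ) z.2.1 z.2.2)
      (Sum.elim (fun z => (1 : Matrix (Fin q) (Fin q) ℂ) z.2.1 z.2.2) 0), fun b => ?_, fun b => ?_⟩
    · have : parU (Sum.elim (fun z => (1 : Matrix (Fin p) (Fin p) ℂ) z.2.1 z.2.2)
        (Sum.elim (fun z => (1 : Matrix (Fin q) (Fin q) ℂ) z.2.1 z.2.2) 0)) b = 1 := rfl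
      rw [this]; simp
    · have : parW (Sum.elim (fun z => (1 : Matrix (Fin p) (Fin p) ℂ) z.2.1 z.2.2)
        (Sum.elim (fun z => (1 : Matrix (Fin q) (Fin q) ℂ) z.2.1 z.2.2) 0)) b = 1 := rfl
      rw [this]; simp
  obtain ⟨x, ⟨hxU, hxW⟩, hx⟩ := (dense_algebraicIndependent (Par p q)).2.inter_open_nonempty _ hopen hne
  have hU : ∀ b, (parU x b)⁻¹ * parU x b = 1 := fun b => nonsing_inv_mul _ (hxU b).isUnit
  have hW : ∀ b, (parW x b)⁻¹ * parW x b = 1 := fun b => nonsing_inv_mul _ (hxW b).isUnit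
  refine ⟨fun b => (parU x b)⁻¹, fun b => (parW x b)⁻¹, parX x,
    fun b => isUnit_nonsing_inv_det _ (hxU b).isUnit,
    fun b => isUnit_nonsing_inv_det _ (hxW b).isUnit, ?_⟩
  intro AU' AW' X' hAU' hAW' VU VW hX
  let y : Par p q → ℂ := Sum.elim (fun z => (AU' z.1)⁻¹ z.2.1 z.2.2)
    (Sum.elim (fun z => (AW' z.1)⁻¹ z.2.1 z.2.2) fun z => X' z.1 z.2)
  have hyX : parX y = X' := rfl
  have hU' : ∀ b, AU' b * parU y b = 1 := fun b => mul_nonsing_inv _ (hAU' b)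
  have hW' : ∀ b, AW' b * parW y b = 1 := fun b => mul_nonsing_inv _ (hAW' b)
  have hmem : x ∈ InvSet opF opB (Module.finrank ℂ (prodSub VU VW))
      fun s => Module.finrank ℂ ↥(prodSub VU VW ⊓ LinearMap.ker (mulVecLin (opB s x))) := by
    rw [mem_invSet_iff]
    refine ⟨prodSub VU VW, rfl, fun a v hv => ?_, fun s => le_rfl⟩
    cases a
    · simp only [opF]
      rw [if_neg (by simp), fromBlocks_mulVec_elim, mem_prodSub]
      simpa using hX _ hv.2
    · simp only [opF]
      rw [if_pos trivial, fromBlocks_mulVec_elim, mem_prodSub]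
      simpa using hv.1
  have := invSet_eq_univ opF_map opB_map continuous_opF continuous_opB hx hmem y
  rw [mem_invSet_iff] at this
  obtain ⟨V, hd, hF, hc⟩ := this
  obtain ⟨VU', VW', rfl, hX'⟩ := eq_prodSub hF
  have hle := le_finrank_of_opB hc hU hW hU' hW'
  rw [finrank_prodSub, finrank_prodSub] at hd
  have h1 := (hle none).1 p le_rfl
  have h2 := (hle none).2 q le_rfl
  rw [low_of_le le_rfl, inf_top_eq, inf_top_eq, finrank_comap_of_mul (frU_inv hU none),
    finrank_comap_of_mul (frU_inv hU' none)] at h1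
  rw [low_of_le le_rfl, inf_top_eq, inf_top_eq, finrank_comap_of_mul (frU_inv hW none),
    finrank_comap_of_mul (frU_inv hW' none)] at h2
  have hdU : Module.finrank ℂ VU' = Module.finrank ℂ VU := by omega
  have hdW : Module.finrank ℂ VW' = Module.finrank ℂ VW := by omega
  refine ⟨VU', VW', hX', hdU, hdW, fun aU aW haU haW => ?_⟩
  refine Finset.sum_le_sum fun t _ => add_le_add ?_ ?_
  · refine sum_piv_le_of_finrank_le ?_ (fun b => ?_) (haU t)
    · rw [finrank_comap_of_mul (frU_inv hU' t), finrank_comap_of_mul (frU_inv hU t), hdU]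
    · rcases le_total b p with hb | hb
      · exact (hle t).1 b hb
      · rw [low_of_le hb, inf_top_eq, inf_top_eq, finrank_comap_of_mul (frU_inv hU' t),
          finrank_comap_of_mul (frU_inv hU t), hdU]
  · refine sum_piv_le_of_finrank_le ?_ (fun b => ?_) (haW t)
    · rw [finrank_comap_of_mul (frU_inv hW' t), finrank_comap_of_mul (frU_inv hW t), hdW]
    · rcases le_total b q with hb | hb
      · exact (hle t).2 b hb
      · rw [low_of_le hb, inf_top_eq, inf_top_eq, finrank_comap_of_mul (frU_inv hW' t),
          finrank_comap_of_mul (frU_inv hW t), hdW]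

/-- Semistability of a configuration with respect to weights. -/
def KSemi (EU : Option Bool → Matrix (Fin p) (Fin p) ℂ)
    (EW : Option Bool → Matrix (Fin q) (Fin q) ℂ) (X : Matrix (Fin p) (Fin q) ℂ)
    (aU : Option Bool → Fin p → ℝ) (aW : Option Bool → Fin q → ℝ) : Prop :=
  ∀ (VU : Submodule ℂ (Fin p → ℂ)) (VW : Submodule ℂ (Fin q → ℂ)),
    (∀ w ∈ VW, X *ᵥ w ∈ VU) → slope EU EW aU aW VU VW ≤ 0

theorem exists_generic_config (p q : ℕ) : ∃ (AU : Bool → Matrix (Fin p) (Fin p) ℂ)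
    (AW : Bool → Matrix (Fin q) (Fin q) ℂ) (X : Matrix (Fin p) (Fin q) ℂ),
    (∀ b, IsUnit (AU b).det) ∧ (∀ b, IsUnit (AW b).det) ∧
    ∀ (AU' : Bool → Matrix (Fin p) (Fin p) ℂ) (AW' : Bool → Matrix (Fin q) (Fin q) ℂ)
      (X' : Matrix (Fin p) (Fin q) ℂ), (∀ b, IsUnit (AU' b).det) → (∀ b, IsUnit (AW' b).det) →
      ∀ aU aW, (∀ t, Antitone (aU t)) → (∀ t, Antitone (aW t)) →
      (KSemi (frU AU') (frU AW') X' aU aW → KSemi (frU AU) (frU AW) X aU aW) ∧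
      (KStable (frU AU') (frU AW') X' aU aW → KStable (frU AU) (frU AW) X aU aW) := by
  obtain ⟨AU, AW, X, hU, hW, h⟩ := exists_generic p q
  refine ⟨AU, AW, X, hU, hW, fun AU' AW' X' hU' hW' aU aW haU haW => ⟨fun hs VU VW hX => ?_,
    fun hs VU VW hX h0 h1 => ?_⟩⟩
  · obtain ⟨VU', VW', hX', -, -, hle⟩ := h AU' AW' X' hU' hW' VU VW hX
    exact (hle aU aW haU haW).trans (hs VU' VW' hX')
  · obtain ⟨VU', VW', hX', hdU, hdW, hle⟩ := h AU' AW' X' hU' hW' VU VW hX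
    refine (hle aU aW haU haW).trans_lt (hs VU' VW' hX' ?_ ?_)
    · rintro ⟨rfl, rfl⟩
      rw [finrank_bot] at hdU hdW
      exact h0 ⟨Submodule.finrank_eq_zero.1 hdU.symm, Submodule.finrank_eq_zero.1 hdW.symm⟩
    · rintro ⟨rfl, rfl⟩
      rw [finrank_top] at hdU hdW
      exact h1 ⟨Submodule.eq_top_of_finrank_eq hdU.symm, Submodule.eq_top_of_finrank_eq hdW.symm⟩

end GenericConfig

section PivotBasis

variable {n : Type} [Fintype n] [DecidableEq n]

/-- A subspace of larger dimension contains a nonzero vector orthogonal to a smaller one. -/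
theorem exists_orthogonal {L W : Submodule ℂ (n → ℂ)}
    (h : Module.finrank ℂ L < Module.finrank ℂ W) (J : Matrix n n ℂ) :
    ∃ v ∈ W, v ≠ 0 ∧ ∀ l ∈ L, star l ⬝ᵥ J *ᵥ v = 0 := by
  obtain ⟨M, M', hM, hML⟩ := exists_frame L le_rfl
  let f : W →ₗ[ℂ] (Fin (Module.finrank ℂ L) → ℂ) := (mulVecLin (Mᴴ * J)).comp W.subtype
  have hker : LinearMap.ker f ≠ ⊥ := LinearMap.ker_ne_bot_of_finrank_lt (by simpa using h)
  obtain ⟨v, hv, hv0⟩ := Submodule.exists_mem_ne_zero_of_ne_bot hker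
  refine ⟨v, v.2, by simpa using hv0, fun l hl => ?_⟩
  have hr : LinearMap.range (mulVecLin M) = L := by
    apply Submodule.eq_of_le_of_finrank_eq
    · rintro _ ⟨w, rfl⟩; exact hML w
    · rw [finrank_range_of_leftInverse hM]
  rw [← hr] at hl
  obtain ⟨y, rfl⟩ := hl
  have hv' : (Mᴴ * J) *ᵥ (v : n → ℂ) = 0 := hv
  rw [mulVecLin_apply, star_mulVec, ← dotProduct_mulVec, mulVec_mulVec, hv', dotProduct_zero]

/-- Triangular `J`-orthogonal bases adapted to a flag. -/
theorem exists_pivot_basis {rk : n → ℕ} (hrk : Function.Injective rk) {J : Matrix n n ℂ}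
    (hJ : J.IsHermitian) {s : n → ℝ} (hs : ∀ i, s i * s i = 1) (V : Submodule ℂ (n → ℂ))
    (hV : ∀ i, ∀ v ∈ V, v ≠ 0 → v ∈ low rk (rk i + 1) →
      (∀ l ∈ V ⊓ low rk (rk i), star l ⬝ᵥ J *ᵥ v = 0) → 0 < s i * qf J v) :
    ∃ U : Matrix n n ℂ, (∀ x, U *ᵥ x ∈ V) ∧ (∀ i j, rk i < rk j → U j i = 0) ∧
      (∀ i ∉ piv rk V, ∀ j, U j i = 0) ∧
      Uᴴ * J * U = diagonal (fun i => ((if i ∈ piv rk V then s i else 0 : ℝ) : ℂ)) ∧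
      ∀ v ∈ V, ∃ x, v = U *ᵥ x := by
  have key : ∀ i, ∃ v ∈ V, v ∈ low rk (rk i + 1) ∧ (i ∉ piv rk V → v = 0) ∧
      (∀ l ∈ V ⊓ low rk (rk i), star l ⬝ᵥ J *ᵥ v = 0) ∧
      qf J v = if i ∈ piv rk V then s i else 0 := by
    intro i
    by_cases hi : i ∈ piv rk V
    · have hlt : Module.finrank ℂ ↥(V ⊓ low rk (rk i))
          < Module.finrank ℂ ↥(V ⊓ low rk (rk i + 1)) := by
        rw [← card_piv_filter hrk, ← card_piv_filter hrk]
        apply Finset.card_lt_card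
        rw [Finset.ssubset_iff_of_subset]
        · exact ⟨i, by simp [hi], by simp⟩
        · intro j
          simp only [Finset.mem_filter]
          rintro ⟨h1, h2⟩
          exact ⟨h1, by omega⟩
      obtain ⟨v, ⟨hvV, hvl⟩, hv0, hort⟩ := exists_orthogonal hlt J
      have hpos := hV i v hvV hv0 hvl hort
      set t := s i * qf J v with ht
      refine ⟨((Real.sqrt t)⁻¹ : ℂ) • v, V.smul_mem _ hvV, Submodule.smul_mem _ _ hvl,
        fun h => absurd hi h, fun l hl => ?_, ?_⟩
      · rw [mulVec_smul, dotProduct_smul, hort l hl, smul_zero]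
      · have e : qf J (((Real.sqrt t)⁻¹ : ℂ) • v) = t⁻¹ * qf J v := by
          simp only [qf, star_smul, mulVec_smul, smul_dotProduct, dotProduct_smul, smul_eq_mul]
          rw [← mul_assoc]
          have : ((Real.sqrt t)⁻¹ : ℂ) * star ((Real.sqrt t)⁻¹ : ℂ) = ((t⁻¹ : ℝ) : ℂ) := by
            rw [← Complex.ofReal_inv]
            change _ * (starRingEnd ℂ) _ = _
            rw [Complex.conj_ofReal, ← Complex.ofReal_mul, ← mul_inv, Real.mul_self_sqrt hpos.le]
          rw [this, Complex.re_ofReal_mul]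
        rw [e, if_pos hi]
        have : qf J v = s i * t := by rw [ht, ← mul_assoc, hs, one_mul]
        rw [this]
        field_simp
    · refine ⟨0, V.zero_mem, Submodule.zero_mem _, fun _ => rfl, fun l _ => by simp, ?_⟩
      simp [hi, qf]
  choose v hvV hvl hv0 hort hq using key
  let U : Matrix n n ℂ := Matrix.of fun j i => v i j
  have hU : ∀ x, U *ᵥ x = ∑ i, x i • v i := fun x => by
    ext j
    simp [U, mulVec, dotProduct, mul_comm]
  have hUV : ∀ x, U *ᵥ x ∈ V := fun x => by
    rw [hU]; exact V.sum_mem fun i _ => V.smul_mem _ (hvV i)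
  have hent : ∀ i j, (Uᴴ * J * U) i j = star (v i) ⬝ᵥ J *ᵥ v j := by
    intro i j
    rw [Matrix.mul_assoc, Matrix.mul_apply_eq_vecMul]
    rfl
  have hD : Uᴴ * J * U = diagonal (fun i => ((if i ∈ piv rk V then s i else 0 : ℝ) : ℂ)) := by
    have hlt : ∀ i j, rk i < rk j → star (v i) ⬝ᵥ J *ᵥ v j = 0 := fun i j hij =>
      hort j _ ⟨hvV i, fun l hl => hvl i l (by omega)⟩
    have hherm : (Uᴴ * J * U)ᴴ = Uᴴ * J * U := (isHermitian_conjTranspose_mul_mul U hJ)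
    ext i j
    rcases lt_trichotomy (rk i) (rk j) with h | h | h
    · rw [hent, hlt i j h, diagonal_apply_ne]
      rintro rfl; omega
    · obtain rfl := hrk h
      rw [hent, isHermitian_dot hJ, hq, diagonal_apply_eq]
    · rw [← hherm, conjTranspose_apply, hent, hlt j i h, diagonal_apply_ne, star_zero]
      rintro rfl; omega
  refine ⟨U, hUV, fun i j hij => hvl i j (by omega), fun i hi j => ?_, hD, ?_⟩
  · change v i j = 0
    rw [hv0 i hi]; rfl
  · have hr : LinearMap.range (mulVecLin U) = V := by
      apply Submodule.eq_of_le_of_finrank_le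
      · rintro _ ⟨w, rfl⟩; exact hUV w
      · have h1 : (Uᴴ * J * U).rank ≤ U.rank := rank_mul_le_right _ _
        rw [hD, rank_diagonal] at h1
        rw [← card_piv hrk]
        refine le_trans (le_of_eq ?_) h1
        rw [Fintype.card_subtype]
        congr 1
        ext i
        have : s i ≠ 0 := fun h => by have := hs i; simp [h] at this
        by_cases hi : i ∈ piv rk V <;> simp [hi, this]
    intro v hv
    rw [← hr] at hv
    obtain ⟨x, rfl⟩ := hv
    exact ⟨x, rfl⟩

/-- The sign condition for subspaces that are definite modulo the first coordinate block. -/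
theorem sign_of_decomposition {rk : n → ℕ} {s : n → ℝ} (hs : ∀ i, s i * s i = 1) {e : ℝ}
    (hrk : ∀ i j, s i = e → s j = -e → rk i < rk j) (he : e * e = 1)
    (V : Submodule ℂ (n → ℂ))
    (hV : ∀ v ∈ V, ∃ u ∈ V, (∀ j, s j = -e → u j = 0) ∧
      (v - u ≠ 0 → 0 < -e * qf (diagonal fun i => (s i : ℂ)) (v - u))) :
    ∀ i, ∀ v ∈ V, v ≠ 0 → v ∈ low rk (rk i + 1) →
      (∀ l ∈ V ⊓ low rk (rk i), star l ⬝ᵥ (diagonal fun i => (s i : ℂ)) *ᵥ v = 0) →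
      0 < s i * qf (diagonal fun i => (s i : ℂ)) v := by
  have hcase : ∀ i, s i = e ∨ s i = -e := fun i => by
    have : (s i - e) * (s i + e) = 0 := by linear_combination hs i - he
    rcases mul_eq_zero.1 this with h | h
    · left; linarith
    · right; linarith
  have he0 : e ≠ 0 := fun h => by simp [h] at he
  have hdef : ∀ u : n → ℂ, (∀ j, s j = -e → u j = 0) →
      e * qf (diagonal fun i => (s i : ℂ)) u = nsq u := by
    intro u hu
    rw [qf_diagonal, nsq, Finset.mul_sum]
    refine Finset.sum_congr rfl fun i _ => ?_
    rcases hcase i with h | h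
    · rw [h, ← mul_assoc, he, one_mul]
    · rw [hu i h]; simp
  intro i v hv hv0 hvl hort
  rcases hcase i with hi | hi
  · rw [hi, hdef v]
    · exact nsq_pos hv0
    · intro j hj
      exact hvl j (hrk i j hi hj)
  · obtain ⟨u, huV, hu, hpos⟩ := hV v hv
    have hul : u ∈ V ⊓ low rk (rk i) := by
      refine ⟨huV, fun l hl => ?_⟩
      rcases hcase l with h | h
      · exact absurd (hrk l i h hi) (by omega)
      · exact hu l h
    have h0 := hort u hul
    have hJ : (diagonal fun i => (s i : ℂ)).IsHermitian := by
      rw [IsHermitian, diagonal_conjTranspose]; congr 1; ext i; simp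
    have h0' : star v ⬝ᵥ (diagonal fun i => (s i : ℂ)) *ᵥ u = 0 := by
      rw [star_dotProduct, star_mulVec, hJ.eq, ← dotProduct_mulVec, h0, star_zero]
    have e1 : qf (diagonal fun i => (s i : ℂ)) (v - u)
        = qf (diagonal fun i => (s i : ℂ)) v + qf (diagonal fun i => (s i : ℂ)) u := by
      simp only [qf, mulVec_sub, star_sub, sub_dotProduct, dotProduct_sub, h0, h0']
      simp
    have h2 := hdef u hu
    rw [e1] at hpos
    rw [hi]
    by_cases hvu : v - u = 0
    · exfalso
      rw [sub_eq_zero] at hvu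
      subst hvu
      have h3 := nsq_pos hv0
      rw [qf, h0] at h2
      simp at h2
      linarith
    · have := hpos hvu
      have := nsq_nonneg u
      linarith

end PivotBasis

section TraceBound

variable {p q : ℕ}

theorem J0_herm : (J0 p q).IsHermitian := J0_conj

theorem isUnit_det_of_frame {J w : Matrix (Fin p ⊕ Fin q) (Fin p ⊕ Fin q) ℂ}
    (hw : wᴴ * J * w = J0 p q) : IsUnit w.det ∧ IsUnit J.det := by
  have h := congrArg Matrix.det hw
  have h2 : (J0 p q).det * (J0 p q).det = 1 := by rw [← det_mul, J0_sq, det_one]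
  rw [det_mul, det_mul] at h
  have h0 : (J0 p q).det ≠ 0 := fun h => by simp [h] at h2
  rw [← h] at h0
  simp only [isUnit_iff_ne_zero]
  constructor
  · rintro h1; simp [h1] at h0
  · rintro h1; simp [h1] at h0

theorem isHermitian_of_frame {J w : Matrix (Fin p ⊕ Fin q) (Fin p ⊕ Fin q) ℂ}
    (hw : wᴴ * J * w = J0 p q) : J.IsHermitian := by
  obtain ⟨hwd, -⟩ := isUnit_det_of_frame hw
  have e : J = (w⁻¹)ᴴ * J0 p q * w⁻¹ := by
    rw [← hw]
    have h1 : (w⁻¹)ᴴ * wᴴ = 1 := by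
      rw [← conjTranspose_mul, mul_nonsing_inv _ hwd, conjTranspose_one]
    calc J = ((w⁻¹)ᴴ * wᴴ) * J * (w * w⁻¹) := by rw [h1, mul_nonsing_inv _ hwd]; simp
      _ = _ := by simp only [Matrix.mul_assoc]
  rw [e]
  exact isHermitian_conjTranspose_mul_mul _ J0_herm

/-- The orthogonal projection onto `V` and its pairing with a diagonalised operator. -/
theorem exists_projection {J w : Matrix (Fin p ⊕ Fin q) (Fin p ⊕ Fin q) ℂ}
    (hw : wᴴ * J * w = J0 p q) {rk : Fin p ⊕ Fin q → ℕ} (hrk : Function.Injective rk)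
    {al : Fin p ⊕ Fin q → ℝ} (hal : ∀ i j, rk j ≤ rk i → 0 ≤ sg i * sg j * (al j - al i))
    (V : Submodule ℂ (Fin p ⊕ Fin q → ℂ))
    (hV : ∀ i, ∀ v ∈ V.comap (mulVecLin w), v ≠ 0 → v ∈ low rk (rk i + 1) →
      (∀ l ∈ V.comap (mulVecLin w) ⊓ low rk (rk i), star l ⬝ᵥ J0 p q *ᵥ v = 0) →
      0 < sg i * qf (J0 p q) v) :
    ∃ P : Matrix (Fin p ⊕ Fin q) (Fin p ⊕ Fin q) ℂ, (∀ x, P *ᵥ x ∈ V) ∧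
      (∀ v ∈ V, P *ᵥ v = v) ∧ (J * P).IsHermitian ∧
      ∑ i ∈ piv rk (V.comap (mulVecLin w)), al i
        ≤ (P * (w * diagonal (fun i => ((al i : ℝ) : ℂ)) * w⁻¹)).trace.re ∧
      ((P * (w * diagonal (fun i => ((al i : ℝ) : ℂ)) * w⁻¹)).trace.re
        ≤ ∑ i ∈ piv rk (V.comap (mulVecLin w)), al i →
        ∀ v ∈ V, (w * diagonal (fun i => ((al i : ℝ) : ℂ)) * w⁻¹) *ᵥ v ∈ V) := by
  obtain ⟨hwd, -⟩ := isUnit_det_of_frame hw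
  obtain ⟨U, hUV, hUt, hU0, hUU, hUr⟩ := exists_pivot_basis hrk J0_herm sg_mul_self _ hV
  set S : Matrix (Fin p ⊕ Fin q) (Fin p ⊕ Fin q) ℂ :=
    diagonal (fun i => ((if i ∈ piv rk (V.comap (mulVecLin w)) then sg i else 0 : ℝ) : ℂ)) with hS
  set D : Matrix (Fin p ⊕ Fin q) (Fin p ⊕ Fin q) ℂ :=
    diagonal (fun i => ((al i : ℝ) : ℂ)) with hD
  have hUSS : U * (S * S) = U := by
    ext j i
    rw [hS, diagonal_mul_diagonal, mul_diagonal]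
    by_cases hi : i ∈ piv rk (V.comap (mulVecLin w))
    · simp only [hi, if_true]
      rw [← Complex.ofReal_mul, sg_mul_self]; simp
    · rw [hU0 i hi]; simp
  have hvec : ∀ v ∈ V, ∃ x, v = (w * U) *ᵥ x := by
    intro v hv
    obtain ⟨x, hx⟩ := hUr (w⁻¹ *ᵥ v) (by
      rw [Submodule.mem_comap, mulVecLin_apply, mulVec_mulVec, mul_nonsing_inv _ hwd, one_mulVec]
      exact hv)
    refine ⟨x, ?_⟩
    rw [← mulVec_mulVec, ← hx, mulVec_mulVec, mul_nonsing_inv _ hwd, one_mulVec]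
  have hmem : ∀ x, (w * U) *ᵥ x ∈ V := fun x => by
    rw [← mulVec_mulVec]; exact hUV x
  have hSc : Sᴴ = S := by
    rw [hS, diagonal_conjTranspose]; congr 1; ext i; simp
  have hJ := isHermitian_of_frame hw
  have hw' : (w * U)ᴴ * J * (w * U) = S := by
    rw [← hUU, ← hw, conjTranspose_mul]; simp only [Matrix.mul_assoc]
  have htr : ((w * U * S * (w * U)ᴴ * J) * (w * D * w⁻¹)).trace
      = ∑ i, ∑ j, (((if i ∈ piv rk (V.comap (mulVecLin w)) then sg i else 0)
        * (sg j * al j * Complex.normSq (U j i)) : ℝ) : ℂ) := by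
    have e1 : ((w * U * S * (w * U)ᴴ * J) * (w * D * w⁻¹)).trace = (S * (Uᴴ * (J0 p q * D) * U)).trace := by
      have : (w * U * S * (w * U)ᴴ * J) * (w * D * w⁻¹)
          = w * (U * (S * (Uᴴ * (wᴴ * J * w * D))) * w⁻¹) := by
        rw [conjTranspose_mul]; simp only [Matrix.mul_assoc]
      rw [this, hw, trace_mul_comm, Matrix.mul_assoc, nonsing_inv_mul _ hwd, Matrix.mul_one,
        trace_mul_comm]
      simp only [Matrix.mul_assoc]
    rw [e1, trace]
    refine Finset.sum_congr rfl fun i _ => ?_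
    rw [diag_apply, hS, diagonal_mul, Matrix.mul_apply, Finset.mul_sum]
    refine Finset.sum_congr rfl fun j _ => ?_
    rw [J0, hD, diagonal_mul_diagonal, mul_diagonal, conjTranspose_apply]
    push_cast
    rw [Complex.normSq_eq_conj_mul_self]
    change _ * ((starRingEnd ℂ) (U j i) * _ * _) = _
    ring
  have hdiag : ∀ i ∈ piv rk (V.comap (mulVecLin w)), ∑ j, sg j * Complex.normSq (U j i) = sg i := by
    intro i hi
    have : (Uᴴ * J0 p q * U) i i = S i i := by rw [hUU]
    rw [hS, J0, diagonal_apply_eq, if_pos hi, Matrix.mul_apply] at this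
    have e : ∀ j, (Uᴴ * diagonal (fun i => ((sg i : ℝ) : ℂ)) :
        Matrix (Fin p ⊕ Fin q) (Fin p ⊕ Fin q) ℂ) i j * U j i
        = ((sg j * Complex.normSq (U j i) : ℝ) : ℂ) := fun j => by
      rw [mul_diagonal, conjTranspose_apply]
      push_cast
      rw [Complex.normSq_eq_conj_mul_self]
      change (starRingEnd ℂ) (U j i) * _ * _ = _
      ring
    simp only [e] at this
    exact_mod_cast this
  have hdiff : ((w * U * S * (w * U)ᴴ * J) * (w * D * w⁻¹)).trace.re
      - ∑ i ∈ piv rk (V.comap (mulVecLin w)), al i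
      = ∑ i ∈ piv rk (V.comap (mulVecLin w)), ∑ j,
        sg i * sg j * (al j - al i) * Complex.normSq (U j i) := by
    rw [htr]
    simp only [← Complex.ofReal_sum, Complex.ofReal_re]
    have : ∀ i, (∑ j, (if i ∈ piv rk (V.comap (mulVecLin w)) then sg i else 0)
        * (sg j * al j * Complex.normSq (U j i)))
        = if i ∈ piv rk (V.comap (mulVecLin w)) then
          ∑ j, sg i * (sg j * al j * Complex.normSq (U j i)) else 0 := fun i => by
      split_ifs <;> simp
    simp only [this]
    rw [Finset.sum_ite_mem, Finset.univ_inter, ← Finset.sum_sub_distrib]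
    refine Finset.sum_congr rfl fun i hi => ?_
    have h1 : al i = ∑ j, al i * (sg i * (sg j * Complex.normSq (U j i))) := by
      rw [← Finset.mul_sum, ← Finset.mul_sum, hdiag i hi, sg_mul_self, mul_one]
    conv_lhs => rw [h1]
    rw [← Finset.sum_sub_distrib]
    exact Finset.sum_congr rfl fun j _ => by ring
  have hnn : ∀ i j, 0 ≤ sg i * sg j * (al j - al i) * Complex.normSq (U j i) := by
    intro i j
    rcases le_or_gt (rk j) (rk i) with h | h
    · exact mul_nonneg (hal i j h) (Complex.normSq_nonneg _)
    · rw [hUt i j h]; simp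
  refine ⟨w * U * S * (w * U)ᴴ * J, fun x => ?_, fun v hv => ?_, ?_, ?_, fun hle v hv => ?_⟩
  · rw [Matrix.mul_assoc, Matrix.mul_assoc, ← mulVec_mulVec]; exact hmem _
  · obtain ⟨x, rfl⟩ := hvec v hv
    rw [mulVec_mulVec]
    congr 1
    calc w * U * S * (w * U)ᴴ * J * (w * U) = w * U * (S * ((w * U)ᴴ * J * (w * U))) := by
          simp only [Matrix.mul_assoc]
      _ = w * U := by rw [hw', Matrix.mul_assoc w, hUSS]
  · have : J * (w * U * S * (w * U)ᴴ * J) = ((w * U)ᴴ * J)ᴴ * S * ((w * U)ᴴ * J) := by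
      rw [conjTranspose_mul (w * U)ᴴ, conjTranspose_conjTranspose, hJ.eq]; simp only [Matrix.mul_assoc]
    rw [this]
    exact isHermitian_conjTranspose_mul_mul _ hSc
  · have : 0 ≤ ∑ i ∈ piv rk (V.comap (mulVecLin w)), ∑ j,
        sg i * sg j * (al j - al i) * Complex.normSq (U j i) :=
      Finset.sum_nonneg fun i _ => Finset.sum_nonneg fun j _ => hnn i j
    linarith
  · have h0 : ∑ i ∈ piv rk (V.comap (mulVecLin w)), ∑ j,
        sg i * sg j * (al j - al i) * Complex.normSq (U j i) = 0 :=
      le_antisymm (by linarith)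
        (Finset.sum_nonneg fun i _ => Finset.sum_nonneg fun j _ => hnn i j)
    rw [Finset.sum_eq_zero_iff_of_nonneg fun i _ => Finset.sum_nonneg fun j _ => hnn i j] at h0
    have hcomm : D * U = U * D := by
      ext j i
      rw [hD, diagonal_mul, mul_diagonal]
      by_cases hi : i ∈ piv rk (V.comap (mulVecLin w))
      · have h1 := (Finset.sum_eq_zero_iff_of_nonneg fun j _ => hnn i j).1 (h0 i hi) j
          (Finset.mem_univ j)
        by_cases hU : U j i = 0
        · simp [hU]
        · have h2 : al j - al i = 0 := by
            have hi' := sg_mul_self i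
            have hj' := sg_mul_self j
            have h3 : Complex.normSq (U j i) ≠ 0 := by simpa using hU
            have h4 : sg i ≠ 0 := fun h => by simp [h] at hi'
            have h5 : sg j ≠ 0 := fun h => by simp [h] at hj'
            simpa [h3, h4, h5] using h1
          have : al j = al i := by linarith
          rw [this, mul_comm]
      · rw [hU0 i hi]; simp
    obtain ⟨x, rfl⟩ := hvec v hv
    rw [mulVec_mulVec]
    have : w * D * w⁻¹ * (w * U) = w * U * D := by
      calc w * D * w⁻¹ * (w * U) = w * D * (w⁻¹ * w) * U := by simp only [Matrix.mul_assoc]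
        _ = _ := by rw [nonsing_inv_mul _ hwd, Matrix.mul_one, Matrix.mul_assoc, hcomm,
                    Matrix.mul_assoc]
    rw [this, ← mulVec_mulVec]
    exact hmem _

theorem sum_piv_le {T : Type} [Fintype T] {J : Matrix (Fin p ⊕ Fin q) (Fin p ⊕ Fin q) ℂ}
    {w : T → Matrix (Fin p ⊕ Fin q) (Fin p ⊕ Fin q) ℂ}
    (hw : ∀ t, (w t)ᴴ * J * w t = J0 p q) {rk : T → Fin p ⊕ Fin q → ℕ}
    (hrk : ∀ t, Function.Injective (rk t))
    {al : T → Fin p ⊕ Fin q → ℝ}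
    (hsum : ∑ t, w t * diagonal (fun i => ((al t i : ℝ) : ℂ)) * (w t)⁻¹ = 0)
    (hal : ∀ t i j, rk t j ≤ rk t i → 0 ≤ sg i * sg j * (al t j - al t i))
    (V : Submodule ℂ (Fin p ⊕ Fin q → ℂ))
    (hV : ∀ t i, ∀ v ∈ V.comap (mulVecLin (w t)), v ≠ 0 → v ∈ low (rk t) (rk t i + 1) →
      (∀ l ∈ V.comap (mulVecLin (w t)) ⊓ low (rk t) (rk t i), star l ⬝ᵥ J0 p q *ᵥ v = 0) →
      0 < sg i * qf (J0 p q) v) :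
    ∑ t, ∑ i ∈ piv (rk t) (V.comap (mulVecLin (w t))), al t i ≤ 0 ∧
      (0 ≤ ∑ t, ∑ i ∈ piv (rk t) (V.comap (mulVecLin (w t))), al t i →
        ∀ t, ∀ v ∈ V, (w t * diagonal (fun i => ((al t i : ℝ) : ℂ)) * (w t)⁻¹) *ᵥ v ∈ V) := by
  have key := fun t => exists_projection (hw t) (hrk t) (hal t) V (hV t)
  choose P hPV hPid hPJ hle heq using key
  rcases isEmpty_or_nonempty T with hT | ⟨⟨s⟩⟩
  · simp
  have hJ := isHermitian_of_frame (hw s)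
  obtain ⟨-, hJd⟩ := isUnit_det_of_frame (hw s)
  have hPP : ∀ t, P t = P s := by
    intro t
    have h1 : ∀ a b, P a * P b = P b := fun a b => by
      apply Matrix.ext_of_mulVec_single
      intro j
      rw [← mulVec_mulVec, hPid a _ (hPV b _)]
    have h2 : ∀ a, (P a)ᴴ * J = J * P a := fun a => by
      have := (hPJ a).eq
      rwa [conjTranspose_mul, hJ.eq] at this
    have h3 : J * P t = J * P s := by
      calc J * P t = J * (P s * P t) := by rw [h1]
        _ = (P s)ᴴ * (J * P t) := by rw [← Matrix.mul_assoc, ← h2, Matrix.mul_assoc]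
        _ = (P s)ᴴ * ((P t)ᴴ * J) := by rw [h2]
        _ = (P t * P s)ᴴ * J := by rw [conjTranspose_mul, Matrix.mul_assoc]
        _ = J * P s := by rw [h1, h2]
    have := congrArg (fun M => J⁻¹ * M) h3
    simpa only [← Matrix.mul_assoc, nonsing_inv_mul _ hJd, Matrix.one_mul] using this
  have htot : ∑ t, (P t * (w t * diagonal (fun i => ((al t i : ℝ) : ℂ)) * (w t)⁻¹)).trace.re = 0 := by
    simp only [hPP]
    rw [← Complex.re_sum, ← trace_sum, ← Finset.mul_sum, hsum]
    simp
  refine ⟨(Finset.sum_le_sum fun t _ => hle t).trans_eq htot, fun h0 t => ?_⟩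
  apply heq t
  have h1 : ∑ t, ((P t * (w t * diagonal (fun i => ((al t i : ℝ) : ℂ)) * (w t)⁻¹)).trace.re
      - ∑ i ∈ piv (rk t) (V.comap (mulVecLin (w t))), al t i) ≤ 0 := by
    rw [Finset.sum_sub_distrib, htot]; linarith
  have h2 := Finset.single_le_sum (f := fun t =>
    (P t * (w t * diagonal (fun i => ((al t i : ℝ) : ℂ)) * (w t)⁻¹)).trace.re
      - ∑ i ∈ piv (rk t) (V.comap (mulVecLin (w t))), al t i)
    (fun t _ => sub_nonneg.2 (hle t)) (Finset.mem_univ t)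
  have h3 := h2.trans h1
  linarith

end TraceBound

section Derived

variable {p q : ℕ}

theorem piv_comap_subset {n : Type} [Fintype n] [DecidableEq n] {rk : n → ℕ} {T : Matrix n n ℂ}
    (hT : ∀ v i, (∀ l, rk i < rk l → v l = 0) →
      (T *ᵥ v) i = v i ∧ ∀ l, rk i < rk l → (T *ᵥ v) l = 0)
    (V : Submodule ℂ (n → ℂ)) : piv rk (V.comap (mulVecLin T)) ⊆ piv rk V := by
  intro i hi
  obtain ⟨v, hv, h1, h2⟩ := mem_piv.1 hi
  obtain ⟨h3, h4⟩ := hT v i h2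
  exact mem_piv.2 ⟨T *ᵥ v, hv, by rwa [h3], h4⟩

theorem piv_comap_eq {n : Type} [Fintype n] [DecidableEq n] {rk : n → ℕ} {T T' : Matrix n n ℂ}
    (hTT : T' * T = 1)
    (hT : ∀ v i, (∀ l, rk i < rk l → v l = 0) →
      (T *ᵥ v) i = v i ∧ ∀ l, rk i < rk l → (T *ᵥ v) l = 0)
    (hT' : ∀ v i, (∀ l, rk i < rk l → v l = 0) →
      (T' *ᵥ v) i = v i ∧ ∀ l, rk i < rk l → (T' *ᵥ v) l = 0)
    (V : Submodule ℂ (n → ℂ)) : piv rk (V.comap (mulVecLin T)) = piv rk V := by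
  apply subset_antisymm (piv_comap_subset hT V)
  have h : V = (V.comap (mulVecLin T)).comap (mulVecLin T') := by
    ext v
    simp only [Submodule.mem_comap, mulVecLin_apply]
    rw [mulVec_mulVec, mul_eq_one_comm.1 hTT, one_mulVec]
  conv_lhs => rw [h]
  exact piv_comap_subset hT' _

theorem upper_top (X : Matrix (Fin p) (Fin q) ℂ) (v : Fin p ⊕ Fin q → ℂ) (i : Fin p ⊕ Fin q)
    (hv : ∀ l : Fin p ⊕ Fin q, rkU i < rkU l → v l = 0) :
    (fromBlocks 1 X 0 1 *ᵥ v) i = v i ∧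
      ∀ l : Fin p ⊕ Fin q, rkU i < rkU l → (fromBlocks 1 X 0 1 *ᵥ v) l = 0 := by
  rw [fromBlocks_mulVec]
  rcases i with i | i
  · have h0 : v ∘ Sum.inr = 0 := funext fun j => hv _ (by simp [rkU]; omega)
    rw [h0]
    refine ⟨by simp, ?_⟩
    rintro (l | l) hl
    · simpa using hv _ hl
    · simp
  · refine ⟨by simp, ?_⟩
    rintro (l | l) hl
    · simp [rkU] at hl; omega
    · simpa using hv _ hl

theorem lower_top (Y : Matrix (Fin q) (Fin p) ℂ) (v : Fin p ⊕ Fin q → ℂ) (i : Fin p ⊕ Fin q)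
    (hv : ∀ l : Fin p ⊕ Fin q, rkW i < rkW l → v l = 0) :
    (fromBlocks 1 0 Y 1 *ᵥ v) i = v i ∧
      ∀ l : Fin p ⊕ Fin q, rkW i < rkW l → (fromBlocks 1 0 Y 1 *ᵥ v) l = 0 := by
  rw [fromBlocks_mulVec]
  rcases i with i | i
  · refine ⟨by simp, ?_⟩
    rintro (l | l) hl
    · simpa using hv _ hl
    · simp [rkW] at hl; omega
  · have h0 : v ∘ Sum.inl = 0 := funext fun j => hv _ (by simp [rkW]; omega)
    rw [h0]
    refine ⟨by simp, ?_⟩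
    rintro (l | l) hl
    · simp
    · simpa using hv _ hl

theorem fromBlocks_mulVec_sum (A : Matrix (Fin p) (Fin p) ℂ) (B : Matrix (Fin p) (Fin q) ℂ)
    (C : Matrix (Fin q) (Fin p) ℂ) (D : Matrix (Fin q) (Fin q) ℂ) (u : Fin p → ℂ) (y : Fin q → ℂ) :
    fromBlocks A B C D *ᵥ Sum.elim u y = Sum.elim (A *ᵥ u + B *ᵥ y) (C *ᵥ u + D *ᵥ y) := by
  rw [fromBlocks_mulVec]; rfl

theorem qf_J0_elim (u : Fin p → ℂ) (y : Fin q → ℂ) :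
    qf (J0 p q) (Sum.elim u y) = nsq u - nsq y := by
  rw [J0, qf_diagonal, Fintype.sum_sum_type]
  simp [sg, nsq, sub_eq_add_neg]

theorem qf_frame {w : Matrix (Fin p ⊕ Fin q) (Fin p ⊕ Fin q) ℂ} (hw : wᴴ * J0 p q * w = J0 p q)
    (v : Fin p ⊕ Fin q → ℂ) : qf (J0 p q) (w *ᵥ v) = qf (J0 p q) v := by
  rw [← qf_conj, hw]

theorem isUnit_det_corner {w : Matrix (Fin p ⊕ Fin q) (Fin p ⊕ Fin q) ℂ}
    (hw : wᴴ * J0 p q * w = J0 p q) : IsUnit w.toBlocks₂₂.det := by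
  rw [isUnit_iff_ne_zero]
  intro h0
  obtain ⟨y, hy, h⟩ := exists_mulVec_eq_zero_iff.2 h0
  have h1 := qf_frame hw (Sum.elim 0 y)
  rw [← fromBlocks_toBlocks w, fromBlocks_mulVec_sum, qf_J0_elim, qf_J0_elim, h] at h1
  simp [nsq] at h1
  have h2 := nsq_pos hy
  have h3 := nsq_nonneg (w.toBlocks₁₂ *ᵥ y)
  simp only [nsq] at h2 h3
  linarith

/-- The triangular data attached to three pseudo-unitary frames. -/
theorem exists_derived {w : Option Bool → Matrix (Fin p ⊕ Fin q) (Fin p ⊕ Fin q) ℂ}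
    (hw : ∀ t, (w t)ᴴ * J0 p q * w t = J0 p q) (hw1 : w none = 1)
    {al : Option Bool → Fin p ⊕ Fin q → ℝ}
    (hsum : ∑ t, w t * diagonal (fun i => ((al t i : ℝ) : ℂ)) * (w t)⁻¹ = 0)
    (hal : ∀ t i j, rkT t j ≤ rkT t i → 0 ≤ sg i * sg j * (al t j - al t i)) :
    ∃ (AU : Bool → Matrix (Fin p) (Fin p) ℂ) (AW : Bool → Matrix (Fin q) (Fin q) ℂ)
      (X : Matrix (Fin p) (Fin q) ℂ), (∀ b, IsUnit (AU b).det) ∧ (∀ b, IsUnit (AW b).det) ∧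
      KSemi (frU AU) (frU AW) X (fun t i => al t (Sum.inl i)) (fun t i => al t (Sum.inr i)) ∧
      ((∀ V : Submodule ℂ (Fin p ⊕ Fin q → ℂ),
        (∀ t, ∀ v ∈ V, (w t * diagonal (fun i => ((al t i : ℝ) : ℂ)) * (w t)⁻¹) *ᵥ v ∈ V) →
          V = ⊥ ∨ V = ⊤) →
      KStable (frU AU) (frU AW) X (fun t i => al t (Sum.inl i)) (fun t i => al t (Sum.inr i))) := by
  let S : Bool → Matrix (Fin q) (Fin q) ℂ := fun b => (w (some b)).toBlocks₂₂
  let Q : Bool → Matrix (Fin p) (Fin q) ℂ := fun b => (w (some b)).toBlocks₁₂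
  let R : Bool → Matrix (Fin q) (Fin p) ℂ := fun b => (w (some b)).toBlocks₂₁
  let P : Bool → Matrix (Fin p) (Fin p) ℂ := fun b => (w (some b)).toBlocks₁₁
  have hwb : ∀ b, w (some b) = fromBlocks (P b) (Q b) (R b) (S b) := fun b =>
    (fromBlocks_toBlocks _).symm
  have hS : ∀ b, IsUnit (S b).det := fun b => isUnit_det_corner (hw _)
  let Y : Bool → Matrix (Fin q) (Fin p) ℂ := fun b => -((S b)⁻¹ * R b)
  let AU : Bool → Matrix (Fin p) (Fin p) ℂ := fun b => P b + Q b * Y b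
  let XX : Bool → Matrix (Fin p) (Fin q) ℂ := fun b => Q b * (S b)⁻¹
  have hE : ∀ b, w (some b) * fromBlocks 1 0 (Y b) 1 = frm AU S XX (some b) := by
    intro b
    rw [hwb, fromBlocks_multiply]
    simp only [Matrix.mul_one, Matrix.mul_zero, zero_add, frm, XX]
    rw [Matrix.mul_assoc, nonsing_inv_mul _ (hS b), Matrix.mul_one]
    congr 1
    change R b + S b * -((S b)⁻¹ * R b) = 0
    rw [Matrix.mul_neg, ← Matrix.mul_assoc, mul_nonsing_inv _ (hS b), Matrix.one_mul, add_neg_cancel]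
  have hAU : ∀ b, IsUnit (AU b).det := by
    intro b
    have h := congrArg Matrix.det (hE b)
    rw [det_mul, det_fromBlocks_zero₁₂, frm, det_fromBlocks_zero₂₁] at h
    simp only [det_one, mul_one] at h
    have h1 := (isUnit_det_of_frame (hw (some b))).1
    rw [h] at h1
    exact isUnit_of_mul_isUnit_left h1
  refine ⟨AU, S, XX true - XX false, hAU, hS, ?_⟩
  have hd : ∀ b, S b * (S b)⁻¹ = 1 := fun b => mul_nonsing_inv _ (hS b)
  let V : Submodule ℂ (Fin p → ℂ) → Submodule ℂ (Fin q → ℂ) → Submodule ℂ (Fin p ⊕ Fin q → ℂ) :=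
    fun VU VW => (prodSub VU VW).comap (mulVecLin (fromBlocks 1 (-XX true) 0 1))
  have hVelim : ∀ VU VW u y, Sum.elim u y ∈ V VU VW ↔ u - XX true *ᵥ y ∈ VU ∧ y ∈ VW := by
    intro VU VW u y
    change mulVecLin _ _ ∈ prodSub VU VW ↔ _
    rw [mulVecLin_apply, fromBlocks_mulVec_sum, mem_prodSub]
    simp [neg_mulVec, sub_eq_add_neg]
  have hVelim' : ∀ VU VW, (∀ z ∈ VW, (XX true - XX false) *ᵥ z ∈ VU) → ∀ b u y,
      Sum.elim u y ∈ V VU VW ↔ u - XX b *ᵥ y ∈ VU ∧ y ∈ VW := by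
    intro VU VW hadm b u y
    rw [hVelim]
    cases b
    · constructor
      · rintro ⟨h1, h2⟩
        refine ⟨?_, h2⟩
        have := VU.add_mem h1 (hadm y h2)
        rw [sub_mulVec] at this
        convert this using 1
        abel
      · rintro ⟨h1, h2⟩
        refine ⟨?_, h2⟩
        have := VU.sub_mem h1 (hadm y h2)
        rw [sub_mulVec] at this
        convert this using 1
        abel
    · rfl
  have hsplit : ∀ v : Fin p ⊕ Fin q → ℂ, ∃ u y, v = Sum.elim u y := fun v =>
    ⟨v ∘ Sum.inl, v ∘ Sum.inr, (Sum.elim_comp_inl_inr v).symm⟩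
  have hgraph : ∀ b y, w (some b) *ᵥ Sum.elim (0 : Fin p → ℂ) ((S b)⁻¹ *ᵥ y)
      = Sum.elim (XX b *ᵥ y) y := by
    intro b y
    rw [hwb, fromBlocks_mulVec_sum, mulVec_mulVec, mulVec_mulVec, hd]
    simp [XX]
  have hslope : ∀ VU VW, (∀ z ∈ VW, (XX true - XX false) *ᵥ z ∈ VU) →
      slope (frU AU) (frU S) (fun t i => al t (Sum.inl i)) (fun t i => al t (Sum.inr i)) VU VW
      = ∑ t, ∑ i ∈ piv (rkT t) ((V VU VW).comap (mulVecLin (w t))), al t i := by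
    intro VU VW hadm
    rw [slope]
    refine Finset.sum_congr rfl fun t _ => ?_
    rw [← Finset.sum_disjSum]
    congr 1
    cases t with
    | none =>
      rw [hw1]
      have h1 : (V VU VW).comap (mulVecLin (1 : Matrix (Fin p ⊕ Fin q) (Fin p ⊕ Fin q) ℂ))
          = V VU VW := by
        ext v; simp
      have h2 : VU.comap (mulVecLin (frU AU none)) = VU := by ext v; simp [frU]
      have h3 : VW.comap (mulVecLin (frU S none)) = VW := by ext v; simp [frU]
      rw [h1, h2, h3, ← piv_prodSub rkU_inl_lt rkU_inr_lt]
      refine (piv_comap_eq (T' := fromBlocks 1 (XX true) 0 1) ?_ (fun v i => upper_top _ v i)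
        (fun v i => upper_top _ v i) _).symm
      rw [fromBlocks_multiply]; simp
    | some b =>
      rw [← piv_prodSub rkW_inl_lt rkW_inr_lt]
      have h1 : prodSub (VU.comap (mulVecLin (frU AU (some b))))
          (VW.comap (mulVecLin (frU S (some b))))
          = ((V VU VW).comap (mulVecLin (w (some b)))).comap
            (mulVecLin (fromBlocks 1 0 (Y b) 1)) := by
        ext v
        obtain ⟨u, y, rfl⟩ := hsplit v
        rw [mem_prodSub, Submodule.mem_comap, Submodule.mem_comap, Submodule.mem_comap,
          Submodule.mem_comap, mulVecLin_apply, mulVecLin_apply, mulVecLin_apply, mulVecLin_apply,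
          mulVec_mulVec, hE, frm, fromBlocks_mulVec_sum, hVelim' VU VW hadm b]
        simp [frU, mulVec_mulVec]
      rw [h1]
      refine piv_comap_eq (T' := fromBlocks 1 0 (-Y b) 1) ?_ (fun v i => lower_top _ v i)
        (fun v i => lower_top _ v i) _
      rw [fromBlocks_multiply]; simp
  have hsign : ∀ VU VW, (∀ z ∈ VW, (XX true - XX false) *ᵥ z ∈ VU) →
      ∀ (t : Option Bool) (i : Fin p ⊕ Fin q),
      ∀ v ∈ (V VU VW).comap (mulVecLin (w t)), v ≠ 0 → v ∈ low (rkT t) (rkT t i + 1) →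
      (∀ l ∈ (V VU VW).comap (mulVecLin (w t)) ⊓ low (rkT t) (rkT t i),
        star l ⬝ᵥ J0 p q *ᵥ v = 0) → 0 < sg i * qf (J0 p q) v := by
    intro VU VW hadm t
    cases t with
    | none =>
      refine sign_of_decomposition sg_mul_self (e := 1) ?_ (by norm_num) _ ?_
      · rintro (i | i) (j | j) h1 h2
        · norm_num [sg] at h2
        · simp [rkT, rkU]; omega
        · norm_num [sg] at h1
        · norm_num [sg] at h1
      · intro v hv
        obtain ⟨u, y, rfl⟩ := hsplit v
        rw [hw1, Submodule.mem_comap, mulVecLin_apply, one_mulVec, hVelim] at hv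
        refine ⟨Sum.elim (u - XX true *ᵥ y) 0, ?_, ?_, ?_⟩
        · rw [hw1, Submodule.mem_comap, mulVecLin_apply, one_mulVec, hVelim]
          simpa using hv.1
        · rintro (j | j) h
          · norm_num [sg] at h
          · rfl
        · have e : (Sum.elim u y - Sum.elim (u - XX true *ᵥ y) 0 : Fin p ⊕ Fin q → ℂ)
              = Sum.elim (XX true *ᵥ y) y := by
            ext (i | i) <;> simp
          rw [e]
          intro hne
          have h1 := qf_frame (hw (some true)) (Sum.elim (0 : Fin p → ℂ) ((S true)⁻¹ *ᵥ y))
          rw [hgraph, qf_J0_elim 0] at h1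
          change 0 < -1 * qf (J0 p q) _
          rw [h1]
          have hy : (S true)⁻¹ *ᵥ y ≠ 0 := by
            intro h
            apply hne
            rw [← hgraph, h]
            rw [(elim_zero_iff _ _).2 ⟨rfl, rfl⟩, mulVec_zero]
          have := nsq_pos hy
          have h0 : nsq (0 : Fin p → ℂ) = 0 := by simp [nsq]
          rw [h0]
          linarith
    | some b =>
      refine sign_of_decomposition sg_mul_self (e := -1) ?_ (by norm_num) _ ?_
      · rintro (i | i) (j | j) h1 h2
        · norm_num [sg] at h1
        · norm_num [sg] at h1
        · simp [rkT, rkW]; omega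
        · norm_num [sg] at h2
      · intro v hv
        rw [Submodule.mem_comap, mulVecLin_apply] at hv
        obtain ⟨u, y, huy⟩ := hsplit (w (some b) *ᵥ v)
        rw [huy, hVelim' VU VW hadm b] at hv
        refine ⟨Sum.elim (0 : Fin p → ℂ) ((S b)⁻¹ *ᵥ y), ?_, ?_, ?_⟩
        · rw [Submodule.mem_comap, mulVecLin_apply, hgraph, hVelim' VU VW hadm b]
          simpa using hv.2
        · rintro (j | j) h
          · rfl
          · norm_num [sg] at h
        · intro hne
          have h1 := qf_frame (hw (some b)) (v - Sum.elim (0 : Fin p → ℂ) ((S b)⁻¹ *ᵥ y))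
          rw [mulVec_sub, huy, hgraph] at h1
          have e : (Sum.elim u y - Sum.elim (XX b *ᵥ y) y : Fin p ⊕ Fin q → ℂ)
              = Sum.elim (u - XX b *ᵥ y) 0 := by
            ext (i | i) <;> simp
          rw [e, qf_J0_elim] at h1
          have hu : u - XX b *ᵥ y ≠ 0 := by
            intro h
            apply hne
            have h2 : w (some b) *ᵥ (v - Sum.elim (0 : Fin p → ℂ) ((S b)⁻¹ *ᵥ y)) = 0 := by
              rw [mulVec_sub, huy, hgraph, e, h, (elim_zero_iff _ _).2 ⟨rfl, rfl⟩]
            have h3 := congrArg (fun z => (w (some b))⁻¹ *ᵥ z) h2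
            simpa [mulVec_mulVec, nonsing_inv_mul _ (isUnit_det_of_frame (hw (some b))).1]
              using h3
          have := nsq_pos hu
          have h0 : nsq (0 : Fin q → ℂ) = 0 := by simp [nsq]
          change 0 < - -1 * qf (J0 p q) _
          rw [← h1, h0]
          linarith
  have hmain := fun VU VW hadm => sum_piv_le hw rkT_inj hsum hal (V VU VW) (hsign VU VW hadm)
  refine ⟨fun VU VW hadm => ?_, fun hirr VU VW hadm hbot htop => ?_⟩
  · rw [hslope VU VW hadm]
    exact (hmain VU VW hadm).1
  · change slope (frU AU) (frU S) (fun t i => al t (Sum.inl i)) (fun t i => al t (Sum.inr i)) VU VW < 0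
    rw [hslope VU VW hadm]
    by_contra hcon
    rcases hirr _ ((hmain VU VW hadm).2 (not_lt.1 hcon)) with h | h
    · apply hbot
      constructor
      · rw [eq_bot_iff]
        intro u hu
        have : Sum.elim u 0 ∈ V VU VW := by rw [hVelim]; simpa using hu
        rw [h, Submodule.mem_bot, elim_zero_iff] at this
        exact this.1
      · rw [eq_bot_iff]
        intro y hy
        have : Sum.elim (XX true *ᵥ y) y ∈ V VU VW := by rw [hVelim]; simpa using hy
        rw [h, Submodule.mem_bot, elim_zero_iff] at this
        exact this.2
    · apply htop
      have hall : ∀ u y, Sum.elim u y ∈ V VU VW := fun u y => by rw [h]; trivial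
      constructor
      · rw [eq_top_iff]
        intro u _
        simpa using ((hVelim _ _ _ _).1 (hall u 0)).1
      · rw [eq_top_iff]
        intro y _
        exact ((hVelim _ _ _ _).1 (hall 0 y)).2

end Derived

section Pencil

variable {p q : ℕ}

theorem posDef_factor {n : Type*} [Fintype n] [DecidableEq n] {K : Matrix n n ℂ} (hK : K.PosDef) :
    ∃ C : Matrix n n ℂ, IsUnit C.det ∧ K = Cᴴ * C := by
  obtain ⟨k, d, h1, h2, h3⟩ := spectral K hK.isHermitian
  have hd : ∀ i, 0 ≤ d i := by
    intro i
    have h := qf_nonneg hK (kᴴ *ᵥ Pi.single i 1)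
    rw [h3, qf_conj, mulVec_mulVec, h2, one_mulVec, qf_diagonal, Finset.sum_eq_single i] at h
    · simpa using h
    · intro b _ hb; simp [hb]
    · simp
  have e : K = (diagonal (fun i => ((Real.sqrt (d i) : ℝ) : ℂ)) * k)ᴴ
      * (diagonal (fun i => ((Real.sqrt (d i) : ℝ) : ℂ)) * k) := by
    rw [conjTranspose_mul, diagonal_conjTranspose, Matrix.mul_assoc, ← Matrix.mul_assoc (diagonal _),
      diagonal_mul_diagonal, ← Matrix.mul_assoc]
    conv_lhs => rw [h3]
    congr 3
    ext i
    rw [Pi.star_apply]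
    change _ = (starRingEnd ℂ) _ * _
    rw [Complex.conj_ofReal, ← Complex.ofReal_mul, Real.mul_self_sqrt (hd i)]
  refine ⟨_, ?_, e⟩
  have := posDef_det_ne hK
  rw [e, det_mul] at this
  exact isUnit_iff_ne_zero.2 (right_ne_zero_of_mul this)

/-- A form takes definite values on a subspace of dimension at most its index. -/
theorem card_le_of_definite {m n l : Type} [Fintype m] [DecidableEq m] [Fintype n] [DecidableEq n]
    [Fintype l] [DecidableEq l] (f : (n → ℂ) →ₗ[ℂ] (l → ℂ)) (F : (n → ℂ) → ℝ)
    (hF : ∀ v, f v = 0 → F v ≤ 0) (s : Finset n)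
    (hs : ∀ v : n → ℂ, v ≠ 0 → (∀ i ∉ s, v i = 0) → 0 < F v) : s.card ≤ Fintype.card l := by
  let ext : (s → ℂ) →ₗ[ℂ] (n → ℂ) :=
    { toFun := fun x i => if h : i ∈ s then x ⟨i, h⟩ else 0
      map_add' := fun x y => by ext i; by_cases h : i ∈ s <;> simp [h]
      map_smul' := fun c x => by ext i; by_cases h : i ∈ s <;> simp [h] }
  have hinj : Function.Injective (f.comp ext) := by
    rw [injective_iff_map_eq_zero]
    intro x hx
    by_contra hx0
    have h1 : ext x ≠ 0 := by
      intro h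
      apply hx0
      ext ⟨i, hi⟩
      have := congrFun h i
      simpa [ext, hi] using this
    have h2 := hs (ext x) h1 (fun i hi => by simp [ext, hi])
    have h3 := hF (ext x) hx
    linarith
  have := LinearMap.finrank_le_finrank_of_injective hinj
  simpa using this

theorem exists_antitone_perm {n : ℕ} (y : Fin n → ℝ) : ∃ σ : Equiv.Perm (Fin n), Antitone (y ∘ σ) := by
  refine ⟨Tuple.sort (fun i => - y i), fun i j h => ?_⟩
  have := Tuple.monotone_sort (fun i => - y i) h
  simp only [Function.comp_apply] at this ⊢
  linarith

theorem rkU_eq (i : Fin p ⊕ Fin q) : rkU i = (finSumFinEquiv i : ℕ) := by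
  rcases i with i | i <;> simp [rkU]

/-- Rearranging reals with a prescribed number of positive entries. -/
theorem exists_sorting (y : Fin p ⊕ Fin q → ℝ) (h : (Finset.univ.filter fun i => 0 < y i).card = p) :
    ∃ σ : Equiv.Perm (Fin p ⊕ Fin q), (∀ i j, rkU i ≤ rkU j → y (σ j) ≤ y (σ i)) ∧
      (∀ i, 0 < y (σ (Sum.inl i))) ∧ ∀ j, y (σ (Sum.inr j)) ≤ 0 := by
  obtain ⟨τ, hτ⟩ := exists_antitone_perm (fun i => y (finSumFinEquiv.symm i) : Fin (p + q) → ℝ)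
  set σ : Equiv.Perm (Fin p ⊕ Fin q) := (finSumFinEquiv.trans τ).trans finSumFinEquiv.symm with hσ
  have hmono : ∀ i j, rkU i ≤ rkU j → y (σ j) ≤ y (σ i) := by
    intro i j hij
    rw [rkU_eq, rkU_eq] at hij
    exact hτ hij
  have hcard : (Finset.univ.filter fun i => 0 < y (σ i)).card = p := by
    refine Eq.trans ?_ h
    apply Finset.card_bij (fun i _ => σ i)
    · intro i hi; simpa using hi
    · intro i _ j _ hij; exact σ.injective hij
    · intro i hi
      exact ⟨σ.symm i, by simpa using hi, by simp⟩
  have hlow : ∀ b ≤ p + q, (Finset.univ.filter fun i : Fin p ⊕ Fin q => rkU i < b).card = b := by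
    intro b hb
    have : (Finset.univ.filter fun i : Fin p ⊕ Fin q => rkU i < b).card
        = (Finset.univ.filter fun i : Fin (p + q) => i.val < b).card := by
      apply Finset.card_bij (fun i _ => finSumFinEquiv i)
      · intro i hi; simpa [rkU_eq] using hi
      · intro i _ j _ hij; exact finSumFinEquiv.injective hij
      · intro i hi
        exact ⟨finSumFinEquiv.symm i, by simpa [rkU_eq] using hi, by simp⟩
    rw [this, Fin.card_filter_val_lt]
    omega
  refine ⟨σ, hmono, fun i => ?_, fun j => ?_⟩
  · by_contra hcon
    have hsub : (Finset.univ.filter fun k => 0 < y (σ k))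
        ⊆ Finset.univ.filter fun k : Fin p ⊕ Fin q => rkU k < rkU (Sum.inl i : Fin p ⊕ Fin q) := by
      intro k hk
      simp only [Finset.mem_filter, Finset.mem_univ, true_and] at hk ⊢
      by_contra hk'
      have := hmono _ _ (not_lt.1 hk')
      linarith
    have := Finset.card_le_card hsub
    have hi : rkU (Sum.inl i : Fin p ⊕ Fin q) = i.val := rfl
    rw [hcard, hi, hlow _ (by omega)] at this
    omega
  · by_contra hcon
    have hsub : (Finset.univ.filter fun k : Fin p ⊕ Fin q => rkU k < rkU (Sum.inr j : Fin p ⊕ Fin q) + 1)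
        ⊆ (Finset.univ.filter fun k => 0 < y (σ k)) := by
      intro k hk
      simp only [Finset.mem_filter, Finset.mem_univ, true_and] at hk ⊢
      have := hmono k (Sum.inr j) (by omega)
      linarith
    have := Finset.card_le_card hsub
    have hj : rkU (Sum.inr j : Fin p ⊕ Fin q) = p + j.val := rfl
    rw [hcard, hj, hlow _ (by omega)] at this
    omega

theorem exists_simultaneous {K : Matrix (Fin p ⊕ Fin q) (Fin p ⊕ Fin q) ℂ} (hD : K.PosDef) :
    ∃ (G : Matrix (Fin p ⊕ Fin q) (Fin p ⊕ Fin q) ℂ) (μ : Fin p ⊕ Fin q → ℝ), IsUnit G.det ∧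
      Gᴴ * G = K ∧ Gᴴ * diagonal (fun i => (μ i : ℂ)) * G = J0 p q := by
  obtain ⟨C, hC, hK⟩ := posDef_factor hD
  have hH : ((C⁻¹)ᴴ * J0 p q * C⁻¹).IsHermitian := isHermitian_conjTranspose_mul_mul _ J0_herm
  obtain ⟨k, μ, h1, h2, h3⟩ := spectral _ hH
  obtain ⟨G, hG⟩ : ∃ G, G = k * C := ⟨_, rfl⟩
  have hkd : IsUnit k.det := by
    have := congrArg Matrix.det h1
    rw [det_mul, det_one] at this
    exact isUnit_iff_ne_zero.2 (right_ne_zero_of_mul_eq_one this)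
  have hGd : IsUnit G.det := by rw [hG, det_mul]; exact hkd.mul hC
  have hGG : Gᴴ * G = K := by
    rw [hK, hG, conjTranspose_mul, Matrix.mul_assoc, ← Matrix.mul_assoc kᴴ, h1, Matrix.one_mul]
  have hCC : C⁻¹ * C = 1 := nonsing_inv_mul _ hC
  have hJG : Gᴴ * diagonal (fun i => (μ i : ℂ)) * G = J0 p q := by
    calc Gᴴ * diagonal (fun i => (μ i : ℂ)) * G
        = Cᴴ * (kᴴ * diagonal (fun i => (μ i : ℂ)) * k) * C := by
          rw [hG, conjTranspose_mul k C]; simp only [Matrix.mul_assoc]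
      _ = (C⁻¹ * C)ᴴ * J0 p q * (C⁻¹ * C) := by
          rw [← h3, conjTranspose_mul]; simp only [Matrix.mul_assoc]
      _ = J0 p q := by rw [hCC]; simp
  exact ⟨G, μ, hGd, hGG, hJG⟩

theorem card_pos_of_congruent {G : Matrix (Fin p ⊕ Fin q) (Fin p ⊕ Fin q) ℂ}
    {μ : Fin p ⊕ Fin q → ℝ} (hGd : IsUnit G.det)
    (hJG : Gᴴ * diagonal (fun i => (μ i : ℂ)) * G = J0 p q) :
    (∀ i, μ i ≠ 0) ∧ (Finset.univ.filter fun i => 0 < (μ i)⁻¹).card = p := by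
  have hGi : G * G⁻¹ = 1 := mul_nonsing_inv _ hGd
  have hμq : ∀ v, qf (J0 p q) (G⁻¹ *ᵥ v) = ∑ i, μ i * Complex.normSq (v i) := by
    intro v
    rw [← hJG, qf_conj, mulVec_mulVec, hGi, one_mulVec, qf_diagonal]
  have hμ0 : ∀ i, μ i ≠ 0 := by
    have hdet : (J0 p q).det ≠ 0 := fun h => by
      have h2 : (J0 p q).det * (J0 p q).det = 1 := by rw [← det_mul, J0_sq, det_one]
      simp [h] at h2
    rw [← hJG, det_mul, det_mul, det_diagonal] at hdet
    have := Finset.prod_ne_zero_iff.1 (right_ne_zero_of_mul (left_ne_zero_of_mul hdet))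
    intro i hi
    exact this i (Finset.mem_univ i) (by rw [hi]; simp)
  have hle : ∀ (e : ℝ) (s : Finset (Fin p ⊕ Fin q)) (v : Fin p ⊕ Fin q → ℂ), v ≠ 0 →
      (∀ i ∈ s, 0 < e * μ i) → (∀ i ∉ s, v i = 0) → 0 < e * qf (J0 p q) (G⁻¹ *ᵥ v) := by
    intro e s v hv hs hvs
    rw [hμq, Finset.mul_sum]
    have hnn : ∀ i, 0 ≤ e * (μ i * Complex.normSq (v i)) := by
      intro i
      by_cases hi : i ∈ s
      · rw [← mul_assoc]; exact mul_nonneg (hs i hi).le (Complex.normSq_nonneg _)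
      · simp [hvs i hi]
    obtain ⟨i, hi⟩ := Function.ne_iff.1 hv
    refine Finset.sum_pos' (fun i _ => hnn i) ⟨i, Finset.mem_univ i, ?_⟩
    have his : i ∈ s := by
      by_contra h
      exact hi (hvs i h)
    rw [← mul_assoc]
    exact mul_pos (hs i his) (Complex.normSq_pos.2 hi)
  have hpos : (Finset.univ.filter fun i => 0 < μ i).card ≤ p := by
    have := card_le_of_definite (m := Fin p)
      ((LinearMap.funLeft ℂ ℂ (Sum.inl : Fin p → Fin p ⊕ Fin q)).comp (mulVecLin G⁻¹))
      (fun v => 1 * qf (J0 p q) (G⁻¹ *ᵥ v)) (fun v hv => ?_) (Finset.univ.filter fun i => 0 < μ i)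
      (fun v hv hvs => hle 1 _ v hv (fun i hi => by simpa using hi) hvs)
    · simpa using this
    · have h0 : (G⁻¹ *ᵥ v) ∘ Sum.inl = 0 := hv
      rw [← Sum.elim_comp_inl_inr (G⁻¹ *ᵥ v), qf_J0_elim, h0]
      have := nsq_nonneg ((G⁻¹ *ᵥ v) ∘ Sum.inr)
      have h1 : nsq (0 : Fin p → ℂ) = 0 := by simp [nsq]
      linarith
  have hneg : (Finset.univ.filter fun i => ¬ 0 < μ i).card ≤ q := by
    have := card_le_of_definite (m := Fin p)
      ((LinearMap.funLeft ℂ ℂ (Sum.inr : Fin q → Fin p ⊕ Fin q)).comp (mulVecLin G⁻¹))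
      (fun v => (-1) * qf (J0 p q) (G⁻¹ *ᵥ v)) (fun v hv => ?_)
      (Finset.univ.filter fun i => ¬ 0 < μ i)
      (fun v hv hvs => hle (-1) _ v hv (fun i hi => by
        have h5 : μ i ≤ 0 := by simpa using hi
        have := lt_of_le_of_ne h5 (hμ0 i)
        linarith) hvs)
    · simpa using this
    · have h0 : (G⁻¹ *ᵥ v) ∘ Sum.inr = 0 := hv
      rw [← Sum.elim_comp_inl_inr (G⁻¹ *ᵥ v), qf_J0_elim, h0]
      have := nsq_nonneg ((G⁻¹ *ᵥ v) ∘ Sum.inl)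
      have h1 : nsq (0 : Fin q → ℂ) = 0 := by simp [nsq]
      linarith
  have hcard : (Finset.univ.filter fun i => 0 < (μ i)⁻¹).card = p := by
    simp only [inv_pos]
    have := Finset.card_filter_add_card_filter_not (s := Finset.univ) fun i => 0 < μ i
    rw [Finset.card_univ, Fintype.card_sum, Fintype.card_fin, Fintype.card_fin] at this
    omega
  exact ⟨hμ0, hcard⟩

theorem exists_normalization {μ : Fin p ⊕ Fin q → ℝ} (hμ0 : ∀ i, μ i ≠ 0)
    (hcard : (Finset.univ.filter fun i => 0 < (μ i)⁻¹).card = p) :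
    ∃ (σ : Equiv.Perm (Fin p ⊕ Fin q)) (N : Matrix (Fin p ⊕ Fin q) (Fin p ⊕ Fin q) ℂ),
      (∀ i j, rkU i ≤ rkU j → (μ (σ j))⁻¹ ≤ (μ (σ i))⁻¹) ∧ (∀ i, 0 < (μ (σ (Sum.inl i)))⁻¹) ∧
      (∀ j, (μ (σ (Sum.inr j)))⁻¹ ≤ 0) ∧
      (∀ d : Fin p ⊕ Fin q → ℂ, diagonal d * N = N * diagonal (fun i => d (σ i))) ∧
      Nᴴ * diagonal (fun i => (μ i : ℂ)) * N = J0 p q := by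
  obtain ⟨σ, hσ, hσp, hσn⟩ := exists_sorting (fun i => (μ i)⁻¹) hcard
  let N : Matrix (Fin p ⊕ Fin q) (Fin p ⊕ Fin q) ℂ :=
    Matrix.of fun j i => if j = σ i then (((Real.sqrt |μ j|)⁻¹ : ℝ) : ℂ) else 0
  have hNd : ∀ d : Fin p ⊕ Fin q → ℂ, diagonal d * N = N * diagonal (fun i => d (σ i)) := by
    intro d
    ext j i
    rw [diagonal_mul, mul_diagonal]
    by_cases h : j = σ i
    · rw [h, mul_comm]
    · simp [N, h]
  have hsgn : ∀ i, μ (σ i) * |μ (σ i)|⁻¹ = sg i := by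
    intro i
    have h0 : |μ (σ i)| ≠ 0 := abs_ne_zero.2 (hμ0 _)
    rcases i with i | i
    · have h5 : 0 < μ (σ (Sum.inl i)) := by simpa using hσp i
      rw [abs_of_pos h5, mul_inv_cancel₀ h5.ne']; rfl
    · have h5 : μ (σ (Sum.inr i)) < 0 :=
        lt_of_le_of_ne (by simpa using hσn i) (hμ0 _)
      rw [abs_of_neg h5, inv_neg, mul_neg, mul_inv_cancel₀ h5.ne]; rfl
  have hNN : Nᴴ * diagonal (fun i => (μ i : ℂ)) * N = J0 p q := by
    rw [Matrix.mul_assoc, hNd]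
    ext i j
    rw [Matrix.mul_apply, Finset.sum_eq_single (σ i), conjTranspose_apply, mul_diagonal, J0]
    · by_cases h : i = j
      · subst h
        rw [diagonal_apply_eq, ← hsgn i]
        have h0 : 0 < |μ (σ i)| := abs_pos.2 (hμ0 _)
        simp only [N, of_apply, if_true]
        change (starRingEnd ℂ) _ * _ = _
        rw [Complex.conj_ofReal, ← Complex.ofReal_mul, ← Complex.ofReal_mul]
        congr 1
        rw [← mul_assoc, ← mul_inv, Real.mul_self_sqrt h0.le]
        ring
      · rw [diagonal_apply_ne _ h]
        have : σ i ≠ σ j := fun h' => h (σ.injective h')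
        simp [N, this]
    · intro k _ hk
      rw [conjTranspose_apply]
      simp [N, hk]
    · simp
  exact ⟨σ, N, hσ, hσp, hσn, hNd, hNN⟩

set_option maxHeartbeats 800000 in
/-- Pseudo-unitary diagonalisation of a definite pencil. -/
theorem exists_diagonalization {D : Matrix (Fin p ⊕ Fin q) (Fin p ⊕ Fin q) ℂ} {s : ℝ}
    (hD : (J0 p q * (D - (s : ℂ) • 1)).PosDef) :
    ∃ (w : Matrix (Fin p ⊕ Fin q) (Fin p ⊕ Fin q) ℂ) (y : Fin p ⊕ Fin q → ℝ),
      wᴴ * J0 p q * w = J0 p q ∧ D = w * diagonal (fun i => ((y i : ℝ) : ℂ)) * w⁻¹ ∧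
      (∀ i j, rkU i ≤ rkU j → y j ≤ y i) ∧ (∀ i, s < y (Sum.inl i)) ∧ ∀ j, y (Sum.inr j) < s := by
  obtain ⟨G, μ, hGd, hGG, hJG⟩ := exists_simultaneous hD
  obtain ⟨hμ0, hcard⟩ := card_pos_of_congruent hGd hJG
  obtain ⟨σ, N, hσ, hσp, hσn, hNd, hNN⟩ := exists_normalization hμ0 hcard
  have hGi : G * G⁻¹ = 1 := mul_nonsing_inv _ hGd
  have hw : (G⁻¹ * N)ᴴ * J0 p q * (G⁻¹ * N) = J0 p q := by
    calc (G⁻¹ * N)ᴴ * J0 p q * (G⁻¹ * N)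
        = (G⁻¹ * N)ᴴ * (Gᴴ * diagonal (fun i => (μ i : ℂ)) * G) * (G⁻¹ * N) := by rw [hJG]
      _ = Nᴴ * ((G * G⁻¹)ᴴ * diagonal (fun i => (μ i : ℂ)) * (G * G⁻¹)) * N := by
          rw [conjTranspose_mul G⁻¹ N, conjTranspose_mul G G⁻¹]; simp only [Matrix.mul_assoc]
      _ = J0 p q := by rw [hGi, conjTranspose_one, Matrix.one_mul, Matrix.mul_one, hNN]
  have hwd := (isUnit_det_of_frame hw).1
  have hμμ : diagonal (fun i => (((μ i)⁻¹ : ℝ) : ℂ)) * diagonal (fun i => (μ i : ℂ)) = 1 := by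
    rw [diagonal_mul_diagonal, ← diagonal_one]
    congr 1
    ext i
    rw [← Complex.ofReal_mul, inv_mul_cancel₀ (hμ0 i)]; simp
  have hDG : D - (s : ℂ) • 1 = G⁻¹ * diagonal (fun i => (((μ i)⁻¹ : ℝ) : ℂ)) * G := by
    have hJG' : J0 p q * (G⁻¹ * diagonal (fun i => (((μ i)⁻¹ : ℝ) : ℂ)) * G) = Gᴴ * G := by
      calc J0 p q * (G⁻¹ * diagonal (fun i => (((μ i)⁻¹ : ℝ) : ℂ)) * G)
          = (Gᴴ * diagonal (fun i => (μ i : ℂ)) * G)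
            * (G⁻¹ * diagonal (fun i => (((μ i)⁻¹ : ℝ) : ℂ)) * G) := by rw [hJG]
        _ = Gᴴ * (diagonal (fun i => (μ i : ℂ)) * (G * G⁻¹)
            * diagonal (fun i => (((μ i)⁻¹ : ℝ) : ℂ))) * G := by simp only [Matrix.mul_assoc]
        _ = _ := by rw [hGi, Matrix.mul_one, mul_eq_one_comm.1 hμμ, Matrix.mul_one]
    rw [hGG] at hJG'
    have := congrArg (fun M => J0 p q * M) hJG'
    simpa only [← Matrix.mul_assoc, J0_sq, Matrix.one_mul, eq_comm] using this.symm
  refine ⟨G⁻¹ * N, fun i => s + (μ (σ i))⁻¹, hw, ?_, fun i j hij => ?_, fun i => ?_, fun j => ?_⟩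
  · have e1 : D * (G⁻¹ * N) = G⁻¹ * N * diagonal (fun i => ((s + (μ (σ i))⁻¹ : ℝ) : ℂ)) := by
      have e2 : D = (s : ℂ) • 1 + G⁻¹ * diagonal (fun i => (((μ i)⁻¹ : ℝ) : ℂ)) * G := by
        rw [← hDG]; abel
      have e3 : diagonal (fun i => ((s + (μ (σ i))⁻¹ : ℝ) : ℂ))
          = (s : ℂ) • (1 : Matrix (Fin p ⊕ Fin q) (Fin p ⊕ Fin q) ℂ)
            + diagonal (fun i => (((μ (σ i))⁻¹ : ℝ) : ℂ)) := by
        rw [smul_one_eq_diagonal, diagonal_add]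
        congr 1; ext i; push_cast; rfl
      have e4 : G⁻¹ * diagonal (fun i => (((μ i)⁻¹ : ℝ) : ℂ)) * G * (G⁻¹ * N)
          = G⁻¹ * N * diagonal (fun i => (((μ (σ i))⁻¹ : ℝ) : ℂ)) := by
        calc G⁻¹ * diagonal (fun i => (((μ i)⁻¹ : ℝ) : ℂ)) * G * (G⁻¹ * N)
            = G⁻¹ * (diagonal (fun i => (((μ i)⁻¹ : ℝ) : ℂ)) * (G * G⁻¹) * N) := by
              simp only [Matrix.mul_assoc]
          _ = _ := by rw [hGi, Matrix.mul_one, hNd, Matrix.mul_assoc]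
      have e5 : ∀ M : Matrix (Fin p ⊕ Fin q) (Fin p ⊕ Fin q) ℂ,
          (s : ℂ) • (1 : Matrix (Fin p ⊕ Fin q) (Fin p ⊕ Fin q) ℂ) * M
          = M * ((s : ℂ) • (1 : Matrix (Fin p ⊕ Fin q) (Fin p ⊕ Fin q) ℂ)) := fun M => by
        rw [smul_mul_assoc, mul_smul_comm, Matrix.one_mul, Matrix.mul_one]
      rw [e3, e2, Matrix.add_mul, Matrix.mul_add, e4, e5]
    rw [← e1, Matrix.mul_assoc, mul_nonsing_inv _ hwd, Matrix.mul_one]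
  · have := hσ i j hij; simp only at this ⊢; linarith
  · have := hσp i; simp only at this ⊢; linarith
  · have := lt_of_le_of_ne (hσn j) (inv_ne_zero (hμ0 _)); simp only at this ⊢; linarith

end Pencil

section Sums

variable {p q : ℕ}

theorem frame_mul {g w : Matrix (Fin p ⊕ Fin q) (Fin p ⊕ Fin q) ℂ} (hg : gᴴ * J0 p q * g = J0 p q)
    (hw : wᴴ * J0 p q * w = J0 p q) : (g * w)ᴴ * J0 p q * (g * w) = J0 p q := by
  calc (g * w)ᴴ * J0 p q * (g * w) = wᴴ * (gᴴ * J0 p q * g) * w := by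
        rw [conjTranspose_mul g w]; simp only [Matrix.mul_assoc]
    _ = J0 p q := by rw [hg, hw]

theorem inv_conj_of_frame {J w : Matrix (Fin p ⊕ Fin q) (Fin p ⊕ Fin q) ℂ}
    (hw : wᴴ * J * w = J0 p q) : (w⁻¹)ᴴ * J0 p q * w⁻¹ = J := by
  have hwd := (isUnit_det_of_frame hw).1
  calc (w⁻¹)ᴴ * J0 p q * w⁻¹ = (w⁻¹)ᴴ * (wᴴ * J * w) * w⁻¹ := by rw [hw]
    _ = (w * w⁻¹)ᴴ * J * (w * w⁻¹) := by
        rw [conjTranspose_mul w w⁻¹]; simp only [Matrix.mul_assoc]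
    _ = J := by rw [mul_nonsing_inv _ hwd]; simp

theorem frame_inv {w : Matrix (Fin p ⊕ Fin q) (Fin p ⊕ Fin q) ℂ}
    (hw : wᴴ * J0 p q * w = J0 p q) : (w⁻¹)ᴴ * J0 p q * w⁻¹ = J0 p q := inv_conj_of_frame hw

theorem J0_conj_frame {w : Matrix (Fin p ⊕ Fin q) (Fin p ⊕ Fin q) ℂ}
    (hw : wᴴ * J0 p q * w = J0 p q) (M : Matrix (Fin p ⊕ Fin q) (Fin p ⊕ Fin q) ℂ) :
    J0 p q * (w * M * w⁻¹) = (w⁻¹)ᴴ * (J0 p q * M) * w⁻¹ := by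
  have hwd := (isUnit_det_of_frame hw).1
  have h : J0 p q * w = (w⁻¹)ᴴ * J0 p q := by
    calc J0 p q * w = ((w⁻¹)ᴴ * J0 p q * w⁻¹) * w := by rw [frame_inv hw]
      _ = _ := by rw [Matrix.mul_assoc _ w⁻¹ w, nonsing_inv_mul _ hwd, Matrix.mul_one]
  rw [← Matrix.mul_assoc, ← Matrix.mul_assoc, h]
  simp only [Matrix.mul_assoc]

theorem J0_mul_sub {w : Matrix (Fin p ⊕ Fin q) (Fin p ⊕ Fin q) ℂ}
    (hw : wᴴ * J0 p q * w = J0 p q) (a : Fin p ⊕ Fin q → ℝ) (s : ℝ) :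
    J0 p q * (w * diagonal (fun i => ((a i : ℝ) : ℂ)) * w⁻¹ - (s : ℂ) • 1)
      = (w⁻¹)ᴴ * diagonal (fun i => ((sg i * (a i - s) : ℝ) : ℂ)) * w⁻¹ := by
  have hwd := (isUnit_det_of_frame hw).1
  have h1 : w * diagonal (fun i => ((a i : ℝ) : ℂ)) * w⁻¹ - (s : ℂ) • 1
      = w * diagonal (fun i => ((a i - s : ℝ) : ℂ)) * w⁻¹ := by
    have h2 : diagonal (fun i => ((a i - s : ℝ) : ℂ)) = diagonal (fun i => ((a i : ℝ) : ℂ))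
        - (s : ℂ) • (1 : Matrix (Fin p ⊕ Fin q) (Fin p ⊕ Fin q) ℂ) := by
      rw [smul_one_eq_diagonal, diagonal_sub]
      congr 1; ext i; push_cast; rfl
    rw [h2, Matrix.mul_sub, Matrix.sub_mul, Matrix.mul_smul, Matrix.smul_mul, Matrix.mul_one,
      mul_nonsing_inv _ hwd]
  rw [h1, J0_conj_frame hw, J0, diagonal_mul_diagonal]
  simp only [Complex.ofReal_mul]

theorem qf_J0_mul_sub {w : Matrix (Fin p ⊕ Fin q) (Fin p ⊕ Fin q) ℂ}
    (hw : wᴴ * J0 p q * w = J0 p q) (a : Fin p ⊕ Fin q → ℝ) (s : ℝ) (v : Fin p ⊕ Fin q → ℂ) :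
    qf (J0 p q * (w * diagonal (fun i => ((a i : ℝ) : ℂ)) * w⁻¹ - (s : ℂ) • 1)) v
      = ∑ i, sg i * (a i - s) * Complex.normSq ((w⁻¹ *ᵥ v) i) := by
  rw [J0_mul_sub hw, qf_conj, qf_diagonal]

theorem isHermitian_J0_mul_sub {w : Matrix (Fin p ⊕ Fin q) (Fin p ⊕ Fin q) ℂ}
    (hw : wᴴ * J0 p q * w = J0 p q) (a : Fin p ⊕ Fin q → ℝ) (s : ℝ) :
    (J0 p q * (w * diagonal (fun i => ((a i : ℝ) : ℂ)) * w⁻¹ - (s : ℂ) • 1)).IsHermitian := by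
  rw [J0_mul_sub hw]
  refine isHermitian_conjTranspose_mul_mul _ ?_
  rw [Matrix.IsHermitian, diagonal_conjTranspose]
  congr 1; ext i; simp

/-- The number `s` separates the two blocks of `a`. -/
def Sep (a : Fin p ⊕ Fin q → ℝ) (s : ℝ) : Prop :=
  (∀ i, s ≤ a (Sum.inl i)) ∧ ∀ j, a (Sum.inr j) ≤ s

theorem Sep.nonneg {a : Fin p ⊕ Fin q → ℝ} {s : ℝ} (h : Sep a s) (i : Fin p ⊕ Fin q) :
    0 ≤ sg i * (a i - s) := by
  rcases i with i | i
  · have := h.1 i; simp only [sg, Sum.elim_inl]; linarith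
  · have := h.2 i; simp only [sg, Sum.elim_inr]; linarith

theorem qf_nonneg_of_sep {w : Matrix (Fin p ⊕ Fin q) (Fin p ⊕ Fin q) ℂ}
    (hw : wᴴ * J0 p q * w = J0 p q) {a : Fin p ⊕ Fin q → ℝ} {s : ℝ} (h : Sep a s)
    (v : Fin p ⊕ Fin q → ℂ) :
    0 ≤ qf (J0 p q * (w * diagonal (fun i => ((a i : ℝ) : ℂ)) * w⁻¹ - (s : ℂ) • 1)) v := by
  rw [qf_J0_mul_sub hw]
  exact Finset.sum_nonneg fun i _ => mul_nonneg (h.nonneg i) (Complex.normSq_nonneg _)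

theorem posDef_of_sep {w : Matrix (Fin p ⊕ Fin q) (Fin p ⊕ Fin q) ℂ}
    (hw : wᴴ * J0 p q * w = J0 p q) {a : Fin p ⊕ Fin q → ℝ} {s : ℝ}
    (h : (∀ i, s < a (Sum.inl i)) ∧ ∀ j, a (Sum.inr j) < s) :
    (J0 p q * (w * diagonal (fun i => ((a i : ℝ) : ℂ)) * w⁻¹ - (s : ℂ) • 1)).PosDef := by
  have hwd := (isUnit_det_of_frame hw).1
  refine posDef_of_qf (isHermitian_J0_mul_sub hw a s) fun v hv => ?_
  rw [qf_J0_mul_sub hw]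
  have hpos : ∀ i, 0 < sg i * (a i - s) := by
    rintro (i | i)
    · have := h.1 i; simp only [sg, Sum.elim_inl]; linarith
    · have := h.2 i; simp only [sg, Sum.elim_inr]; linarith
  have hv' : w⁻¹ *ᵥ v ≠ 0 := by
    intro h0
    apply hv
    have := congrArg (fun z => w *ᵥ z) h0
    simpa [mulVec_mulVec, mul_nonsing_inv _ hwd] using this
  obtain ⟨i, hi⟩ := Function.ne_iff.1 hv'
  exact Finset.sum_pos' (fun i _ => mul_nonneg (hpos i).le (Complex.normSq_nonneg _))
    ⟨i, Finset.mem_univ i, mul_pos (hpos i) (Complex.normSq_pos.2 hi)⟩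

theorem charpoly_conj {w : Matrix (Fin p ⊕ Fin q) (Fin p ⊕ Fin q) ℂ} (hw : IsUnit w.det)
    (M : Matrix (Fin p ⊕ Fin q) (Fin p ⊕ Fin q) ℂ) : (w * M * w⁻¹).charpoly = M.charpoly := by
  exact charpoly_units_conj (Matrix.nonsingInvUnit w hw) M

theorem eq_of_prod_eq {x y : Fin p ⊕ Fin q → ℝ} (hx : ∀ i j, rkU i ≤ rkU j → x j ≤ x i)
    (hy : ∀ i j, rkU i ≤ rkU j → y j ≤ y i)
    (h : ∏ i, (X - C ((x i : ℝ) : ℂ)) = ∏ i, (X - C ((y i : ℝ) : ℂ))) : x = y := by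
  have key : ∀ z : Fin p ⊕ Fin q → ℝ, (∏ i, (X - C ((z i : ℝ) : ℂ))).roots
      = Multiset.map (fun r : ℝ => (r : ℂ))
        (Multiset.map (fun i => z (finSumFinEquiv.symm i)) Finset.univ.val) := by
    intro z
    rw [← finSumFinEquiv.symm.prod_comp]
    have := Polynomial.roots_multiset_prod_X_sub_C
      ((Finset.univ.val).map fun i : Fin (p + q) => ((z (finSumFinEquiv.symm i) : ℝ) : ℂ))
    rw [Multiset.map_map] at this
    rw [Multiset.map_map]
    exact this
  have h1 := key x
  rw [h, key y, Multiset.map_eq_map Complex.ofReal_injective, Fin.univ_val_map, Fin.univ_val_map,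
    Multiset.coe_eq_coe] at h1
  have anti : ∀ z : Fin p ⊕ Fin q → ℝ, (∀ i j, rkU i ≤ rkU j → z j ≤ z i) →
      Antitone fun i : Fin (p + q) => z (finSumFinEquiv.symm i) := by
    intro z hz i j hij
    refine hz _ _ ?_
    rw [rkU_eq, rkU_eq]
    simpa using hij
  have h2 := h1.eq_of_sortedGE (anti y hy).sortedGE_ofFn (anti x hx).sortedGE_ofFn
  have h3 := List.ofFn_injective h2
  ext i
  have := congrFun h3 (finSumFinEquiv i)
  simpa using this.symm

/-- The spectrum of a sum of two admissible matrices determines its pseudo-unitary orbit. -/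
theorem exists_frame_of_charpoly {g h : Matrix (Fin p ⊕ Fin q) (Fin p ⊕ Fin q) ℂ}
    (hg : gᴴ * J0 p q * g = J0 p q) (hh : hᴴ * J0 p q * h = J0 p q)
    {a b x : Fin p ⊕ Fin q → ℝ} {s s' : ℝ}
    (ha : (∀ i, s < a (Sum.inl i)) ∧ ∀ j, a (Sum.inr j) < s)
    (hb : (∀ i, s' < b (Sum.inl i)) ∧ ∀ j, b (Sum.inr j) < s')
    (hx : ∀ i j, rkU i ≤ rkU j → x j ≤ x i)
    (hch : (g * diagonal (fun i => ((a i : ℝ) : ℂ)) * g⁻¹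
      + h * diagonal (fun i => ((b i : ℝ) : ℂ)) * h⁻¹).charpoly = ∏ i, (X - C ((x i : ℝ) : ℂ))) :
    ∃ w : Matrix (Fin p ⊕ Fin q) (Fin p ⊕ Fin q) ℂ, wᴴ * J0 p q * w = J0 p q ∧
      g * diagonal (fun i => ((a i : ℝ) : ℂ)) * g⁻¹ + h * diagonal (fun i => ((b i : ℝ) : ℂ)) * h⁻¹
        = w * diagonal (fun i => ((x i : ℝ) : ℂ)) * w⁻¹ := by
  obtain ⟨A, hA⟩ : ∃ A, A = g * diagonal (fun i => ((a i : ℝ) : ℂ)) * g⁻¹ := ⟨_, rfl⟩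
  obtain ⟨B, hB⟩ : ∃ B, B = h * diagonal (fun i => ((b i : ℝ) : ℂ)) * h⁻¹ := ⟨_, rfl⟩
  have h1 := posDef_of_sep hg ha
  have h2 := posDef_of_sep hh hb
  rw [← hA, ← hB] at hch ⊢
  rw [← hA] at h1
  rw [← hB] at h2
  have h3 : (J0 p q * (A + B - ((s + s' : ℝ) : ℂ) • 1)).PosDef := by
    have e : A + B - ((s + s' : ℝ) : ℂ) • 1 = (A - (s : ℂ) • 1) + (B - (s' : ℂ) • 1) := by
      push_cast
      rw [add_smul]
      abel
    rw [e, Matrix.mul_add]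
    exact h1.add h2
  obtain ⟨w, y, hw, hD, hy, -⟩ := exists_diagonalization h3
  refine ⟨w, hw, ?_⟩
  rw [hD, charpoly_conj (isUnit_det_of_frame hw).1, charpoly_diagonal] at hch
  rw [hD, eq_of_prod_eq hy hx hch]

/-- Separating values add. -/
theorem sep_add {g h w : Matrix (Fin p ⊕ Fin q) (Fin p ⊕ Fin q) ℂ}
    (hg : gᴴ * J0 p q * g = J0 p q) (hh : hᴴ * J0 p q * h = J0 p q) (hw : wᴴ * J0 p q * w = J0 p q)
    {a b x : Fin p ⊕ Fin q → ℝ} {s s' : ℝ} (ha : Sep a s) (hb : Sep b s')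
    (hD : g * diagonal (fun i => ((a i : ℝ) : ℂ)) * g⁻¹
      + h * diagonal (fun i => ((b i : ℝ) : ℂ)) * h⁻¹
        = w * diagonal (fun i => ((x i : ℝ) : ℂ)) * w⁻¹) : Sep x (s + s') := by
  have hwd := (isUnit_det_of_frame hw).1
  have key : ∀ i, 0 ≤ sg i * (x i - (s + s')) := by
    intro i
    have h1 := qf_nonneg_of_sep hg ha (w *ᵥ Pi.single i 1)
    have h2 := qf_nonneg_of_sep hh hb (w *ᵥ Pi.single i 1)
    have h3 := qf_J0_mul_sub hw x (s + s') (w *ᵥ Pi.single i 1)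
    rw [mulVec_mulVec _ w⁻¹ w, nonsing_inv_mul _ hwd, one_mulVec,
      Finset.sum_eq_single i (fun j _ hj => by simp [hj]) (by simp)] at h3
    simp only [Pi.single_eq_same, map_one, mul_one] at h3
    have e : ∀ A B : Matrix (Fin p ⊕ Fin q) (Fin p ⊕ Fin q) ℂ,
        A + B - ((s + s' : ℝ) : ℂ) • 1 = (A - (s : ℂ) • 1) + (B - (s' : ℂ) • 1) := by
      intro A B
      push_cast
      rw [add_smul]
      abel
    rw [← h3, ← hD, e, Matrix.mul_add, qf_add]
    exact add_nonneg h1 h2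
  constructor
  · intro i
    have := key (Sum.inl i); simp only [sg, Sum.elim_inl] at this; linarith
  · intro i
    have := key (Sum.inr i); simp only [sg, Sum.elim_inr] at this; linarith

theorem exists_perm_frame (ρ : Equiv.Perm (Fin p ⊕ Fin q)) (hρ : ∀ i, sg (ρ i) = sg i) :
    ∃ R : Matrix (Fin p ⊕ Fin q) (Fin p ⊕ Fin q) ℂ, Rᴴ * J0 p q * R = J0 p q ∧
      ∀ d : Fin p ⊕ Fin q → ℂ, R * diagonal (fun i => d (ρ i)) * R⁻¹ = diagonal d := by
  let R : Matrix (Fin p ⊕ Fin q) (Fin p ⊕ Fin q) ℂ := Matrix.of fun j i => if j = ρ i then 1 else 0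
  have hRd : ∀ d : Fin p ⊕ Fin q → ℂ, diagonal d * R = R * diagonal (fun i => d (ρ i)) := by
    intro d
    ext j i
    rw [diagonal_mul, mul_diagonal]
    by_cases h : j = ρ i
    · rw [h, mul_comm]
    · simp [R, h]
  have hRR : Rᴴ * R = 1 := by
    ext i j
    rw [Matrix.mul_apply, Finset.sum_eq_single (ρ i), conjTranspose_apply]
    · by_cases h : i = j
      · subst h; simp [R]
      · have : ρ i ≠ ρ j := fun h' => h (ρ.injective h')
        simp [R, this, h]
    · intro k _ hk
      rw [conjTranspose_apply]
      simp [R, hk]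
    · simp
  have hR : Rᴴ * J0 p q * R = J0 p q := by
    rw [J0, Matrix.mul_assoc, hRd, ← Matrix.mul_assoc, hRR, Matrix.one_mul]
    simp only [hρ]
  refine ⟨R, hR, fun d => ?_⟩
  rw [← hRd, Matrix.mul_assoc, mul_nonsing_inv _ (isUnit_det_of_frame hR).1, Matrix.mul_one]

theorem mul_conj_inv (g R M : Matrix (Fin p ⊕ Fin q) (Fin p ⊕ Fin q) ℂ) :
    g * R * M * (g * R)⁻¹ = g * (R * M * R⁻¹) * g⁻¹ := by
  rw [Matrix.mul_inv_rev]; simp only [Matrix.mul_assoc]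

theorem sg_sumCongr (σ : Equiv.Perm (Fin p)) (τ : Equiv.Perm (Fin q)) (i : Fin p ⊕ Fin q) :
    sg (Equiv.sumCongr σ τ i) = sg i := by
  rcases i with i | i <;> rfl

/-- The block weights attached to a pair of spectra and the spectrum of the sum. -/
def wt (a b x : Fin p ⊕ Fin q → ℝ) : Option Bool → Fin p ⊕ Fin q → ℝ
  | none => fun i => - x (Equiv.sumCongr Fin.revPerm Fin.revPerm i)
  | some true => a
  | some false => b

theorem sum_option_bool {M : Type*} [AddCommMonoid M] (f : Option Bool → M) :
    ∑ t, f t = f none + (f (some true) + f (some false)) := by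
  rw [Fintype.sum_option, Fintype.sum_bool]

/-- Triples of frames realising a sum, normalised at the sum. -/
theorem realize_iff_exists {al : Option Bool → Fin p ⊕ Fin q → ℝ} :
    Realize al ↔ ∃ w : Option Bool → Matrix (Fin p ⊕ Fin q) (Fin p ⊕ Fin q) ℂ,
      (∀ t, (w t)ᴴ * J0 p q * w t = J0 p q) ∧ w none = 1 ∧
      ∑ t, w t * diagonal (fun i => ((al t i : ℝ) : ℂ)) * (w t)⁻¹ = 0 := by
  constructor
  · rintro ⟨J, w, hw, hs⟩
    obtain ⟨g, hg⟩ : ∃ g, g = w none := ⟨_, rfl⟩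
    have hgd := (isUnit_det_of_frame (hw none)).1
    have hJ : (g⁻¹)ᴴ * J0 p q * g⁻¹ = J := by rw [hg]; exact inv_conj_of_frame (hw none)
    rw [← hg] at hgd
    refine ⟨fun t => g⁻¹ * w t, fun t => ?_, ?_, ?_⟩
    · have hJ2 : (g⁻¹)ᴴ * J0 p q * g⁻¹ = J := hJ
      calc (g⁻¹ * w t)ᴴ * J0 p q * (g⁻¹ * w t) = (w t)ᴴ * ((g⁻¹)ᴴ * J0 p q * g⁻¹) * w t := by
            rw [conjTranspose_mul g⁻¹ (w t)]; simp only [Matrix.mul_assoc]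
        _ = J0 p q := by rw [hJ2, hw]
    · simp only [← hg]
      exact nonsing_inv_mul _ hgd
    · simp only [mul_conj_inv, ← Finset.sum_mul, ← Finset.mul_sum, hs, Matrix.mul_zero,
        Matrix.zero_mul]
  · rintro ⟨w, hw, -, hs⟩
    exact ⟨J0 p q, w, hw, hs⟩

theorem neg_diagonal_ofReal (x : Fin p ⊕ Fin q → ℝ) :
    diagonal (fun i => ((- x i : ℝ) : ℂ)) = - diagonal (fun i => ((x i : ℝ) : ℂ)) := by
  rw [diagonal_neg]
  simp only [Complex.ofReal_neg]

theorem realize_wt_of_sum {g h w : Matrix (Fin p ⊕ Fin q) (Fin p ⊕ Fin q) ℂ}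
    (hg : gᴴ * J0 p q * g = J0 p q) (hh : hᴴ * J0 p q * h = J0 p q) (hw : wᴴ * J0 p q * w = J0 p q)
    {a b x : Fin p ⊕ Fin q → ℝ}
    (hD : g * diagonal (fun i => ((a i : ℝ) : ℂ)) * g⁻¹
      + h * diagonal (fun i => ((b i : ℝ) : ℂ)) * h⁻¹
        = w * diagonal (fun i => ((x i : ℝ) : ℂ)) * w⁻¹) : Realize (wt a b x) := by
  obtain ⟨R, hR, hRd⟩ := exists_perm_frame (p := p) (q := q) (Equiv.sumCongr Fin.revPerm Fin.revPerm)
    (sg_sumCongr _ _)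
  refine ⟨J0 p q, fun t => match t with
    | none => w * R
    | some true => g
    | some false => h, ?_, ?_⟩
  · rintro (_ | _ | _)
    exacts [frame_mul hw hR, hh, hg]
  · rw [sum_option_bool]
    simp only [wt]
    rw [hD, mul_conj_inv, hRd (fun i => ((- x i : ℝ) : ℂ)), neg_diagonal_ofReal, Matrix.mul_neg,
      Matrix.neg_mul, neg_add_cancel]

theorem exists_sum_of_realize_wt {a b x : Fin p ⊕ Fin q → ℝ} (h : Realize (wt a b x)) :
    ∃ g h : Matrix (Fin p ⊕ Fin q) (Fin p ⊕ Fin q) ℂ, gᴴ * J0 p q * g = J0 p q ∧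
      hᴴ * J0 p q * h = J0 p q ∧ (g * diagonal (fun i => ((a i : ℝ) : ℂ)) * g⁻¹
      + h * diagonal (fun i => ((b i : ℝ) : ℂ)) * h⁻¹).charpoly = ∏ i, (X - C ((x i : ℝ) : ℂ)) := by
  obtain ⟨w, hw, hw1, hs⟩ := realize_iff_exists.1 h
  refine ⟨w (some true), w (some false), hw _, hw _, ?_⟩
  rw [sum_option_bool, hw1] at hs
  simp only [wt, inv_one, Matrix.mul_one, Matrix.one_mul] at hs
  rw [eq_neg_of_add_eq_zero_right hs,
    neg_diagonal_ofReal (fun i => x (Equiv.sumCongr Fin.revPerm Fin.revPerm i)), neg_neg, charpoly_diagonal]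
  exact Equiv.prod_comp (Equiv.sumCongr Fin.revPerm Fin.revPerm) (fun i => X - C ((x i : ℝ) : ℂ))

end Sums

section StableWeights

variable {p q : ℕ}

theorem sum_eq_zero_of_realize {T : Type*} [Fintype T] {al : T → Fin p ⊕ Fin q → ℝ}
    (h : Realize al) : ∑ t, ∑ i, al t i = 0 := by
  obtain ⟨J, w, hw, hs⟩ := h
  have h1 := congrArg Matrix.trace hs
  rw [trace_sum, trace_zero] at h1
  have h2 : ∀ t, (w t * diagonal (fun i => ((al t i : ℝ) : ℂ)) * (w t)⁻¹).trace
      = ((∑ i, al t i : ℝ) : ℂ) := by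
    intro t
    rw [trace_mul_comm, ← Matrix.mul_assoc, nonsing_inv_mul _ (isUnit_det_of_frame (hw t)).1,
      Matrix.one_mul, trace_diagonal, Complex.ofReal_sum]
  simp only [h2] at h1
  rw [← Complex.ofReal_sum] at h1
  exact_mod_cast h1

/-- A subspace invariant under a diagonal matrix with distinct entries contains the coordinate
lines it meets. -/
theorem single_mem_of_invariant {n : Type} [Fintype n] [DecidableEq n] {d : n → ℝ}
    (hd : Function.Injective d) {V : Submodule ℂ (n → ℂ)}
    (hV : ∀ v ∈ V, diagonal (fun i => ((d i : ℝ) : ℂ)) *ᵥ v ∈ V) {v : n → ℂ} (hv : v ∈ V) {i : n}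
    (hi : v i ≠ 0) : (Pi.single i 1 : n → ℂ) ∈ V := by
  have key : ∀ s : Finset n, (fun j => (∏ k ∈ s, ((d j - d k : ℝ) : ℂ)) * v j) ∈ V := by
    intro s
    induction s using Finset.induction_on with
    | empty => simpa using hv
    | insert a s ha ih =>
      have h := V.sub_mem (hV _ ih) (V.smul_mem ((d a : ℝ) : ℂ) ih)
      convert h using 1
      ext j
      rw [Finset.prod_insert ha, Pi.sub_apply, Pi.smul_apply, mulVec_diagonal, smul_eq_mul]
      push_cast
      ring
  have h := V.smul_mem ((∏ k ∈ Finset.univ.erase i, ((d i - d k : ℝ) : ℂ)) * v i)⁻¹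
    (key (Finset.univ.erase i))
  have hne : (∏ k ∈ Finset.univ.erase i, ((d i - d k : ℝ) : ℂ)) ≠ 0 := by
    refine Finset.prod_ne_zero_iff.2 fun k hk => ?_
    have : d i ≠ d k := fun h => (Finset.mem_erase.1 hk).1 (hd h).symm
    exact_mod_cast sub_ne_zero.2 this
  convert h using 1
  ext j
  rw [Pi.smul_apply, smul_eq_mul]
  by_cases hj : j = i
  · subst hj
    rw [inv_mul_cancel₀ (mul_ne_zero hne hi), Pi.single_eq_same]
  · have h0 : (∏ k ∈ Finset.univ.erase i, ((d j - d k : ℝ) : ℂ)) = 0 :=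
      Finset.prod_eq_zero (Finset.mem_erase.2 ⟨hj, Finset.mem_univ j⟩) (by simp)
    rw [h0]
    simp [hj]

theorem eq_bot_or_top_of_invariant {n : Type} [Fintype n] [DecidableEq n] {d : n → ℝ}
    (hd : Function.Injective d) {B : Matrix n n ℂ} (hB : ∀ i j, B i j ≠ 0)
    {V : Submodule ℂ (n → ℂ)} (hV : ∀ v ∈ V, diagonal (fun i => ((d i : ℝ) : ℂ)) *ᵥ v ∈ V)
    (hVB : ∀ v ∈ V, B *ᵥ v ∈ V) : V = ⊥ ∨ V = ⊤ := by
  by_cases h : V = ⊥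
  · exact Or.inl h
  right
  obtain ⟨v, hv, hv0⟩ := (Submodule.ne_bot_iff V).1 h
  obtain ⟨i, hi⟩ := Function.ne_iff.1 hv0
  have h1 := single_mem_of_invariant hd hV hv hi
  have h2 : ∀ j, (Pi.single j 1 : n → ℂ) ∈ V := by
    intro j
    refine single_mem_of_invariant hd hV (hVB _ h1) (i := j) ?_
    rw [mulVec_single_one]
    exact hB j i
  rw [eq_top_iff]
  intro x _
  rw [pi_eq_sum_univ' x]
  refine V.sum_mem fun j _ => ?_
  exact V.smul_mem _ (h2 j)

theorem normSq_sum_le {n : Type} [Fintype n] (v : n → ℂ) :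
    Complex.normSq (∑ i, v i) ≤ Fintype.card n * nsq v := by
  have h1 : ‖∑ i, v i‖ ≤ ∑ i, ‖v i‖ := norm_sum_le _ _
  have h2 := sq_sum_le_card_mul_sum_sq (s := Finset.univ) (f := fun i => ‖v i‖)
  rw [Complex.normSq_eq_norm_sq]
  calc ‖∑ i, v i‖ ^ 2 ≤ (∑ i, ‖v i‖) ^ 2 := by gcongr
    _ ≤ _ := h2
    _ = _ := by simp only [nsq, Complex.normSq_eq_norm_sq, Finset.card_univ]

theorem qf_ones {n : Type} [Fintype n] (v : n → ℂ) :
    qf (Matrix.of fun _ _ => (1 : ℂ)) v = Complex.normSq (∑ i, v i) := by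
  have : star v ⬝ᵥ (Matrix.of fun _ _ => (1 : ℂ)) *ᵥ v = star (∑ i, v i) * ∑ i, v i := by
    simp only [dotProduct, mulVec, of_apply, one_mul, Pi.star_apply]
    rw [← Finset.sum_mul, star_sum]
  rw [qf, this]
  change ((starRingEnd ℂ) _ * _).re = _
  rw [← Complex.normSq_eq_conj_mul_self, Complex.ofReal_re]

/-- The diagonal weights of the model configuration. -/
def kv (p q : ℕ) : Fin p ⊕ Fin q → ℝ :=
  Sum.elim (fun i => (p + q + 2 : ℝ) + i) (fun j => (p + q + 2 : ℝ) + (q - j))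

theorem kv_ge (i : Fin p ⊕ Fin q) : (p + q + 2 : ℝ) ≤ kv p q i := by
  rcases i with i | i
  · simp [kv]
  · have : ((i : ℕ) : ℝ) ≤ q := by exact_mod_cast i.2.le
    simp only [kv, Sum.elim_inr]; linarith

theorem kv_inj : Function.Injective fun i : Fin p ⊕ Fin q => - (sg i * kv p q i) := by
  have hpos : ∀ i : Fin p ⊕ Fin q, 0 < kv p q i := fun i => by
    have := kv_ge i
    have h2 : (0 : ℝ) ≤ p := by positivity
    have h3 : (0 : ℝ) ≤ q := by positivity
    linarith
  rintro (i | i) (j | j) h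
  · simp only [sg, kv, Sum.elim_inl] at h
    have : ((i : ℕ) : ℝ) = j := by linarith
    exact congrArg _ (Fin.ext (by exact_mod_cast this))
  · have h1 := hpos (Sum.inl i)
    have h2 := hpos (Sum.inr j)
    simp only [sg, Sum.elim_inl, Sum.elim_inr] at h
    linarith
  · have h1 := hpos (Sum.inr i)
    have h2 := hpos (Sum.inl j)
    simp only [sg, Sum.elim_inl, Sum.elim_inr] at h
    linarith
  · simp only [sg, kv, Sum.elim_inr] at h
    have : ((i : ℕ) : ℝ) = j := by linarith
    exact congrArg _ (Fin.ext (by exact_mod_cast this))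

/-- Some weights with a spectral gap are stable. -/
theorem exists_stable_weights (p q : ℕ) : ∃ al : Option Bool → Fin p ⊕ Fin q → ℝ,
    (∀ t, Antitone fun i => al t (Sum.inl i)) ∧ (∀ t, Antitone fun i => al t (Sum.inr i)) ∧
    (∑ t, ∑ i, al t i = 0) ∧ (∀ b i, 0 < al (some b) (Sum.inl i)) ∧
    (∀ b i, al (some b) (Sum.inr i) < 0) ∧
    ∃ (AU : Bool → Matrix (Fin p) (Fin p) ℂ) (AW : Bool → Matrix (Fin q) (Fin q) ℂ)
      (X : Matrix (Fin p) (Fin q) ℂ), (∀ b, IsUnit (AU b).det) ∧ (∀ b, IsUnit (AW b).det) ∧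
      KStable (frU AU) (frU AW) X (fun t i => al t (Sum.inl i)) (fun t i => al t (Sum.inr i)) := by
  obtain ⟨O, hO⟩ : ∃ O : Matrix (Fin p ⊕ Fin q) (Fin p ⊕ Fin q) ℂ, O = Matrix.of fun _ _ => 1 :=
    ⟨_, rfl⟩
  have hOh : O.IsHermitian := by
    rw [hO]; ext i j; simp [conjTranspose_apply]
  have hKh : (diagonal (fun i => ((kv p q i : ℝ) : ℂ))).IsHermitian := by
    rw [Matrix.IsHermitian, diagonal_conjTranspose]
    congr 1; ext i; simp
  have hQ : (1 + O).PosDef := by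
    refine posDef_of_qf (isHermitian_one.add hOh) fun v hv => ?_
    rw [qf_add, qf_one, hO, qf_ones]
    have := nsq_pos hv
    have := Complex.normSq_nonneg (∑ i, v i)
    linarith
  have hP : (diagonal (fun i => ((kv p q i : ℝ) : ℂ)) - (1 + O)).PosDef := by
    refine posDef_of_qf (hKh.sub (isHermitian_one.add hOh)) fun v hv => ?_
    rw [qf_sub, qf_add, qf_one, hO, qf_ones, qf_diagonal]
    have h1 := nsq_pos hv
    have h2 := normSq_sum_le v
    rw [Fintype.card_sum, Fintype.card_fin, Fintype.card_fin] at h2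
    have h3 : (p + q + 2 : ℝ) * nsq v ≤ ∑ i, kv p q i * Complex.normSq (v i) := by
      rw [nsq, Finset.mul_sum]
      exact Finset.sum_le_sum fun i _ =>
        mul_le_mul_of_nonneg_right (kv_ge i) (Complex.normSq_nonneg _)
    push_cast at h2
    nlinarith
  have hJJ : ∀ M : Matrix (Fin p ⊕ Fin q) (Fin p ⊕ Fin q) ℂ,
      J0 p q * (J0 p q * M - ((0 : ℝ) : ℂ) • 1) = M := by
    intro M
    rw [Complex.ofReal_zero, zero_smul, sub_zero, ← Matrix.mul_assoc, J0_sq, Matrix.one_mul]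
  obtain ⟨w1, y1, hw1, hD1, hy1, hU1, hW1⟩ := exists_diagonalization (s := 0)
    (D := J0 p q * (diagonal (fun i => ((kv p q i : ℝ) : ℂ)) - (1 + O))) (by rw [hJJ]; exact hP)
  obtain ⟨w2, y2, hw2, hD2, hy2, hU2, hW2⟩ := exists_diagonalization (s := 0)
    (D := J0 p q * (1 + O)) (by rw [hJJ]; exact hQ)
  let w : Option Bool → Matrix (Fin p ⊕ Fin q) (Fin p ⊕ Fin q) ℂ := fun t => match t with
    | none => 1
    | some true => w1
    | some false => w2
  let al : Option Bool → Fin p ⊕ Fin q → ℝ := fun t => match t with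
    | none => fun i => - (sg i * kv p q i)
    | some true => y1
    | some false => y2
  have hw : ∀ t, (w t)ᴴ * J0 p q * w t = J0 p q := by
    rintro (_ | _ | _)
    · simp [w]
    · exact hw2
    · exact hw1
  have hC : diagonal (fun i => ((- (sg i * kv p q i) : ℝ) : ℂ))
      = - (J0 p q * diagonal (fun i => ((kv p q i : ℝ) : ℂ))) := by
    rw [J0, diagonal_mul_diagonal, diagonal_neg]
    simp only [Complex.ofReal_neg, Complex.ofReal_mul]
  have hsum : ∑ t, w t * diagonal (fun i => ((al t i : ℝ) : ℂ)) * (w t)⁻¹ = 0 := by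
    rw [sum_option_bool]
    simp only [w, al]
    rw [← hD1, ← hD2, hC, inv_one, Matrix.mul_one, Matrix.one_mul, ← Matrix.mul_add,
      sub_add_cancel, neg_add_cancel]
  have hpos : ∀ i : Fin p ⊕ Fin q, 0 < kv p q i := fun i => by
    have := kv_ge i
    have h2 : (0 : ℝ) ≤ p := by positivity
    have h3 : (0 : ℝ) ≤ q := by positivity
    linarith
  have haU : ∀ t, Antitone fun i => al t (Sum.inl i) := by
    rintro (_ | _ | _) i j hij
    · have : ((i : ℕ) : ℝ) ≤ (j : ℕ) := by exact_mod_cast hij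
      simp only [al, sg, kv, Sum.elim_inl]
      linarith
    · exact hy2 _ _ hij
    · exact hy1 _ _ hij
  have haW : ∀ t, Antitone fun i => al t (Sum.inr i) := by
    rintro (_ | _ | _) i j hij
    · have : ((i : ℕ) : ℝ) ≤ (j : ℕ) := by exact_mod_cast hij
      simp only [al, sg, kv, Sum.elim_inr]
      linarith
    · exact hy2 _ _ (Nat.add_le_add_left hij p)
    · exact hy1 _ _ (Nat.add_le_add_left hij p)
  have hU : ∀ b i, 0 < al (some b) (Sum.inl i) := by
    rintro (_ | _) i
    exacts [hU2 i, hU1 i]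
  have hW : ∀ b i, al (some b) (Sum.inr i) < 0 := by
    rintro (_ | _) i
    exacts [hW2 i, hW1 i]
  have hal : ∀ t i j, rkT t j ≤ rkT t i → 0 ≤ sg i * sg j * (al t j - al t i) := by
    intro t i j hij
    rcases i with i | i <;> rcases j with j | j
    · have h1 : j ≤ i := by
        rcases t with _ | t
        · exact hij
        · simpa [rkT, rkW] using hij
      have := haU t h1
      simp only [sg, Sum.elim_inl] at this ⊢
      linarith
    · rcases t with _ | t
      · simp only [rkT, rkU, Sum.elim_inl, Sum.elim_inr] at hij
        have := i.2
        omega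
      · have h1 := hU t i
        have h2 := hW t j
        simp only [sg, Sum.elim_inl, Sum.elim_inr]
        linarith
    · rcases t with _ | t
      · have h1 := hpos (Sum.inr i)
        have h2 := hpos (Sum.inl j)
        simp only [al, sg, Sum.elim_inl, Sum.elim_inr]
        linarith
      · simp only [rkT, rkW, Sum.elim_inl, Sum.elim_inr] at hij
        have := i.2
        omega
    · have h1 : j ≤ i := by
        rcases t with _ | t
        · simpa [rkT, rkU] using hij
        · exact hij
      have := haW t h1
      simp only [sg, Sum.elim_inr] at this ⊢
      linarith
  obtain ⟨AU, AW, X, hAU, hAW, -, hst⟩ := exists_derived hw rfl hsum hal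
  refine ⟨al, haU, haW, sum_eq_zero_of_realize ⟨J0 p q, w, hw, hsum⟩, hU, hW, AU, AW, X, hAU, hAW,
    hst fun V hV => ?_⟩
  refine eq_bot_or_top_of_invariant (B := J0 p q * (1 + O)) kv_inj ?_ ?_ ?_
  · intro i j
    rw [J0, diagonal_mul, hO]
    refine mul_ne_zero ?_ ?_
    · rcases i with i | i <;> simp [sg]
    · rw [Matrix.add_apply, of_apply]
      by_cases h : i = j
      · subst h; rw [one_apply_eq]; norm_num
      · rw [one_apply_ne h]; norm_num
  · intro v hv
    have := hV none v hv
    simpa only [w, al, inv_one, Matrix.mul_one, Matrix.one_mul] using this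
  · intro v hv
    have := hV (some false) v hv
    rwa [hD2]

end StableWeights

section Closed

variable {p q : ℕ}

theorem inv_eq_of_frame {w : Matrix (Fin p ⊕ Fin q) (Fin p ⊕ Fin q) ℂ}
    (hw : wᴴ * J0 p q * w = J0 p q) : w⁻¹ = J0 p q * wᴴ * J0 p q := by
  refine inv_eq_left_inv ?_
  calc J0 p q * wᴴ * J0 p q * w = J0 p q * (wᴴ * J0 p q * w) := by simp only [Matrix.mul_assoc]
    _ = 1 := by rw [hw, J0_sq]

theorem norm_entry_eq_of_frame {w : Matrix (Fin p ⊕ Fin q) (Fin p ⊕ Fin q) ℂ}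
    (hw : wᴴ * J0 p q * w = J0 p q) (i j : Fin p ⊕ Fin q) : ‖w i j‖ = ‖w⁻¹ j i‖ := by
  rw [inv_eq_of_frame hw, J0, mul_diagonal, diagonal_mul, conjTranspose_apply, norm_mul, norm_mul,
    norm_sg, norm_sg, norm_star]
  ring

/-- Frames realising weights with a spectral gap are bounded. -/
theorem norm_entry_le_of_realize {al : Option Bool → Fin p ⊕ Fin q → ℝ}
    {w : Option Bool → Matrix (Fin p ⊕ Fin q) (Fin p ⊕ Fin q) ℂ}
    (hw : ∀ t, (w t)ᴴ * J0 p q * w t = J0 p q) (hw1 : w none = 1)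
    (hs : ∑ t, w t * diagonal (fun i => ((al t i : ℝ) : ℂ)) * (w t)⁻¹ = 0) {c M : ℝ} (hc : 0 < c)
    (hU : ∀ b i, c ≤ al (some b) (Sum.inl i)) (hW : ∀ b i, al (some b) (Sum.inr i) ≤ -c)
    (hM : ∀ i, |al none i| ≤ M) (hcM : c ≤ M) (t : Option Bool) (i j : Fin p ⊕ Fin q) :
    ‖w t i j‖ ≤ Real.sqrt (M / c) := by
  have key : ∀ t v, c * nsq ((w t)⁻¹ *ᵥ v) ≤ M * nsq v := by
    intro t v
    have hq : ∀ t, qf (J0 p q * (w t * diagonal (fun i => ((al t i : ℝ) : ℂ)) * (w t)⁻¹)) v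
        = ∑ i, sg i * al t i * Complex.normSq (((w t)⁻¹ *ᵥ v) i) := by
      intro t
      have := qf_J0_mul_sub (hw t) (al t) 0 v
      simpa only [Complex.ofReal_zero, zero_smul, sub_zero] using this
    have hsum : ∑ t, qf (J0 p q * (w t * diagonal (fun i => ((al t i : ℝ) : ℂ)) * (w t)⁻¹)) v = 0 := by
      rw [sum_option_bool, ← qf_add, ← qf_add, ← Matrix.mul_add, ← Matrix.mul_add,
        ← sum_option_bool (fun t => w t * diagonal (fun i => ((al t i : ℝ) : ℂ)) * (w t)⁻¹), hs]
      simp [qf]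
    have hlow : ∀ b, c * nsq ((w (some b))⁻¹ *ᵥ v)
        ≤ qf (J0 p q * (w (some b) * diagonal (fun i => ((al (some b) i : ℝ) : ℂ)) * (w (some b))⁻¹)) v := by
      intro b
      rw [hq, nsq, Finset.mul_sum]
      refine Finset.sum_le_sum fun i _ => mul_le_mul_of_nonneg_right ?_ (Complex.normSq_nonneg _)
      rcases i with i | i
      · have := hU b i; simp only [sg, Sum.elim_inl]; linarith
      · have := hW b i; simp only [sg, Sum.elim_inr]; linarith
    have hup : - (M * nsq v) ≤ qf (J0 p q *
        (w none * diagonal (fun i => ((al none i : ℝ) : ℂ)) * (w none)⁻¹)) v := by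
      rw [hq, hw1, inv_one, one_mulVec, nsq, Finset.mul_sum, ← Finset.sum_neg_distrib]
      refine Finset.sum_le_sum fun i _ => ?_
      rw [← neg_mul]
      refine mul_le_mul_of_nonneg_right ?_ (Complex.normSq_nonneg _)
      have := abs_le.1 (hM i)
      rcases i with i | i
      · simp only [sg, Sum.elim_inl]; linarith
      · simp only [sg, Sum.elim_inr]; linarith
    rw [sum_option_bool] at hsum
    have h1 := hlow true
    have h2 := hlow false
    have h3 := mul_nonneg hc.le (nsq_nonneg ((w (some true))⁻¹ *ᵥ v))
    have h4 := mul_nonneg hc.le (nsq_nonneg ((w (some false))⁻¹ *ᵥ v))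
    rcases t with _ | _ | _
    · rw [hw1, inv_one, one_mulVec]
      exact mul_le_mul_of_nonneg_right hcM (nsq_nonneg v)
    · linarith
    · linarith
  rw [norm_entry_eq_of_frame (hw t)]
  have h1 := key t (Pi.single i 1)
  rw [mulVec_single_one] at h1
  have h2 : nsq (Pi.single i 1 : Fin p ⊕ Fin q → ℂ) = 1 := by
    rw [nsq, Finset.sum_eq_single i (fun j _ hj => by simp [hj]) (by simp)]
    simp
  have h3 := normSq_le_nsq ((w t)⁻¹.col i) j
  rw [Complex.normSq_eq_norm_sq] at h3
  refine Real.le_sqrt_of_sq_le ?_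
  rw [le_div_iff₀ hc, mul_comm]
  calc c * ‖(w t)⁻¹ j i‖ ^ 2 ≤ c * nsq ((w t)⁻¹.col i) := mul_le_mul_of_nonneg_left h3 hc.le
    _ ≤ M * 1 := by rw [← h2]; exact h1
    _ = M := mul_one M

/-- Realisable weights with a uniform spectral gap form a closed set. -/
theorem realize_of_tendsto {al : ℕ → Option Bool → Fin p ⊕ Fin q → ℝ}
    {be : Option Bool → Fin p ⊕ Fin q → ℝ}
    (hlim : ∀ t i, Tendsto (fun n => al n t i) atTop (𝓝 (be t i))) {c M : ℝ} (hc : 0 < c)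
    (hU : ∀ n b i, c ≤ al n (some b) (Sum.inl i)) (hW : ∀ n b i, al n (some b) (Sum.inr i) ≤ -c)
    (hM : ∀ n i, |al n none i| ≤ M) (h : ∀ n, Realize (al n)) : Realize be := by
  choose w hw hw1 hs using fun n => realize_iff_exists.1 (h n)
  have hcM : c ≤ max c M := le_max_left _ _
  let K : Set (Option Bool → Matrix (Fin p ⊕ Fin q) (Fin p ⊕ Fin q) ℂ) :=
    Set.univ.pi fun _ => {A | ∀ i j, ‖A i j‖ ≤ Real.sqrt (max c M / c)}
  have hK : IsCompact K := isCompact_univ_pi fun _ => isCompact_entries _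
  have hmem : ∀ n, w n ∈ K := fun n t _ i j =>
    norm_entry_le_of_realize (hw n) (hw1 n) (hs n) hc (hU n) (hW n)
      (fun i => (hM n i).trans (le_max_right _ _)) hcM t i j
  have i1 : FirstCountableTopology (Matrix (Fin p ⊕ Fin q) (Fin p ⊕ Fin q) ℂ) :=
    inferInstanceAs (FirstCountableTopology (Fin p ⊕ Fin q → Fin p ⊕ Fin q → ℂ))
  obtain ⟨W, -, φ, hφ, hW'⟩ := hK.tendsto_subseq hmem
  have hWt : ∀ t, Tendsto (fun n => w (φ n) t) atTop (𝓝 (W t)) := tendsto_pi_nhds.1 hW'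
  have hWc : ∀ t, Tendsto (fun n => (w (φ n) t)ᴴ) atTop (𝓝 (W t)ᴴ) := by
    intro t
    refine tendsto_pi_nhds.2 fun i => tendsto_pi_nhds.2 fun j => ?_
    exact ((continuous_star.tendsto _).comp (tendsto_pi_nhds.1 (tendsto_pi_nhds.1 (hWt t) j) i))
  have hconst : Tendsto (fun _ : ℕ => J0 p q) atTop (𝓝 (J0 p q)) := tendsto_const_nhds
  have hWf : ∀ t, (W t)ᴴ * J0 p q * W t = J0 p q := by
    intro t
    have h1 := tendsto_matrix_mul (tendsto_matrix_mul (hWc t) hconst) (hWt t)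
    simp only [hw] at h1
    exact tendsto_nhds_unique h1 hconst
  have hd : ∀ t, Tendsto (fun n => diagonal (fun i => ((al (φ n) t i : ℝ) : ℂ))) atTop
      (𝓝 (diagonal (fun i => ((be t i : ℝ) : ℂ)))) := by
    intro t
    refine tendsto_pi_nhds.2 fun i => tendsto_pi_nhds.2 fun j => ?_
    by_cases hij : i = j
    · subst hij
      simp only [diagonal_apply_eq]
      exact (Complex.continuous_ofReal.tendsto _).comp ((hlim t i).comp hφ.tendsto_atTop)
    · simp only [diagonal_apply_ne _ hij]
      exact tendsto_const_nhds
  refine ⟨J0 p q, W, hWf, ?_⟩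
  have hterm : ∀ t, Tendsto (fun n => w (φ n) t * diagonal (fun i => ((al (φ n) t i : ℝ) : ℂ))
      * (w (φ n) t)⁻¹) atTop (𝓝 (W t * diagonal (fun i => ((be t i : ℝ) : ℂ)) * (W t)⁻¹)) := by
    intro t
    simp only [inv_eq_of_frame (hw _ t), inv_eq_of_frame (hWf t)]
    exact tendsto_matrix_mul (tendsto_matrix_mul (hWt t) (hd t))
      (tendsto_matrix_mul (tendsto_matrix_mul hconst (hWc t)) hconst)
  have hz : Tendsto (fun n => ∑ t, w (φ n) t * diagonal (fun i => ((al (φ n) t i : ℝ) : ℂ))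
      * (w (φ n) t)⁻¹) atTop (𝓝 (∑ t, W t * diagonal (fun i => ((be t i : ℝ) : ℂ)) * (W t)⁻¹)) := by
    refine tendsto_pi_nhds.2 fun i => tendsto_pi_nhds.2 fun j => ?_
    simp only [Matrix.sum_apply]
    exact tendsto_finsetSum _ fun t _ => tendsto_pi_nhds.1 (tendsto_pi_nhds.1 (hterm t) i) j
  simp only [hs] at hz
  exact (tendsto_nhds_unique tendsto_const_nhds hz).symm

end Closed

section Criterion

variable {p q : ℕ}

theorem slope_comb (EU : Option Bool → Matrix (Fin p) (Fin p) ℂ)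
    (EW : Option Bool → Matrix (Fin q) (Fin q) ℂ) (aU aU' : Option Bool → Fin p → ℝ)
    (aW aW' : Option Bool → Fin q → ℝ) (r r' : ℝ) (VU : Submodule ℂ (Fin p → ℂ))
    (VW : Submodule ℂ (Fin q → ℂ)) :
    slope EU EW (fun t i => r * aU t i + r' * aU' t i) (fun t i => r * aW t i + r' * aW' t i) VU VW
      = r * slope EU EW aU aW VU VW + r' * slope EU EW aU' aW' VU VW := by
  simp only [slope, Finset.mul_sum, ← Finset.sum_add_distrib, mul_add]
  refine Finset.sum_congr rfl fun t _ => ?_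
  rw [Finset.sum_add_distrib, Finset.sum_add_distrib]
  ring

/-- Mixing semistable weights with stable ones yields stable weights. -/
theorem kStable_mix {EU : Option Bool → Matrix (Fin p) (Fin p) ℂ}
    {EW : Option Bool → Matrix (Fin q) (Fin q) ℂ} {X : Matrix (Fin p) (Fin q) ℂ}
    {aU aU' : Option Bool → Fin p → ℝ} {aW aW' : Option Bool → Fin q → ℝ} {r r' : ℝ} (hr : 0 ≤ r)
    (hr' : 0 < r') (h : KSemi EU EW X aU aW) (h' : KStable EU EW X aU' aW') :
    KStable EU EW X (fun t i => r * aU t i + r' * aU' t i)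
      (fun t i => r * aW t i + r' * aW' t i) := by
  intro VU VW hX h0 h1
  have e := slope_comb EU EW aU aU' aW aW' r r' VU VW
  have h2 : slope EU EW aU' aW' VU VW < 0 := h' VU VW hX h0 h1
  have h3 := h VU VW hX
  change slope EU EW _ _ VU VW < 0
  rw [e]
  have := mul_pos_of_neg_of_neg h2 (neg_lt_zero.2 hr')
  have := mul_nonneg hr (neg_nonneg.2 h3)
  linarith

/-- The weights of the generic configuration decide realisability. -/
theorem exists_realize_criterion (hp : 0 < p) (q : ℕ) :
    ∃ (EU : Option Bool → Matrix (Fin p) (Fin p) ℂ) (EW : Option Bool → Matrix (Fin q) (Fin q) ℂ)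
      (X : Matrix (Fin p) (Fin q) ℂ), ∀ (al : Option Bool → Fin p ⊕ Fin q → ℝ) (c : ℝ), 0 < c →
      (∀ t, Antitone fun i => al t (Sum.inl i)) → (∀ t, Antitone fun i => al t (Sum.inr i)) →
      (∀ b i, c ≤ al (some b) (Sum.inl i)) → (∀ b i, al (some b) (Sum.inr i) ≤ -c) →
      (∀ i j, al none (Sum.inl i) ≤ al none (Sum.inr j)) → ∑ t, ∑ i, al t i = 0 →
      (Realize al ↔
        KSemi EU EW X (fun t i => al t (Sum.inl i)) (fun t i => al t (Sum.inr i))) := by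
  obtain ⟨AU, AW, X, hAU, hAW, hgen⟩ := exists_generic_config p q
  refine ⟨frU AU, frU AW, X, fun al c hc haU haW hU hW hgap hsum => ⟨fun hR => ?_, fun hS => ?_⟩⟩
  · obtain ⟨w, hw, hw1, hs⟩ := realize_iff_exists.1 hR
    have hal : ∀ t i j, rkT t j ≤ rkT t i → 0 ≤ sg i * sg j * (al t j - al t i) := by
      intro t i j hij
      rcases i with i | i <;> rcases j with j | j
      · have h1 : j ≤ i := by
          rcases t with _ | t
          · exact hij
          · simpa [rkT, rkW] using hij
        have := haU t h1
        simp only [sg, Sum.elim_inl] at this ⊢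
        linarith
      · rcases t with _ | t
        · simp only [rkT, rkU, Sum.elim_inl, Sum.elim_inr] at hij
          have := i.2
          omega
        · have h1 := hU t i
          have h2 := hW t j
          simp only [sg, Sum.elim_inl, Sum.elim_inr]
          linarith
      · rcases t with _ | t
        · have h1 := hgap j i
          simp only [sg, Sum.elim_inl, Sum.elim_inr]
          linarith
        · simp only [rkT, rkW, Sum.elim_inl, Sum.elim_inr] at hij
          have := i.2
          omega
      · have h1 : j ≤ i := by
          rcases t with _ | t
          · simpa [rkT, rkU] using hij
          · exact hij
        have := haW t h1
        simp only [sg, Sum.elim_inr] at this ⊢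
        linarith
    obtain ⟨AU', AW', X', hAU', hAW', hsemi, -⟩ := exists_derived hw hw1 hs hal
    exact (hgen AU' AW' X' hAU' hAW' _ _ haU haW).1 hsemi
  · obtain ⟨al0, haU0, haW0, hsum0, hU0, hW0, AU', AW', X', hAU', hAW', hst'⟩ :=
      exists_stable_weights p q
    have hst := (hgen AU' AW' X' hAU' hAW' _ _ haU0 haW0).2 hst'
    obtain ⟨c0, hc0, hcU, hcW⟩ : ∃ c0 > 0, (∀ b i, c0 ≤ al0 (some b) (Sum.inl i)) ∧
        ∀ b i, al0 (some b) (Sum.inr i) ≤ -c0 := by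
      have hpos : ∀ z : Bool × (Fin p ⊕ Fin q), 0 < sg z.2 * al0 (some z.1) z.2 := by
        rintro ⟨b, i | i⟩
        · have := hU0 b i; simp only [sg, Sum.elim_inl]; linarith
        · have := hW0 b i; simp only [sg, Sum.elim_inr]; linarith
      have : Nonempty (Bool × (Fin p ⊕ Fin q)) := ⟨(true, Sum.inl ⟨0, hp⟩)⟩
      obtain ⟨z, hz⟩ := Finite.exists_min fun z : Bool × (Fin p ⊕ Fin q) =>
        sg z.2 * al0 (some z.1) z.2
      refine ⟨_, hpos z, fun b i => ?_, fun b i => ?_⟩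
      · have := hz (b, Sum.inl i); simpa [sg] using this
      · have := hz (b, Sum.inr i)
        have e : sg (Sum.inr i : Fin p ⊕ Fin q) = -1 := rfl
        simp only [e] at this; linarith
    let r : ℕ → ℝ := fun n => 1 / ((n : ℝ) + 1)
    have hr0 : ∀ n, 0 < r n := fun n => by positivity
    have hr1 : ∀ n, r n ≤ 1 := fun n => by
      have h5 : (1 : ℝ) ≤ (n : ℝ) + 1 := by
        have : (0 : ℝ) ≤ n := by positivity
        linarith
      exact (div_le_one (by linarith)).2 h5
    have hlim : Tendsto r atTop (𝓝 0) := tendsto_one_div_add_atTop_nhds_zero_nat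
    have hm : 0 < min c c0 := lt_min hc hc0
    have hmc : min c c0 ≤ c := min_le_left _ _
    have hmc0 : min c c0 ≤ c0 := min_le_right _ _
    have hgU : ∀ n b i, min c c0
        ≤ (1 - r n) * al (some b) (Sum.inl i) + r n * al0 (some b) (Sum.inl i) := by
      intro n b i
      have h1 := mul_le_mul_of_nonneg_left (hmc.trans (hU b i)) (sub_nonneg.2 (hr1 n))
      have h2 := mul_le_mul_of_nonneg_left (hmc0.trans (hcU b i)) (hr0 n).le
      linarith
    have hgW : ∀ n b i, (1 - r n) * al (some b) (Sum.inr i) + r n * al0 (some b) (Sum.inr i)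
        ≤ - min c c0 := by
      intro n b i
      have h1 := mul_le_mul_of_nonneg_left ((hW b i).trans (neg_le_neg hmc)) (sub_nonneg.2 (hr1 n))
      have h2 := mul_le_mul_of_nonneg_left ((hcW b i).trans (neg_le_neg hmc0)) (hr0 n).le
      linarith
    refine realize_of_tendsto (al := fun n t i => (1 - r n) * al t i + r n * al0 t i)
      (c := min c c0) (M := ∑ i, (|al none i| + |al0 none i|)) (fun t i => ?_) hm hgU hgW
      (fun n i => ?_) fun n => ?_
    · have := ((tendsto_const_nhds (x := (1 : ℝ))).sub hlim).mul_const (al t i)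
      have h2 := this.add (hlim.mul_const (al0 t i))
      simpa using h2
    · have h1 : |(1 - r n) * al none i + r n * al0 none i| ≤ |al none i| + |al0 none i| := by
        refine (abs_add_le _ _).trans (add_le_add ?_ ?_)
        · rw [abs_mul, abs_of_nonneg (sub_nonneg.2 (hr1 n))]
          exact mul_le_of_le_one_left (abs_nonneg _) (by linarith [hr0 n])
        · rw [abs_mul, abs_of_nonneg (hr0 n).le]
          exact mul_le_of_le_one_left (abs_nonneg _) (hr1 n)
      exact h1.trans (Finset.single_le_sum (f := fun i => |al none i| + |al0 none i|)
        (fun i _ => by positivity) (Finset.mem_univ i))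
    · have hanti : ∀ (f g : ℝ) (x y x' y' : ℝ), 0 ≤ f → 0 ≤ g → x ≤ x' → y ≤ y' →
          f * x + g * y ≤ f * x' + g * y' := fun f g x y x' y' hf hg h1 h2 =>
        add_le_add (mul_le_mul_of_nonneg_left h1 hf) (mul_le_mul_of_nonneg_left h2 hg)
      refine realize_of_kStable (XX := fun b => if b then X else 0) hp hAU hAW (c := min c c0)
        (c' := 0) hm (fun b i => ?_) (fun b i => ?_) (fun t i j hij => ?_) (fun t i j hij => ?_) ?_ ?_
      · rw [zero_add]; exact hgU n b i
      · exact (hgW n b i).trans (by linarith)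
      · exact hanti _ _ _ _ _ _ (sub_nonneg.2 (hr1 n)) (hr0 n).le (haU t hij) (haU0 t hij)
      · exact hanti _ _ _ _ _ _ (sub_nonneg.2 (hr1 n)) (hr0 n).le (haW t hij) (haW0 t hij)
      · simp only [Finset.sum_add_distrib, ← Finset.mul_sum]
        rw [hsum, hsum0]; ring
      · have := kStable_mix (sub_nonneg.2 (hr1 n)) (hr0 n) hS hst
        simpa using this

/-- Weakly decreasing within each block. -/
def BlockAnti (x : Fin p ⊕ Fin q → ℝ) : Prop :=
  (Antitone fun i => x (Sum.inl i)) ∧ Antitone fun i => x (Sum.inr i)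

theorem BlockAnti.rkU {x : Fin p ⊕ Fin q → ℝ} (h : BlockAnti x)
    (hgap : ∀ i j, x (Sum.inr j) < x (Sum.inl i)) (i j : Fin p ⊕ Fin q)
    (hij : Spectra.rkU i ≤ Spectra.rkU j) : x j ≤ x i := by
  rcases i with i | i <;> rcases j with j | j
  · exact h.1 hij
  · exact (hgap i j).le
  · simp only [Spectra.rkU, Sum.elim_inl, Sum.elim_inr] at hij
    have := j.2
    omega
  · exact h.2 (by simpa [Spectra.rkU] using hij)

/-- The set of spectra of sums, for weights separated at zero and sorted within blocks. -/
theorem exists_spectra_criterion (hp : 0 < p) (q : ℕ) :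
    ∃ (EU : Option Bool → Matrix (Fin p) (Fin p) ℂ) (EW : Option Bool → Matrix (Fin q) (Fin q) ℂ)
      (Y : Matrix (Fin p) (Fin q) ℂ), ∀ (a b : Fin p ⊕ Fin q → ℝ) (c : ℝ), 0 < c →
      BlockAnti a → BlockAnti b → (∀ i, c ≤ a (Sum.inl i)) → (∀ i, a (Sum.inr i) ≤ -c) →
      (∀ i, c ≤ b (Sum.inl i)) → (∀ i, b (Sum.inr i) ≤ -c) → ∀ x : Fin p ⊕ Fin q → ℝ,
      ((∃ g h : Matrix (Fin p ⊕ Fin q) (Fin p ⊕ Fin q) ℂ, gᴴ * J0 p q * g = J0 p q ∧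
        hᴴ * J0 p q * h = J0 p q ∧ BlockAnti x ∧ (∀ i j, x (Sum.inr j) < x (Sum.inl i)) ∧
        (g * diagonal (fun i => ((a i : ℝ) : ℂ)) * g⁻¹
        + h * diagonal (fun i => ((b i : ℝ) : ℂ)) * h⁻¹).charpoly = ∏ i, (X - C ((x i : ℝ) : ℂ))) ↔
      BlockAnti x ∧ (∀ i, c ≤ x (Sum.inl i)) ∧ (∀ i, x (Sum.inr i) ≤ -c) ∧
        ∑ t, ∑ i, wt a b x t i = 0 ∧
        KSemi EU EW Y (fun t i => wt a b x t (Sum.inl i)) (fun t i => wt a b x t (Sum.inr i))) := by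
  obtain ⟨EU, EW, Y, hcrit⟩ := exists_realize_criterion hp q
  refine ⟨EU, EW, Y, fun a b c hc ha hb haU haW hbU hbW x => ?_⟩
  have crit : BlockAnti x → (∀ i j, x (Sum.inr j) < x (Sum.inl i)) →
      ∑ t, ∑ i, wt a b x t i = 0 → (Realize (wt a b x) ↔ KSemi EU EW Y
        (fun t i => wt a b x t (Sum.inl i)) (fun t i => wt a b x t (Sum.inr i))) := by
    intro hx hgap hsum
    refine hcrit (wt a b x) c hc ?_ ?_ ?_ ?_ ?_ hsum
    · rintro (_ | _ | _) i j hij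
      · exact neg_le_neg (hx.1 (Fin.rev_le_rev.2 hij))
      · exact hb.1 hij
      · exact ha.1 hij
    · rintro (_ | _ | _) i j hij
      · exact neg_le_neg (hx.2 (Fin.rev_le_rev.2 hij))
      · exact hb.2 hij
      · exact ha.2 hij
    · rintro (_ | _) i
      exacts [hbU i, haU i]
    · rintro (_ | _) i
      exacts [hbW i, haW i]
    · intro i j
      exact neg_le_neg (hgap _ _).le
  constructor
  · rintro ⟨g, h, hg, hh, hx, hgap, hch⟩
    obtain ⟨w, hw, hD⟩ := exists_frame_of_charpoly hg hh (s := 0) (s' := 0)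
      ⟨fun i => hc.trans_le (haU i), fun i => (haW i).trans_lt (by linarith)⟩
      ⟨fun i => hc.trans_le (hbU i), fun i => (hbW i).trans_lt (by linarith)⟩ (hx.rkU hgap) hch
    have h1 := sep_add hg hh hw (s := c) (s' := c) ⟨haU, fun i => (haW i).trans (by linarith)⟩
      ⟨hbU, fun i => (hbW i).trans (by linarith)⟩ hD
    have h2 := sep_add hg hh hw (s := -c) (s' := -c) ⟨fun i => le_trans (by linarith) (haU i), haW⟩
      ⟨fun i => le_trans (by linarith) (hbU i), hbW⟩ hD
    have hR := realize_wt_of_sum hg hh hw hD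
    have hsum := sum_eq_zero_of_realize hR
    exact ⟨hx, fun i => le_trans (by linarith) (h1.1 i), fun i => (h2.2 i).trans (by linarith), hsum,
      (crit hx hgap hsum).1 hR⟩
  · rintro ⟨hx, hxU, hxW, hsum, hS⟩
    have hgap : ∀ i j, x (Sum.inr j) < x (Sum.inl i) := fun i j => by
      have := hxU i
      have := hxW j
      linarith
    obtain ⟨g, h, hg, hh, hch⟩ := exists_sum_of_realize_wt ((crit hx hgap hsum).2 hS)
    exact ⟨g, h, hg, hh, hx, hgap, hch⟩

end Criterion

section Polyhedral

variable {ι κ : Type*} [Fintype ι] [Fintype κ]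

/-- Affine real functions. -/
def Aff (f : (ι → ℝ) → ℝ) : Prop := ∃ (u : ι → ℝ) (d : ℝ), ∀ x, f x = ∑ j, u j * x j + d

theorem Aff.const (d : ℝ) : Aff fun _ : ι → ℝ => d := ⟨0, d, fun x => by simp⟩

theorem Aff.coord (j : ι) : Aff fun x : ι → ℝ => x j := by
  classical
  exact ⟨Pi.single j 1, 0, fun x => by simp [Pi.single_apply]⟩

theorem Aff.add {f g : (ι → ℝ) → ℝ} (hf : Aff f) (hg : Aff g) : Aff fun x => f x + g x := by
  obtain ⟨u, d, h⟩ := hf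
  obtain ⟨v, e, h'⟩ := hg
  refine ⟨u + v, d + e, fun x => ?_⟩
  simp only [h, h', Pi.add_apply, add_mul, Finset.sum_add_distrib]
  ring

theorem Aff.const_mul {f : (ι → ℝ) → ℝ} (r : ℝ) (hf : Aff f) : Aff fun x => r * f x := by
  obtain ⟨u, d, h⟩ := hf
  refine ⟨fun j => r * u j, r * d, fun x => ?_⟩
  simp only [h, mul_add, Finset.mul_sum, mul_assoc]

theorem Aff.neg {f : (ι → ℝ) → ℝ} (hf : Aff f) : Aff fun x => -f x := by
  simpa using hf.const_mul (-1)

theorem Aff.sub {f g : (ι → ℝ) → ℝ} (hf : Aff f) (hg : Aff g) : Aff fun x => f x - g x := by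
  simpa only [sub_eq_add_neg] using hf.add hg.neg

theorem Aff.sum {T : Type*} (s : Finset T) {f : T → (ι → ℝ) → ℝ} (hf : ∀ t, Aff (f t)) :
    Aff fun x => ∑ t ∈ s, f t x := by
  classical
  induction s using Finset.induction_on with
  | empty => simpa using Aff.const (ι := ι) 0
  | insert a s ha ih => simpa only [Finset.sum_insert ha] using (hf a).add ih

theorem Aff.comp {f : (κ → ℝ) → ℝ} (hf : Aff f) {F : (ι → ℝ) → κ → ℝ}
    (hF : ∀ i, Aff fun x => F x i) : Aff fun x => f (F x) := by
  obtain ⟨u, d, h⟩ := hf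
  simp only [h]
  exact (Aff.sum _ fun j => (hF j).const_mul _).add (Aff.const d)

/-- Finite intersections of closed half-spaces. -/
def Poly (P : (ι → ℝ) → Prop) : Prop :=
  ∃ (T : Type) (_ : Finite T) (f : T → (ι → ℝ) → ℝ), (∀ t, Aff (f t)) ∧ ∀ x, P x ↔ ∀ t, f t x ≤ 0

theorem Poly.le {f g : (ι → ℝ) → ℝ} (hf : Aff f) (hg : Aff g) : Poly fun x => f x ≤ g x :=
  ⟨Unit, inferInstance, fun _ x => f x - g x, fun _ => hf.sub hg, fun x => by simp⟩

theorem Poly.forall {T : Type} [Finite T] {P : T → (ι → ℝ) → Prop} (h : ∀ t, Poly (P t)) :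
    Poly fun x => ∀ t, P t x := by
  choose S hS f hf hP using h
  refine ⟨Σ t, S t, inferInstance, fun z => f z.1 z.2, fun z => hf z.1 z.2, fun x => ?_⟩
  simp only [hP, Sigma.forall]

theorem Poly.and {P Q : (ι → ℝ) → Prop} (hP : Poly P) (hQ : Poly Q) : Poly fun x => P x ∧ Q x := by
  have := Poly.forall (P := fun b : Bool => if b then P else Q) (by
    rintro (_ | _)
    exacts [hQ, hP])
  obtain ⟨T, hT, f, hf, h⟩ := this
  refine ⟨T, hT, f, hf, fun x => ?_⟩
  rw [← h x]
  simp [and_comm]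

theorem Poly.imp (c : Prop) {P : (ι → ℝ) → Prop} (hP : Poly P) : Poly fun x => c → P x := by
  by_cases hc : c
  · simpa [hc] using hP
  · exact ⟨Empty, inferInstance, fun e => e.elim, fun e => e.elim, fun x => by simp [hc]⟩

theorem Poly.eq {f g : (ι → ℝ) → ℝ} (hf : Aff f) (hg : Aff g) : Poly fun x => f x = g x := by
  simpa only [le_antisymm_iff] using (Poly.le hf hg).and (Poly.le hg hf)

theorem Poly.comp {P : (κ → ℝ) → Prop} (hP : Poly P) {F : (ι → ℝ) → κ → ℝ}
    (hF : ∀ i, Aff fun x => F x i) : Poly fun x => P (F x) := by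
  obtain ⟨T, hT, f, hf, h⟩ := hP
  exact ⟨T, hT, fun t x => f t (F x), fun t => (hf t).comp hF, fun x => h (F x)⟩

theorem Poly.exists_fin {P : (ι → ℝ) → Prop} (hP : Poly P) :
    ∃ (k : ℕ) (u : Fin k → ι → ℝ) (c : Fin k → ℝ), {x | P x} = {x | ∀ i, ∑ j, u i j * x j ≤ c i} := by
  obtain ⟨T, hT, f, hf, h⟩ := hP
  choose u d hu using hf
  obtain ⟨k, ⟨e⟩⟩ := Finite.exists_equiv_fin T
  refine ⟨k, fun i => u (e.symm i), fun i => -d (e.symm i), ?_⟩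
  ext x
  rw [Set.mem_ofPred_eq, Set.mem_ofPred_eq, h x]
  constructor
  · intro hx i
    have := hx (e.symm i)
    rw [hu] at this
    linarith
  · intro hx t
    have := hx (e t)
    simp only [Equiv.symm_apply_apply] at this
    rw [hu]
    linarith

theorem poly_antitone {m : ℕ} {F : Fin m → (ι → ℝ) → ℝ} (hF : ∀ i, Aff (F i)) :
    Poly fun x => Antitone fun i => F i x := by
  have : Poly fun x => ∀ i j : Fin m, i ≤ j → F j x ≤ F i x :=
    Poly.forall fun i => Poly.forall fun j => Poly.imp _ (Poly.le (hF j) (hF i))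
  exact this

variable {p q : ℕ}

theorem poly_blockAnti : Poly (BlockAnti (p := p) (q := q)) :=
  (poly_antitone fun i => Aff.coord (Sum.inl i)).and (poly_antitone fun i => Aff.coord (Sum.inr i))

theorem aff_wt (a b : Fin p ⊕ Fin q → ℝ) (t : Option Bool) (i : Fin p ⊕ Fin q) :
    Aff fun x => wt a b x t i := by
  rcases t with _ | _ | _
  exacts [(Aff.coord _).neg, Aff.const _, Aff.const _]

theorem poly_kSemi (EU : Option Bool → Matrix (Fin p) (Fin p) ℂ)
    (EW : Option Bool → Matrix (Fin q) (Fin q) ℂ) (X : Matrix (Fin p) (Fin q) ℂ)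
    {aU : (ι → ℝ) → Option Bool → Fin p → ℝ} {aW : (ι → ℝ) → Option Bool → Fin q → ℝ}
    (hU : ∀ t i, Aff fun x => aU x t i) (hW : ∀ t i, Aff fun x => aW x t i) :
    Poly fun x => KSemi EU EW X (aU x) (aW x) := by
  have key : Poly fun x => ∀ τ : Option Bool → Finset (Fin p) × Finset (Fin q),
      (∃ (VU : Submodule ℂ (Fin p → ℂ)) (VW : Submodule ℂ (Fin q → ℂ)), (∀ w ∈ VW, X *ᵥ w ∈ VU) ∧
        τ = fun t => (piv Fin.val (VU.comap (Matrix.mulVecLin (EU t))),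
          piv Fin.val (VW.comap (Matrix.mulVecLin (EW t))))) →
      ∑ t, (∑ i ∈ (τ t).1, aU x t i + ∑ i ∈ (τ t).2, aW x t i) ≤ 0 :=
    Poly.forall fun τ => Poly.imp _ (Poly.le (Aff.sum _ fun t =>
      (Aff.sum _ fun i => hU t i).add (Aff.sum _ fun i => hW t i)) (Aff.const 0))
  obtain ⟨T, hT, f, hf, h⟩ := key
  refine ⟨T, hT, f, hf, fun x => ?_⟩
  rw [← h x]
  constructor
  · rintro hS τ ⟨VU, VW, hX, rfl⟩
    exact hS VU VW hX
  · intro hS VU VW hX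
    exact hS _ ⟨VU, VW, hX, rfl⟩

theorem poly_spectra (hp : 0 < p) {a b : Fin p ⊕ Fin q → ℝ} {c : ℝ} (hc : 0 < c)
    (ha : BlockAnti a) (hb : BlockAnti b) (haU : ∀ i, c ≤ a (Sum.inl i))
    (haW : ∀ i, a (Sum.inr i) ≤ -c) (hbU : ∀ i, c ≤ b (Sum.inl i))
    (hbW : ∀ i, b (Sum.inr i) ≤ -c) : Poly fun x : Fin p ⊕ Fin q → ℝ =>
      ∃ g h : Matrix (Fin p ⊕ Fin q) (Fin p ⊕ Fin q) ℂ, gᴴ * J0 p q * g = J0 p q ∧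
        hᴴ * J0 p q * h = J0 p q ∧ BlockAnti x ∧ (∀ i j, x (Sum.inr j) < x (Sum.inl i)) ∧
        (g * diagonal (fun i => ((a i : ℝ) : ℂ)) * g⁻¹
        + h * diagonal (fun i => ((b i : ℝ) : ℂ)) * h⁻¹).charpoly
          = ∏ i, (X - C ((x i : ℝ) : ℂ)) := by
  obtain ⟨EU, EW, Y, h⟩ := exists_spectra_criterion hp q
  simp only [h a b c hc ha hb haU haW hbU hbW]
  exact poly_blockAnti.and ((Poly.forall fun i => Poly.le (Aff.const _) (Aff.coord _)).and
    ((Poly.forall fun i => Poly.le (Aff.coord _) (Aff.const _)).and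
    ((Poly.eq (Aff.sum _ fun t => Aff.sum _ fun i => aff_wt a b t i) (Aff.const 0)).and
    (poly_kSemi EU EW Y (fun t i => aff_wt a b t _) fun t i => aff_wt a b t _))))

end Polyhedral

section Transfer

variable {p q : ℕ}

theorem charpoly_sub_scalar_of_eq_prod {n : Type*} [Fintype n] [DecidableEq n] {M : Matrix n n ℂ}
    {x : n → ℝ} (h : M.charpoly = ∏ i, (X - C ((x i : ℝ) : ℂ))) (s : ℝ) :
    (M - scalar n (s : ℂ)).charpoly = ∏ i, (X - C ((x i - s : ℝ) : ℂ)) := by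
  rw [Matrix.charpoly_sub_scalar, h, Polynomial.prod_comp]
  refine Finset.prod_congr rfl fun i _ => ?_
  rw [sub_comp, X_comp, C_comp, Complex.ofReal_sub, C_sub]
  ring

theorem charpoly_add_scalar_eq_prod_iff {n : Type*} [Fintype n] [DecidableEq n] {M : Matrix n n ℂ}
    {x : n → ℝ} (s : ℝ) : (M + scalar n (s : ℂ)).charpoly = ∏ i, (X - C ((x i : ℝ) : ℂ)) ↔
      M.charpoly = ∏ i, (X - C ((x i - s : ℝ) : ℂ)) := by
  constructor
  · intro h
    have := charpoly_sub_scalar_of_eq_prod h s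
    rwa [add_sub_cancel_right] at this
  · intro h
    have := charpoly_sub_scalar_of_eq_prod h (-s)
    rw [Complex.ofReal_neg, map_neg, sub_neg_eq_add] at this
    rw [this]
    simp

theorem exists_frame_normalize (a : Fin p ⊕ Fin q → ℝ) (s : ℝ) (ρ : Equiv.Perm (Fin p ⊕ Fin q))
    (hρ : ∀ i, sg (ρ i) = sg i) :
    ∃ R : Matrix (Fin p ⊕ Fin q) (Fin p ⊕ Fin q) ℂ, Rᴴ * J0 p q * R = J0 p q ∧
      ∀ g, gᴴ * J0 p q * g = J0 p q → g * diagonal (fun i => ((a i : ℝ) : ℂ)) * g⁻¹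
        = g * R * diagonal (fun i => ((a (ρ i) - s : ℝ) : ℂ)) * (g * R)⁻¹ + scalar _ (s : ℂ) := by
  obtain ⟨R, hR, hd⟩ := exists_perm_frame ρ hρ
  refine ⟨R, hR, fun g hg => ?_⟩
  have hgd := (isUnit_det_of_frame hg).1
  rw [mul_conj_inv, hd (fun i => ((a i - s : ℝ) : ℂ))]
  have : diagonal (fun i => ((a i : ℝ) : ℂ)) = diagonal (fun i => ((a i - s : ℝ) : ℂ))
      + (s : ℂ) • (1 : Matrix (Fin p ⊕ Fin q) (Fin p ⊕ Fin q) ℂ) := by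
    rw [smul_one_eq_diagonal, diagonal_add]
    congr 1; ext i; push_cast; ring
  rw [this, Matrix.mul_add, Matrix.add_mul, Matrix.mul_smul, Matrix.smul_mul, Matrix.mul_one,
    mul_nonsing_inv _ hgd, scalar_apply, smul_one_eq_diagonal]

theorem exists_normal_weights (hp : 0 < p) (hq : 0 < q) (a : Fin p ⊕ Fin q → ℝ)
    (ha : ∀ i j, a (Sum.inr j) < a (Sum.inl i)) :
    ∃ (s c : ℝ) (ρ : Equiv.Perm (Fin p ⊕ Fin q)), 0 < c ∧ (∀ i, sg (ρ i) = sg i) ∧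
      BlockAnti (fun i => a (ρ i) - s) ∧ (∀ i, c ≤ a (ρ (Sum.inl i)) - s) ∧
      ∀ i, a (ρ (Sum.inr i)) - s ≤ -c := by
  have : Nonempty (Fin p) := ⟨⟨0, hp⟩⟩
  have : Nonempty (Fin q) := ⟨⟨0, hq⟩⟩
  obtain ⟨i0, hi0⟩ := Finite.exists_min fun i : Fin p => a (Sum.inl i)
  obtain ⟨j0, hj0⟩ := Finite.exists_max fun j : Fin q => a (Sum.inr j)
  obtain ⟨σ, hσ⟩ := exists_antitone_perm fun i : Fin p => a (Sum.inl i)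
  obtain ⟨τ, hτ⟩ := exists_antitone_perm fun i : Fin q => a (Sum.inr i)
  have h0 := ha i0 j0
  refine ⟨(a (Sum.inl i0) + a (Sum.inr j0)) / 2, (a (Sum.inl i0) - a (Sum.inr j0)) / 2,
    Equiv.sumCongr σ τ, by linarith, sg_sumCongr σ τ, ⟨fun i j hij => ?_, fun i j hij => ?_⟩,
    fun i => ?_, fun i => ?_⟩
  · exact sub_le_sub_right (hσ hij) _
  · exact sub_le_sub_right (hτ hij) _
  · have := hi0 (σ i)
    simp only [Equiv.sumCongr_apply, Sum.map_inl]
    linarith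
  · have := hj0 (τ i)
    simp only [Equiv.sumCongr_apply, Sum.map_inr]
    linarith

theorem poly_spectra_of_gap (hp : 0 < p) (hq : 0 < q) {a b : Fin p ⊕ Fin q → ℝ}
    (ha : ∀ i j, a (Sum.inr j) < a (Sum.inl i)) (hb : ∀ i j, b (Sum.inr j) < b (Sum.inl i)) :
    Poly fun x : Fin p ⊕ Fin q → ℝ =>
      ∃ g h : Matrix (Fin p ⊕ Fin q) (Fin p ⊕ Fin q) ℂ, gᴴ * J0 p q * g = J0 p q ∧
        hᴴ * J0 p q * h = J0 p q ∧ BlockAnti x ∧ (∀ i j, x (Sum.inr j) < x (Sum.inl i)) ∧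
        (g * diagonal (fun i => ((a i : ℝ) : ℂ)) * g⁻¹
        + h * diagonal (fun i => ((b i : ℝ) : ℂ)) * h⁻¹).charpoly
          = ∏ i, (X - C ((x i : ℝ) : ℂ)) := by
  obtain ⟨s, c, ρ, hc, hρ, hA, hAU, hAW⟩ := exists_normal_weights hp hq a ha
  obtain ⟨s', c', ρ', hc', hρ', hB, hBU, hBW⟩ := exists_normal_weights hp hq b hb
  have hP := (poly_spectra hp (lt_min hc hc') hA hB (fun i => (min_le_left _ _).trans (hAU i))
    (fun i => (hAW i).trans (neg_le_neg (min_le_left _ _)))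
    (fun i => (min_le_right _ _).trans (hBU i))
    (fun i => (hBW i).trans (neg_le_neg (min_le_right _ _)))).comp
    (F := fun x i => x i - (s + s')) (fun i => (Aff.coord i).sub (Aff.const _))
  obtain ⟨T, hT, f, hf, h⟩ := hP
  refine ⟨T, hT, f, hf, fun x => ?_⟩
  rw [← h x]
  obtain ⟨R, hR, hRa⟩ := exists_frame_normalize a s ρ hρ
  obtain ⟨R', hR', hRb⟩ := exists_frame_normalize b s' ρ' hρ'
  have hanti : BlockAnti (fun i => x i - (s + s')) ↔ BlockAnti x := by
    constructor
    · exact fun h => ⟨fun i j hij => (sub_le_sub_iff_right _).1 (h.1 hij),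
        fun i j hij => (sub_le_sub_iff_right _).1 (h.2 hij)⟩
    · exact fun h => ⟨fun i j hij => (sub_le_sub_iff_right _).2 (h.1 hij),
        fun i j hij => (sub_le_sub_iff_right _).2 (h.2 hij)⟩
  have hmat : ∀ g h : Matrix (Fin p ⊕ Fin q) (Fin p ⊕ Fin q) ℂ, gᴴ * J0 p q * g = J0 p q →
      hᴴ * J0 p q * h = J0 p q → ((g * diagonal (fun i => ((a i : ℝ) : ℂ)) * g⁻¹
        + h * diagonal (fun i => ((b i : ℝ) : ℂ)) * h⁻¹).charpoly = ∏ i, (X - C ((x i : ℝ) : ℂ)) ↔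
      (g * R * diagonal (fun i => ((a (ρ i) - s : ℝ) : ℂ)) * (g * R)⁻¹
        + h * R' * diagonal (fun i => ((b (ρ' i) - s' : ℝ) : ℂ)) * (h * R')⁻¹).charpoly
          = ∏ i, (X - C ((x i - (s + s') : ℝ) : ℂ))) := by
    intro g h hg hh
    rw [← charpoly_add_scalar_eq_prod_iff, hRa g hg, hRb h hh, Complex.ofReal_add, map_add,
      add_add_add_comm]
  simp only [hanti, sub_lt_sub_iff_right]
  constructor
  · rintro ⟨g, h, hg, hh, hx, hgap, hch⟩
    exact ⟨g * R, h * R', frame_mul hg hR, frame_mul hh hR', hx, hgap, (hmat g h hg hh).1 hch⟩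
  · rintro ⟨g, h, hg, hh, hx, hgap, hch⟩
    refine ⟨g * R⁻¹, h * R'⁻¹, frame_mul hg (frame_inv hR), frame_mul hh (frame_inv hR'), hx, hgap,
      (hmat _ _ (frame_mul hg (frame_inv hR)) (frame_mul hh (frame_inv hR'))).2 ?_⟩
    rw [Matrix.mul_assoc g, Matrix.mul_assoc h, nonsing_inv_mul _ (isUnit_det_of_frame hR).1,
      nonsing_inv_mul _ (isUnit_det_of_frame hR').1, Matrix.mul_one, Matrix.mul_one, hch]

theorem norm_det_of_frame {g : Matrix (Fin p ⊕ Fin q) (Fin p ⊕ Fin q) ℂ}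
    (hg : gᴴ * J0 p q * g = J0 p q) : ‖g.det‖ = 1 := by
  have hJ := (isUnit_det_of_frame hg).2
  have h := congrArg det hg
  rw [det_mul, det_mul, det_conjTranspose, mul_right_comm] at h
  have h1 := mul_right_cancel₀ hJ.ne_zero (h.trans (one_mul _).symm)
  have h2 := congrArg norm h1
  rw [norm_mul, norm_star, norm_one] at h2
  nlinarith [norm_nonneg g.det]

/-- A pseudo-unitary matrix may be rescaled to have determinant one. -/
theorem exists_frame_det_one (hp : 0 < p) {g : Matrix (Fin p ⊕ Fin q) (Fin p ⊕ Fin q) ℂ}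
    (hg : gᴴ * J0 p q * g = J0 p q) :
    ∃ g' : Matrix (Fin p ⊕ Fin q) (Fin p ⊕ Fin q) ℂ, g'ᴴ * J0 p q * g' = J0 p q ∧ g'.det = 1 ∧
      ∀ M, g' * M * g'⁻¹ = g * M * g⁻¹ := by
  have hn := norm_det_of_frame hg
  obtain ⟨z, hz⟩ := IsAlgClosed.exists_pow_nat_eq (g.det)⁻¹ (n := p + q) (by omega)
  have hz1 : ‖z‖ = 1 := by
    have := congrArg norm hz
    rw [norm_pow, norm_inv, hn, inv_one] at this
    exact (pow_eq_one_iff_of_nonneg (norm_nonneg z) (by omega)).1 this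
  have hz0 : z ≠ 0 := fun h => by simp [h] at hz1
  refine ⟨z • g, ?_, ?_, fun M => ?_⟩
  · rw [conjTranspose_smul, Matrix.smul_mul, Matrix.smul_mul, Matrix.mul_smul, smul_smul, hg]
    have : star z * z = 1 := by
      rw [Complex.star_def, ← Complex.normSq_eq_conj_mul_self, Complex.normSq_eq_norm_sq, hz1]
      simp
    rw [this, one_smul]
  · rw [det_smul, Fintype.card_sum, Fintype.card_fin, Fintype.card_fin, hz, inv_mul_cancel₀]
    exact (isUnit_det_of_frame hg).1.ne_zero
  · have hinv : (z • g)⁻¹ = z⁻¹ • g⁻¹ := by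
      refine inv_eq_right_inv ?_
      rw [Matrix.smul_mul, Matrix.mul_smul, smul_smul, mul_inv_cancel₀ hz0, one_smul,
        mul_nonsing_inv _ (isUnit_det_of_frame hg).1]
    rw [hinv, Matrix.smul_mul, Matrix.smul_mul, Matrix.mul_smul, smul_smul, mul_inv_cancel₀ hz0,
      one_smul]

end Transfer

section Reindex

variable {p q : ℕ}

theorem submatrix_Jmat (p q : ℕ) :
    (Jmat p q).submatrix (finSumFinEquiv (m := p) (n := q)) finSumFinEquiv = J0 p q := by
  rw [Jmat, J0, submatrix_diagonal_equiv]
  congr 1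
  ext i
  rcases i with i | i <;> simp [sg]

theorem submatrix_mem_SUpq_iff {g : Matrix (Fin (p + q)) (Fin (p + q)) ℂ} :
    g ∈ SUpq p q ↔ (g.submatrix finSumFinEquiv finSumFinEquiv).det = 1 ∧
      (g.submatrix finSumFinEquiv finSumFinEquiv)ᴴ * J0 p q
        * g.submatrix finSumFinEquiv finSumFinEquiv = J0 p q := by
  rw [← submatrix_Jmat, conjTranspose_submatrix, submatrix_mul_equiv, submatrix_mul_equiv,
    det_submatrix_equiv_self]
  refine and_congr_right fun _ => ⟨fun h => congrArg (fun M : Matrix _ _ ℂ =>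
    M.submatrix finSumFinEquiv finSumFinEquiv) h, fun h => ?_⟩
  ext i j
  have := congrFun (congrFun h (finSumFinEquiv.symm i)) (finSumFinEquiv.symm j)
  simpa only [submatrix_apply, Equiv.apply_symm_apply] using this

theorem submatrix_conj_diagonal (g : Matrix (Fin (p + q)) (Fin (p + q)) ℂ)
    (a : Fin (p + q) → ℝ) :
    (g * diagonal (fun i => ((a i : ℝ) : ℂ)) * g⁻¹).submatrix (finSumFinEquiv (m := p) (n := q))
        finSumFinEquiv
      = g.submatrix finSumFinEquiv finSumFinEquiv
        * diagonal (fun i => ((a (finSumFinEquiv i) : ℝ) : ℂ))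
        * (g.submatrix finSumFinEquiv finSumFinEquiv)⁻¹ := by
  rw [inv_submatrix_equiv, ← submatrix_mul_equiv (e₂ := finSumFinEquiv (m := p) (n := q)),
    ← submatrix_mul_equiv (e₂ := finSumFinEquiv (m := p) (n := q)), submatrix_diagonal_equiv]
  rfl

theorem isOrderedSpectrum_iff (M : Matrix (Fin (p + q)) (Fin (p + q)) ℂ) (x : Fin (p + q) → ℝ) :
    IsOrderedSpectrum p q M x ↔ BlockAnti (fun i => x (finSumFinEquiv i)) ∧
      (∀ (i : Fin p) (j : Fin q), x (finSumFinEquiv (Sum.inr j)) < x (finSumFinEquiv (Sum.inl i))) ∧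
      (M.submatrix (finSumFinEquiv (m := p) (n := q)) finSumFinEquiv).charpoly
        = ∏ i : Fin p ⊕ Fin q, (X - C ((x (finSumFinEquiv i) : ℝ) : ℂ)) := by
  have h3 : (M.submatrix (finSumFinEquiv (m := p) (n := q)) finSumFinEquiv).charpoly = M.charpoly :=
    charpoly_reindex finSumFinEquiv.symm M
  have h4 := finSumFinEquiv.prod_comp
    (fun i : Fin (p + q) => (X - C ((x i : ℝ) : ℂ) : Polynomial ℂ))
  rw [h3, h4, IsOrderedSpectrum]
  refine and_congr ?_ (and_congr ?_ Iff.rfl)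
  · constructor
    · refine fun h => ⟨fun i j hij => h _ _ ?_ (Or.inl ?_), fun i j hij => h _ _ ?_ (Or.inr ?_)⟩
      · rw [finSumFinEquiv_apply_left, finSumFinEquiv_apply_left]
        exact hij
      · simp
      · simpa using hij
      · simp
    · intro h i j hij hb
      obtain ⟨i, rfl⟩ := (finSumFinEquiv (m := p) (n := q)).surjective i
      obtain ⟨j, rfl⟩ := (finSumFinEquiv (m := p) (n := q)).surjective j
      rcases i with i | i <;> rcases j with j | j
      · rw [finSumFinEquiv_apply_left, finSumFinEquiv_apply_left] at hij
        exact h.1 hij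
      · exfalso
        have := i.2
        simp at hb
        omega
      · exfalso
        have := j.2
        simp [Fin.le_def] at hij
        omega
      · exact h.2 (by simpa using hij)
  · constructor
    · exact fun h i j => h _ _ (by simp) (by simp)
    · intro h i j hi hj
      obtain ⟨i, rfl⟩ := (finSumFinEquiv (m := p) (n := q)).surjective i
      obtain ⟨j, rfl⟩ := (finSumFinEquiv (m := p) (n := q)).surjective j
      rcases i with i | i <;> rcases j with j | j
      · simp at hj
        have := j.2
        omega
      · exact h i j
      · simp at hi
      · simp at hi

theorem exists_isOrderedSpectrum_iff (hp : 0 < p) (a b x : Fin (p + q) → ℝ) :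
    (∃ g ∈ SUpq p q, ∃ h ∈ SUpq p q, IsOrderedSpectrum p q
      (g * diagonal (fun i => (a i : ℂ)) * g⁻¹ + h * diagonal (fun i => (b i : ℂ)) * h⁻¹) x) ↔
    ∃ g h : Matrix (Fin p ⊕ Fin q) (Fin p ⊕ Fin q) ℂ, gᴴ * J0 p q * g = J0 p q ∧
      hᴴ * J0 p q * h = J0 p q ∧ BlockAnti (fun i => x (finSumFinEquiv i)) ∧
      (∀ (i : Fin p) (j : Fin q), x (finSumFinEquiv (Sum.inr j)) < x (finSumFinEquiv (Sum.inl i))) ∧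
      (g * diagonal (fun i => ((a (finSumFinEquiv i) : ℝ) : ℂ)) * g⁻¹
        + h * diagonal (fun i => ((b (finSumFinEquiv i) : ℝ) : ℂ)) * h⁻¹).charpoly
          = ∏ i : Fin p ⊕ Fin q, (X - C ((x (finSumFinEquiv i) : ℝ) : ℂ)) := by
  have hsub : ∀ g h : Matrix (Fin (p + q)) (Fin (p + q)) ℂ,
      (g * diagonal (fun i => (a i : ℂ)) * g⁻¹ + h * diagonal (fun i => (b i : ℂ)) * h⁻¹).submatrix
        (finSumFinEquiv (m := p) (n := q)) finSumFinEquiv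
      = g.submatrix finSumFinEquiv finSumFinEquiv
        * diagonal (fun i => ((a (finSumFinEquiv i) : ℝ) : ℂ))
        * (g.submatrix finSumFinEquiv finSumFinEquiv)⁻¹
        + h.submatrix finSumFinEquiv finSumFinEquiv
        * diagonal (fun i => ((b (finSumFinEquiv i) : ℝ) : ℂ))
        * (h.submatrix finSumFinEquiv finSumFinEquiv)⁻¹ := fun g h => by
    rw [← submatrix_conj_diagonal, ← submatrix_conj_diagonal]
    rfl
  simp only [isOrderedSpectrum_iff, submatrix_mem_SUpq_iff, hsub]
  constructor
  · rintro ⟨g, ⟨-, hg⟩, h, ⟨-, hh⟩, hx⟩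
    exact ⟨_, _, hg, hh, hx⟩
  · rintro ⟨g, h, hg, hh, h1, h2, h3⟩
    obtain ⟨g', hg', hgd, hgM⟩ := exists_frame_det_one hp hg
    obtain ⟨h', hh', hhd, hhM⟩ := exists_frame_det_one hp hh
    have hs : ∀ M : Matrix (Fin p ⊕ Fin q) (Fin p ⊕ Fin q) ℂ,
        (M.submatrix finSumFinEquiv.symm finSumFinEquiv.symm).submatrix finSumFinEquiv finSumFinEquiv
          = M := fun M => by
      rw [submatrix_submatrix, Equiv.symm_comp_self, submatrix_id_id]
    refine ⟨g'.submatrix finSumFinEquiv.symm finSumFinEquiv.symm, ?_,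
      h'.submatrix finSumFinEquiv.symm finSumFinEquiv.symm, ?_, h1, h2, ?_⟩
    · rw [hs]; exact ⟨hgd, hg'⟩
    · rw [hs]; exact ⟨hhd, hh'⟩
    · rw [hs, hs, hgM, hhM, h3]

end Reindex

end Spectra

/-- the set `S` of ordered spectra of sums `g Λ_A g⁻¹ + h Λ_B h⁻¹`,
`g, h ∈ SU(p,q)`, is a convex polyhedral set: an intersection of finitely many closed
affine half-spaces `{x | ⟨u i, x⟩ ≤ c i}`. -/
theorem spectraSet_polyhedral (p q : ℕ) (hp : 1 ≤ p) (hq : 1 ≤ q)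
    (a b : Fin (p + q) → ℝ)
    (ha0 : ∑ i, a i = 0) (hb0 : ∑ i, b i = 0)
    (ha : ∀ i j : Fin (p + q), (i : ℕ) < p → p ≤ (j : ℕ) → a j < a i)
    (hb : ∀ i j : Fin (p + q), (i : ℕ) < p → p ≤ (j : ℕ) → b j < b i) :
    ∃ (k : ℕ) (u : Fin k → (Fin (p + q) → ℝ)) (c : Fin k → ℝ),
      { x : Fin (p + q) → ℝ |
        ∃ g ∈ SUpq p q, ∃ h ∈ SUpq p q,
          IsOrderedSpectrum p q
            (g * Matrix.diagonal (fun i => (a i : ℂ)) * g⁻¹ +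
              h * Matrix.diagonal (fun i => (b i : ℂ)) * h⁻¹) x } =
      { x : Fin (p + q) → ℝ | ∀ i : Fin k, ∑ j, u i j * x j ≤ c i } := by
  have hP := (Spectra.poly_spectra_of_gap hp hq (a := fun i => a (finSumFinEquiv i))
    (b := fun i => b (finSumFinEquiv i)) (fun i j => ha _ _ (by simp) (by simp))
    (fun i j => hb _ _ (by simp) (by simp))).comp
    (F := fun (x : Fin (p + q) → ℝ) i => x (finSumFinEquiv i))
    (fun i => Spectra.Aff.coord (finSumFinEquiv i))
  obtain ⟨k, u, c, h⟩ := hP.exists_fin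
  refine ⟨k, u, c, ?_⟩
  rw [← h]
  ext x
  exact Spectra.exists_isOrderedSpectrum_iff hp a b x
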